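/- The set of homotopy classes in π_7(S^4) that can be represented by C¹ maps of arbitrarily small 4-dilation is a proper, non-zero subgroup of π_7(S^4): there exists a non-trivial class a ∈ π_7(S^4) such that for every ε > 0 some C¹ map in the class a has 4-dilation less than ε, and there exists a class b ∈ π_7(S^4) and a constant c > 0 such that every C¹ map in the class b has 4-dilation at least c. -/

import Mathlib

/-!
Basic notions: the unit sphere `S^{d-1} ⊆ ℝ^d`, the norm `‖Λ^k A‖` of the induced map on
`k`-th exterior powers of a linear map between inner product spaces, and the `k`-dilation of a
`C¹` map between unit spheres.  A (`C¹`) map from `S^{d₁-1}` to `S^{d₂-1}` is represented by a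
(`C¹`) ambient map `F : ℝ^{d₁} → ℝ^{d₂}` mapping the unit sphere into the unit sphere; its
`k`-dilation only depends on the restriction of `F` to the sphere, since the derivative is
restricted to the tangent space of the sphere.
-/

open scoped RealInnerProductSpace
open Set

noncomputable section

abbrev EucA (d : ℕ) := EuclideanSpace ℝ (Fin d)

/-- The unit sphere `S^{d-1}` in `ℝ^d` (with the round metric induced from `ℝ^d`). -/
def usph (d : ℕ) : Set (EucA d) := Metric.sphere 0 1

/-- The operator norm `‖Λ^k A‖` of the induced map on `k`-th exterior powers (with their induced
inner products): the supremum, over orthonormal `k`-frames `v` of the domain, of the `k`-volume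
`√ det (⟪A vᵢ, A vⱼ⟫)` of the image frame `A v₁, …, A v_k`. -/
noncomputable def lamNorm {E F : Type*} [NormedAddCommGroup E] [InnerProductSpace ℝ E]
    [NormedAddCommGroup F] [InnerProductSpace ℝ F] (k : ℕ) (A : E →ₗ[ℝ] F) : ℝ :=
  ⨆ v : {v : Fin k → E // Orthonormal ℝ v},
    Real.sqrt (Matrix.of fun (i j : Fin k) => ⟪A (v.1 i), A (v.1 j)⟫).det

/-- The `k`-dilation of a map of the unit sphere `S^{d-1}` into an inner product space (e.g. into
`ℝ^{d₂}`, for a map to the sphere `S^{d₂-1}`), the map being given by an ambient map `F`: the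
supremum over points `x` of the sphere of `‖Λ^k df_x‖`, where `df_x` is the derivative of `F` at
`x` restricted to the tangent space `(ℝ∙x)ᗮ` of the sphere at `x`. -/
noncomputable def kDilation {d : ℕ} {F' : Type*} [NormedAddCommGroup F']
    [InnerProductSpace ℝ F'] (k : ℕ) (F : EucA d → F') : ℝ :=
  ⨆ x : usph d,
    lamNorm k ((fderiv ℝ F (x : EucA d)).toLinearMap ∘ₗ ((ℝ ∙ (x : EucA d))ᗮ).subtype)

/-- A free homotopy, through maps of the unit sphere `S^{d-1}` into `T`, between (the
restrictions to the sphere of) `f` and `g`: a map `H` on `[0,1] × S^{d-1}`, continuous there,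
with values in `T`, starting at `f` and ending at `g`. -/
def FreelyHomotopic {d : ℕ} {E : Type*} [NormedAddCommGroup E] (T : Set E)
    (f g : EucA d → E) : Prop :=
  ∃ H : ℝ → EucA d → E,
    ContinuousOn (fun q : ℝ × EucA d => H q.1 q.2) (Icc (0:ℝ) 1 ×ˢ usph d) ∧
    (∀ t ∈ Icc (0:ℝ) 1, MapsTo (H t) (usph d) T) ∧
    EqOn (H 0) f (usph d) ∧ EqOn (H 1) g (usph d)

/-- A based homotopy (rel the basepoint `x₀` of the sphere, with basepoint value `y₀`), through
maps of the unit sphere `S^{d-1}` into `T`, between `f` and `g`. -/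
def BasedHomotopic {d : ℕ} {E : Type*} [NormedAddCommGroup E] (T : Set E)
    (x₀ : EucA d) (y₀ : E) (f g : EucA d → E) : Prop :=
  ∃ H : ℝ → EucA d → E,
    ContinuousOn (fun q : ℝ × EucA d => H q.1 q.2) (Icc (0:ℝ) 1 ×ˢ usph d) ∧
    (∀ t ∈ Icc (0:ℝ) 1, MapsTo (H t) (usph d) T) ∧
    (∀ t ∈ Icc (0:ℝ) 1, H t x₀ = y₀) ∧
    EqOn (H 0) f (usph d) ∧ EqOn (H 1) g (usph d)

/-- The basepoint of the sphere `S^{d} ⊆ ℝ^{d+1}`: the last standard basis vector. -/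
def bpt (d : ℕ) : EucA (d + 1) := EuclideanSpace.single (Fin.last d) 1

open MeasureTheory Filter Topology

/-- The determinant of `n` vectors in `ℝⁿ` as a continuous alternating form. -/
def detForm (n : ℕ) : (Fin n → ℝ) [⋀^Fin n]→L[ℝ] ℝ :=
  { (Matrix.detRowAlternating : (Fin n → ℝ) [⋀^Fin n]→ₗ[ℝ] ℝ) with
    cont := by
      change Continuous fun m : Fin n → Fin n → ℝ => Matrix.det (Matrix.of m)
      fun_prop }

lemma detForm_apply {n : ℕ} (m : Fin n → Fin n → ℝ) : detForm n m = Matrix.det (Matrix.of m) := rfl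

lemma detForm_comp_single {n : ℕ} (A : (Fin n → ℝ) →L[ℝ] (Fin n → ℝ)) :
    detForm n (fun j => A (Pi.single j 1)) = A.det := by
  rw [detForm_apply, ContinuousLinearMap.det, ← LinearMap.det_toMatrix', ← Matrix.det_transpose]
  congr 1

lemma alternating_succ_eq_zero {n : ℕ} (η : (Fin n → ℝ) [⋀^Fin (n + 1)]→L[ℝ] ℝ) : η = 0 := by
  ext v
  refine AlternatingMap.map_linearDependent η.toAlternatingMap v fun h => ?_
  have := h.fintype_card_le_finrank
  simp at this

/-- The pullback of the form `Ψ dy₁ ∧ ⋯ ∧ dyₙ` by `G`. -/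
def pullForm {n m : ℕ} (Ψ : (Fin n → ℝ) → ℝ) (G : (Fin m → ℝ) → (Fin n → ℝ))
    (x : Fin m → ℝ) : (Fin m → ℝ) [⋀^Fin n]→L[ℝ] ℝ :=
  (Ψ (G x) • detForm n).compContinuousLinearMap (fderiv ℝ G x)

lemma pullForm_contDiffAt {n m : ℕ} {Ψ : (Fin n → ℝ) → ℝ} (hΨ : ContDiff ℝ 1 Ψ)
    {G : (Fin m → ℝ) → (Fin n → ℝ)} {x : Fin m → ℝ} (hG : ContDiffAt ℝ 2 G x)
    (v : Fin n → Fin m → ℝ) : ContDiffAt ℝ 1 (fun x => pullForm Ψ G x v) x := by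
  have h1 : ContDiffAt ℝ 1 (fderiv ℝ G) x := hG.fderiv_right (by norm_num)
  have h2 : (fun x => pullForm Ψ G x v) =
      fun x => Ψ (G x) * (Matrix.of fun i => fderiv ℝ G x (v i)).det := by
    ext y
    simp [pullForm, detForm_apply]
    left; rfl
  rw [h2]
  refine (hΨ.contDiffAt.comp x (hG.of_le (by norm_num))).mul ?_
  simp only [Matrix.det_apply']
  refine ContDiffAt.sum fun σ _ => contDiffAt_const.mul (contDiffAt_prod fun i _ => ?_)
  simp only [Matrix.of_apply]
  exact contDiffAt_pi.1 (h1.clm_apply contDiffAt_const) i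

lemma pullForm_differentiableAt {n m : ℕ} {Ψ : (Fin n → ℝ) → ℝ} (hΨ : ContDiff ℝ 1 Ψ)
    {G : (Fin m → ℝ) → (Fin n → ℝ)} {x : Fin m → ℝ} (hG : ContDiffAt ℝ 2 G x) :
    DifferentiableAt ℝ (pullForm Ψ G) x := by
  have h1 : DifferentiableAt ℝ (fderiv ℝ G) x :=
    (hG.fderiv_right (m := 1) (by norm_num)).differentiableAt (by norm_num)
  have h2 : DifferentiableAt ℝ (fun x => Ψ (G x) • detForm n) x :=
    ((hΨ.differentiable (by norm_num)).differentiableAt.comp x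
      (hG.differentiableAt (by norm_num))).smul_const _
  exact h2.continuousAlternatingMapCompContinuousLinearMap h1

lemma extDeriv_pullForm {n : ℕ} {Ψ : (Fin n → ℝ) → ℝ} (hΨ : ContDiff ℝ 1 Ψ)
    {G : (Fin (n + 1) → ℝ) → (Fin n → ℝ)} {x : Fin (n + 1) → ℝ} (hG : ContDiffAt ℝ 2 G x)
    (v : Fin (n + 1) → Fin (n + 1) → ℝ) :
    ∑ i : Fin (n + 1), (-1 : ℝ) ^ (i : ℕ) *
      fderiv ℝ (fun x => pullForm Ψ G x (i.removeNth v)) x (v i) = 0 := by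
  have h2 := extDeriv_apply (pullForm_differentiableAt hΨ hG) v
  have h3 : extDeriv (pullForm Ψ G) x = 0 := by
    have := extDeriv_pullback (ω := fun y => Ψ y • detForm n) (f := G) (x := x) (r := 2)
      (((hΨ.differentiable (by norm_num)).differentiableAt).smul_const _) hG (by simp)
    change extDeriv (fun x => pullForm Ψ G x) x = _ at this
    rw [this, alternating_succ_eq_zero (extDeriv _ _)]
    ext; simp
  rw [h3] at h2
  simpa using h2.symm

theorem integral_pullback_box_aux {n : ℕ} {Ψ : (Fin n → ℝ) → ℝ} (hΨ : ContDiff ℝ 1 Ψ)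
    {W : Set (Fin (n + 1) → ℝ)} (hW : IsOpen W) {G : (Fin (n + 1) → ℝ) → (Fin n → ℝ)}
    (hG : ContDiffOn ℝ 2 G W) {K : Set (Fin (n + 1) → ℝ)} (hK : IsCompact K) (hKW : K ⊆ W)
    (hsupp : ∀ x ∈ W, x 0 ∈ Icc (0 : ℝ) 1 → Ψ (G x) ≠ 0 → x ∈ K) :
    ∫ x : Fin n → ℝ, W.indicator (fun x => pullForm Ψ G x
        (fun j : Fin n => Pi.single j.succ 1)) (Fin.insertNth 0 0 x) =
      ∫ x : Fin n → ℝ, W.indicator (fun x => pullForm Ψ G x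
        (fun j : Fin n => Pi.single j.succ 1)) (Fin.insertNth 0 1 x) := by
  classical
  obtain ⟨R, hR0, hR⟩ : ∃ R : ℝ, 0 < R ∧ ∀ x ∈ K, ∀ i, |x i| < R := by
    obtain ⟨R, hR⟩ := hK.isBounded.exists_norm_le
    refine ⟨|R| + 1, by positivity, fun x hx i => ?_⟩
    have := (norm_le_pi_norm x i).trans (hR x hx)
    rw [Real.norm_eq_abs] at this
    linarith [le_abs_self R]
  let e : Fin (n + 1) → Fin (n + 1) → ℝ := fun j => Pi.single j 1
  let φ : Fin (n + 1) → (Fin (n + 1) → ℝ) → ℝ := fun i =>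
    W.indicator (fun x => (-1 : ℝ) ^ (i : ℕ) * pullForm Ψ G x (i.removeNth e))
  let a : Fin (n + 1) → ℝ := Fin.insertNth 0 0 fun _ => -R
  let b : Fin (n + 1) → ℝ := Fin.insertNth 0 1 fun _ => R
  have hab : a ≤ b := by
    intro i
    refine Fin.cases ?_ (fun j => ?_) i
    · simp [a, b]
    · simp [a, b]; linarith
  have hGx : ∀ x ∈ W, ContDiffAt ℝ 2 G x := fun x hx => hG.contDiffAt (hW.mem_nhds hx)
  have hφW : ∀ i, ∀ x ∈ W, φ i =ᶠ[𝓝 x]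
      fun x => (-1 : ℝ) ^ (i : ℕ) * pullForm Ψ G x (i.removeNth e) := fun i x hx => by
    filter_upwards [hW.mem_nhds hx] with y hy
    simp only [φ, indicator_of_mem hy]
  have hφC : ∀ i, ∀ x ∈ W, ContDiffAt ℝ 1 (φ i) x := fun i x hx =>
    ContDiffAt.congr_of_eventuallyEq (contDiffAt_const.mul (pullForm_contDiffAt hΨ (hGx x hx) _))
      (hφW i x hx)
  have hbox : ∀ x ∈ Icc a b, x 0 ∈ Icc (0 : ℝ) 1 := fun x hx => by
    have h1 := hx.1 0
    have h2 := hx.2 0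
    simp only [a, b, Fin.insertNth_apply_same] at h1 h2
    exact ⟨h1, h2⟩
  have hφ0 : ∀ i, ∀ x ∈ Icc a b, x ∉ K → φ i x = 0 := fun i x hx hxK => by
    by_cases hxW : x ∈ W
    · have : Ψ (G x) = 0 := by
        by_contra h
        exact hxK (hsupp x hxW (hbox x hx) h)
      simp [φ, hxW, pullForm, this]
    · simp [φ, hxW]
  have hzero : ∀ x ∈ pi univ fun i => Ioo (a i) (b i),
      ∑ i, fderiv ℝ (φ i) x (Pi.single i 1) = 0 := by
    intro x hx
    by_cases hxW : x ∈ W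
    · rw [← extDeriv_pullForm hΨ (hGx x hxW) e]
      refine Finset.sum_congr rfl fun i _ => ?_
      rw [(hφW i x hxW).fderiv_eq, fderiv_const_mul]
      · rfl
      · exact ((pullForm_contDiffAt hΨ (hGx x hxW) _).differentiableAt (by norm_num))
    · refine Finset.sum_eq_zero fun i _ => ?_
      have : φ i =ᶠ[𝓝 x] fun _ => 0 := by
        have hxK : x ∉ K := fun h => hxW (hKW h)
        filter_upwards [hK.isClosed.isOpen_compl.mem_nhds hxK,
          (isOpen_set_pi finite_univ fun i _ => isOpen_Ioo).mem_nhds hx] with y hy1 hy2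
        exact hφ0 i y ⟨fun j => (hy2 j trivial).1.le, fun j => (hy2 j trivial).2.le⟩ hy1
      rw [this.fderiv_eq]
      simp
  have hdiv := integral_divergence_of_hasFDerivAt_off_countable' a b hab φ
    (fun i => fderiv ℝ (φ i)) ∅ countable_empty ?_ ?_ ?_
  · have hL : ∫ x in Icc a b, ∑ i, fderiv ℝ (φ i) x (Pi.single i 1) = 0 := by
      rw [volume_pi, ← setIntegral_congr_set Measure.univ_pi_Ioo_ae_eq_Icc]
      exact setIntegral_eq_zero_of_forall_eq_zero hzero
    rw [hL, Fin.sum_univ_succ] at hdiv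
    have hside : ∀ i : Fin n, ∀ c : ℝ, |c| = R → ∀ x ∈ Icc (a ∘ i.succ.succAbove)
        (b ∘ i.succ.succAbove), c ∈ Icc (a i.succ) (b i.succ) →
        φ i.succ (i.succ.insertNth c x) = 0 := by
      intro i c hc x hx hcI
      refine hφ0 _ _ ⟨?_, ?_⟩ fun h => ?_
      · refine Fin.le_insertNth_iff.2 ⟨hcI.1, hx.1⟩
      · refine Fin.insertNth_le_iff.2 ⟨hcI.2, hx.2⟩
      · have := hR _ h i.succ
        simp [hc] at this
    have hai : ∀ i : Fin n, a i.succ = -R := fun i => by simp [a]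
    have hbi : ∀ i : Fin n, b i.succ = R := fun i => by simp [b]
    rw [Finset.sum_eq_zero, add_zero] at hdiv
    · have hface : ∀ c ∈ Icc (0 : ℝ) 1,
          ∫ x in Icc (a ∘ (0 : Fin (n + 1)).succAbove) (b ∘ (0 : Fin (n + 1)).succAbove),
            φ 0 (Fin.insertNth 0 c x) =
          ∫ x : Fin n → ℝ, W.indicator (fun x => pullForm Ψ G x
            (fun j : Fin n => Pi.single j.succ 1)) (Fin.insertNth 0 c x) := by
        intro c hc
        have h0 : φ 0 = W.indicator (fun x => pullForm Ψ G x
            (fun j : Fin n => Pi.single j.succ 1)) := by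
          simp [φ, e]
          rfl
        rw [← h0]
        refine setIntegral_eq_integral_of_forall_compl_eq_zero fun x hx => ?_
        by_cases hxW : (Fin.insertNth 0 c x : Fin (n + 1) → ℝ) ∈ W
        · by_contra hne
          have hxK : (Fin.insertNth 0 c x : Fin (n + 1) → ℝ) ∈ K := by
            refine hsupp _ hxW (by simpa using hc) fun h => hne ?_
            rw [h0, indicator_of_mem hxW]
            simp only [pullForm, h, zero_smul]
            rfl
          refine hx ⟨fun j => ?_, fun j => ?_⟩
          · have := hR _ hxK j.succ
            simp [a] at this ⊢
            exact (abs_lt.1 this).1.le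
          · have := hR _ hxK j.succ
            simp [b] at this ⊢
            exact (abs_lt.1 this).2.le
        · rw [h0]
          exact indicator_of_notMem hxW _
      rw [hface _ (by simp [b]), hface _ (by simp [a])] at hdiv
      have ha0 : a 0 = 0 := by simp [a]
      have hb0 : b 0 = 1 := by simp [b]
      rw [ha0, hb0] at hdiv
      linarith
    · intro i _
      rw [setIntegral_eq_zero_of_forall_eq_zero, setIntegral_eq_zero_of_forall_eq_zero, sub_zero]
      · intro x hx
        exact hside i _ (by rw [hai, abs_neg, abs_of_pos hR0]) x hx ⟨le_rfl, hab _⟩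
      · intro x hx
        exact hside i _ (by rw [hbi, abs_of_pos hR0]) x hx ⟨hab _, le_rfl⟩
  · intro i x hx
    by_cases hxW : x ∈ W
    · exact (hφC i x hxW).continuousAt.continuousWithinAt
    · have hxK : x ∉ K := fun h => hxW (hKW h)
      have : φ i =ᶠ[𝓝[Icc a b] x] fun _ => 0 := by
        filter_upwards [mem_nhdsWithin_of_mem_nhds (hK.isClosed.isOpen_compl.mem_nhds hxK),
          self_mem_nhdsWithin] with y hy1 hy2
        exact hφ0 i y hy2 hy1
      exact continuousWithinAt_const.congr_of_eventuallyEq this (hφ0 i x hx hxK)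
  · rintro x ⟨hx, -⟩ i
    by_cases hxW : x ∈ W
    · exact ((hφC i x hxW).differentiableAt (by norm_num)).hasFDerivAt
    · have hxK : x ∉ K := fun h => hxW (hKW h)
      have : φ i =ᶠ[𝓝 x] fun _ => 0 := by
        filter_upwards [hK.isClosed.isOpen_compl.mem_nhds hxK,
          (isOpen_set_pi finite_univ fun i _ => isOpen_Ioo).mem_nhds hx] with y hy1 hy2
        exact hφ0 i y ⟨fun j => (hy2 j trivial).1.le, fun j => (hy2 j trivial).2.le⟩ hy1
      exact (((hasFDerivAt_const (0 : ℝ) x).congr_of_eventuallyEq this).differentiableAt).hasFDerivAt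
  · rw [volume_pi, IntegrableOn, ← Measure.restrict_congr_set
      Measure.univ_pi_Ioo_ae_eq_Icc]
    exact (integrableOn_zero (ε' := ℝ)).congr_fun (fun x hx => (hzero x hx).symm)
      (MeasurableSet.univ_pi fun i => measurableSet_Ioo)

section Degree

variable {E : Type*} [NormedAddCommGroup E] [NormedSpace ℝ E]

/-- The integral over `U` of the pullback by `G` of the density `Ψ`: a local mapping degree of `G`,
weighted by `Ψ`. -/
def degI [MeasurableSpace E] (μ : Measure E) (U : Set E) (Ψ : E → ℝ) (G : E → E) : ℝ :=
  ∫ x in U, Ψ (G x) * (fderiv ℝ G x).det ∂μ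

variable [FiniteDimensional ℝ E] [MeasurableSpace E] [BorelSpace E] (μ : Measure E)
  [μ.IsAddHaarMeasure]

theorem degI_homotopy {W : Set (ℝ × E)} (hW : IsOpen W) {G : ℝ × E → E}
    (hG : ContDiffOn ℝ 2 G W) {Ψ : E → ℝ} (hΨ : ContDiff ℝ 1 Ψ) {K : Set (ℝ × E)}
    (hK : IsCompact K) (hKW : K ⊆ W)
    (hsupp : ∀ p ∈ W, p.1 ∈ Icc (0 : ℝ) 1 → Ψ (G p) ≠ 0 → p ∈ K) :
    degI μ {x | ((0 : ℝ), x) ∈ W} Ψ (fun x => G (0, x)) =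
      degI μ {x | ((1 : ℝ), x) ∈ W} Ψ (fun x => G (1, x)) := by
  let n := Module.finrank ℝ E
  let e : E ≃L[ℝ] (Fin n → ℝ) := ContinuousLinearEquiv.ofFinrankEq (by simp [n])
  let L : (Fin (n + 1) → ℝ) ≃L[ℝ] ℝ × E :=
    (Fin.consEquivL ℝ (fun _ : Fin (n + 1) => ℝ)).symm.trans
      ((ContinuousLinearEquiv.refl ℝ ℝ).prodCongr e.symm)
  have hL : ∀ (c : ℝ) (x : Fin n → ℝ), L (Fin.insertNth 0 c x) = (c, e.symm x) := by
    intro c x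
    simp [L]
  have hL0 : ∀ x, (L x).1 = x 0 := fun x => by simp [L]
  let Gh : (Fin (n + 1) → ℝ) → (Fin n → ℝ) := fun x => e (G (L x))
  have hWo : IsOpen (L ⁻¹' W) := hW.preimage L.continuous
  have hGh : ContDiffOn ℝ 2 Gh (L ⁻¹' W) :=
    e.contDiff.comp_contDiffOn (hG.comp L.contDiff.contDiffOn fun x hx => hx)
  have key := integral_pullback_box_aux (Ψ := fun y => Ψ (e.symm y)) (hΨ.comp e.symm.contDiff)
    hWo hGh (K := L ⁻¹' K) (L.toHomeomorph.isCompact_preimage.2 hK) (preimage_mono hKW) (by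
      intro x hx hx0 hne
      exact hsupp (L x) hx (by rwa [hL0]) (by simpa [Gh] using hne))
  have hν : ∃ k : ENNReal, μ = k • (Measure.map e.symm (volume : Measure (Fin n → ℝ))) :=
    ⟨_, Measure.isAddLeftInvariant_eq_smul μ _⟩
  obtain ⟨k, hk⟩ := hν
  have conv : ∀ c : ℝ, degI μ {x | (c, x) ∈ W} Ψ (fun x => G (c, x)) = k.toReal *
      ∫ x : Fin n → ℝ, (L ⁻¹' W).indicator (fun x => pullForm (fun y => Ψ (e.symm y)) Gh x
        (fun j : Fin n => Pi.single j.succ 1)) (Fin.insertNth 0 c x) := by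
    intro c
    have hm : MeasurableSet {x | (c, x) ∈ W} :=
      (hW.preimage (by fun_prop : Continuous fun x : E => (c, x))).measurableSet
    rw [degI, ← integral_indicator hm, hk, integral_smul_measure, smul_eq_mul]
    congr 1
    have he : MeasurableEmbedding e.symm := e.symm.toHomeomorph.measurableEmbedding
    rw [he.integral_map]
    congr 1
    ext x
    by_cases hx : (c, e.symm x) ∈ W
    · have hx' : Fin.insertNth 0 c x ∈ L ⁻¹' W := by rw [mem_preimage, hL]; exact hx
      rw [indicator_of_mem (by exact hx), indicator_of_mem hx']
      have hd : DifferentiableAt ℝ G (c, e.symm x) :=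
        (hG.contDiffAt (hW.mem_nhds hx)).differentiableAt (by norm_num)
      have hL' := hL c x
      have h1 : HasFDerivAt (fun x => G (c, x))
          ((fderiv ℝ G (c, e.symm x)).comp (ContinuousLinearMap.inr ℝ ℝ E)) (e.symm x) :=
        hd.hasFDerivAt.comp (e.symm x) (hasFDerivAt_prodMk_right c (e.symm x))
      have h2 : HasFDerivAt Gh ((e : E →L[ℝ] (Fin n → ℝ)).comp
          ((fderiv ℝ G (c, e.symm x)).comp (L : (Fin (n + 1) → ℝ) →L[ℝ] ℝ × E)))
          (Fin.insertNth 0 c x) := by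
        refine e.hasFDerivAt.comp _ (HasFDerivAt.comp _ ?_ L.hasFDerivAt)
        rw [hL']; exact hd.hasFDerivAt
      rw [h1.fderiv]
      have h3 : ∀ j : Fin n, L (Pi.single j.succ 1) = (0, e.symm (Pi.single j 1)) := by
        intro j
        rw [← hL]
        congr 1
        ext i
        refine Fin.cases ?_ (fun i => ?_) i
        · simp
        · simp [Pi.single_apply]
      simp only [pullForm, ContinuousAlternatingMap.compContinuousLinearMap_apply, h2.fderiv,
        ContinuousAlternatingMap.smul_apply, smul_eq_mul, Gh, hL',
        ContinuousLinearEquiv.symm_apply_apply]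
      congr 1
      rw [ContinuousLinearMap.det, ← LinearMap.det_conj _ e.toLinearEquiv]
      have h4 := detForm_comp_single ((e : E →L[ℝ] (Fin n → ℝ)).comp
        (((fderiv ℝ G (c, e.symm x)).comp (ContinuousLinearMap.inr ℝ ℝ E)).comp
          (e.symm : (Fin n → ℝ) →L[ℝ] E)))
      refine Eq.trans ?_ (h4.symm.trans ?_)
      · rfl
      · congr 1
        ext j : 1
        simp [h3]
    · have hx' : Fin.insertNth 0 c x ∉ L ⁻¹' W := by rw [mem_preimage, hL]; exact hx
      rw [indicator_of_notMem (by exact hx), indicator_of_notMem hx']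
  rw [conv, conv, key]

end Degree

section Count

variable {E : Type*} [NormedAddCommGroup E] [NormedSpace ℝ E]
variable [FiniteDimensional ℝ E]

lemma exists_injOn_nhds {U : Set E} (hU : IsOpen U) {G : E → E} (hG : ContDiffOn ℝ 1 G U) {x : E}
    (hx : x ∈ U) (hdet : (fderiv ℝ G x).det ≠ 0) :
    map G (𝓝 x) = 𝓝 (G x) ∧ ∃ N ∈ 𝓝 x, N ⊆ U ∧ InjOn G N ∧
      ∀ z ∈ N, SignType.sign (fderiv ℝ G z).det = SignType.sign (fderiv ℝ G x).det := by
  have hs : HasStrictFDerivAt G (fderiv ℝ G x) x :=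
    (hG.contDiffAt (hU.mem_nhds hx)).hasStrictFDerivAt (by norm_num)
  let f' := (fderiv ℝ G x).toContinuousLinearEquivOfDetNeZero hdet
  have hs' : HasStrictFDerivAt G (f' : E →L[ℝ] E) x := by
    simpa [f'] using hs
  refine ⟨hs'.map_nhds_eq_of_equiv, ?_⟩
  have hc : ContinuousAt (fun z => (fderiv ℝ G z).det) x := by
    have h1 : ContinuousAt (fderiv ℝ G) x :=
      ((hG.contDiffAt (hU.mem_nhds hx)).fderiv_right (m := 0) (by norm_num)).continuousAt
    exact ContinuousLinearMap.continuous_det.continuousAt.comp h1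
  have hsgn : ∀ᶠ z in 𝓝 x,
      SignType.sign (fderiv ℝ G z).det = SignType.sign (fderiv ℝ G x).det := by
    rcases lt_or_gt_of_ne hdet with h | h
    · filter_upwards [hc.eventually (gt_mem_nhds h)] with z hz
      rw [sign_neg hz, sign_neg h]
    · filter_upwards [hc.eventually (lt_mem_nhds h)] with z hz
      rw [sign_pos hz, sign_pos h]
  let e := hs'.toOpenPartialHomeomorph G
  have hsrc : e.source ∈ 𝓝 x := e.open_source.mem_nhds hs'.mem_toOpenPartialHomeomorph_source
  refine ⟨e.source ∩ (U ∩ {z | SignType.sign (fderiv ℝ G z).det =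
    SignType.sign (fderiv ℝ G x).det}), inter_mem hsrc (inter_mem (hU.mem_nhds hx) hsgn),
    fun z hz => hz.2.1, fun z hz w hw h => e.injOn hz.1 hw.1 h, fun z hz => hz.2.2⟩

lemma finite_preimage {U : Set E} (hU : IsOpen U) {G : E → E} (hG : ContDiffOn ℝ 1 G U)
    {K : Set E} (hK : IsCompact K) (hKU : K ⊆ U) {y₀ : E}
    (hy : ∀ x ∈ U, G x = y₀ → x ∈ K) (hreg : ∀ x ∈ U, G x = y₀ → (fderiv ℝ G x).det ≠ 0) :
    {x | x ∈ U ∧ G x = y₀}.Finite := by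
  have hset : {x | x ∈ U ∧ G x = y₀} = K ∩ G ⁻¹' {y₀} := by
    ext x
    exact ⟨fun h => ⟨hy x h.1 h.2, h.2⟩, fun h => ⟨hKU h.1, h.2⟩⟩
  have hc : IsCompact {x | x ∈ U ∧ G x = y₀} := by
    rw [hset]
    exact hK.of_isClosed_subset ((hG.continuousOn.mono hKU).preimage_isClosed_of_isClosed
      hK.isClosed isClosed_singleton) inter_subset_left
  have hN : ∀ x ∈ {x | x ∈ U ∧ G x = y₀}, ∃ N ∈ 𝓝 x, InjOn G N := fun x hx => by
    obtain ⟨-, N, hN, -, hinj, -⟩ := exists_injOn_nhds hU hG hx.1 (hreg x hx.1 hx.2)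
    exact ⟨N, hN, hinj⟩
  choose! N hN hinj using hN
  obtain ⟨t, ht, hcov⟩ := hc.elim_nhds_subcover N hN
  refine t.finite_toSet.subset fun x hx => ?_
  obtain ⟨z, hz, hxz⟩ := mem_iUnion₂.1 (hcov hx)
  rw [hinj z (ht z hz) hxz (mem_of_mem_nhds (hN z (ht z hz))) (hx.2.trans (ht z hz).2.symm)]
  exact hz

variable [MeasurableSpace E] [BorelSpace E] (μ : Measure E) [μ.IsAddHaarMeasure]

/-- Near a regular value, the degree integral counts preimages with sign. -/
theorem degI_eq_sum_sign {U : Set E} (hU : IsOpen U) {G : E → E} (hG : ContDiffOn ℝ 1 G U)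
    {K : Set E} (hK : IsCompact K) (hKU : K ⊆ U) {y₀ : E} {δ : ℝ} (hδ : 0 < δ)
    (hy : ∀ x ∈ U, G x ∈ Metric.ball y₀ δ → x ∈ K)
    (hreg : ∀ x ∈ U, G x = y₀ → (fderiv ℝ G x).det ≠ 0)
    (hfin : {x | x ∈ U ∧ G x = y₀}.Finite) :
    ∃ ε > 0, ∀ Ψ : E → ℝ, Continuous Ψ → (∀ y, Ψ y ≠ 0 → y ∈ Metric.ball y₀ ε) →
      degI μ U Ψ G =
        ((∑ x ∈ hfin.toFinset, (SignType.sign (fderiv ℝ G x).det : ℤ) : ℤ) : ℝ) * ∫ y, Ψ y ∂μ := by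
  classical
  set S := hfin.toFinset with hS
  have hmem : ∀ x, x ∈ S ↔ x ∈ U ∧ G x = y₀ := fun x => by simp [hS]
  obtain ⟨V, hV, hdisj⟩ := S.finite_toSet.t2_separation
  have hN : ∀ x ∈ S, ∃ N, IsOpen N ∧ x ∈ N ∧ N ⊆ V x ∧ N ⊆ U ∧ InjOn G N ∧
      (∀ z ∈ N, SignType.sign (fderiv ℝ G z).det = SignType.sign (fderiv ℝ G x).det) ∧
      G '' N ∈ 𝓝 y₀ := by
    intro x hx
    obtain ⟨hmap, N, hN, hNU, hinj, hsg⟩ := exists_injOn_nhds hU hG ((hmem x).1 hx).1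
      (hreg x ((hmem x).1 hx).1 ((hmem x).1 hx).2)
    obtain ⟨N', hN', hN'o, hxN'⟩ := mem_nhds_iff.1 (inter_mem hN ((hV x).2.mem_nhds (hV x).1))
    refine ⟨N', hN'o, hxN', fun z hz => (hN' hz).2, fun z hz => hNU (hN' hz).1,
      hinj.mono fun z hz => (hN' hz).1, fun z hz => hsg z (hN' hz).1, ?_⟩
    rw [← ((hmem x).1 hx).2, ← hmap]
    exact image_mem_map (hN'o.mem_nhds hxN')
  choose! N hNo hxN hNV hNU hinj hsg himg using hN
  have hKc : IsCompact (K \ ⋃ x ∈ S, N x) :=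
    hK.diff (isOpen_biUnion fun x hx => hNo x hx)
  obtain ⟨ε₁, hε₁, hfar⟩ : ∃ ε₁ > 0, ∀ z ∈ K \ ⋃ x ∈ S, N x, ε₁ ≤ dist (G z) y₀ := by
    rcases (K \ ⋃ x ∈ S, N x).eq_empty_or_nonempty with he | hne
    · exact ⟨1, one_pos, by simp [he]⟩
    · have hc : ContinuousOn (fun z => dist (G z) y₀) (K \ ⋃ x ∈ S, N x) :=
        continuous_id.dist continuous_const |>.comp_continuousOn
          (hG.continuousOn.mono (sdiff_subset.trans hKU))
      obtain ⟨z, hz, hmin⟩ := hKc.exists_isMinOn hne hc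
      refine ⟨dist (G z) y₀, dist_pos.2 fun h => hz.2 ?_, fun w hw => hmin hw⟩
      have hzS := (hmem z).2 ⟨hKU hz.1, h⟩
      exact mem_biUnion (x := z) hzS (hxN z hzS)
  obtain ⟨ε₂, hε₂, hball⟩ : ∃ ε₂ > 0, Metric.ball y₀ ε₂ ⊆ ⋂ x ∈ S, G '' N x := by
    have : (⋂ x ∈ S, G '' N x) ∈ 𝓝 y₀ := (Finset.iInter_mem_sets S).2 himg
    exact Metric.mem_nhds_iff.1 this
  refine ⟨min δ (min ε₁ ε₂), by positivity, fun Ψ hΨc hΨ => ?_⟩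
  have hΨi : Integrable Ψ μ := by
    refine hΨc.integrable_of_hasCompactSupport (HasCompactSupport.intro
      (isCompact_closedBall y₀ (min δ (min ε₁ ε₂))) fun y hy => ?_)
    by_contra h
    exact hy (Metric.ball_subset_closedBall (hΨ y h))
  have hder : ∀ x ∈ S, ∀ z ∈ N x, HasFDerivWithinAt G (fderiv ℝ G z) (N x) z := by
    intro x hx z hz
    exact (((hG.contDiffAt (hU.mem_nhds (hNU x hx hz))).differentiableAt
      (by norm_num)).hasFDerivAt).hasFDerivWithinAt
  have hfun : ∀ x ∈ S, ∀ z ∈ N x, Ψ (G z) * (fderiv ℝ G z).det =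
      ((SignType.sign (fderiv ℝ G x).det : ℤ) : ℝ) * (|(fderiv ℝ G z).det| • Ψ (G z)) := by
    intro x hx z hz
    have h1 := sign_mul_abs (fderiv ℝ G z).det
    rw [hsg x hx z hz] at h1
    rw [smul_eq_mul, ← mul_assoc]
    have h2 : ((SignType.sign (fderiv ℝ G x).det : ℤ) : ℝ) =
        (SignType.sign (fderiv ℝ G x).det : ℝ) := by
      cases SignType.sign (fderiv ℝ G x).det <;> simp
    rw [h2, h1, mul_comm]
  have h1 : degI μ U Ψ G = ∫ z in ⋃ x ∈ S, N x, Ψ (G z) * (fderiv ℝ G z).det ∂μ := by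
    rw [degI]
    refine (setIntegral_eq_of_subset_of_forall_sdiff_eq_zero hU.measurableSet
      (iUnion₂_subset hNU) fun z hz => ?_)
    by_contra hne
    have hb := hΨ (G z) (left_ne_zero_of_mul hne)
    have hzK := hy z hz.1 (Metric.ball_subset_ball (min_le_left _ _) hb)
    have h3 := hfar z ⟨hzK, hz.2⟩
    have h4 := Metric.mem_ball.1 hb
    have h5 : min δ (min ε₁ ε₂) ≤ ε₁ := (min_le_right _ _).trans (min_le_left _ _)
    linarith
  rw [h1, integral_biUnion_finset S (fun x hx => (hNo x hx).measurableSet)]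
  · rw [Int.cast_sum, Finset.sum_mul]
    refine Finset.sum_congr rfl fun x hx => ?_
    rw [setIntegral_congr_fun (hNo x hx).measurableSet (fun z hz => hfun x hx z hz),
      integral_const_mul, ← integral_image_eq_integral_abs_det_fderiv_smul μ
        (hNo x hx).measurableSet (hder x hx) (hinj x hx),
      setIntegral_eq_integral_of_forall_compl_eq_zero]
    intro y hy
    by_contra hne
    refine hy (mem_iInter₂.1 (hball (Metric.ball_subset_ball ?_ (hΨ y hne))) x hx)
    exact (min_le_right _ _).trans (min_le_right _ _)
  · intro x hx z hz hxz
    exact (hdisj hx hz hxz).mono (hNV x hx) (hNV z hz)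
  · intro x hx
    refine IntegrableOn.congr_fun (f := fun z => ((SignType.sign (fderiv ℝ G x).det : ℤ) : ℝ) *
      (|(fderiv ℝ G z).det| • Ψ (G z))) ?_ (fun z hz => (hfun x hx z hz).symm)
      (hNo x hx).measurableSet
    exact Integrable.const_mul ((integrableOn_image_iff_integrableOn_abs_det_fderiv_smul μ
      (hNo x hx).measurableSet (hder x hx) (hinj x hx) Ψ).1 hΨi.integrableOn) _

end Count

lemma three_dvd_card_of_perm {α : Type*} [DecidableEq α] (S : Finset α) (P : α → α)
    (hPS : ∀ x ∈ S, P x ∈ S) (h3 : ∀ x ∈ S, P (P (P x)) = x) (hfix : ∀ x ∈ S, P x ≠ x) :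
    3 ∣ S.card := by
  have : Fact (Nat.Prime 3) := ⟨by norm_num⟩
  let f : Function.End S := fun x => ⟨P x, hPS x x.2⟩
  have hf : f ^ 3 ^ 1 = 1 := by
    funext x
    exact Subtype.ext (h3 x x.2)
  have h := Equiv.Perm.card_fixedPoints_modEq (p := 3) (n := 1) hf
  have : IsEmpty (Function.fixedPoints f) :=
    ⟨fun x => hfix x.1 x.1.2 (congrArg Subtype.val x.2)⟩
  rw [Fintype.card_coe] at h
  have h0 : Fintype.card (Function.fixedPoints f) = 0 := Fintype.card_eq_zero
  rw [h0] at h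
  exact (Nat.modEq_zero_iff_dvd).1 h

lemma three_dvd_sum_sign_of_perm {α : Type*} [DecidableEq α] (S : Finset α) (P : α → α)
    (hPS : ∀ x ∈ S, P x ∈ S) (h3 : ∀ x ∈ S, P (P (P x)) = x) (hfix : ∀ x ∈ S, P x ≠ x)
    (f : α → SignType) (hf : ∀ x ∈ S, f (P x) = f x) :
    (3 : ℤ) ∣ ∑ x ∈ S, (f x : ℤ) := by
  have key : ∀ c : SignType, 3 ∣ (S.filter fun x => f x = c).card := fun c => by
    refine three_dvd_card_of_perm _ P ?_ ?_ ?_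
    · intro x hx
      rw [Finset.mem_filter] at hx ⊢
      exact ⟨hPS x hx.1, (hf x hx.1).trans hx.2⟩
    · exact fun x hx => h3 x (Finset.mem_filter.1 hx).1
    · exact fun x hx => hfix x (Finset.mem_filter.1 hx).1
  have hsum : ∑ x ∈ S, (f x : ℤ) =
      ((S.filter fun x => f x = 1).card : ℤ) - ((S.filter fun x => f x = -1).card : ℤ) := by
    rw [Finset.card_filter, Finset.card_filter]
    push_cast
    rw [← Finset.sum_sub_distrib]
    refine Finset.sum_congr rfl fun x _ => ?_
    cases f x <;> simp
  rw [hsum]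
  exact dvd_sub (Int.natCast_dvd_natCast.2 (key 1)) (Int.natCast_dvd_natCast.2 (key (-1)))

section Equivariant

variable {E : Type*} [NormedAddCommGroup E] [NormedSpace ℝ E] [FiniteDimensional ℝ E]

lemma det_eq_one_of_pow_three (P : E ≃L[ℝ] E) (h3 : ∀ x, P (P (P x)) = x) :
    (P : E →L[ℝ] E).det = 1 := by
  have h : ((P : E →L[ℝ] E).det) ^ 3 = 1 := by
    have : (P : E →L[ℝ] E).toLinearMap ∘ₗ (P : E →L[ℝ] E).toLinearMap ∘ₗ
        (P : E →L[ℝ] E).toLinearMap = LinearMap.id := LinearMap.ext h3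
    have h' := congrArg LinearMap.det this
    rw [LinearMap.det_comp, LinearMap.det_comp, LinearMap.det_id] at h'
    rw [ContinuousLinearMap.det, pow_three]
    exact h'
  exact (pow_eq_one_iff_of_ne_zero (by norm_num)).1 h |>.resolve_right (by
    rintro ⟨-, h⟩; exact absurd h (by decide))

/-- Signed preimage counts of a regular value fixed by an order three symmetry are divisible
by three, provided the symmetries of the source and the target are not conjugate. -/
theorem three_dvd_sum_sign {U : Set E} (hU : IsOpen U) {G : E → E} (hG : ContDiffOn ℝ 1 G U)
    (P P' : E ≃L[ℝ] E) (hP : ∀ x, P (P (P x)) = x) (hP' : ∀ x, P' (P' (P' x)) = x)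
    (hPU : ∀ x ∈ U, P x ∈ U) (hcomm : ∀ x ∈ U, G (P x) = P' (G x))
    (htr : LinearMap.trace ℝ E (P : E →L[ℝ] E) ≠ LinearMap.trace ℝ E (P' : E →L[ℝ] E))
    {y₀ : E} (hfix : P' y₀ = y₀) (hreg : ∀ x ∈ U, G x = y₀ → (fderiv ℝ G x).det ≠ 0)
    (hfin : {x | x ∈ U ∧ G x = y₀}.Finite) :
    (3 : ℤ) ∣ ∑ x ∈ hfin.toFinset, (SignType.sign (fderiv ℝ G x).det : ℤ) := by
  classical
  have hmem : ∀ x, x ∈ hfin.toFinset ↔ x ∈ U ∧ G x = y₀ := fun x => by simp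
  have hchain : ∀ x ∈ U, (fderiv ℝ G (P x)).comp (P : E →L[ℝ] E) =
      (P' : E →L[ℝ] E).comp (fderiv ℝ G x) := by
    intro x hx
    have hd : ∀ z ∈ U, HasFDerivAt G (fderiv ℝ G z) z := fun z hz =>
      ((hG.contDiffAt (hU.mem_nhds hz)).differentiableAt (by norm_num)).hasFDerivAt
    have h1 : HasFDerivAt (fun z => G (P z)) ((fderiv ℝ G (P x)).comp (P : E →L[ℝ] E)) x :=
      (hd _ (hPU x hx)).comp x P.hasFDerivAt
    have h2 : HasFDerivAt (fun z => P' (G z)) ((P' : E →L[ℝ] E).comp (fderiv ℝ G x)) x :=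
      P'.hasFDerivAt.comp x (hd x hx)
    refine h1.unique (h2.congr_of_eventuallyEq ?_)
    filter_upwards [hU.mem_nhds hx] with z hz using hcomm z hz
  refine three_dvd_sum_sign_of_perm _ P ?_ (fun x _ => hP x) ?_ _ ?_
  · intro x hx
    rw [hmem] at hx ⊢
    exact ⟨hPU x hx.1, by rw [hcomm x hx.1, hx.2, hfix]⟩
  · intro x hx hPx
    rw [hmem] at hx
    have h := hchain x hx.1
    rw [hPx] at h
    let D := (fderiv ℝ G x).toContinuousLinearEquivOfDetNeZero (hreg x hx.1 hx.2)
    refine htr ?_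
    rw [← LinearMap.trace_conj' (P : E →L[ℝ] E).toLinearMap D.toLinearEquiv]
    congr 1
    ext z
    have h2 := DFunLike.congr_fun h (D.symm z)
    have h3 : fderiv ℝ G x (D.symm z) = z := D.apply_symm_apply z
    simp only [ContinuousLinearMap.comp_apply, h3] at h2
    exact h2
  · intro x hx
    rw [hmem] at hx
    have h := congrArg (fun A : E →L[ℝ] E => LinearMap.det A.toLinearMap) (hchain x hx.1)
    have h1 := det_eq_one_of_pow_three P hP
    have h2 := det_eq_one_of_pow_three P' hP'
    rw [ContinuousLinearMap.det] at h1 h2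
    simp only [ContinuousLinearMap.toLinearMap_comp, LinearMap.det_comp, h1, h2, one_mul,
      mul_one] at h
    rw [ContinuousLinearMap.det, ContinuousLinearMap.det, h]

variable [MeasurableSpace E] [BorelSpace E] (μ : Measure E) [μ.IsAddHaarMeasure]

end Equivariant

section Gram

variable {V W : Type*} [NormedAddCommGroup V] [InnerProductSpace ℝ V]
  [NormedAddCommGroup W] [InnerProductSpace ℝ W]

/-- The Gram determinant of a finite family of vectors. -/
def gramDet {n : ℕ} (v : Fin n → V) : ℝ := (Matrix.of fun i j : Fin n => ⟪v i, v j⟫).det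

lemma gramDet_le {n : ℕ} {v : Fin n → V} {R : ℝ} (hv : ∀ i, ‖v i‖ ≤ R) :
    |gramDet v| ≤ n.factorial * (R ^ 2) ^ n := by
  have h := Matrix.det_le (A := Matrix.of fun i j : Fin n => ⟪v i, v j⟫) (abv := AbsoluteValue.abs)
    (x := R ^ 2) (fun i j => by
      refine (abs_real_inner_le_norm _ _).trans ?_
      rw [sq]
      exact mul_le_mul (hv i) (hv j) (norm_nonneg _) ((norm_nonneg _).trans (hv i)))
  simpa [gramDet] using h

lemma gramDet_combination {n : ℕ} (q : Fin n → V) (R : Matrix (Fin n) (Fin n) ℝ) :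
    gramDet (fun j => ∑ i, R i j • q i) = R.det ^ 2 * gramDet q := by
  have : (Matrix.of fun i j : Fin n => ⟪∑ k, R k i • q k, ∑ k, R k j • q k⟫) =
      R.transpose * (Matrix.of fun i j : Fin n => ⟪q i, q j⟫) * R := by
    ext i j
    simp only [Matrix.of_apply, Matrix.mul_apply, Matrix.transpose_apply, sum_inner, inner_sum,
      real_inner_smul_left, real_inner_smul_right, Finset.sum_mul]
    exact Finset.sum_congr rfl fun _ _ => Finset.sum_congr rfl fun _ _ => by
      rw [real_inner_comm]; ring
  rw [gramDet, this, Matrix.det_mul, Matrix.det_mul, Matrix.det_transpose, gramDet]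
  ring

/-- Every family of `n` vectors in a space of dimension at least `n` is in the span of an
orthonormal family of the same size. -/
lemma exists_orthonormal_combination [FiniteDimensional ℝ V] {n m : ℕ}
    (hV : Module.finrank ℝ V = n + m) (u : Fin n → V) :
    ∃ q : Fin n → V, Orthonormal ℝ q ∧ ∀ j, u j = ∑ i, ⟪q i, u j⟫ • q i := by
  have hc : Module.finrank ℝ V = Fintype.card (Fin (n + m)) := by simpa using hV
  let f : Fin (n + m) → V := Fin.append u 0
  let b := InnerProductSpace.gramSchmidtOrthonormalBasis hc f
  refine ⟨fun i => b (Fin.castAdd m i), b.orthonormal.comp _ (Fin.castAdd_injective n m),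
    fun j => ?_⟩
  have h := b.sum_repr' (u j)
  rw [Fin.sum_univ_add] at h
  have h0 : ∀ i : Fin m, ⟪b (Fin.natAdd n i), u j⟫ = 0 := by
    intro i
    have := InnerProductSpace.gramSchmidtOrthonormalBasis_inv_triangular hc f
      (i := Fin.castAdd m j) (j := Fin.natAdd n i) (by
        rw [Fin.lt_def]; simp; omega)
    simpa [f, b] using this
  simpa [h0] using h.symm

lemma sqrt_gramDet_le_of_orthonormal_bound [FiniteDimensional ℝ V] {n m : ℕ}
    (hV : Module.finrank ℝ V = n + m) (A : V →ₗ[ℝ] W) {C : ℝ}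
    (hC : ∀ q : Fin n → V, Orthonormal ℝ q → Real.sqrt (gramDet fun i => A (q i)) ≤ C)
    {u : Fin n → V} {R : ℝ} (hu : ∀ i, ‖u i‖ ≤ R) :
    Real.sqrt (gramDet fun i => A (u i)) ≤ n.factorial * R ^ n * C := by
  obtain ⟨q, hq, hqu⟩ := exists_orthonormal_combination hV u
  set M : Matrix (Fin n) (Fin n) ℝ := Matrix.of fun i j => ⟪q i, u j⟫ with hM
  have h1 : (fun j => A (u j)) = fun j => ∑ i, M i j • A (q i) := by
    funext j
    conv_lhs => rw [hqu j]
    simp [hM]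
  have hdet : |M.det| ≤ n.factorial * R ^ n := by
    have h := Matrix.det_le (A := M) (abv := AbsoluteValue.abs) (x := R) (fun i j => by
      refine (abs_real_inner_le_norm _ _).trans ?_
      rw [hq.1 i, one_mul]
      exact hu j)
    simpa using h
  rw [h1, gramDet_combination, Real.sqrt_mul (sq_nonneg _), Real.sqrt_sq_eq_abs]
  exact mul_le_mul hdet (hC q hq) (Real.sqrt_nonneg _) ((abs_nonneg _).trans hdet)

lemma gramDet_nonneg {n : ℕ} (v : Fin n → V) : 0 ≤ gramDet v :=
  (Matrix.posSemidef_gram ℝ v).det_nonneg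

/-- A maximal minor is bounded by the square root of the Gram determinant. -/
lemma abs_det_castSucc_le {n : ℕ} (w : Fin n → EucA (n + 1)) :
    |(Matrix.of fun i j : Fin n => w j i.castSucc).det| ≤ Real.sqrt (gramDet w) := by
  set M : Matrix (Fin n) (Fin n) ℝ := Matrix.of fun i j : Fin n => w j i.castSucc with hM
  refine Real.abs_le_sqrt ?_
  by_cases h0 : M.det = 0
  · rw [h0]; simpa using gramDet_nonneg w
  set c : Fin n → ℝ := fun j => w j (Fin.last n) with hc
  have hA : (Matrix.of fun i j : Fin n => ⟪w i, w j⟫) = M.transpose * M +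
      Matrix.replicateCol Unit c * Matrix.replicateRow Unit c := by
    ext i j
    simp only [Matrix.of_apply, PiLp.inner_apply, Fin.sum_univ_castSucc, Matrix.add_apply,
      Matrix.mul_apply, Matrix.transpose_apply, hM, hc, Matrix.replicateCol_apply,
      Matrix.replicateRow_apply, Finset.univ_unique, Finset.sum_singleton]
    simp [mul_comm]
  have hdet : (M.transpose * M).det = M.det ^ 2 := by
    rw [Matrix.det_mul, Matrix.det_transpose, sq]
  have hu : IsUnit (M.transpose * M).det := by
    rw [hdet]; exact (pow_ne_zero 2 h0).isUnit
  rw [gramDet, hA, Matrix.det_add_replicateCol_mul_replicateRow hu, hdet]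
  have hps : (M.transpose * M)⁻¹.PosSemidef := by
    have : (M.transpose * M).PosSemidef := by
      simpa [Matrix.conjTranspose_eq_transpose_of_trivial] using
        Matrix.posSemidef_conjTranspose_mul_self M
    exact this.inv
  have h2 : (1 + Matrix.replicateRow Unit c * (M.transpose * M)⁻¹ *
      Matrix.replicateCol Unit c).det = 1 + c ⬝ᵥ ((M.transpose * M)⁻¹).mulVec c := by
    rw [Matrix.det_unique, Matrix.mul_assoc]
    simp [Matrix.add_apply, Matrix.mul_apply, dotProduct, Matrix.mulVec]
  rw [h2]
  have h3 : 0 ≤ c ⬝ᵥ ((M.transpose * M)⁻¹).mulVec c := by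
    simpa using hps.dotProduct_mulVec_nonneg c
  nlinarith [sq_nonneg M.det]

end Gram

lemma exists_orthonormalBasis_adapted
    (L₁ : EuclideanSpace ℝ (Fin 4 ⊕ Fin 4) →L[ℝ] (Fin 4 → ℝ)) :
    ∃ b : OrthonormalBasis (Fin 4 ⊕ Fin 4) ℝ (EuclideanSpace ℝ (Fin 4 ⊕ Fin 4)),
      ∀ i j, L₁ (b (Sum.inr j)) i = 0 := by
  have hc : Module.finrank ℝ (EuclideanSpace ℝ (Fin 4 ⊕ Fin 4)) = Fintype.card (Fin (4 + 4)) := by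
    simp
  let g : Fin 4 → EuclideanSpace ℝ (Fin 4 ⊕ Fin 4) := fun i =>
    (InnerProductSpace.toDual ℝ _).symm ((ContinuousLinearMap.proj (R := ℝ) i).comp L₁)
  have hg : ∀ i x, ⟪g i, x⟫ = L₁ x i := fun i x => by simp [g]
  let f : Fin (4 + 4) → EuclideanSpace ℝ (Fin 4 ⊕ Fin 4) := Fin.append g 0
  let b' := InnerProductSpace.gramSchmidtOrthonormalBasis hc f
  refine ⟨b'.reindex finSumFinEquiv.symm, fun i j => ?_⟩
  have hb : b'.reindex finSumFinEquiv.symm (Sum.inr j) = b' (Fin.natAdd 4 j) := by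
    rw [OrthonormalBasis.reindex_apply]
    rfl
  have := InnerProductSpace.gramSchmidtOrthonormalBasis_inv_triangular hc f
    (i := Fin.castAdd 4 i) (j := Fin.natAdd 4 j) (by
      rw [Fin.lt_def]; simp; omega)
  rw [← hg, real_inner_comm, hb]
  simpa only [f, Fin.append_left] using this

lemma abs_det_sum_le {L₁ L₂ : EuclideanSpace ℝ (Fin 4 ⊕ Fin 4) →L[ℝ] (Fin 4 → ℝ)}
    {A : EuclideanSpace ℝ (Fin 4 ⊕ Fin 4) →L[ℝ] EuclideanSpace ℝ (Fin 4 ⊕ Fin 4)}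
    (hA1 : ∀ x i, A x (Sum.inl i) = L₁ x i) (hA2 : ∀ x i, A x (Sum.inr i) = L₂ x i)
    {C₁ C₂ : ℝ}
    (h1 : ∀ v : Fin 4 → EuclideanSpace ℝ (Fin 4 ⊕ Fin 4), Orthonormal ℝ v →
      |(Matrix.of fun i j => L₁ (v j) i).det| ≤ C₁)
    (h2 : ∀ v : Fin 4 → EuclideanSpace ℝ (Fin 4 ⊕ Fin 4), Orthonormal ℝ v →
      |(Matrix.of fun i j => L₂ (v j) i).det| ≤ C₂) : |A.det| ≤ C₁ * C₂ := by
  obtain ⟨b, hb0⟩ := exists_orthonormalBasis_adapted L₁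
  let Q : Matrix (Fin 4 ⊕ Fin 4) (Fin 4 ⊕ Fin 4) ℝ := Matrix.of fun i j => b j i
  have hQ : |Q.det| = 1 := by
    have hQQ : Q.transpose * Q = 1 := by
      ext i j
      have := orthonormal_iff_ite.1 b.orthonormal i j
      rw [Matrix.one_apply, ← this, PiLp.inner_apply, Matrix.mul_apply]
      refine Finset.sum_congr rfl fun k _ => ?_
      simp only [Q, Matrix.transpose_apply, Matrix.of_apply]
      exact mul_comm _ _
    have h := congrArg Matrix.det hQQ
    rw [Matrix.det_mul, Matrix.det_transpose, Matrix.det_one, ← sq] at h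
    rwa [← sq_eq_sq₀ (abs_nonneg _) zero_le_one, sq_abs, one_pow]
  let e := (EuclideanSpace.basisFun (Fin 4 ⊕ Fin 4) ℝ).toBasis
  have hM : LinearMap.toMatrix e e A.toLinearMap * Q =
      Matrix.fromBlocks (Matrix.of fun i j => L₁ (b (Sum.inl j)) i) 0
        (Matrix.of fun i j => L₂ (b (Sum.inl j)) i) (Matrix.of fun i j => L₂ (b (Sum.inr j)) i) := by
    have h : ∀ i j, (LinearMap.toMatrix e e A.toLinearMap * Q) i j = A (b j) i := by
      intro i j
      have hx := LinearMap.toMatrix_mulVec_repr e e A.toLinearMap (b j)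
      have := congrFun hx i
      rw [Matrix.mul_apply]
      simpa [Matrix.mulVec, dotProduct, Q, e] using this
    ext i j
    rw [h]
    rcases i with i | i <;> rcases j with j | j <;> simp [hA1, hA2, hb0]
  have hdet : |A.det| = |(LinearMap.toMatrix e e A.toLinearMap * Q).det| := by
    rw [Matrix.det_mul, abs_mul, hQ, mul_one, LinearMap.det_toMatrix]
  rw [hdet, hM, Matrix.det_fromBlocks_zero₁₂, abs_mul]
  refine mul_le_mul (h1 _ (b.orthonormal.comp _ Sum.inl_injective))
    (h2 _ (b.orthonormal.comp _ Sum.inr_injective)) (abs_nonneg _) ?_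
  exact (abs_nonneg _).trans (h1 _ (b.orthonormal.comp _ Sum.inl_injective))

section Dilation

variable {V W : Type*} [NormedAddCommGroup V] [InnerProductSpace ℝ V]
  [NormedAddCommGroup W] [InnerProductSpace ℝ W]

lemma sqrt_gramDet_map_le {k : ℕ} {A : V →ₗ[ℝ] W} {R : ℝ} (hA : ∀ v, ‖A v‖ ≤ R * ‖v‖)
    {v : Fin k → V} (hv : Orthonormal ℝ v) :
    Real.sqrt (gramDet fun i => A (v i)) ≤ Real.sqrt (k.factorial * (R ^ 2) ^ k) := by
  refine Real.sqrt_le_sqrt ((le_abs_self _).trans (gramDet_le fun i => ?_))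
  simpa [hv.1 i] using hA (v i)

lemma lamNorm_le {k : ℕ} {A : V →ₗ[ℝ] W} {C : ℝ} (hC : 0 ≤ C)
    (h : ∀ v : Fin k → V, Orthonormal ℝ v → Real.sqrt (gramDet fun i => A (v i)) ≤ C) :
    lamNorm k A ≤ C :=
  Real.iSup_le (fun v => h v.1 v.2) hC

lemma le_lamNorm {k : ℕ} {A : V →ₗ[ℝ] W} {R : ℝ} (hA : ∀ v, ‖A v‖ ≤ R * ‖v‖)
    {v : Fin k → V} (hv : Orthonormal ℝ v) :
    Real.sqrt (gramDet fun i => A (v i)) ≤ lamNorm k A := by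
  refine le_ciSup (f := fun v : {v : Fin k → V // Orthonormal ℝ v} =>
    Real.sqrt (Matrix.of fun (i j : Fin k) => ⟪A (v.1 i), A (v.1 j)⟫).det) ?_ ⟨v, hv⟩
  refine ⟨Real.sqrt (k.factorial * (R ^ 2) ^ k), ?_⟩
  rintro _ ⟨w, rfl⟩
  exact sqrt_gramDet_map_le hA w.2

variable {d : ℕ}

/-- The derivative along the sphere, as it occurs in the definition of `kDilation`. -/
abbrev sphDeriv (F : EucA d → W) (x : EucA d) : (ℝ ∙ x)ᗮ →ₗ[ℝ] W :=
  (fderiv ℝ F x).toLinearMap ∘ₗ ((ℝ ∙ x)ᗮ).subtype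

lemma exists_sphDeriv_bound {F : EucA d → W} (hF : ContDiff ℝ 1 F) :
    ∃ R : ℝ, 0 ≤ R ∧ ∀ x ∈ usph d, ∀ v, ‖fderiv ℝ F x v‖ ≤ R * ‖v‖ := by
  have hc : Continuous fun x => ‖fderiv ℝ F x‖ := (hF.continuous_fderiv (by norm_num)).norm
  obtain ⟨R, hR⟩ := (isCompact_sphere (0 : EucA d) 1).bddAbove_image hc.continuousOn
  refine ⟨max R 0, le_max_right _ _, fun x hx v => ?_⟩
  refine ((fderiv ℝ F x).le_opNorm v).trans ?_
  gcongr
  exact (hR (mem_image_of_mem _ hx)).trans (le_max_left _ _)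

lemma kDilation_le {k : ℕ} {F : EucA d → W} {C : ℝ} (hC : 0 ≤ C)
    (h : ∀ x ∈ usph d, ∀ v : Fin k → EucA d, Orthonormal ℝ v → (∀ i, ⟪x, v i⟫ = 0) →
      Real.sqrt (gramDet fun i => fderiv ℝ F x (v i)) ≤ C) : kDilation k F ≤ C := by
  refine Real.iSup_le (fun x => lamNorm_le hC fun v hv => ?_) hC
  refine h x x.2 (fun i => (v i : EucA d)) (hv.comp_linearIsometry (Submodule.subtypeₗᵢ _))
    fun i => ?_
  exact Submodule.mem_orthogonal_singleton_iff_inner_right.1 (v i).2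

lemma le_kDilation {k : ℕ} {F : EucA d → W} (hF : ContDiff ℝ 1 F) {x : EucA d}
    (hx : x ∈ usph d) {v : Fin k → (ℝ ∙ x)ᗮ} (hv : Orthonormal ℝ v) :
    Real.sqrt (gramDet fun i => fderiv ℝ F x (v i)) ≤ kDilation k F := by
  obtain ⟨R, hR0, hR⟩ := exists_sphDeriv_bound hF
  have h1 : ∀ y ∈ usph d, ∀ v, ‖sphDeriv F y v‖ ≤ R * ‖v‖ := fun y hy v => hR y hy v
  refine (le_lamNorm (A := sphDeriv F x) (h1 x hx) hv).trans ?_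
  refine le_ciSup (f := fun y : usph d => lamNorm k (sphDeriv F (y : EucA d))) ?_ ⟨x, hx⟩
  refine ⟨Real.sqrt (k.factorial * (R ^ 2) ^ k), ?_⟩
  rintro _ ⟨y, rfl⟩
  exact lamNorm_le (Real.sqrt_nonneg _) fun w hw => sqrt_gramDet_map_le (h1 y y.2) hw

lemma kDilation_nonneg {k : ℕ} (F : EucA d → W) : 0 ≤ kDilation k F :=
  Real.iSup_nonneg fun _ => Real.iSup_nonneg fun _ => Real.sqrt_nonneg _

/-- The `4`-dilation of a map defined on `S⁷` controls the minors of its derivative. -/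
lemma abs_det_fderiv_le {F : EucA 8 → EucA 5} (hF : ContDiff ℝ 1 F) {x : EucA 8}
    (hx : x ∈ usph 8) {u : Fin 4 → EucA 8} (hxu : ∀ i, ⟪x, u i⟫ = 0) {R : ℝ}
    (hu : ∀ i, ‖u i‖ ≤ R) :
    |(Matrix.of fun i j : Fin 4 => fderiv ℝ F x (u j) i.castSucc).det| ≤
      24 * R ^ 4 * kDilation 4 F := by
  haveI : Fact (Module.finrank ℝ (EucA 8) = 7 + 1) := ⟨by simp⟩
  have hx0 : x ≠ 0 := by
    rintro rfl
    simp [usph] at hx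
  have hdim : Module.finrank ℝ (ℝ ∙ x)ᗮ = 4 + 3 :=
    Submodule.finrank_orthogonal_span_singleton (n := 7) hx0
  let u' : Fin 4 → (ℝ ∙ x)ᗮ := fun i =>
    ⟨u i, Submodule.mem_orthogonal_singleton_iff_inner_right.2 (hxu i)⟩
  have h := sqrt_gramDet_le_of_orthonormal_bound hdim (sphDeriv F x)
    (C := kDilation 4 F) (fun q hq => le_kDilation hF hx hq) (u := u') (R := R) hu
  refine (abs_det_castSucc_le (fun i => fderiv ℝ F x (u i))).trans (h.trans (le_of_eq ?_))
  norm_num [Nat.factorial]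

end Dilation

section Stereographic

/-- The inverse of the stereographic projection from `bpt 7`, on all of `ℝ⁸`. -/
def stereo (X : EucA 8) : EucA 8 := bpt 7 + (2 / (‖X‖ ^ 2 + 1)) • (X - bpt 7)

lemma stereo_contDiff {n : ℕ∞} : ContDiff ℝ n stereo := by
  unfold stereo
  have h1 : ContDiff ℝ n fun X : EucA 8 => 2 / (‖X‖ ^ 2 + 1) :=
    contDiff_const.div ((contDiff_norm_sq ℝ).add contDiff_const) fun X => by positivity
  exact contDiff_const.add (h1.smul (contDiff_id.sub contDiff_const))

lemma norm_bpt (d : ℕ) : ‖bpt d‖ = 1 := by simp [bpt]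

lemma inner_bpt (X : EucA 8) : ⟪X, bpt 7⟫ = X 7 := by
  simp only [bpt, EuclideanSpace.inner_single_right]
  simp [Fin.last]

lemma stereo_apply_last {X : EucA 8} (hX : X 7 = 0) : stereo X 7 = 1 - 2 / (‖X‖ ^ 2 + 1) := by
  have : bpt 7 7 = 1 := by simp [bpt, Fin.last]
  simp only [stereo, PiLp.add_apply, PiLp.smul_apply, PiLp.sub_apply, hX, this, smul_eq_mul]
  ring

lemma stereo_mem {X : EucA 8} (hX : X 7 = 0) : stereo X ∈ usph 8 := by
  have h0 : ‖X - bpt 7‖ ^ 2 = ‖X‖ ^ 2 + 1 := by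
    rw [norm_sub_sq_real, inner_bpt, hX, norm_bpt]; ring
  have h1 : ⟪bpt 7, X - bpt 7⟫ = -1 := by
    rw [inner_sub_right, real_inner_comm, inner_bpt, hX, real_inner_self_eq_norm_sq, norm_bpt]
    norm_num
  have h : ‖stereo X‖ ^ 2 = 1 := by
    rw [stereo, norm_add_sq_real, real_inner_smul_right, h1, norm_smul, mul_pow, h0, norm_bpt,
      Real.norm_eq_abs, sq_abs]
    have : ‖X‖ ^ 2 + 1 ≠ 0 := by positivity
    field_simp
    ring
  rw [usph, mem_sphere_zero_iff_norm]
  nlinarith [norm_nonneg (stereo X), h]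

lemma fderiv_stereo (X h : EucA 8) : fderiv ℝ stereo X h =
    (2 / (‖X‖ ^ 2 + 1)) • h - (4 * ⟪X, h⟫ / (‖X‖ ^ 2 + 1) ^ 2) • (X - bpt 7) := by
  have hq : ‖X‖ ^ 2 + 1 ≠ 0 := by positivity
  have h1 : HasFDerivAt (fun X : EucA 8 => ‖X‖ ^ 2 + 1) (2 • innerSL ℝ X) X :=
    ((hasStrictFDerivAt_norm_sq X).hasFDerivAt).add_const 1
  have h2 := (((hasDerivAt_inv hq).comp_hasFDerivAt X h1).const_mul 2).smul
    ((hasFDerivAt_id X).sub_const (bpt 7))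
  have h3 := h2.const_add (bpt 7)
  have h4 : HasFDerivAt stereo _ X := h3
  rw [h4.fderiv]
  simp only [Function.comp, id]
  simp only [add_apply, smul_apply,
    ContinuousLinearMap.smulRight_apply, ContinuousLinearMap.id_apply, innerSL_apply_apply,
    smul_eq_mul, nsmul_eq_mul]
  rw [sub_eq_add_neg (_ • h), ← neg_smul]
  congr 2
  push_cast
  field_simp
  ring

lemma norm_fderiv_stereo_le {X : EucA 8} (hX : X 7 = 0) (h : EucA 8) :
    ‖fderiv ℝ stereo X h‖ ≤ 10 / (‖X‖ ^ 2 + 1) * ‖h‖ := by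
  rw [fderiv_stereo]
  have hq : 0 < ‖X‖ ^ 2 + 1 := by positivity
  refine (norm_sub_le _ _).trans ?_
  rw [norm_smul, norm_smul, Real.norm_eq_abs, Real.norm_eq_abs, abs_div, abs_div, abs_mul,
    abs_of_pos hq, abs_of_pos (pow_pos hq 2)]
  have h0 : ‖X - bpt 7‖ ≤ ‖X‖ + 1 := (norm_sub_le _ _).trans (by rw [norm_bpt])
  have h1 := abs_real_inner_le_norm X h
  have h2 : |⟪X, h⟫| * ‖X - bpt 7‖ ≤ 2 * (‖X‖ ^ 2 + 1) * ‖h‖ := by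
    calc |⟪X, h⟫| * ‖X - bpt 7‖ ≤ (‖X‖ * ‖h‖) * (‖X‖ + 1) := by gcongr
      _ = (‖X‖ * (‖X‖ + 1)) * ‖h‖ := by ring
      _ ≤ _ := by
        refine mul_le_mul_of_nonneg_right ?_ (norm_nonneg h)
        nlinarith [sq_nonneg (‖X‖ - 1)]
  have h3 : |(4:ℝ)| * |⟪X, h⟫| / (‖X‖ ^ 2 + 1) ^ 2 * ‖X - bpt 7‖ ≤
      8 / (‖X‖ ^ 2 + 1) * ‖h‖ := by
    rw [abs_of_pos (by norm_num : (0:ℝ) < 4), div_mul_eq_mul_div, div_mul_eq_mul_div,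
      div_le_div_iff₀ (by positivity) hq]
    nlinarith
  have h4 : |(2:ℝ)| = 2 := abs_of_pos (by norm_num)
  rw [h4]
  calc _ ≤ 2 / (‖X‖ ^ 2 + 1) * ‖h‖ + 8 / (‖X‖ ^ 2 + 1) * ‖h‖ := by gcongr
    _ = _ := by ring

lemma inner_stereo_fderiv {X h : EucA 8} (hX : X 7 = 0) (hh : h 7 = 0) :
    ⟪stereo X, fderiv ℝ stereo X h⟫ = 0 := by
  rw [fderiv_stereo, stereo]
  have e1 : ⟪bpt 7, X⟫ = 0 := by rw [real_inner_comm, inner_bpt, hX]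
  have e2 : ⟪bpt 7, h⟫ = 0 := by rw [real_inner_comm, inner_bpt, hh]
  simp only [inner_add_left, inner_sub_right, inner_sub_left, real_inner_smul_left,
    real_inner_smul_right, e1, e2, inner_bpt, hX, real_inner_self_eq_norm_sq, norm_bpt]
  have : ‖X‖ ^ 2 + 1 ≠ 0 := by positivity
  field_simp
  ring

end Stereographic

/-- The configuration space for vertical pairs of points of `ℝ⁷`. -/
abbrev E44 := EuclideanSpace ℝ (Fin 4 ⊕ Fin 4)

/-- The lower point of a vertical pair. -/
def pairFst : E44 →L[ℝ] EucA 8 := LinearMap.toContinuousLinearMap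
  { toFun := fun x => !₂[x (Sum.inl 0), x (Sum.inl 1), x (Sum.inl 2), x (Sum.inl 3),
      x (Sum.inr 1), x (Sum.inr 2), x (Sum.inr 3), 0]
    map_add' := fun x y => by ext i; fin_cases i <;> simp
    map_smul' := fun c x => by ext i; fin_cases i <;> simp }

/-- The upper point of a vertical pair. -/
def pairSnd : E44 →L[ℝ] EucA 8 := LinearMap.toContinuousLinearMap
  { toFun := fun x => !₂[x (Sum.inr 0), x (Sum.inl 1), x (Sum.inl 2), x (Sum.inl 3),
      x (Sum.inr 1), x (Sum.inr 2), x (Sum.inr 3), 0]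
    map_add' := fun x y => by ext i; fin_cases i <;> simp
    map_smul' := fun c x => by ext i; fin_cases i <;> simp }

lemma pairFst_apply (x : E44) : pairFst x = !₂[x (Sum.inl 0), x (Sum.inl 1), x (Sum.inl 2),
    x (Sum.inl 3), x (Sum.inr 1), x (Sum.inr 2), x (Sum.inr 3), 0] := rfl

lemma pairSnd_apply (x : E44) : pairSnd x = !₂[x (Sum.inr 0), x (Sum.inl 1), x (Sum.inl 2),
    x (Sum.inl 3), x (Sum.inr 1), x (Sum.inr 2), x (Sum.inr 3), 0] := rfl

lemma pairFst_last (x : E44) : pairFst x 7 = 0 := rfl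

lemma pairSnd_last (x : E44) : pairSnd x 7 = 0 := rfl

lemma norm_sq_pairFst (x : E44) : ‖pairFst x‖ ^ 2 = x (Sum.inl 0) ^ 2 + x (Sum.inl 1) ^ 2 +
    x (Sum.inl 2) ^ 2 + x (Sum.inl 3) ^ 2 + x (Sum.inr 1) ^ 2 + x (Sum.inr 2) ^ 2 +
    x (Sum.inr 3) ^ 2 := by
  rw [EuclideanSpace.real_norm_sq_eq, pairFst_apply]
  simp [Fin.sum_univ_succ]
  ring

lemma norm_sq_pairSnd (x : E44) : ‖pairSnd x‖ ^ 2 = x (Sum.inr 0) ^ 2 + x (Sum.inl 1) ^ 2 +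
    x (Sum.inl 2) ^ 2 + x (Sum.inl 3) ^ 2 + x (Sum.inr 1) ^ 2 + x (Sum.inr 2) ^ 2 +
    x (Sum.inr 3) ^ 2 := by
  rw [EuclideanSpace.real_norm_sq_eq, pairSnd_apply]
  simp [Fin.sum_univ_succ]
  ring

lemma norm_sq_E44 (x : E44) : ‖x‖ ^ 2 = x (Sum.inl 0) ^ 2 + x (Sum.inl 1) ^ 2 +
    x (Sum.inl 2) ^ 2 + x (Sum.inl 3) ^ 2 + (x (Sum.inr 0) ^ 2 + x (Sum.inr 1) ^ 2 +
    x (Sum.inr 2) ^ 2 + x (Sum.inr 3) ^ 2) := by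
  rw [EuclideanSpace.real_norm_sq_eq, Fintype.sum_sum_type]
  simp [Fin.sum_univ_succ]
  ring

lemma norm_pairFst_le (x : E44) : ‖pairFst x‖ ≤ ‖x‖ := by
  refine le_of_sq_le_sq ?_ (norm_nonneg _)
  rw [norm_sq_pairFst, norm_sq_E44]
  nlinarith [sq_nonneg (x (Sum.inr 0))]

lemma norm_pairSnd_le (x : E44) : ‖pairSnd x‖ ≤ ‖x‖ := by
  refine le_of_sq_le_sq ?_ (norm_nonneg _)
  rw [norm_sq_pairSnd, norm_sq_E44]
  nlinarith [sq_nonneg (x (Sum.inl 0))]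

/-- The pair map: the first four coordinates of `F` at both points of a vertical pair. -/
def pairMap (F : EucA 8 → EucA 5) (x : E44) : E44 :=
  WithLp.toLp 2 (Sum.elim (fun i => F (stereo (pairFst x)) i.castSucc)
    (fun i => F (stereo (pairSnd x)) i.castSucc))

/-- Ordered vertical pairs of points mapped to the lower hemisphere. -/
def pairDom (F : EucA 8 → EucA 5) : Set E44 :=
  {x | x (Sum.inl 0) < x (Sum.inr 0) ∧ F (stereo (pairFst x)) 4 < 0 ∧
    F (stereo (pairSnd x)) 4 < 0}

lemma HasFDerivAt.euclidean_coord {ι V : Type*} [Fintype ι] [NormedAddCommGroup V]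
    [NormedSpace ℝ V] {f : V → EuclideanSpace ℝ ι} {f' : V →L[ℝ] EuclideanSpace ℝ ι} {x : V}
    (h : HasFDerivAt f f' x) (i : ι) :
    HasFDerivAt (fun y => f y i) ((EuclideanSpace.proj (𝕜 := ℝ) i).comp f') x :=
  (EuclideanSpace.proj (𝕜 := ℝ) i).hasFDerivAt.comp x h

lemma abs_det_fderiv_pairMap_le {F : EucA 8 → EucA 5} (hF : ContDiff ℝ 1 F) (x : E44) :
    |(fderiv ℝ (pairMap F) x).det| ≤
      (24 * (10 / (‖pairFst x‖ ^ 2 + 1)) ^ 4 * kDilation 4 F) *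
      (24 * (10 / (‖pairSnd x‖ ^ 2 + 1)) ^ 4 * kDilation 4 F) := by
  have hd : ∀ L : E44 →L[ℝ] EucA 8, HasFDerivAt (fun x => F (stereo (L x)))
      ((fderiv ℝ F (stereo (L x))).comp ((fderiv ℝ stereo (L x)).comp L)) x := fun L =>
    ((hF.differentiable (by norm_num) _).hasFDerivAt).comp x
      (((stereo_contDiff (n := 1)).differentiable (by norm_num) _).hasFDerivAt.comp x
        L.hasFDerivAt)
  have hdiff : DifferentiableAt ℝ (pairMap F) x := by
    rw [differentiableAt_euclidean]
    rintro (i | i)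
    · exact (differentiableAt_euclidean.1 (hd pairFst).differentiableAt) i.castSucc
    · exact (differentiableAt_euclidean.1 (hd pairSnd).differentiableAt) i.castSucc
  have key : ∀ L : E44 →L[ℝ] EucA 8, (∀ y, L y 7 = 0) → (∀ y, ‖L y‖ ≤ ‖y‖) →
      ∀ v : Fin 4 → E44, Orthonormal ℝ v →
      |(Matrix.of fun i j : Fin 4 => fderiv ℝ F (stereo (L x))
        (fderiv ℝ stereo (L x) (L (v j))) i.castSucc).det| ≤
      24 * (10 / (‖L x‖ ^ 2 + 1)) ^ 4 * kDilation 4 F := by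
    intro L hL hn v hv
    refine abs_det_fderiv_le hF (stereo_mem (hL x))
      (u := fun j => fderiv ℝ stereo (L x) (L (v j)))
      (fun i => inner_stereo_fderiv (hL x) (hL _)) fun i => ?_
    refine (norm_fderiv_stereo_le (hL x) _).trans ?_
    refine mul_le_of_le_one_right (by positivity) ((hn _).trans ?_)
    rw [hv.1 i]
  let pr : EucA 5 →L[ℝ] (Fin 4 → ℝ) := ContinuousLinearMap.pi fun i =>
    EuclideanSpace.proj i.castSucc
  refine abs_det_sum_le (L₁ := pr.comp ((fderiv ℝ F (stereo (pairFst x))).comp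
    ((fderiv ℝ stereo (pairFst x)).comp pairFst)))
    (L₂ := pr.comp ((fderiv ℝ F (stereo (pairSnd x))).comp
    ((fderiv ℝ stereo (pairSnd x)).comp pairSnd))) ?_ ?_
    (key pairFst pairFst_last norm_pairFst_le) (key pairSnd pairSnd_last norm_pairSnd_le)
  · intro y i
    have h1 := (hdiff.hasFDerivAt.euclidean_coord (Sum.inl i)).unique
      ((hd pairFst).euclidean_coord i.castSucc)
    exact DFunLike.congr_fun h1 y
  · intro y i
    have h1 := (hdiff.hasFDerivAt.euclidean_coord (Sum.inr i)).unique
      ((hd pairSnd).euclidean_coord i.castSucc)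
    exact DFunLike.congr_fun h1 y

/-- The degree integral of the pair map over ordered vertical pairs. -/
def pairI (Ψ : E44 → ℝ) (F : EucA 8 → EucA 5) : ℝ := degI volume (pairDom F) Ψ (pairMap F)

lemma integrable_weight : Integrable fun x : E44 => ∏ i, (1 + x i ^ 2)⁻¹ := by
  have h : Integrable fun x : Fin 4 ⊕ Fin 4 → ℝ => ∏ i, (1 + x i ^ 2)⁻¹ :=
    Integrable.fintype_prod (f := fun _ t => (1 + t ^ 2)⁻¹) fun _ => integrable_inv_one_add_sq
  exact (PiLp.volume_preserving_ofLp (Fin 4 ⊕ Fin 4)).integrable_comp_of_integrable h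

lemma weight_le (x : E44) :
    ((‖pairFst x‖ ^ 2 + 1) ^ 4)⁻¹ * ((‖pairSnd x‖ ^ 2 + 1) ^ 4)⁻¹ ≤ ∏ i, (1 + x i ^ 2)⁻¹ := by
  rw [Fintype.prod_sum_type, norm_sq_pairFst, norm_sq_pairSnd]
  simp only [Fin.prod_univ_four, ← mul_inv]
  have key : ∀ q a b c d : ℝ, 1 + a ^ 2 ≤ q → 1 + b ^ 2 ≤ q → 1 + c ^ 2 ≤ q → 1 + d ^ 2 ≤ q →
      (1 + a ^ 2) * (1 + b ^ 2) * (1 + c ^ 2) * (1 + d ^ 2) ≤ q ^ 4 := by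
    intro q a b c d ha hb hc hd
    have : q ^ 4 = q * q * q * q := by ring
    rw [this]
    have hq : 0 ≤ q := by nlinarith [sq_nonneg a]
    gcongr
  refine inv_anti₀ (by positivity) (mul_le_mul (key _ _ _ _ _ ?_ ?_ ?_ ?_)
    (key _ _ _ _ _ ?_ ?_ ?_ ?_) (by positivity) (by positivity)) <;>
  nlinarith [sq_nonneg (x (Sum.inl 0)), sq_nonneg (x (Sum.inl 1)), sq_nonneg (x (Sum.inl 2)),
    sq_nonneg (x (Sum.inl 3)), sq_nonneg (x (Sum.inr 0)), sq_nonneg (x (Sum.inr 1)),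
    sq_nonneg (x (Sum.inr 2)), sq_nonneg (x (Sum.inr 3))]

/-- The degree integral of the pair map is controlled by the square of the `4`-dilation. -/
theorem abs_pairI_le {Ψ : E44 → ℝ} {B : ℝ} (hΨ : ∀ y, |Ψ y| ≤ B) {F : EucA 8 → EucA 5}
    (hF : ContDiff ℝ 1 F) :
    |pairI Ψ F| ≤ (B * 240000 ^ 2 * ∫ x : E44, ∏ i, (1 + x i ^ 2)⁻¹) * kDilation 4 F ^ 2 := by
  have hB : 0 ≤ B := (abs_nonneg _).trans (hΨ 0)
  have hw := integrable_weight.const_mul (B * 240000 ^ 2 * kDilation 4 F ^ 2)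
  have hnn : ∀ x : E44, 0 ≤ ∏ i, (1 + x i ^ 2)⁻¹ := fun x =>
    Finset.prod_nonneg fun i _ => by positivity
  have h := norm_integral_le_of_norm_le (hw.mono_measure (Measure.restrict_le_self
    (s := pairDom F))) (f := fun x => Ψ (pairMap F x) * (fderiv ℝ (pairMap F) x).det)
    (Eventually.of_forall fun x => ?_)
  · refine h.trans ((setIntegral_le_integral hw (Eventually.of_forall fun x => ?_)).trans ?_)
    · exact mul_nonneg (by positivity) (hnn x)
    · rw [integral_const_mul]
      exact le_of_eq (by ring)
  · rw [Real.norm_eq_abs, abs_mul]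
    have h2 := abs_det_fderiv_pairMap_le hF x
    have h3 : (24 * (10 / (‖pairFst x‖ ^ 2 + 1)) ^ 4 * kDilation 4 F) *
      (24 * (10 / (‖pairSnd x‖ ^ 2 + 1)) ^ 4 * kDilation 4 F) =
      (240000 ^ 2 * kDilation 4 F ^ 2) *
      (((‖pairFst x‖ ^ 2 + 1) ^ 4)⁻¹ * ((‖pairSnd x‖ ^ 2 + 1) ^ 4)⁻¹) := by
      rw [div_pow, div_pow]; ring
    calc _ ≤ B * ((240000 ^ 2 * kDilation 4 F ^ 2) *
        (((‖pairFst x‖ ^ 2 + 1) ^ 4)⁻¹ * ((‖pairSnd x‖ ^ 2 + 1) ^ 4)⁻¹)) :=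
          mul_le_mul (hΨ _) (h2.trans h3.le) (abs_nonneg _) hB
      _ ≤ B * ((240000 ^ 2 * kDilation 4 F ^ 2) * ∏ i, (1 + x i ^ 2)⁻¹) := by
          gcongr
          exact weight_le x
      _ = _ := by ring

lemma pairMap_contDiff {H : ℝ × EucA 8 → EucA 5} (hH : ContDiff ℝ 2 H) :
    ContDiff ℝ 2 fun p : ℝ × E44 => pairMap (fun x => H (p.1, x)) p.2 := by
  rw [contDiff_euclidean]
  have h1 : ∀ L : E44 →L[ℝ] EucA 8, ContDiff ℝ 2 fun p : ℝ × E44 => H (p.1, stereo (L p.2)) :=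
    fun L => hH.comp (contDiff_fst.prodMk ((stereo_contDiff (n := 2)).comp
      (L.contDiff.comp contDiff_snd)))
  rintro (i | i)
  · exact contDiff_euclidean.1 (h1 pairFst) i.castSucc
  · exact contDiff_euclidean.1 (h1 pairSnd) i.castSucc

/-- The space-time version of `pairDom` for a family of maps. -/
def pairDomT (H : ℝ × EucA 8 → EucA 5) : Set (ℝ × E44) :=
  {p | p.2 (Sum.inl 0) < p.2 (Sum.inr 0) ∧
      H (p.1, stereo (pairFst p.2)) 4 < 0 ∧ H (p.1, stereo (pairSnd p.2)) 4 < 0}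

lemma pair_isOpen_isCompact {H : ℝ × EucA 8 → EucA 5} (hH : ContDiff ℝ 2 H)
    {T : Set E44} (hT : IsClosed T) {ρ : ℝ}
    (hneq : ∀ y ∈ T, ∃ i, y (Sum.inl i) ≠ y (Sum.inr i))
    (hinl : ∀ y ∈ T, ∑ i, y (Sum.inl i) ^ 2 < ρ)
    (hinr : ∀ y ∈ T, ∑ i, y (Sum.inr i) ^ 2 < ρ)
    (hH0 : ∀ t ∈ Icc (0 : ℝ) 1, ∀ x ∈ usph 8, H (t, x) 4 = 0 →
      ρ ≤ ∑ i : Fin 4, H (t, x) i.castSucc ^ 2)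
    (hHb : ∀ t ∈ Icc (0 : ℝ) 1, 0 < H (t, bpt 7) 4) :
    IsOpen (pairDomT H) ∧ ∃ K, IsCompact K ∧ K ⊆ pairDomT H ∧ ∀ p ∈ pairDomT H,
      p.1 ∈ Icc (0 : ℝ) 1 → pairMap (fun x => H (p.1, x)) p.2 ∈ T → p ∈ K := by
  have hst1 : Continuous fun p : ℝ × E44 => H (p.1, stereo (pairFst p.2)) :=
    hH.continuous.comp (continuous_fst.prodMk ((stereo_contDiff (n := 0)).continuous.comp
      (pairFst.continuous.comp continuous_snd)))
  have hst2 : Continuous fun p : ℝ × E44 => H (p.1, stereo (pairSnd p.2)) :=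
    hH.continuous.comp (continuous_fst.prodMk ((stereo_contDiff (n := 0)).continuous.comp
      (pairSnd.continuous.comp continuous_snd)))
  have hc : ∀ {f : ℝ × E44 → EucA 5}, Continuous f → ∀ i, Continuous fun p => f p i :=
    fun hf i => (EuclideanSpace.proj (𝕜 := ℝ) i).continuous.comp hf
  have hx : ∀ i, Continuous fun p : ℝ × E44 => p.2 i := fun i =>
    (EuclideanSpace.proj (𝕜 := ℝ) i).continuous.comp continuous_snd
  set G : ℝ × E44 → E44 := fun p => pairMap (fun x => H (p.1, x)) p.2 with hG
  have hGs : ContDiff ℝ 2 G := pairMap_contDiff hH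
  obtain ⟨η, hη, hηb⟩ : ∃ η > 0, ∀ t ∈ Icc (0 : ℝ) 1, ∀ x ∈ usph 8, H (t, x) 4 ≤ 0 →
      x 7 ≤ 1 - η := by
    set C := (Icc (0 : ℝ) 1 ×ˢ usph 8) ∩ {p | H p 4 ≤ 0} with hC
    have hCc : IsCompact C := (isCompact_Icc.prod (isCompact_sphere _ _)).inter_right
      (isClosed_le ((EuclideanSpace.proj (𝕜 := ℝ) 4).continuous.comp hH.continuous)
        continuous_const)
    rcases C.eq_empty_or_nonempty with he | hne
    · refine ⟨1, one_pos, fun t ht x hx h => ?_⟩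
      exact absurd (show (t, x) ∈ C from ⟨⟨ht, hx⟩, h⟩) (by simp [he])
    · obtain ⟨p, hp, hmax⟩ := hCc.exists_isMaxOn hne (f := fun p : ℝ × EucA 8 => p.2 7)
        ((EuclideanSpace.proj (𝕜 := ℝ) 7).continuous.comp continuous_snd).continuousOn
      refine ⟨1 - p.2 7, ?_, fun t ht x hx h => ?_⟩
      · have hn : ‖p.2‖ = 1 := mem_sphere_zero_iff_norm.1 hp.1.2
        have h1 : ⟪p.2, bpt 7⟫ ≤ 1 := (real_inner_le_norm _ _).trans (by rw [hn, norm_bpt]; simp)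
        rw [inner_bpt] at h1
        rcases h1.lt_or_eq with h2 | h2
        · linarith
        · have h3 : p.2 = bpt 7 := by
            rw [← inner_bpt] at h2
            exact (inner_eq_one_iff_of_norm_eq_one hn (norm_bpt 7)).1 h2
          have h4 := hHb p.1 hp.1.1
          rw [← h3] at h4
          exact absurd hp.2 (not_le.2 h4)
      · have := hmax (show (t, x) ∈ C from ⟨⟨ht, hx⟩, h⟩)
        simp only [mem_ofPred_eq] at this
        linarith
  refine ⟨(isOpen_lt (hx _) (hx _)).inter ((isOpen_lt (hc hst1 4) continuous_const).inter
      (isOpen_lt (hc hst2 4) continuous_const)), {p : ℝ × E44 | p.1 ∈ Icc (0 : ℝ) 1 ∧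
      p.2 (Sum.inl 0) ≤ p.2 (Sum.inr 0) ∧
      H (p.1, stereo (pairFst p.2)) 4 ≤ 0 ∧ H (p.1, stereo (pairSnd p.2)) 4 ≤ 0 ∧
      G p ∈ T}, ?_, ?_, ?_⟩
  · refine Metric.isCompact_of_isClosed_isBounded ?_ ?_
    · exact (isClosed_Icc.preimage continuous_fst).inter ((isClosed_le (hx _) (hx _)).inter
        ((isClosed_le (hc hst1 4) continuous_const).inter
        ((isClosed_le (hc hst2 4) continuous_const).inter
        (hT.preimage hGs.continuous))))
    · refine ((isCompact_Icc (a := (0 : ℝ)) (b := 1)).isBounded.prod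
        (Metric.isBounded_closedBall (x := (0 : E44)) (r := 1 + 4 / η))).subset ?_
      rintro ⟨t, x⟩ ⟨ht, -, h1, h2, -⟩
      refine ⟨ht, ?_⟩
      have hb : ∀ X : EucA 8, X 7 = 0 → H (t, stereo X) 4 ≤ 0 → ‖X‖ ^ 2 ≤ 2 / η := by
        intro X hX hXH
        have h3 := hηb t ht _ (stereo_mem hX) hXH
        rw [stereo_apply_last hX] at h3
        have h4 : η ≤ 2 / (‖X‖ ^ 2 + 1) := by linarith
        rw [le_div_iff₀ (by positivity)] at h4
        rw [le_div_iff₀ hη]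
        nlinarith
      have h3 := hb _ (pairFst_last x) h1
      have h4 := hb _ (pairSnd_last x) h2
      rw [norm_sq_pairFst] at h3
      rw [norm_sq_pairSnd] at h4
      have h5 := norm_sq_E44 x
      have h6 : ‖x‖ ^ 2 ≤ 4 / η := by
        have : 4 / η = 2 / η + 2 / η := by ring
        nlinarith [sq_nonneg (x (Sum.inl 1)), sq_nonneg (x (Sum.inl 2)),
          sq_nonneg (x (Sum.inl 3)), sq_nonneg (x (Sum.inr 1)), sq_nonneg (x (Sum.inr 2)),
          sq_nonneg (x (Sum.inr 3))]
      rw [mem_closedBall_zero_iff]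
      nlinarith [sq_nonneg (‖x‖ - 1)]
  · rintro ⟨t, x⟩ ⟨ht, h0, h1, h2, h3⟩
    refine ⟨lt_of_le_of_ne h0 fun he => ?_, lt_of_le_of_ne h1 fun he => ?_,
      lt_of_le_of_ne h2 fun he => ?_⟩
    · obtain ⟨i, hi⟩ := hneq _ h3
      refine hi ?_
      have hpq : pairFst x = pairSnd x := by
        rw [pairFst_apply, pairSnd_apply]
        simp only at he
        rw [he]
      simp [hG, pairMap, hpq]
    · exact absurd (hinl _ h3) (not_lt.2 (hH0 t ht _ (stereo_mem (pairFst_last x)) he))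
    · exact absurd (hinr _ h3) (not_lt.2 (hH0 t ht _ (stereo_mem (pairSnd_last x)) he))
  · rintro ⟨t, x⟩ ⟨h0, h1, h2⟩ ht hne
    exact ⟨ht, h0.le, h1.le, h2.le, hne⟩

/-- Homotopy invariance of the degree integral of the pair map. -/
theorem pairI_homotopy {H : ℝ × EucA 8 → EucA 5} (hH : ContDiff ℝ 2 H)
    {Ψ : E44 → ℝ} (hΨ : ContDiff ℝ 1 Ψ) {ρ : ℝ}
    (hneq : ∀ y ∈ tsupport Ψ, ∃ i, y (Sum.inl i) ≠ y (Sum.inr i))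
    (hinl : ∀ y ∈ tsupport Ψ, ∑ i, y (Sum.inl i) ^ 2 < ρ)
    (hinr : ∀ y ∈ tsupport Ψ, ∑ i, y (Sum.inr i) ^ 2 < ρ)
    (hH0 : ∀ t ∈ Icc (0 : ℝ) 1, ∀ x ∈ usph 8, H (t, x) 4 = 0 →
      ρ ≤ ∑ i : Fin 4, H (t, x) i.castSucc ^ 2)
    (hHb : ∀ t ∈ Icc (0 : ℝ) 1, 0 < H (t, bpt 7) 4) :
    pairI Ψ (fun x => H (0, x)) = pairI Ψ (fun x => H (1, x)) := by
  obtain ⟨hW, K, hK, hKW, hKs⟩ := pair_isOpen_isCompact hH (isClosed_tsupport Ψ) hneq hinl hinr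
    hH0 hHb
  exact degI_homotopy volume hW (pairMap_contDiff hH).contDiffOn hΨ hK hKW
    fun p hp ht hne => hKs p hp ht (subset_tsupport _ hne)

section HopfMap

/-- The quaternionic Hopf map `S⁷ → S⁴`. -/
def hopfMap (x : EucA 8) : EucA 5 :=
  !₂[2 * (x 0 * x 7 + x 1 * x 4 + x 2 * x 5 + x 3 * x 6),
    2 * (x 1 * x 7 - x 0 * x 4 - x 2 * x 6 + x 3 * x 5),
    2 * (x 2 * x 7 - x 0 * x 5 + x 1 * x 6 - x 3 * x 4),
    2 * (x 3 * x 7 - x 0 * x 6 - x 1 * x 5 + x 2 * x 4),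
    (x 4 ^ 2 + x 5 ^ 2 + x 6 ^ 2 + x 7 ^ 2) - (x 0 ^ 2 + x 1 ^ 2 + x 2 ^ 2 + x 3 ^ 2)]

/-- The polarisation of the Hopf map. -/
def hopfPolar (x y : EucA 8) : EucA 5 :=
  !₂[2 * (x 0 * y 7 + x 1 * y 4 + x 2 * y 5 + x 3 * y 6 +
      (y 0 * x 7 + y 1 * x 4 + y 2 * x 5 + y 3 * x 6)),
    2 * (x 1 * y 7 - x 0 * y 4 - x 2 * y 6 + x 3 * y 5 +
      (y 1 * x 7 - y 0 * x 4 - y 2 * x 6 + y 3 * x 5)),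
    2 * (x 2 * y 7 - x 0 * y 5 + x 1 * y 6 - x 3 * y 4 +
      (y 2 * x 7 - y 0 * x 5 + y 1 * x 6 - y 3 * x 4)),
    2 * (x 3 * y 7 - x 0 * y 6 - x 1 * y 5 + x 2 * y 4 +
      (y 3 * x 7 - y 0 * x 6 - y 1 * x 5 + y 2 * x 4)),
    2 * (x 4 * y 4 + x 5 * y 5 + x 6 * y 6 + x 7 * y 7) -
      2 * (x 0 * y 0 + x 1 * y 1 + x 2 * y 2 + x 3 * y 3)]

lemma contDiff_coord {ι : Type*} [Fintype ι] (i : ι) {n : WithTop ℕ∞} :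
    ContDiff ℝ n fun x : EuclideanSpace ℝ ι => x i :=
  (EuclideanSpace.proj (𝕜 := ℝ) i).contDiff

lemma hopfMap_contDiff {n : WithTop ℕ∞} : ContDiff ℝ n hopfMap := by
  have h : ∀ i, ContDiff ℝ n fun x : EucA 8 => x i := fun i => contDiff_coord i
  rw [contDiff_euclidean]
  intro i
  fin_cases i <;> simp [hopfMap] <;> fun_prop

lemma fderiv_hopfMap (x y : EucA 8) : fderiv ℝ hopfMap x y = hopfPolar x y := by
  have h1 : HasDerivAt (fun t : ℝ => hopfMap (x + t • y)) (fderiv ℝ hopfMap x y) 0 := by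
    have h := (hopfMap_contDiff (n := 1)).differentiable (by norm_num) (x + (0 : ℝ) • y)
    have h2 := h.hasFDerivAt.comp_hasDerivAt (0 : ℝ)
      (((hasDerivAt_id (0 : ℝ)).smul_const y).const_add x)
    simp only [id, one_smul, zero_smul, add_zero] at h2
    exact h2
  have h2 : HasDerivAt (fun t : ℝ => hopfMap (x + t • y)) (hopfPolar x y) 0 := by
    have he : (fun t : ℝ => hopfMap (x + t • y)) = fun t : ℝ =>
        hopfMap x + (t • hopfPolar x y + (t ^ 2) • hopfMap y) := by
      funext t
      ext i
      fin_cases i <;> simp [hopfMap, hopfPolar] <;> ring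
    rw [he]
    have h3 := (((hasDerivAt_id (0 : ℝ)).smul_const (hopfPolar x y)).add
      ((hasDerivAt_pow 2 (0 : ℝ)).smul_const (hopfMap y))).const_add (hopfMap x)
    simpa using h3
  exact h1.unique h2

lemma sum_sq_hopfMap (x : EucA 8) : ∑ i : Fin 4, hopfMap x i.castSucc ^ 2 =
    4 * (x 0 ^ 2 + x 1 ^ 2 + x 2 ^ 2 + x 3 ^ 2) * (x 4 ^ 2 + x 5 ^ 2 + x 6 ^ 2 + x 7 ^ 2) := by
  simp [Fin.sum_univ_four, hopfMap]
  ring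

lemma norm_sq_EucA8 (x : EucA 8) : ‖x‖ ^ 2 =
    (x 0 ^ 2 + x 1 ^ 2 + x 2 ^ 2 + x 3 ^ 2) + (x 4 ^ 2 + x 5 ^ 2 + x 6 ^ 2 + x 7 ^ 2) := by
  rw [EuclideanSpace.real_norm_sq_eq]
  simp [Fin.sum_univ_succ]
  ring

lemma norm_sq_EucA5 (x : EucA 5) : ‖x‖ ^ 2 = ∑ i : Fin 4, x i.castSucc ^ 2 + x 4 ^ 2 := by
  rw [EuclideanSpace.real_norm_sq_eq, Fin.sum_univ_castSucc]
  rfl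

lemma hopfMap_four (x : EucA 8) : hopfMap x 4 =
    (x 4 ^ 2 + x 5 ^ 2 + x 6 ^ 2 + x 7 ^ 2) - (x 0 ^ 2 + x 1 ^ 2 + x 2 ^ 2 + x 3 ^ 2) := rfl

lemma hopfMap_mapsTo : MapsTo hopfMap (usph 8) (usph 5) := by
  intro x hx
  rw [usph, mem_sphere_zero_iff_norm] at *
  have h1 := norm_sq_EucA8 x
  have h2 := norm_sq_EucA5 (hopfMap x)
  rw [sum_sq_hopfMap, hopfMap_four] at h2
  rw [hx] at h1
  have h3 : ‖hopfMap x‖ ^ 2 = 1 := by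
    rw [h2]
    have : x 0 ^ 2 + x 1 ^ 2 + x 2 ^ 2 + x 3 ^ 2 =
      1 - (x 4 ^ 2 + x 5 ^ 2 + x 6 ^ 2 + x 7 ^ 2) := by linarith
    rw [this]; ring
  nlinarith [norm_nonneg (hopfMap x)]

lemma hopfMap_bpt : hopfMap (bpt 7) = bpt 4 := by
  have h : ∀ i, bpt 7 i = if i = 7 then 1 else 0 := fun i => by
    simp [bpt, Fin.last, PiLp.single_apply]
  ext i
  fin_cases i <;> simp [hopfMap, h, bpt] <;> simp [Fin.ext_iff, Fin.last]

/-- A configuration of two vertically aligned points on the two fibres over `-e₅` and over a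
second point of the southern hemisphere. -/
def hopfPair : E44 := WithLp.toLp 2 (Sum.elim ![-4 / 5, 3 / 5, 0, 0] ![0, 0, 0, 0])

/-- The value of the pair map at `hopfPair`. -/
def hopfPairVal : E44 := WithLp.toLp 2 (Sum.elim ![0, 0, 0, 0] ![0, -240 / 289, 0, 0])

lemma stereo_of_last {a : Fin 7 → ℝ} : stereo !₂[a 0, a 1, a 2, a 3, a 4, a 5, a 6, 0] =
    (let s := 2 / (‖(!₂[a 0, a 1, a 2, a 3, a 4, a 5, a 6, 0] : EucA 8)‖ ^ 2 + 1)
    !₂[s * a 0, s * a 1, s * a 2, s * a 3, s * a 4, s * a 5, s * a 6, 1 - s]) := by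
  have hb : ∀ i, bpt 7 i = if i = 7 then 1 else 0 := fun i => by
    simp [bpt, Fin.last, PiLp.single_apply]
  ext i
  fin_cases i <;> simp [stereo, hb]
  ring

lemma stereo_pairFst (x : E44) : stereo (pairFst x) =
    (let s := 2 / (‖pairFst x‖ ^ 2 + 1)
    !₂[s * x (Sum.inl 0), s * x (Sum.inl 1), s * x (Sum.inl 2), s * x (Sum.inl 3),
      s * x (Sum.inr 1), s * x (Sum.inr 2), s * x (Sum.inr 3), 1 - s]) :=
  stereo_of_last (a := ![x (Sum.inl 0), x (Sum.inl 1), x (Sum.inl 2), x (Sum.inl 3),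
      x (Sum.inr 1), x (Sum.inr 2), x (Sum.inr 3)])

lemma stereo_pairSnd (x : E44) : stereo (pairSnd x) =
    (let s := 2 / (‖pairSnd x‖ ^ 2 + 1)
    !₂[s * x (Sum.inr 0), s * x (Sum.inl 1), s * x (Sum.inl 2), s * x (Sum.inl 3),
      s * x (Sum.inr 1), s * x (Sum.inr 2), s * x (Sum.inr 3), 1 - s]) :=
  stereo_of_last (a := ![x (Sum.inr 0), x (Sum.inl 1), x (Sum.inl 2), x (Sum.inl 3),
      x (Sum.inr 1), x (Sum.inr 2), x (Sum.inr 3)])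

lemma hopfMap_southPole {y : EucA 8} (h : ∀ i : Fin 4, hopfMap y i.castSucc = 0)
    (h4 : hopfMap y 4 < 0) : y 4 = 0 ∧ y 5 = 0 ∧ y 6 = 0 ∧ y 7 = 0 := by
  have hs := sum_sq_hopfMap y
  rw [Finset.sum_eq_zero fun i _ => by rw [h i]; norm_num] at hs
  rw [hopfMap_four] at h4
  have hB : y 4 ^ 2 + y 5 ^ 2 + y 6 ^ 2 + y 7 ^ 2 = 0 := by
    rcases mul_eq_zero.1 hs.symm with h | h
    · nlinarith [sq_nonneg (y 4), sq_nonneg (y 5), sq_nonneg (y 6), sq_nonneg (y 7)]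
    · exact h
  refine ⟨?_, ?_, ?_, ?_⟩ <;> rw [← sq_eq_zero_iff] <;>
    nlinarith [sq_nonneg (y 4), sq_nonneg (y 5), sq_nonneg (y 6), sq_nonneg (y 7)]

lemma hopf_fibre {s a : ℝ} (hs : 0 < s) (h1 : s * a * (1 - s) = -120 / 289)
    (hlt : (1 - s) ^ 2 < (s * a) ^ 2) (hn : (s * a) ^ 2 + (1 - s) ^ 2 = 1) (hle : a ^ 2 ≤ 1) :
    a = 3 / 5 := by
  set y := s * a with hy
  have hq : (y ^ 2 - 225 / 289) * (y ^ 2 - 64 / 289) = 0 := by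
    have : y ^ 2 * (1 - y ^ 2) = (120 / 289) ^ 2 := by
      have : 1 - y ^ 2 = (1 - s) ^ 2 := by linarith
      rw [this, ← mul_pow, h1]; norm_num
    nlinarith
  have hy2 : y ^ 2 - 225 / 289 = 0 := (mul_eq_zero.1 hq).resolve_right (by nlinarith)
  have hyy : (y - 15 / 17) * (y + 15 / 17) = 0 := by nlinarith
  rcases mul_eq_zero.1 hyy with h | h
  · have e : y = 15 / 17 := by linarith
    have e2 : s = 25 / 17 := by rw [e] at h1; linarith
    rw [e, e2] at hy
    linarith
  · have e : y = -15 / 17 := by linarith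
    have e2 : s = 9 / 17 := by rw [e] at h1; linarith
    rw [e, e2] at hy
    have : a = -5 / 3 := by linarith
    rw [this] at hle
    norm_num at hle

lemma hopfPair_unique {x : E44} (hx : x ∈ pairDom hopfMap)
    (he : pairMap hopfMap x = hopfPairVal) : x = hopfPair := by
  obtain ⟨h0, h1, h2⟩ := hx
  have hE : ∀ j, pairMap hopfMap x j = hopfPairVal j := fun j => by rw [he]
  have hl : ∀ i : Fin 4, hopfMap (stereo (pairFst x)) i.castSucc = 0 := fun i => by
    have := hE (Sum.inl i)
    simp only [pairMap, hopfPairVal, Sum.elim_inl] at this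
    rw [this]
    fin_cases i <;> rfl
  have hr : ∀ i : Fin 4, hopfMap (stereo (pairSnd x)) i.castSucc =
      ![0, -240 / 289, 0, 0] i := fun i => by
    have := hE (Sum.inr i)
    simpa only [pairMap, hopfPairVal, Sum.elim_inr] using this
  have hX1 := norm_sq_pairFst x
  have hs : ∀ y : EucA 8, 0 < 2 / (‖y‖ ^ 2 + 1) := fun y => by positivity
  obtain ⟨g4, g5, g6, g7⟩ := hopfMap_southPole hl h1
  have hm2 := mem_sphere_zero_iff_norm.1 (stereo_mem (pairSnd_last x))
  have hn2 := norm_sq_EucA8 (stereo (pairSnd x))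
  rw [hm2] at hn2
  rw [hopfMap_four] at h2
  have f0 := hr 0
  have f1 := hr 1
  have f2 := hr 2
  have f3 := hr 3
  have hsp := hs (pairFst x)
  have htp := hs (pairSnd x)
  rw [stereo_pairSnd] at h2 hn2 f0 f1 f2 f3
  rw [stereo_pairFst] at g4 g5 g6 g7
  have g7' : 1 - 2 / (‖pairFst x‖ ^ 2 + 1) = 0 := g7
  have hX : ‖pairFst x‖ ^ 2 = 1 := by
    have : 2 / (‖pairFst x‖ ^ 2 + 1) = 1 := by linarith
    rw [div_eq_one_iff_eq (by positivity)] at this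
    linarith
  generalize 2 / (‖pairFst x‖ ^ 2 + 1) = s at *
  generalize 2 / (‖pairSnd x‖ ^ 2 + 1) = t at *
  have r1 : x (Sum.inr 1) = 0 := (mul_eq_zero.1 g4).resolve_left hsp.ne'
  have r2 : x (Sum.inr 2) = 0 := (mul_eq_zero.1 g5).resolve_left hsp.ne'
  have r3 : x (Sum.inr 3) = 0 := (mul_eq_zero.1 g6).resolve_left hsp.ne'
  simp [hopfMap, r1, r2, r3, htp.ne'] at f0 f1 f2 f3 h2 hn2
  rw [hX, r1, r2, r3] at hX1
  have hne : 1 - t ≠ 0 := fun h => by rw [h] at f1; norm_num at f1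
  have a0 := f0.resolve_right hne
  have a2 := f2.resolve_right hne
  have a3 := f3.resolve_right hne
  rw [a0, a2, a3] at h2 hn2
  have a1 := (hopf_fibre (a := x (Sum.inl 1)) htp (by linarith) (by linarith) (by linarith)
    (by nlinarith [sq_nonneg (x (Sum.inl 0)), sq_nonneg (x (Sum.inl 2)),
      sq_nonneg (x (Sum.inl 3))]))
  have b0 : x (Sum.inl 0) = -4 / 5 := by
    rw [a1, a2, a3] at hX1
    rw [a0] at h0
    have : (x (Sum.inl 0) - 4 / 5) * (x (Sum.inl 0) + 4 / 5) = 0 := by nlinarith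
    rcases mul_eq_zero.1 this with h | h <;> linarith
  ext j
  rcases j with i | i <;> fin_cases i <;> simp [hopfPair, a0, a1, a2, a3, b0, r1, r2, r3]

lemma fderiv_pairMap {F : EucA 8 → EucA 5} (hF : ContDiff ℝ 1 F) (x h : E44) (i : Fin 4) :
    fderiv ℝ (pairMap F) x h (Sum.inl i) =
      fderiv ℝ F (stereo (pairFst x)) (fderiv ℝ stereo (pairFst x) (pairFst h)) i.castSucc ∧
    fderiv ℝ (pairMap F) x h (Sum.inr i) =
      fderiv ℝ F (stereo (pairSnd x)) (fderiv ℝ stereo (pairSnd x) (pairSnd h)) i.castSucc := by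
  have hd : ∀ L : E44 →L[ℝ] EucA 8, HasFDerivAt (fun x => F (stereo (L x)))
      ((fderiv ℝ F (stereo (L x))).comp ((fderiv ℝ stereo (L x)).comp L)) x := fun L =>
    ((hF.differentiable (by norm_num) _).hasFDerivAt).comp x
      (((stereo_contDiff (n := 1)).differentiable (by norm_num) _).hasFDerivAt.comp x
        L.hasFDerivAt)
  have hdiff : DifferentiableAt ℝ (pairMap F) x := by
    rw [differentiableAt_euclidean]
    rintro (i | i)
    · exact (differentiableAt_euclidean.1 (hd pairFst).differentiableAt) i.castSucc
    · exact (differentiableAt_euclidean.1 (hd pairSnd).differentiableAt) i.castSucc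
  exact ⟨DFunLike.congr_fun ((hdiff.hasFDerivAt.euclidean_coord (Sum.inl i)).unique
      ((hd pairFst).euclidean_coord i.castSucc)) h,
    DFunLike.congr_fun ((hdiff.hasFDerivAt.euclidean_coord (Sum.inr i)).unique
      ((hd pairSnd).euclidean_coord i.castSucc)) h⟩

lemma hopfPair_norm : ‖pairFst hopfPair‖ ^ 2 = 1 ∧ ‖pairSnd hopfPair‖ ^ 2 = 9 / 25 := by
  rw [norm_sq_pairFst, norm_sq_pairSnd]
  constructor <;> simp [hopfPair] <;> norm_num

lemma hopfPair_mem : hopfPair ∈ pairDom hopfMap := by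
  obtain ⟨n1, n2⟩ := hopfPair_norm
  refine ⟨by simp [hopfPair]; norm_num, ?_, ?_⟩
  · rw [hopfMap_four, stereo_pairFst, n1]
    simp [hopfPair]
    norm_num
  · rw [hopfMap_four, stereo_pairSnd, n2]
    simp [hopfPair]
    norm_num

lemma pairMap_hopfPair : pairMap hopfMap hopfPair = hopfPairVal := by
  obtain ⟨n1, n2⟩ := hopfPair_norm
  ext j
  rcases j with i | i <;> simp only [pairMap, stereo_pairFst, stereo_pairSnd, n1, n2,
    Sum.elim_inl, Sum.elim_inr] <;> fin_cases i <;>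
    simp [hopfMap, hopfPair, hopfPairVal] <;> norm_num

lemma det_fderiv_pairMap_hopfPair : (fderiv ℝ (pairMap hopfMap) hopfPair).det ≠ 0 := by
  intro h0
  obtain ⟨h, hmem, hne⟩ := Submodule.exists_mem_ne_zero_of_ne_bot
    (LinearMap.bot_lt_ker_of_det_eq_zero h0).ne'
  refine hne ?_
  have hk : fderiv ℝ (pairMap hopfMap) hopfPair h = 0 := hmem
  have hF := fderiv_pairMap (hopfMap_contDiff (n := 1)) hopfPair h
  obtain ⟨n1, n2⟩ := hopfPair_norm
  have i1 : ⟪pairFst hopfPair, pairFst h⟫ = -4 / 5 * h (Sum.inl 0) + 3 / 5 * h (Sum.inl 1) := by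
    rw [PiLp.inner_apply]
    simp [Fin.sum_univ_succ, pairFst_apply, hopfPair]
    ring
  have i2 : ⟪pairSnd hopfPair, pairSnd h⟫ = 3 / 5 * h (Sum.inl 1) := by
    rw [PiLp.inner_apply]
    simp [Fin.sum_univ_succ, pairSnd_apply, hopfPair]
    ring
  have hb : ∀ i, bpt 7 i = if i = 7 then 1 else 0 := fun i => by
    simp [bpt, Fin.last, PiLp.single_apply]
  have hF1 : ∀ i : Fin 4, _ := fun i => (hF i).1.symm
  have hF2 : ∀ i : Fin 4, _ := fun i => (hF i).2.symm
  simp only [hk, fderiv_hopfMap, fderiv_stereo, n1, n2, i1, i2, stereo_pairFst,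
    stereo_pairSnd] at hF1 hF2
  have p0 := hF1 0
  have p1 := hF1 1
  have p2 := hF1 2
  have p3 := hF1 3
  have q0 := hF2 0
  have q1 := hF2 1
  have q2 := hF2 2
  have q3 := hF2 3
  simp [hopfPolar, hopfPair, pairFst_apply, hb] at p0 p1 p2 p3
  simp [hopfPolar, hopfPair, pairSnd_apply, hb] at q0 q1 q2 q3
  norm_num at p0 p1 p2 p3 q0 q1 q2 q3
  have e0 : h (Sum.inl 0) = 0 := by linarith
  have e1 : h (Sum.inl 1) = 0 := by linarith
  have e2 : h (Sum.inl 2) = 0 := by linarith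
  have e3 : h (Sum.inl 3) = 0 := by linarith
  have e4 : h (Sum.inr 0) = 0 := by linarith
  have e5 : h (Sum.inr 1) = 0 := by linarith
  have e6 : h (Sum.inr 2) = 0 := by linarith
  have e7 : h (Sum.inr 3) = 0 := by linarith
  ext j
  rcases j with i | i <;> fin_cases i <;> simpa

/-- A weight for which the degree integral of the pair map of the Hopf map does not vanish. -/
theorem exists_pairI_hopfMap_ne_zero : ∃ Ψ : E44 → ℝ, ContDiff ℝ 1 Ψ ∧ (∀ y, |Ψ y| ≤ 1) ∧
    (∀ y ∈ tsupport Ψ, ∃ i, y (Sum.inl i) ≠ y (Sum.inr i)) ∧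
    (∀ y ∈ tsupport Ψ, ∑ i, y (Sum.inl i) ^ 2 < 4 / 5) ∧
    (∀ y ∈ tsupport Ψ, ∑ i, y (Sum.inr i) ^ 2 < 4 / 5) ∧ pairI Ψ hopfMap ≠ 0 := by
  set T : Set E44 := Metric.closedBall hopfPairVal (1 / 100) with hTdef
  have hcoord : ∀ y ∈ T, ∀ j, |y j - hopfPairVal j| ≤ 1 / 100 := by
    intro y hy j
    have h1 := mem_closedBall_iff_norm.1 hy
    refine le_trans ?_ h1
    have := PiLp.norm_apply_le (y - hopfPairVal) j
    simpa using this
  have hl : ∀ y ∈ T, ∀ i, y (Sum.inl i) ^ 2 ≤ 1 / 10000 := by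
    intro y hy i
    have h1 := hcoord y hy (Sum.inl i)
    have h2 : hopfPairVal (Sum.inl i) = 0 := by fin_cases i <;> rfl
    rw [h2, sub_zero] at h1
    rw [← sq_abs]
    nlinarith [abs_nonneg (y (Sum.inl i))]
  have hr : ∀ y ∈ T, ∀ i, i ≠ 1 → y (Sum.inr i) ^ 2 ≤ 1 / 10000 := by
    intro y hy i hi
    have h1 := hcoord y hy (Sum.inr i)
    have h2 : hopfPairVal (Sum.inr i) = 0 := by
      fin_cases i
      · rfl
      · exact absurd rfl hi
      · rfl
      · rfl
    rw [h2, sub_zero] at h1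
    rw [← sq_abs]
    nlinarith [abs_nonneg (y (Sum.inr i))]
  have hr1 : ∀ y ∈ T, |y (Sum.inr 1) + 240 / 289| ≤ 1 / 100 := by
    intro y hy
    have h1 := hcoord y hy (Sum.inr 1)
    have h2 : hopfPairVal (Sum.inr 1) = -240 / 289 := rfl
    rw [h2] at h1
    convert h1 using 2
    ring
  have hneq : ∀ y ∈ T, ∃ i, y (Sum.inl i) ≠ y (Sum.inr i) := by
    intro y hy
    refine ⟨1, fun h => ?_⟩
    have h1 := hl y hy 1
    have h2 := abs_le.1 (hr1 y hy)
    rw [h] at h1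
    nlinarith
  have hinl : ∀ y ∈ T, ∑ i, y (Sum.inl i) ^ 2 < 4 / 5 := by
    intro y hy
    rw [Fin.sum_univ_four]
    linarith [hl y hy 0, hl y hy 1, hl y hy 2, hl y hy 3]
  have hinr : ∀ y ∈ T, ∑ i, y (Sum.inr i) ^ 2 < 4 / 5 := by
    intro y hy
    rw [Fin.sum_univ_four]
    have h2 := abs_le.1 (hr1 y hy)
    nlinarith [hr y hy 0 (by decide), hr y hy 2 (by decide), hr y hy 3 (by decide)]
  have hH : ContDiff ℝ 2 fun p : ℝ × EucA 8 => hopfMap p.2 := hopfMap_contDiff.comp contDiff_snd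
  obtain ⟨hW, K, hK, hKW, hKs⟩ := pair_isOpen_isCompact hH (T := T) Metric.isClosed_closedBall
    hneq hinl hinr (fun t _ x hx h => by
      have h1 := norm_sq_EucA5 (hopfMap x)
      have h2 : ‖hopfMap x‖ = 1 := mem_sphere_zero_iff_norm.1 (hopfMap_mapsTo hx)
      simp only at h ⊢
      rw [h2, h] at h1
      linarith) (fun t _ => by
      simp only [hopfMap_bpt]
      simp [bpt, Fin.last])
  have hU : IsOpen (pairDom hopfMap) :=
    hW.preimage (f := fun x : E44 => ((0 : ℝ), x)) (by fun_prop)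
  have hG : ContDiffOn ℝ 1 (pairMap hopfMap) (pairDom hopfMap) := by
    have h1 := (pairMap_contDiff hH).comp (contDiff_prodMk_right (𝕜 := ℝ) (0 : ℝ))
    exact (h1.of_le (by norm_num)).contDiffOn
  have hKU : Prod.snd '' K ⊆ pairDom hopfMap := by
    rintro _ ⟨p, hp, rfl⟩
    exact hKW hp
  have hy : ∀ x ∈ pairDom hopfMap, pairMap hopfMap x ∈ Metric.ball hopfPairVal (1 / 100) →
      x ∈ Prod.snd '' K := fun x hx hxy =>
    ⟨(0, x), hKs (0, x) hx (by simp) (Metric.ball_subset_closedBall hxy), rfl⟩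
  have hset : {x | x ∈ pairDom hopfMap ∧ pairMap hopfMap x = hopfPairVal} ⊆ {hopfPair} :=
    fun x hx => hopfPair_unique hx.1 hx.2
  have hfin := (finite_singleton hopfPair).subset hset
  obtain ⟨ε, hε, hdeg⟩ := degI_eq_sum_sign volume hU hG (hK.image continuous_snd) hKU
    (by norm_num) hy (fun x hx he => by
      rw [hset ⟨hx, he⟩]; exact det_fderiv_pairMap_hopfPair) hfin
  set m := min ε (1 / 100) with hm
  have hmp : 0 < m := lt_min hε (by norm_num)
  let b : ContDiffBump hopfPairVal := ⟨m / 4, m / 2, by positivity, by linarith⟩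
  have hts : tsupport b ⊆ T := by
    rw [b.tsupport_eq]
    refine Metric.closedBall_subset_closedBall ?_
    change m / 2 ≤ 1 / 100
    linarith [min_le_right ε (1 / 100)]
  refine ⟨b, b.contDiff, fun y => by rw [abs_of_nonneg b.nonneg]; exact b.le_one,
    fun y hy => hneq y (hts hy), fun y hy => hinl y (hts hy), fun y hy => hinr y (hts hy), ?_⟩
  rw [pairI, hdeg b b.continuous fun y hy => ?_]
  · refine mul_ne_zero ?_ (b.integral_pos (μ := volume)).ne'
    have hS : hfin.toFinset = {hopfPair} := by
      ext x
      simp only [Finite.mem_toFinset, Finset.mem_singleton]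
      exact ⟨fun h => hset h, fun h => h ▸ ⟨hopfPair_mem, pairMap_hopfPair⟩⟩
    rw [hS, Finset.sum_singleton]
    rcases lt_or_gt_of_ne det_fderiv_pairMap_hopfPair with h | h
    · rw [sign_neg h]; norm_num
    · rw [sign_pos h]; norm_num
  · have : y ∈ Function.support b := hy
    rw [b.support_eq] at this
    refine Metric.ball_subset_ball ?_ this
    change m / 2 ≤ ε
    linarith [min_le_left ε (1 / 100)]

end HopfMap

section SmoothApproximation

lemma exists_smooth_approx_deriv {d : ℕ} {W : Type*} [NormedAddCommGroup W] [NormedSpace ℝ W]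
    [FiniteDimensional ℝ W] {F : EucA d → W} (hF : ContDiff ℝ 1 F) {δ : ℝ} (hδ : 0 < δ) :
    ∃ F' : EucA d → W, ContDiff ℝ 2 F' ∧ ∀ x ∈ usph d, ‖F' x - F x‖ ≤ δ ∧
      ‖fderiv ℝ F' x - fderiv ℝ F x‖ ≤ δ := by
  let χ : ContDiffBump (0 : EucA d) := ⟨2, 3, by norm_num, by norm_num⟩
  set g : EucA d → W := fun x => χ x • F x with hg
  have hgs : ContDiff ℝ 1 g := χ.contDiff.smul hF
  have hgc : HasCompactSupport g := χ.hasCompactSupport.smul_right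
  have hgeq : ∀ x ∈ usph d, g =ᶠ[𝓝 x] F := by
    intro x hx
    have : ∀ᶠ y in 𝓝 x, y ∈ Metric.ball (0 : EucA d) 2 := Metric.isOpen_ball.mem_nhds (by
      rw [mem_ball_zero_iff, mem_sphere_zero_iff_norm.1 hx]; norm_num)
    filter_upwards [this] with y hy
    simp [hg, χ.one_of_mem_closedBall (Metric.ball_subset_closedBall hy)]
  have hdc : Continuous (fderiv ℝ g) := hgs.continuous_fderiv (by norm_num)
  obtain ⟨δ₁, hδ₁, h1⟩ := Metric.uniformContinuous_iff.1
    (hgc.uniformContinuous_of_continuous hgs.continuous) δ hδ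
  obtain ⟨δ₂, hδ₂, h2⟩ := Metric.uniformContinuous_iff.1
    ((hgc.fderiv (𝕜 := ℝ)).uniformContinuous_of_continuous hdc) δ hδ
  have hm : 0 < min δ₁ δ₂ := lt_min hδ₁ hδ₂
  let φ : ContDiffBump (0 : EucA d) := ⟨min δ₁ δ₂ / 2, min δ₁ δ₂, by positivity, by linarith⟩
  have hφr : φ.rOut = min δ₁ δ₂ := rfl
  refine ⟨convolution (φ.normed volume) g (ContinuousLinearMap.lsmul ℝ ℝ) volume,
    HasCompactSupport.contDiff_convolution_left (n := 2) _ φ.hasCompactSupport_normed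
      φ.contDiff_normed (hgs.continuous.locallyIntegrable), fun x hx => ⟨?_, ?_⟩⟩
  · rw [← (hgeq x hx).eq_of_nhds, ← dist_eq_norm]
    refine ContDiffBump.dist_normed_convolution_le hgs.continuous.aestronglyMeasurable
      fun y hy => (h1 ?_).le
    rw [hφr, Metric.mem_ball] at hy
    exact hy.trans_le (min_le_left _ _)
  · have hfd := HasCompactSupport.hasFDerivAt_convolution_right (μ := volume)
      (f := φ.normed volume)
      (ContinuousLinearMap.lsmul ℝ ℝ) hgc
      φ.continuous_normed.locallyIntegrable hgs x
    rw [hfd.fderiv, ← (hgeq x hx).fderiv_eq, ← dist_eq_norm]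
    refine ContDiffBump.dist_normed_convolution_le hdc.aestronglyMeasurable
      fun y hy => (h2 ?_).le
    rw [hφr, Metric.mem_ball] at hy
    exact hy.trans_le (min_le_right _ _)

lemma exists_smooth_approx_kDilation {d k : ℕ} {W : Type*} [NormedAddCommGroup W]
    [InnerProductSpace ℝ W] [FiniteDimensional ℝ W] {F : EucA d → W} (hF : ContDiff ℝ 1 F)
    {η : ℝ} (hη : 0 < η) : ∃ F' : EucA d → W, ContDiff ℝ 2 F' ∧
      (∀ x ∈ usph d, ‖F' x - F x‖ ≤ η) ∧ kDilation k F' ≤ kDilation k F + η := by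
  obtain ⟨R, hR⟩ := (isCompact_sphere (0 : EucA d) 1).exists_bound_of_continuousOn
    (hF.continuous_fderiv (by norm_num)).continuousOn
  set Q : Set ((EucA d →L[ℝ] W) × (Fin k → EucA d)) :=
    Metric.closedBall 0 (R + 1) ×ˢ Metric.closedBall 0 1 with hQ
  have hQc : IsCompact Q := (isCompact_closedBall _ _).prod (isCompact_closedBall _ _)
  have hcont : Continuous fun p : (EucA d →L[ℝ] W) × (Fin k → EucA d) =>
      √(gramDet fun i => p.1 (p.2 i)) := by
    refine Real.continuous_sqrt.comp (Continuous.matrix_det ?_)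
    refine continuous_matrix fun i j => ?_
    simp only [Matrix.of_apply]
    fun_prop
  obtain ⟨δ, hδ, h⟩ := Metric.uniformContinuousOn_iff.1
    (hQc.uniformContinuousOn_of_continuous hcont.continuousOn) η hη
  set δ' := min (δ / 2) (min η 1) with hδ'
  have hδ'p : 0 < δ' := lt_min (by positivity) (lt_min hη one_pos)
  obtain ⟨F', hF', hF'b⟩ := exists_smooth_approx_deriv hF hδ'p
  refine ⟨F', hF', fun x hx => (hF'b x hx).1.trans ((min_le_right _ _).trans (min_le_left _ _)),
    kDilation_le (add_nonneg (kDilation_nonneg _) hη.le) fun x hx v hv hvx => ?_⟩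
  have hb := (hF'b x hx).2
  have hvn : v ∈ Metric.closedBall (0 : Fin k → EucA d) 1 := by
    rw [mem_closedBall_zero_iff, pi_norm_le_iff_of_nonneg zero_le_one]
    exact fun i => (hv.1 i).le
  have h1 : (fderiv ℝ F x, v) ∈ Q := ⟨by
    rw [mem_closedBall_zero_iff]; linarith [hR x hx], hvn⟩
  have h2 : (fderiv ℝ F' x, v) ∈ Q := ⟨by
    rw [mem_closedBall_zero_iff]
    have := norm_le_norm_add_norm_sub' (fderiv ℝ F' x) (fderiv ℝ F x)
    have h3 : δ' ≤ 1 := (min_le_right _ _).trans (min_le_right _ _)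
    rw [norm_sub_rev] at this
    linarith [hR x hx, norm_sub_rev (fderiv ℝ F' x) (fderiv ℝ F x)], hvn⟩
  have h3 := h _ h2 _ h1 (by
    rw [Prod.dist_eq, dist_self, max_eq_left dist_nonneg, dist_eq_norm]
    linarith [min_le_left (δ / 2) (min η 1)])
  have hvx' : ∀ i, v i ∈ (ℝ ∙ x)ᗮ := fun i =>
    Submodule.mem_orthogonal_singleton_iff_inner_right.2 (hvx i)
  have h4 := le_kDilation (k := k) hF hx (v := fun i => ⟨v i, hvx' i⟩)
    ⟨fun i => hv.1 i, fun i j hij => hv.2 hij⟩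
  rw [Real.dist_eq] at h3
  have := (abs_lt.1 h3).2
  linarith

end SmoothApproximation

lemma abs_pairI_eq_of_homotopic {F g : EucA 8 → EucA 5} (hF : ContDiff ℝ 1 F)
    (hg : ContDiff ℝ 2 g) (h : BasedHomotopic (usph 5) (bpt 7) (bpt 4) F g)
    {Ψ : E44 → ℝ} (hΨ : ContDiff ℝ 1 Ψ)
    (hneq : ∀ y ∈ tsupport Ψ, ∃ i, y (Sum.inl i) ≠ y (Sum.inr i))
    (hinl : ∀ y ∈ tsupport Ψ, ∑ i, y (Sum.inl i) ^ 2 < 4 / 5)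
    (hinr : ∀ y ∈ tsupport Ψ, ∑ i, y (Sum.inr i) ^ 2 < 4 / 5) {η : ℝ} (hη : 0 < η) :
    ∃ F' : EucA 8 → EucA 5, ContDiff ℝ 1 F' ∧ kDilation 4 F' ≤ kDilation 4 F + η ∧
      pairI Ψ F' = pairI Ψ g := by
  obtain ⟨H, hHc, hHm, hHb, hH0, hH1⟩ := h
  set ζ := min η (1 / 100) with hζ
  have hζp : 0 < ζ := lt_min hη (by norm_num)
  have hζ1 : ζ ≤ 1 / 100 := min_le_right _ _
  obtain ⟨F', hF', hF'F, hF'k⟩ := exists_smooth_approx_kDilation (k := 4) hF hζp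
  have hC : IsClosed (Icc (0 : ℝ) 1 ×ˢ usph 8) := isClosed_Icc.prod Metric.isClosed_sphere
  obtain ⟨f, hf⟩ := ContinuousMap.exists_restrict_eq hC
    ⟨_, continuousOn_iff_continuous_domRestrict.1 hHc⟩
  have hfH : ∀ t ∈ Icc (0 : ℝ) 1, ∀ x ∈ usph 8, f (t, x) = H t x := fun t ht x hx =>
    DFunLike.congr_fun hf (⟨(t, x), ht, hx⟩ : Icc (0 : ℝ) 1 ×ˢ usph 8)
  obtain ⟨S, hS, hSf, -⟩ := f.continuous.exists_contDiff_approx 2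
    (continuous_const (y := ζ)) fun _ => hζp
  set G : ℝ × EucA 8 → EucA 5 := fun p => S p + (1 - p.1) • (F' p.2 - S (0, p.2)) +
    p.1 • (g p.2 - S (1, p.2)) with hG
  have hS' : ContDiff ℝ 2 S := hS
  have hGs : ContDiff ℝ 2 G := by
    have h1 : ∀ a : ℝ, ContDiff ℝ 2 fun p : ℝ × EucA 8 => S (a, p.2) := fun a =>
      hS'.comp (contDiff_const.prodMk contDiff_snd)
    exact (hS'.add ((contDiff_const.sub contDiff_fst).smul
      ((hF'.comp contDiff_snd).sub (h1 0)))).add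
      (contDiff_fst.smul ((hg.comp contDiff_snd).sub (h1 1)))
  have hSH : ∀ t ∈ Icc (0 : ℝ) 1, ∀ x ∈ usph 8, ‖S (t, x) - H t x‖ ≤ ζ := fun t ht x hx => by
    rw [← hfH t ht x hx, ← dist_eq_norm]
    exact (hSf _).le
  have hGH : ∀ t ∈ Icc (0 : ℝ) 1, ∀ x ∈ usph 8, ‖G (t, x) - H t x‖ ≤ 1 / 20 := by
    intro t ht x hx
    have e0 : ‖F' x - S (0, x)‖ ≤ 2 * ζ := by
      have h1 := hSH 0 (by simp) x hx
      rw [hH0 hx] at h1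
      have : F' x - S (0, x) = (F' x - F x) - (S (0, x) - F x) := by abel
      rw [this]
      exact (norm_sub_le _ _).trans (by linarith [hF'F x hx])
    have e1 : ‖g x - S (1, x)‖ ≤ ζ := by
      have h1 := hSH 1 (by simp) x hx
      rwa [hH1 hx, norm_sub_rev] at h1
    have e2 : G (t, x) - H t x = (S (t, x) - H t x) + (1 - t) • (F' x - S (0, x)) +
        t • (g x - S (1, x)) := by simp only [hG]; abel
    have e3 : ‖(1 - t) • (F' x - S (0, x))‖ ≤ 2 * ζ := by
      rw [norm_smul, Real.norm_eq_abs, abs_of_nonneg (by linarith [ht.2])]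
      exact (mul_le_of_le_one_left (norm_nonneg _) (by linarith [ht.1])).trans e0
    have e4 : ‖t • (g x - S (1, x))‖ ≤ ζ := by
      rw [norm_smul, Real.norm_eq_abs, abs_of_nonneg ht.1]
      exact (mul_le_of_le_one_left (norm_nonneg _) ht.2).trans e1
    rw [e2]
    exact (norm_add₃_le).trans (by linarith [hSH t ht x hx])
  refine ⟨F', hF'.of_le (by norm_num), hF'k.trans (by linarith [min_le_left η (1 / 100)]), ?_⟩
  have hmain := pairI_homotopy hGs hΨ hneq hinl hinr (fun t ht x hx h4 => ?_) (fun t ht => ?_)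
  · convert hmain using 2 <;> · funext x; simp [hG]
  · have h1 := hGH t ht x hx
    have h2 : ‖H t x‖ = 1 := mem_sphere_zero_iff_norm.1 (hHm t ht hx)
    have h3 := norm_sq_EucA5 (G (t, x))
    have h5 := norm_le_norm_add_norm_sub' (H t x) (G (t, x))
    rw [norm_sub_rev] at h5
    rw [h4] at h3
    nlinarith
  · have hb : bpt 7 ∈ usph 8 := mem_sphere_zero_iff_norm.2 (norm_bpt 7)
    have h1 := hGH t ht _ hb
    rw [hHb t ht] at h1
    have h2 := (PiLp.norm_apply_le (G (t, bpt 7) - bpt 4) 4).trans h1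
    have h3 : bpt 4 4 = 1 := by simp [bpt, Fin.last]
    rw [PiLp.sub_apply, h3, Real.norm_eq_abs] at h2
    linarith [(abs_le.1 h2).1]

/-- The `4`-dilation is bounded below on the homotopy class of the Hopf map. -/
theorem exists_le_kDilation_hopfMap : ∃ c : ℝ, 0 < c ∧ ∀ F : EucA 8 → EucA 5, ContDiff ℝ 1 F →
    BasedHomotopic (usph 5) (bpt 7) (bpt 4) F hopfMap → c ≤ kDilation 4 F := by
  obtain ⟨Ψ, hΨ, hΨ1, hneq, hinl, hinr, hI⟩ := exists_pairI_hopfMap_ne_zero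
  set C := (1 * 240000 ^ 2 * ∫ x : E44, ∏ i, (1 + x i ^ 2)⁻¹) with hC
  have key : ∀ F : EucA 8 → EucA 5, ContDiff ℝ 1 F →
      BasedHomotopic (usph 5) (bpt 7) (bpt 4) F hopfMap →
      |pairI Ψ hopfMap| ≤ C * kDilation 4 F ^ 2 := by
    intro F hF hFh
    have h1 : ∀ η > 0, |pairI Ψ hopfMap| ≤ C * (kDilation 4 F + η) ^ 2 := by
      intro η hη
      obtain ⟨F', hF', hk, he⟩ := abs_pairI_eq_of_homotopic hF hopfMap_contDiff hFh hΨ hneq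
        hinl hinr hη
      rw [← he]
      refine (abs_pairI_le hΨ1 hF').trans ?_
      have hC0 : 0 ≤ C := mul_nonneg (by positivity) (integral_nonneg fun x =>
        Finset.prod_nonneg fun i _ => by positivity)
      have := kDilation_nonneg (k := 4) F'
      gcongr
    have h2 : Tendsto (fun η : ℝ => C * (kDilation 4 F + η) ^ 2) (𝓝[>] 0)
        (𝓝 (C * (kDilation 4 F + 0) ^ 2)) := by
      refine Tendsto.mono_left (Continuous.tendsto ?_ 0) nhdsWithin_le_nhds
      fun_prop
    rw [add_zero] at h2
    exact ge_of_tendsto h2 (eventually_mem_nhdsWithin.mono fun η hη => h1 η hη)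
  have hIp : 0 < |pairI Ψ hopfMap| := abs_pos.2 hI
  by_cases hCp : 0 < C
  · refine ⟨√(|pairI Ψ hopfMap| / C), Real.sqrt_pos.2 (div_pos hIp hCp), fun F hF hFh => ?_⟩
    refine Real.sqrt_le_iff.2 ⟨kDilation_nonneg _, ?_⟩
    rw [div_le_iff₀ hCp]
    linarith [key F hF hFh]
  · refine ⟨1, one_pos, fun F hF hFh => absurd (key F hF hFh) (not_le.2 ?_)⟩
    nlinarith [sq_nonneg (kDilation 4 F)]

open scoped Quaternion

/-- The quaternion with given coordinates. -/
def quatMk (a b c d : ℝ) : ℍ[ℝ] := ⟨a, b, c, d⟩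

@[simp] lemma quatMk_re (a b c d : ℝ) : (quatMk a b c d).re = a := rfl
@[simp] lemma quatMk_imI (a b c d : ℝ) : (quatMk a b c d).imI = b := rfl
@[simp] lemma quatMk_imJ (a b c d : ℝ) : (quatMk a b c d).imJ = c := rfl
@[simp] lemma quatMk_imK (a b c d : ℝ) : (quatMk a b c d).imK = d := rfl

lemma ContDiff.quatMk {X : Type*} [NormedAddCommGroup X] [NormedSpace ℝ X] {n : WithTop ℕ∞}
    {a b c d : X → ℝ} (ha : ContDiff ℝ n a) (hb : ContDiff ℝ n b) (hc : ContDiff ℝ n c)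
    (hd : ContDiff ℝ n d) : ContDiff ℝ n fun x => quatMk (a x) (b x) (c x) (d x) := by
  have h : ContDiff ℝ n fun x =>
      Quaternion.linearIsometryEquivTuple.symm !₂[a x, b x, c x, d x] := by
    refine (LinearIsometryEquiv.contDiff _).comp (contDiff_euclidean.2 fun i => ?_)
    fin_cases i <;> simpa
  exact h

/-- The quaternion formed by the first four coordinates of a point of `ℝ⁵`. -/
def quatM (y : EucA 5) : ℍ[ℝ] := quatMk (y 0) (y 1) (y 2) (y 3)

@[simp] lemma quatM_re (y : EucA 5) : (quatM y).re = y 0 := rfl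
@[simp] lemma quatM_imI (y : EucA 5) : (quatM y).imI = y 1 := rfl
@[simp] lemma quatM_imJ (y : EucA 5) : (quatM y).imJ = y 2 := rfl
@[simp] lemma quatM_imK (y : EucA 5) : (quatM y).imK = y 3 := rfl

lemma norm_sq_quaternion (a : ℍ[ℝ]) : ‖a‖ ^ 2 = a.re ^ 2 + a.imI ^ 2 + a.imJ ^ 2 + a.imK ^ 2 := by
  rw [sq ‖a‖, ← Quaternion.normSq_eq_norm_mul_self, Quaternion.normSq_def']

lemma star_mul_self_eq_norm (a : ℍ[ℝ]) : star a * a = ((‖a‖ ^ 2 : ℝ) : ℍ[ℝ]) := by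
  rw [Quaternion.star_mul_self, Quaternion.normSq_eq_norm_mul_self, sq]

lemma mul_star_self_eq_norm (a : ℍ[ℝ]) : a * star a = ((‖a‖ ^ 2 : ℝ) : ℍ[ℝ]) := by
  rw [Quaternion.self_mul_star, Quaternion.normSq_eq_norm_mul_self, sq]

lemma norm_sq_eq_quatM (y : EucA 5) : ‖y‖ ^ 2 = ‖quatM y‖ ^ 2 + y 4 ^ 2 := by
  rw [norm_sq_EucA5, norm_sq_quaternion]; simp [Fin.sum_univ_four]

lemma contDiff_quatM {n : WithTop ℕ∞} : ContDiff ℝ n quatM :=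
  .quatMk (contDiff_coord 0) (contDiff_coord 1) (contDiff_coord 2) (contDiff_coord 3)

lemma continuous_quatM : Continuous quatM := (contDiff_quatM (n := 0)).continuous

/-- Clifford multiplication by a vector of `ℝ⁵` on `ℍ²`. -/
def cliffordMul (y : EucA 5) (p : ℍ[ℝ] × ℍ[ℝ]) : ℍ[ℝ] × ℍ[ℝ] :=
  (-(y 4) • p.1 + quatM y * p.2, star (quatM y) * p.1 + (y 4) • p.2)

lemma continuous_cliffordMul :
    Continuous fun q : EucA 5 × ℍ[ℝ] × ℍ[ℝ] => cliffordMul q.1 q.2 := by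
  have h1 : Continuous fun q : EucA 5 × ℍ[ℝ] × ℍ[ℝ] => quatM q.1 :=
    continuous_quatM.comp continuous_fst
  have h2 : Continuous fun q : EucA 5 × ℍ[ℝ] × ℍ[ℝ] => q.1 4 := by fun_prop
  unfold cliffordMul
  fun_prop

lemma norm_sq_cliffordMul (y : EucA 5) (p : ℍ[ℝ] × ℍ[ℝ]) :
    ‖(cliffordMul y p).1‖ ^ 2 + ‖(cliffordMul y p).2‖ ^ 2 =
      ‖y‖ ^ 2 * (‖p.1‖ ^ 2 + ‖p.2‖ ^ 2) := by
  rw [norm_sq_eq_quatM]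
  simp only [norm_sq_quaternion]
  simp [cliffordMul]
  ring

lemma cliffordMul_cliffordMul {y : EucA 5} (hy : ‖y‖ = 1) (p : ℍ[ℝ] × ℍ[ℝ]) :
    cliffordMul y (cliffordMul y p) = p := by
  have h := norm_sq_EucA5 y
  simp only [hy, Fin.sum_univ_four] at h
  simp at h
  ext <;> simp [cliffordMul]
  · linear_combination (-p.1.re) * h
  · linear_combination (-p.1.imI) * h
  · linear_combination (-p.1.imJ) * h
  · linear_combination (-p.1.imK) * h
  · linear_combination (-p.2.re) * h
  · linear_combination (-p.2.imI) * h
  · linear_combination (-p.2.imJ) * h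
  · linear_combination (-p.2.imK) * h

lemma cliffordMul_add (y : EucA 5) (p q : ℍ[ℝ] × ℍ[ℝ]) :
    cliffordMul y (p + q) = cliffordMul y p + cliffordMul y q := by
  ext <;> simp [cliffordMul] <;> ring

lemma cliffordMul_sub_left (y z : EucA 5) (p : ℍ[ℝ] × ℍ[ℝ]) :
    cliffordMul (y - z) p = cliffordMul y p - cliffordMul z p := by
  ext <;> simp [cliffordMul] <;> ring

lemma norm_sq_add_pos {p : ℍ[ℝ] × ℍ[ℝ]} (hp : p ≠ 0) : 0 < ‖p.1‖ ^ 2 + ‖p.2‖ ^ 2 := by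
  by_contra! h
  have h1 : ‖p.1‖ = 0 := by nlinarith [sq_nonneg ‖p.1‖, sq_nonneg ‖p.2‖]
  have h2 : ‖p.2‖ = 0 := by nlinarith [sq_nonneg ‖p.1‖, sq_nonneg ‖p.2‖]
  exact hp (Prod.ext (norm_eq_zero.1 h1) (norm_eq_zero.1 h2))

lemma add_cliffordMul_ne_zero {y z : EucA 5} {p : ℍ[ℝ] × ℍ[ℝ]} (hp : p ≠ 0)
    (h : cliffordMul z p = p) (hyz : ‖y - z‖ < 2) : p + cliffordMul y p ≠ 0 := by
  intro h0
  have h1 : cliffordMul (y - z) p = (-2 : ℝ) • p := by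
    rw [cliffordMul_sub_left, h, eq_neg_of_add_eq_zero_right h0]
    module
  have h2 := norm_sq_cliffordMul (y - z) p
  rw [h1] at h2
  simp only [Prod.smul_fst, Prod.smul_snd, norm_smul, mul_pow] at h2
  norm_num at h2
  have h3 := norm_sq_add_pos hp
  nlinarith [norm_nonneg (y - z), mul_pos h3 (by nlinarith [norm_nonneg (y - z)] :
    0 < 4 - ‖y - z‖ ^ 2)]

lemma exists_clifford_section {H : ℝ → EucA 8 → EucA 5}
    (hH : ContinuousOn (fun q : ℝ × EucA 8 => H q.1 q.2) (Icc (0 : ℝ) 1 ×ˢ usph 8))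
    (hm : ∀ t ∈ Icc (0 : ℝ) 1, MapsTo (H t) (usph 8) (usph 5))
    (h1 : EqOn (H 1) (fun _ => bpt 4) (usph 8)) :
    ∃ l : EucA 8 → ℍ[ℝ] × ℍ[ℝ], ContinuousOn l (usph 8) ∧
      ∀ x ∈ usph 8, l x ≠ 0 ∧ cliffordMul (H 0 x) (l x) = l x := by
  have hK : IsCompact (Icc (0 : ℝ) 1 ×ˢ usph 8) := isCompact_Icc.prod (isCompact_sphere _ _)
  obtain ⟨δ, hδ, hδ'⟩ := Metric.uniformContinuousOn_iff.1
    (hK.uniformContinuousOn_of_continuous hH) 2 two_pos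
  have key : ∀ n : ℕ, ∃ l : EucA 8 → ℍ[ℝ] × ℍ[ℝ], ContinuousOn l (usph 8) ∧
      ∀ x ∈ usph 8, l x ≠ 0 ∧ cliffordMul (H (max 0 (1 - n * (δ / 2))) x) (l x) = l x := by
    intro n
    induction n with
    | zero =>
      refine ⟨fun _ => (0, 1), continuousOn_const, fun x hx => ⟨by simp, ?_⟩⟩
      have : H (max 0 (1 - (0 : ℕ) * (δ / 2))) x = bpt 4 := by simpa using h1 hx
      rw [this]
      ext <;> simp [cliffordMul, bpt, Fin.last, PiLp.single_apply]
    | succ n ih =>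
      obtain ⟨l, hl, hl'⟩ := ih
      set t := max 0 (1 - n * (δ / 2))
      set t' := max 0 (1 - (n + 1 : ℕ) * (δ / 2)) with ht'
      have hn : 0 ≤ n * (δ / 2) := by positivity
      have htm : t ∈ Icc (0 : ℝ) 1 := ⟨le_max_left _ _, max_le zero_le_one (by linarith)⟩
      have htm' : t' ∈ Icc (0 : ℝ) 1 := by
        refine ⟨le_max_left _ _, max_le zero_le_one ?_⟩
        push_cast; nlinarith
      have htt : |t' - t| < δ := by
        refine (abs_max_sub_max_le_max _ _ _ _).trans_lt ?_
        push_cast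
        rw [show (1 - ((n : ℝ) + 1) * (δ / 2) - (1 - n * (δ / 2))) = -(δ / 2) by ring, abs_neg,
          abs_of_pos (half_pos hδ)]
        simp [hδ]
      have hHt : ContinuousOn (H t') (usph 8) :=
        hH.comp (f := fun x => (t', x)) (by fun_prop) fun x hx => ⟨htm', hx⟩
      refine ⟨fun x => l x + cliffordMul (H t' x) (l x),
        hl.add (continuous_cliffordMul.comp_continuousOn (hHt.prodMk hl)), fun x hx => ⟨?_, ?_⟩⟩
      · refine add_cliffordMul_ne_zero (hl' x hx).1 (hl' x hx).2 ?_
        rw [← dist_eq_norm]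
        refine hδ' (t', x) ⟨htm', hx⟩ (t, x) ⟨htm, hx⟩ ?_
        rw [Prod.dist_eq]
        simpa [Real.dist_eq, hδ] using htt
      · rw [cliffordMul_add, cliffordMul_cliffordMul (by simpa [usph] using hm _ htm' hx), add_comm]
  obtain ⟨n, hn⟩ := exists_nat_gt (1 / (δ / 2))
  obtain ⟨l, hl, hl'⟩ := key n
  refine ⟨l, hl, ?_⟩
  rwa [max_eq_left] at hl'
  rw [div_lt_iff₀ (by positivity)] at hn
  linarith

lemma continuousOn_of_norm_le {X V : Type*} [TopologicalSpace X] [NormedAddCommGroup V]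
    {S : Set X} {m : X → V} {g : X → ℝ} (hg : ContinuousOn g S) (hle : ∀ x ∈ S, ‖m x‖ ≤ g x)
    (h : ∀ x ∈ S, g x ≠ 0 → ContinuousWithinAt m S x) : ContinuousOn m S := by
  intro x hx
  by_cases h0 : g x = 0
  · have hm : m x = 0 := norm_le_zero_iff.1 (h0 ▸ hle x hx)
    rw [ContinuousWithinAt, hm]
    have hgx := hg x hx
    rw [ContinuousWithinAt, h0] at hgx
    exact squeeze_zero_norm' (eventually_nhdsWithin_of_forall hle) hgx
  · exact h x hx h0

/-- The first quaternionic coordinate on `ℝ⁸ = ℍ²`. -/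
def quatA (x : EucA 8) : ℍ[ℝ] := quatMk (x 0) (x 1) (x 2) (x 3)

/-- The second quaternionic coordinate on `ℝ⁸ = ℍ²`. -/
def quatB (x : EucA 8) : ℍ[ℝ] := quatMk (x 4) (x 5) (x 6) (x 7)

lemma contDiff_quatA {n : WithTop ℕ∞} : ContDiff ℝ n quatA :=
  .quatMk (contDiff_coord 0) (contDiff_coord 1) (contDiff_coord 2) (contDiff_coord 3)

lemma contDiff_quatB {n : WithTop ℕ∞} : ContDiff ℝ n quatB :=
  .quatMk (contDiff_coord 4) (contDiff_coord 5) (contDiff_coord 6) (contDiff_coord 7)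

lemma continuous_quatA : Continuous quatA := (contDiff_quatA (n := 0)).continuous

lemma continuous_quatB : Continuous quatB := (contDiff_quatB (n := 0)).continuous

lemma norm_sq_eq_quatA_quatB (x : EucA 8) : ‖x‖ ^ 2 = ‖quatA x‖ ^ 2 + ‖quatB x‖ ^ 2 := by
  rw [norm_sq_EucA8, norm_sq_quaternion, norm_sq_quaternion]; rfl

lemma quatA_bpt : quatA (bpt 7) = 0 := by
  ext <;> simp [quatA, bpt, PiLp.single_apply, Fin.last, Fin.ext_iff]

lemma quatB_bpt : ‖quatB (bpt 7)‖ = 1 := by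
  have h := norm_sq_eq_quatA_quatB (bpt 7)
  rw [norm_bpt, quatA_bpt] at h
  exact (pow_eq_one_iff_of_nonneg (norm_nonneg _) two_ne_zero).1 (by simpa using h.symm)

/-- The point of `ℝ⁵ = ℍ × ℝ` with given components. -/
def quatReal (m : ℍ[ℝ]) (h : ℝ) : EucA 5 := !₂[m.re, m.imI, m.imJ, m.imK, h]

@[simp] lemma quatM_quatReal (m : ℍ[ℝ]) (h : ℝ) : quatM (quatReal m h) = m := rfl

@[simp] lemma quatReal_four (m : ℍ[ℝ]) (h : ℝ) : quatReal m h 4 = h := rfl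

lemma norm_sq_quatReal (m : ℍ[ℝ]) (h : ℝ) : ‖quatReal m h‖ ^ 2 = ‖m‖ ^ 2 + h ^ 2 := by
  rw [norm_sq_eq_quatM]; simp

lemma quatReal_zero_one : quatReal 0 1 = bpt 4 := by
  ext i
  fin_cases i <;> simp [quatReal, bpt, PiLp.single_apply, Fin.last, Fin.ext_iff]

lemma ContDiff.quaternion_coord {X : Type*} [NormedAddCommGroup X] [NormedSpace ℝ X]
    {n : WithTop ℕ∞} {m : X → ℍ[ℝ]} (hm : ContDiff ℝ n m) (i : Fin 4) :
    ContDiff ℝ n fun x => Quaternion.linearIsometryEquivTuple (m x) i :=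
  (contDiff_coord i).comp (Quaternion.linearIsometryEquivTuple.contDiff.comp hm)

lemma contDiff_quatReal {n : WithTop ℕ∞} :
    ContDiff ℝ n fun p : ℍ[ℝ] × ℝ => quatReal p.1 p.2 := by
  refine contDiff_euclidean.2 fun i => ?_
  have h := fun j => ContDiff.quaternion_coord (n := n) (contDiff_fst (E := ℍ[ℝ]) (F := ℝ)) j
  fin_cases i
  · exact h 0
  · exact h 1
  · exact h 2
  · exact h 3
  · exact contDiff_snd

lemma continuous_quatReal : Continuous fun p : ℍ[ℝ] × ℝ => quatReal p.1 p.2 :=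
  (contDiff_quatReal (n := 0)).continuous

/-- The Hopf construction on the commutator map `S³ × S³ → S³`. -/
def commHopf (x : EucA 8) : EucA 5 :=
  quatReal ((2 * ‖quatA x‖⁻¹ * ‖quatB x‖⁻¹) •
    (quatA x * quatB x * star (quatA x) * star (quatB x))) (‖quatB x‖ ^ 2 - ‖quatA x‖ ^ 2)

lemma norm_smul_commutator (a b : ℍ[ℝ]) :
    ‖(2 * ‖a‖⁻¹ * ‖b‖⁻¹) • (a * b * star a * star b)‖ = 2 * ‖a‖ * ‖b‖ := by
  simp only [norm_smul, norm_mul, norm_star, norm_inv, norm_norm]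
  rcases eq_or_ne (‖a‖) 0 with ha | ha
  · simp [ha]
  rcases eq_or_ne (‖b‖) 0 with hb | hb
  · simp [hb]
  field_simp
  norm_num

lemma commHopf_continuous : Continuous commHopf := by
  have hA := continuous_quatA
  have hB := continuous_quatB
  refine continuous_quatReal.comp (Continuous.prodMk ?_ (by fun_prop))
  rw [← continuousOn_univ]
  refine continuousOn_of_norm_le (g := fun x => 2 * ‖quatA x‖ * ‖quatB x‖) (by fun_prop)
    (fun x _ => (norm_smul_commutator _ _).le) fun x _ h => ?_
  have h1 : ‖quatA x‖ ≠ 0 := fun h0 => h (by simp [h0])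
  have h2 : ‖quatB x‖ ≠ 0 := fun h0 => h (by simp [h0])
  exact ContinuousAt.continuousWithinAt (by fun_prop (disch := assumption))

lemma commHopf_mapsTo : MapsTo commHopf (usph 8) (usph 5) := by
  intro x hx
  have h : ‖x‖ = 1 := by simpa [usph] using hx
  have h1 := norm_sq_eq_quatA_quatB x
  have h2 : ‖commHopf x‖ ^ 2 = 1 := by
    rw [commHopf, norm_sq_quatReal, norm_smul_commutator]
    rw [h] at h1
    linear_combination (-(‖quatA x‖ ^ 2 + ‖quatB x‖ ^ 2) - 1) * h1
  simpa [usph] using (pow_eq_one_iff_of_nonneg (norm_nonneg _) two_ne_zero).1 h2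

lemma commHopf_bpt : commHopf (bpt 7) = bpt 4 := by
  rw [commHopf, quatA_bpt, quatB_bpt, ← quatReal_zero_one]
  simp

/-- A unit section produces, pointwise, a vector of `ℍ²` orthogonal to `(a, b)`. -/
lemma section_relation {a b u v : ℍ[ℝ]} (hab : ‖a‖ ^ 2 + ‖b‖ ^ 2 = 1)
    (h1 : (2 * ‖a‖⁻¹ * ‖b‖⁻¹) • (a * b * star a * star b) * v = (2 * ‖b‖ ^ 2) • u) :
    star a * (‖b‖⁻¹ • (star b * v)) + star b * (-(‖a‖⁻¹ • (star a * u))) = 0 := by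
  rcases eq_or_ne a 0 with rfl | ha
  · simp
  rcases eq_or_ne b 0 with rfl | hb
  · simp
  have ha' : ‖a‖ ≠ 0 := norm_ne_zero_iff.2 ha
  have hb' : ‖b‖ ≠ 0 := norm_ne_zero_iff.2 hb
  have hu : u = (‖a‖⁻¹ * (‖b‖ ^ 3)⁻¹) • (a * b * star a * star b * v) := by
    have h2 : u = (2 * ‖b‖ ^ 2)⁻¹ • ((2 * ‖b‖ ^ 2) • u) := by
      rw [inv_smul_smul₀ (by positivity)]
    rw [h2, ← h1, smul_mul_assoc, smul_smul]
    congr 1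
    field_simp
  have h3 : star b * (star a * (a * b * star a * star b * v)) =
      (‖a‖ ^ 2 * ‖b‖ ^ 2) • (star a * (star b * v)) := by
    calc star b * (star a * (a * b * star a * star b * v))
        = star b * ((star a * a) * b) * star a * star b * v := by noncomm_ring
      _ = _ := by
        rw [star_mul_self_eq_norm, Quaternion.coe_mul_eq_smul, mul_smul_comm,
          star_mul_self_eq_norm, Quaternion.smul_coe, Quaternion.coe_mul_eq_smul]
        simp only [smul_mul_assoc, mul_assoc]
  rw [hu]
  simp only [mul_smul_comm, mul_neg, smul_smul, h3]
  rw [← sub_eq_add_neg, ← sub_smul]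
  convert zero_smul ℝ _
  field_simp
  ring

lemma exists_continuousOn_section
    (h : BasedHomotopic (usph 5) (bpt 7) (bpt 4) commHopf (fun _ => bpt 4)) :
    ∃ w : EucA 8 → ℍ[ℝ] × ℍ[ℝ], ContinuousOn w (usph 8) ∧ ∀ x ∈ usph 8, w x ≠ 0 ∧
      star (quatA x) * (w x).1 + star (quatB x) * (w x).2 = 0 := by
  obtain ⟨H, hc, hm, -, h0, h1⟩ := h
  obtain ⟨l, hl, hl'⟩ := exists_clifford_section hc hm h1
  have hA := continuous_quatA.continuousOn (s := usph 8)
  have hB := continuous_quatB.continuousOn (s := usph 8)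
  have hsum : ∀ x ∈ usph 8, ‖quatA x‖ ^ 2 + ‖quatB x‖ ^ 2 = 1 := fun x hx => by
    rw [← norm_sq_eq_quatA_quatB, show ‖x‖ = 1 by simpa [usph] using hx]; norm_num
  have hr1 : ∀ x ∈ usph 8, quatM (commHopf x) * (l x).2 = (2 * ‖quatB x‖ ^ 2) • (l x).1 := by
    intro x hx
    have h2 := congrArg Prod.fst (hl' x hx).2
    rw [h0 hx] at h2
    simp only [cliffordMul] at h2
    have h3 : commHopf x 4 = ‖quatB x‖ ^ 2 - ‖quatA x‖ ^ 2 := rfl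
    rw [show 2 * ‖quatB x‖ ^ 2 = 1 + commHopf x 4 by rw [h3]; linarith [hsum x hx], add_smul,
      one_smul]
    rw [neg_smul, neg_add_eq_iff_eq_add] at h2
    rw [h2, add_comm]
  have hr2 : ∀ x ∈ usph 8,
      star (quatM (commHopf x)) * (l x).1 = (2 * ‖quatA x‖ ^ 2) • (l x).2 := by
    intro x hx
    have h2 := congrArg Prod.snd (hl' x hx).2
    rw [h0 hx] at h2
    simp only [cliffordMul] at h2
    have h3 : commHopf x 4 = ‖quatB x‖ ^ 2 - ‖quatA x‖ ^ 2 := rfl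
    rw [show 2 * ‖quatA x‖ ^ 2 = 1 - commHopf x 4 by rw [h3]; linarith [hsum x hx], sub_smul,
      one_smul]
    exact eq_sub_of_add_eq h2
  have hM : ∀ x, quatM (commHopf x) = (2 * ‖quatA x‖⁻¹ * ‖quatB x‖⁻¹) •
    (quatA x * quatB x * star (quatA x) * star (quatB x)) := fun x => rfl
  have hz2 : ∀ x ∈ usph 8, quatB x = 0 → (l x).2 = 0 := by
    intro x hx hx0
    have h2 := hr2 x hx
    have h3 := hsum x hx
    rw [hM, hx0] at h2
    rw [hx0] at h3
    have h4 : ‖quatA x‖ ^ 2 = 1 := by simpa using h3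
    simpa [h4] using h2.symm
  have hz1 : ∀ x ∈ usph 8, quatA x = 0 → (l x).1 = 0 := by
    intro x hx hx0
    have h2 := hr1 x hx
    have h3 := hsum x hx
    rw [hM, hx0] at h2
    rw [hx0] at h3
    have h4 : ‖quatB x‖ ^ 2 = 1 := by simpa using h3
    simpa [h4] using h2.symm
  refine ⟨fun x => (‖quatB x‖⁻¹ • (star (quatB x) * (l x).2),
    -(‖quatA x‖⁻¹ • (star (quatA x) * (l x).1))), ContinuousOn.prodMk ?_ (ContinuousOn.neg ?_),
    fun x hx => ⟨fun hw => ?_, section_relation (hsum x hx) (hM x ▸ hr1 x hx)⟩⟩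
  · refine continuousOn_of_norm_le (g := fun x => ‖(l x).2‖) (by fun_prop) (fun x hx => ?_)
      fun x hx h => ?_
    · rw [norm_smul, norm_mul, norm_star, norm_inv, norm_norm, ← mul_assoc]
      exact mul_le_of_le_one_left (norm_nonneg _) inv_mul_le_one
    · have h2 : ‖quatB x‖ ≠ 0 := fun h3 => h (by simp [hz2 x hx (norm_eq_zero.1 h3)])
      have hl2 := (hl x hx).snd
      have hB' := hB x hx
      exact (hB'.norm.inv₀ h2).smul (hB'.star.mul hl2)
  · refine continuousOn_of_norm_le (g := fun x => ‖(l x).1‖) (by fun_prop) (fun x hx => ?_)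
      fun x hx h => ?_
    · rw [norm_smul, norm_mul, norm_star, norm_inv, norm_norm, ← mul_assoc]
      exact mul_le_of_le_one_left (norm_nonneg _) inv_mul_le_one
    · have h2 : ‖quatA x‖ ≠ 0 := fun h3 => h (by simp [hz1 x hx (norm_eq_zero.1 h3)])
      have hl2 := (hl x hx).fst
      have hA' := hA x hx
      exact (hA'.norm.inv₀ h2).smul (hA'.star.mul hl2)
  · obtain ⟨hw1, hw2⟩ := Prod.ext_iff.1 hw
    simp only [Prod.fst_zero, Prod.snd_zero, neg_eq_zero, smul_eq_zero, inv_eq_zero, norm_eq_zero,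
      mul_eq_zero, star_eq_zero] at hw1 hw2
    refine (hl' x hx).1 (Prod.ext ?_ ?_)
    · rcases hw2 with h2 | h2 | h2
      exacts [hz1 x hx h2, hz1 x hx h2, h2]
    · rcases hw1 with h2 | h2 | h2
      exacts [hz2 x hx h2, hz2 x hx h2, h2]

/-- The point of `ℝ⁸` with given quaternionic coordinates. -/
def quatPair (p : ℍ[ℝ] × ℍ[ℝ]) : EucA 8 :=
  !₂[p.1.re, p.1.imI, p.1.imJ, p.1.imK, p.2.re, p.2.imI, p.2.imJ, p.2.imK]

lemma quatA_quatPair (p : ℍ[ℝ] × ℍ[ℝ]) : quatA (quatPair p) = p.1 := rfl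

lemma quatB_quatPair (p : ℍ[ℝ] × ℍ[ℝ]) : quatB (quatPair p) = p.2 := rfl

lemma contDiff_quatPair {n : WithTop ℕ∞} : ContDiff ℝ n quatPair := by
  refine contDiff_euclidean.2 fun i => ?_
  have h := fun j => ContDiff.quaternion_coord (n := n) (contDiff_fst (E := ℍ[ℝ]) (F := ℍ[ℝ])) j
  have h' := fun j => ContDiff.quaternion_coord (n := n) (contDiff_snd (E := ℍ[ℝ]) (F := ℍ[ℝ])) j
  fin_cases i
  exacts [h 0, h 1, h 2, h 3, h' 0, h' 1, h' 2, h' 3]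

/-- Quaternionic conjugation as a continuous linear map. -/
def quatStar : ℍ[ℝ] →L[ℝ] ℍ[ℝ] := LinearMap.toContinuousLinearMap
  { toFun := star
    map_add' := star_add
    map_smul' := fun c x => by ext <;> simp }

lemma ContDiff.quatStar {X : Type*} [NormedAddCommGroup X] [NormedSpace ℝ X] {n : WithTop ℕ∞}
    {m : X → ℍ[ℝ]} (hm : ContDiff ℝ n m) : ContDiff ℝ n fun x => star (m x) :=
  _root_.quatStar.contDiff.comp hm

/-- Vectors of `ℍ²` close to an orthogonal one remain independent of the base vector. -/
lemma sub_mul_ne_zero {x w z : ℍ[ℝ] × ℍ[ℝ]} (hx : ‖x.1‖ ^ 2 + ‖x.2‖ ^ 2 = 1)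
    (hw : star x.1 * w.1 + star x.2 * w.2 = 0)
    (hz : ‖z.1 - w.1‖ ^ 2 + ‖z.2 - w.2‖ ^ 2 < ‖w.1‖ ^ 2 + ‖w.2‖ ^ 2) (q : ℍ[ℝ]) :
    (z.1 - x.1 * q, z.2 - x.2 * q) ≠ 0 := by
  intro h
  obtain ⟨h1, h2⟩ := Prod.ext_iff.1 h
  replace h1 : z.1 = x.1 * q := sub_eq_zero.1 h1
  replace h2 : z.2 = x.2 * q := sub_eq_zero.1 h2
  rw [h1, h2] at hz
  have e1 := congrArg QuaternionAlgebra.re hw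
  have e2 := congrArg QuaternionAlgebra.imI hw
  have e3 := congrArg QuaternionAlgebra.imJ hw
  have e4 := congrArg QuaternionAlgebra.imK hw
  simp at e1 e2 e3 e4
  have : ‖x.1 * q - w.1‖ ^ 2 + ‖x.2 * q - w.2‖ ^ 2 =
      ‖q‖ ^ 2 * (‖x.1‖ ^ 2 + ‖x.2‖ ^ 2) + ‖w.1‖ ^ 2 + ‖w.2‖ ^ 2 := by
    simp only [norm_sq_quaternion]
    simp
    linear_combination (-2 * q.re) * e1 + (-2 * q.imI) * e2 + (-2 * q.imJ) * e3 +
      (-2 * q.imK) * e4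
  rw [this, hx] at hz
  nlinarith [sq_nonneg ‖q‖]

theorem exists_smooth_section
    (h : BasedHomotopic (usph 5) (bpt 7) (bpt 4) commHopf (fun _ => bpt 4)) :
    ∃ w : ℍ[ℝ] × ℍ[ℝ] → ℍ[ℝ] × ℍ[ℝ], ContDiff ℝ 2 w ∧ ∀ x, ‖x.1‖ ^ 2 + ‖x.2‖ ^ 2 = 1 →
      w x ≠ 0 ∧ star x.1 * (w x).1 + star x.2 * (w x).2 = 0 := by
  obtain ⟨w, hw, hw'⟩ := exists_continuousOn_section h
  have hC : IsClosed (usph 8) := Metric.isClosed_sphere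
  obtain ⟨f, hf⟩ := ContinuousMap.exists_restrict_eq hC
    ⟨_, continuousOn_iff_continuous_domRestrict.1 hw⟩
  have hf' : ∀ x ∈ usph 8, f x = w x := fun x hx =>
    congrArg (fun g : C(usph 8, ℍ[ℝ] × ℍ[ℝ]) => g ⟨x, hx⟩) hf
  have hne : (usph 8).Nonempty := ⟨bpt 7, by simp [usph, norm_bpt]⟩
  obtain ⟨x₀, hx₀, hmin⟩ := (isCompact_sphere (0 : EucA 8) 1).exists_isMinOn hne hw.norm
  have hpos : 0 < ‖w x₀‖ := norm_pos_iff.2 (hw' x₀ hx₀).1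
  obtain ⟨g, hg, hg'⟩ := f.continuous.exists_contDiff_approx 2
    (continuous_const (y := ‖w x₀‖ / 2)) fun _ => by positivity
  refine ⟨fun x => ((g (quatPair x)).1 - x.1 * (star x.1 * (g (quatPair x)).1 +
      star x.2 * (g (quatPair x)).2), (g (quatPair x)).2 - x.2 * (star x.1 * (g (quatPair x)).1 +
      star x.2 * (g (quatPair x)).2)), ?_, fun x hx => ⟨?_, ?_⟩⟩
  · have h1 : ContDiff ℝ 2 quatPair := contDiff_quatPair
    have hg2 : ContDiff ℝ 2 g := hg
    have h2 : ContDiff ℝ 2 fun x : ℍ[ℝ] × ℍ[ℝ] => star x.1 := contDiff_fst.quatStar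
    have h3 : ContDiff ℝ 2 fun x : ℍ[ℝ] × ℍ[ℝ] => star x.2 := contDiff_snd.quatStar
    fun_prop
  · have hxm : quatPair x ∈ usph 8 := by
      have := norm_sq_eq_quatA_quatB (quatPair x)
      rw [quatA_quatPair, quatB_quatPair, hx] at this
      simpa [usph] using (pow_eq_one_iff_of_nonneg (norm_nonneg _) two_ne_zero).1 this
    have hw2 := (hw' _ hxm).2
    rw [quatA_quatPair, quatB_quatPair] at hw2
    refine sub_mul_ne_zero hx hw2 ?_ _
    have h1 := hg'.1 (quatPair x)
    rw [hf' _ hxm, dist_eq_norm] at h1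
    have h2 : ‖w x₀‖ ≤ ‖w (quatPair x)‖ := hmin hxm
    have h3 : ‖(g (quatPair x)).1 - (w (quatPair x)).1‖ < ‖w x₀‖ / 2 :=
      (norm_fst_le (g (quatPair x) - w (quatPair x))).trans_lt h1
    have h4 : ‖(g (quatPair x)).2 - (w (quatPair x)).2‖ < ‖w x₀‖ / 2 :=
      (norm_snd_le (g (quatPair x) - w (quatPair x))).trans_lt h1
    have h5 : ‖w (quatPair x)‖ ^ 2 ≤ ‖(w (quatPair x)).1‖ ^ 2 + ‖(w (quatPair x)).2‖ ^ 2 := by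
      rw [Prod.norm_def]
      rcases max_choice ‖(w (quatPair x)).1‖ ‖(w (quatPair x)).2‖ with h | h <;> rw [h] <;>
        nlinarith [sq_nonneg ‖(w (quatPair x)).1‖, sq_nonneg ‖(w (quatPair x)).2‖]
    nlinarith [norm_nonneg ((g (quatPair x)).1 - (w (quatPair x)).1),
      norm_nonneg ((g (quatPair x)).2 - (w (quatPair x)).2)]
  · set q := star x.1 * (g (quatPair x)).1 + star x.2 * (g (quatPair x)).2 with hq
    calc star x.1 * ((g (quatPair x)).1 - x.1 * q) + star x.2 * ((g (quatPair x)).2 - x.2 * q)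
        = q - (star x.1 * x.1 + star x.2 * x.2) * q := by rw [hq]; noncomm_ring
      _ = 0 := by
        rw [star_mul_self_eq_norm, star_mul_self_eq_norm, ← Quaternion.coe_add, hx]
        simp

/-- The circle `exp (2π i s)` in the quaternions. -/
def quatExp (s : ℝ) : ℍ[ℝ] := quatMk (Real.cos (2 * Real.pi * s)) (Real.sin (2 * Real.pi * s)) 0 0

lemma contDiff_quatExp {n : WithTop ℕ∞} : ContDiff ℝ n quatExp :=
  .quatMk (Real.contDiff_cos.comp (contDiff_const.mul contDiff_id))
    (Real.contDiff_sin.comp (contDiff_const.mul contDiff_id)) contDiff_const contDiff_const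

lemma norm_quatExp (s : ℝ) : ‖quatExp s‖ = 1 := by
  refine (pow_eq_one_iff_of_nonneg (norm_nonneg _) two_ne_zero).1 ?_
  rw [norm_sq_quaternion]
  simp [quatExp]

lemma quatExp_zero : quatExp 0 = 1 := by ext <;> simp [quatExp]

lemma quatExp_one : quatExp 1 = 1 := by ext <;> simp [quatExp]

/-- The first column of the unitary matrix acting by `exp (2π i s)` on the complex line through
`X` and trivially on its orthogonal complement. -/
def reflFst (s : ℝ) (X : ℍ[ℝ] × ℍ[ℝ]) : ℍ[ℝ] × ℍ[ℝ] :=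
  (1 + (‖X.1‖ ^ 2 + ‖X.2‖ ^ 2)⁻¹ • (X.1 * (quatExp s - 1) * star X.1),
    (‖X.1‖ ^ 2 + ‖X.2‖ ^ 2)⁻¹ • (X.2 * (quatExp s - 1) * star X.1))

/-- The second column of the unitary matrix acting by `exp (2π i s)` on the complex line through
`X` and trivially on its orthogonal complement. -/
def reflSnd (s : ℝ) (X : ℍ[ℝ] × ℍ[ℝ]) : ℍ[ℝ] × ℍ[ℝ] :=
  ((‖X.1‖ ^ 2 + ‖X.2‖ ^ 2)⁻¹ • (X.1 * (quatExp s - 1) * star X.2),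
    1 + (‖X.1‖ ^ 2 + ‖X.2‖ ^ 2)⁻¹ • (X.2 * (quatExp s - 1) * star X.2))

lemma norm_sq_reflFst (s : ℝ) {X : ℍ[ℝ] × ℍ[ℝ]} (hX : X ≠ 0) :
    ‖(reflFst s X).1‖ ^ 2 + ‖(reflFst s X).2‖ ^ 2 = 1 := by
  have hn : ‖X.1‖ ^ 2 + ‖X.2‖ ^ 2 ≠ 0 := (norm_sq_add_pos hX).ne'
  have hP : ‖quatExp s - 1‖ ^ 2 = -2 * (quatExp s - 1).re := by
    rw [norm_sq_quaternion]
    simp [quatExp]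
    linear_combination Real.sin_sq_add_cos_sq (2 * Real.pi * s)
  have h1 : ‖(reflFst s X).1‖ ^ 2 = 1 + (‖X.1‖ ^ 2 + ‖X.2‖ ^ 2)⁻¹ * (2 * ‖X.1‖ ^ 2 *
      (quatExp s - 1).re) + ((‖X.1‖ ^ 2 + ‖X.2‖ ^ 2)⁻¹ * (‖X.1‖ * ‖quatExp s - 1‖ * ‖X.1‖)) ^ 2 := by
    have h2 : (X.1 * (quatExp s - 1) * star X.1).re = ‖X.1‖ ^ 2 * (quatExp s - 1).re := by
      rw [norm_sq_quaternion]; simp; ring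
    have h3 : ∀ (c : ℝ) (z : ℍ[ℝ]), ‖1 + c • z‖ ^ 2 = 1 + c * (2 * z.re) + (c * ‖z‖) ^ 2 := by
      intro c z
      rw [mul_pow, norm_sq_quaternion, norm_sq_quaternion]; simp; ring
    rw [reflFst, h3, h2, norm_mul, norm_mul, norm_star]
    ring
  rw [h1]
  simp only [reflFst, norm_smul, norm_mul, norm_star]
  have h4 : ‖(‖X.1‖ ^ 2 + ‖X.2‖ ^ 2)⁻¹‖ = (‖X.1‖ ^ 2 + ‖X.2‖ ^ 2)⁻¹ :=
    Real.norm_of_nonneg (by positivity)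
  rw [h4]
  field_simp
  linear_combination (‖X.1‖ ^ 2 * (‖X.1‖ ^ 2 + ‖X.2‖ ^ 2)) * hP

lemma reflFst_zero (s : ℝ) (x : ℍ[ℝ]) : reflFst s (0, x) = (1, 0) := by simp [reflFst]

lemma reflSnd_zero (s : ℝ) {x : ℍ[ℝ]} (hx : x ≠ 0) :
    reflSnd s (0, x) = (0, x * quatExp s * x⁻¹) := by
  have hx' : ‖x‖ ≠ 0 := norm_ne_zero_iff.2 hx
  have h1 : star x = (‖x‖ ^ 2) • x⁻¹ := by
    rw [eq_comm, ← Quaternion.coe_mul_eq_smul, ← star_mul_self_eq_norm, mul_assoc,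
      mul_inv_cancel₀ hx, mul_one]
  simp only [reflSnd, norm_zero, zero_mul, smul_zero, h1, mul_smul_comm, smul_smul]
  rw [show ((0 : ℝ) ^ 2 + ‖x‖ ^ 2)⁻¹ * ‖x‖ ^ 2 = 1 by field_simp; simp, one_smul, mul_sub, sub_mul,
    mul_one, mul_inv_cancel₀ hx]
  simp

lemma reflFst_mul (s : ℝ) (X : ℍ[ℝ] × ℍ[ℝ]) {m : ℍ[ℝ]} (hm : m ≠ 0)
    (hc : m * quatExp s = quatExp s * m) : reflFst s (X.1 * m, X.2 * m) = reflFst s X ∧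
      reflSnd s (X.1 * m, X.2 * m) = reflSnd s X := by
  have hm' : ‖m‖ ≠ 0 := norm_ne_zero_iff.2 hm
  have h1 : ∀ a b : ℍ[ℝ], (‖X.1 * m‖ ^ 2 + ‖X.2 * m‖ ^ 2)⁻¹ • (a * m * (quatExp s - 1) *
      star (b * m)) = (‖X.1‖ ^ 2 + ‖X.2‖ ^ 2)⁻¹ • (a * (quatExp s - 1) * star b) := by
    intro a b
    have h2 : a * m * (quatExp s - 1) * star (b * m) =
        (‖m‖ ^ 2) • (a * (quatExp s - 1) * star b) := by
      calc a * m * (quatExp s - 1) * star (b * m)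
          = a * (m * quatExp s - m) * (star m * star b) := by rw [star_mul]; noncomm_ring
        _ = a * (quatExp s - 1) * ((m * star m) * star b) := by rw [hc]; noncomm_ring
        _ = _ := by
          rw [mul_star_self_eq_norm, Quaternion.coe_mul_eq_smul, mul_smul_comm]
    rw [h2, smul_smul, norm_mul, norm_mul]
    congr 1
    rw [mul_pow, mul_pow, ← add_mul, mul_inv, mul_assoc, inv_mul_cancel₀ (by positivity), mul_one]
  constructor <;> simp only [reflFst, reflSnd, h1]

/-- The unitary matrix with columns `reflFst s X`, `reflSnd s X` is invertible. -/
lemma refl_injective (s : ℝ) {X w : ℍ[ℝ] × ℍ[ℝ]} (hX : X ≠ 0)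
    (h1 : star (reflFst s X).1 * w.1 + star (reflFst s X).2 * w.2 = 0)
    (h2 : star (reflSnd s X).1 * w.1 + star (reflSnd s X).2 * w.2 = 0) : w = 0 := by
  have hn : ‖X.1‖ ^ 2 + ‖X.2‖ ^ 2 ≠ 0 := (norm_sq_add_pos hX).ne'
  set n := ‖X.1‖ ^ 2 + ‖X.2‖ ^ 2 with hndef
  set P := quatExp s - 1 with hP
  set ξ := star X.1 * w.1 + star X.2 * w.2 with hξ
  have hsm : ∀ (c : ℝ) (z : ℍ[ℝ]), star (c • z) = c • star z := fun c z => quatStar.map_smul c z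
  have e1 : w.1 + n⁻¹ • (X.1 * (star P * ξ)) = 0 := by
    rw [← h1]
    simp only [reflFst, star_add, hsm, star_mul, star_star, star_one, add_mul, one_mul,
      smul_mul_assoc, hξ, mul_add, smul_add, mul_assoc, ← hndef, ← hP]
    abel
  have e2 : w.2 + n⁻¹ • (X.2 * (star P * ξ)) = 0 := by
    rw [← h2]
    simp only [reflSnd, star_add, hsm, star_mul, star_star, star_one, add_mul, one_mul,
      smul_mul_assoc, hξ, mul_add, smul_add, mul_assoc, ← hndef, ← hP]
    abel
  have e3 : ξ + star P * ξ = 0 := by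
    have h3 : star X.1 * (w.1 + n⁻¹ • (X.1 * (star P * ξ))) +
        star X.2 * (w.2 + n⁻¹ • (X.2 * (star P * ξ))) = 0 := by simp [e1, e2]
    rw [← h3]
    have h4 : star X.1 * (X.1 * (star P * ξ)) = (‖X.1‖ ^ 2) • (star P * ξ) := by
      rw [← mul_assoc, star_mul_self_eq_norm, Quaternion.coe_mul_eq_smul]
    have h5 : star X.2 * (X.2 * (star P * ξ)) = (‖X.2‖ ^ 2) • (star P * ξ) := by
      rw [← mul_assoc, star_mul_self_eq_norm, Quaternion.coe_mul_eq_smul]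
    simp only [mul_add, mul_smul_comm, h4, h5, smul_smul]
    have h6 : star P * ξ = (n⁻¹ * ‖X.1‖ ^ 2) • (star P * ξ) + (n⁻¹ * ‖X.2‖ ^ 2) • (star P * ξ) := by
      rw [← add_smul, ← mul_add, ← hndef, inv_mul_cancel₀ hn, one_smul]
    nth_rewrite 1 [h6]
    nth_rewrite 1 [hξ]
    abel
  have e4 : ξ = 0 := by
    have h7 : star (quatExp s) * ξ = 0 := by
      rw [← e3, hP, star_sub, star_one]; noncomm_ring
    rcases mul_eq_zero.1 h7 with h8 | h8
    · have h9 := norm_quatExp s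
      rw [← norm_star, h8] at h9
      simp at h9
    · exact h8
  rw [e4] at e1 e2
  ext1
  · simpa using e1
  · simpa using e2

lemma norm_ne_zero_sq_add {X : ℍ[ℝ] × ℍ[ℝ]} (hX : X ≠ 0) : ‖X.1‖ ^ 2 + ‖X.2‖ ^ 2 ≠ 0 :=
  (norm_sq_add_pos hX).ne'

lemma contDiffAt_refl {p : ℝ × ℍ[ℝ] × ℍ[ℝ]} (hp : p.2 ≠ 0) {n : WithTop ℕ∞} :
    ContDiffAt ℝ n (fun p : ℝ × ℍ[ℝ] × ℍ[ℝ] => reflFst p.1 p.2) p ∧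
      ContDiffAt ℝ n (fun p : ℝ × ℍ[ℝ] × ℍ[ℝ] => reflSnd p.1 p.2) p := by
  have h1 : ContDiff ℝ n fun p : ℝ × ℍ[ℝ] × ℍ[ℝ] => star p.2.1 := contDiff_snd.fst.quatStar
  have h2 : ContDiff ℝ n fun p : ℝ × ℍ[ℝ] × ℍ[ℝ] => star p.2.2 := contDiff_snd.snd.quatStar
  have h3 : ContDiff ℝ n fun p : ℝ × ℍ[ℝ] × ℍ[ℝ] => quatExp p.1 := contDiff_quatExp.comp contDiff_fst
  have h4 : ContDiffAt ℝ n (fun p : ℝ × ℍ[ℝ] × ℍ[ℝ] => (‖p.2.1‖ ^ 2 + ‖p.2.2‖ ^ 2)⁻¹) p := by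
    refine ContDiffAt.inv ?_ (norm_ne_zero_sq_add hp)
    have h5 : ContDiff ℝ n fun p : ℝ × ℍ[ℝ] × ℍ[ℝ] => ‖p.2.1‖ ^ 2 + ‖p.2.2‖ ^ 2 :=
      (contDiff_snd.fst.norm_sq ℝ).add (contDiff_snd.snd.norm_sq ℝ)
    exact h5.contDiffAt
  have h5 : ContDiff ℝ n fun p : ℝ × ℍ[ℝ] × ℍ[ℝ] => p.2.1 := contDiff_snd.fst
  have h6 : ContDiff ℝ n fun p : ℝ × ℍ[ℝ] × ℍ[ℝ] => p.2.2 := contDiff_snd.snd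
  replace h1 := h1.contDiffAt (x := p)
  replace h2 := h2.contDiffAt (x := p)
  replace h3 := h3.contDiffAt (x := p)
  replace h5 := h5.contDiffAt (x := p)
  replace h6 := h6.contDiffAt (x := p)
  constructor
  · exact (contDiffAt_const.add (h4.smul ((h5.mul (h3.sub contDiffAt_const)).mul h1))).prodMk
      (h4.smul ((h6.mul (h3.sub contDiffAt_const)).mul h1))
  · exact (h4.smul ((h5.mul (h3.sub contDiffAt_const)).mul h2)).prodMk
      (contDiffAt_const.add (h4.smul ((h6.mul (h3.sub contDiffAt_const)).mul h2)))

lemma ContDiffAt.quatStar {X : Type*} [NormedAddCommGroup X] [NormedSpace ℝ X] {n : WithTop ℕ∞}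
    {m : X → ℍ[ℝ]} {x : X} (hm : ContDiffAt ℝ n m x) : ContDiffAt ℝ n (fun x => star (m x)) x :=
  _root_.quatStar.contDiff.contDiffAt.comp x hm

theorem exists_circle_action
    (h : BasedHomotopic (usph 5) (bpt 7) (bpt 4) commHopf (fun _ => bpt 4)) :
    ∃ R : ℝ × ℍ[ℝ] × ℍ[ℝ] → ℍ[ℝ], ContDiffOn ℝ 2 R {p | p.2 ≠ 0} ∧
      (∀ s X, X ≠ 0 → ‖R (s, X)‖ = 1) ∧ (∀ X, X ≠ 0 → R (0, X) = 1 ∧ R (1, X) = 1) ∧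
      (∀ s X m, X ≠ 0 → m ≠ 0 → m.imJ = 0 → m.imK = 0 →
        R (s, X.1 * m, X.2 * m) = R (s, X)) ∧
      ∀ s x, x ≠ 0 → R (s, 0, x) = x * quatExp s * x⁻¹ := by
  obtain ⟨w, hw, hw'⟩ := exists_smooth_section h
  set g : ℝ × ℍ[ℝ] × ℍ[ℝ] → ℍ[ℝ] := fun p =>
    star (w (reflFst p.1 p.2)).1 * (reflSnd p.1 p.2).1 +
      star (w (reflFst p.1 p.2)).2 * (reflSnd p.1 p.2).2 with hg
  obtain ⟨hω0, hω⟩ := hw' (1, 0) (by simp)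
  have hω1 : (w (1, 0)).1 = 0 := by simpa using hω
  have hω2 : (w (1, 0)).2 ≠ 0 := fun h0 => hω0 (Prod.ext hω1 h0)
  have hsω : star (w (1, 0)).2 ≠ 0 := star_ne_zero.2 hω2
  have hg0 : ∀ s X, X ≠ 0 → g (s, X) ≠ 0 := by
    intro s X hX h0
    obtain ⟨h1, h2⟩ := hw' _ (norm_sq_reflFst s hX)
    refine h1 (refl_injective s hX h2 ?_)
    have h3 := congrArg star h0
    simpa [hg] using h3
  have hga : ∀ s x, x ≠ 0 → g (s, 0, x) = star (w (1, 0)).2 * (x * quatExp s * x⁻¹) := by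
    intro s x hx
    simp only [hg, reflFst_zero, reflSnd_zero s hx, mul_zero, zero_add]
  have hg1 : ∀ s X, quatExp s = 1 → g (s, X) = star (w (1, 0)).2 := by
    intro s X hs
    simp [hg, reflFst, reflSnd, hs]
  set Q : ℝ × ℍ[ℝ] × ℍ[ℝ] → ℍ[ℝ] := fun p => (star (w (1, 0)).2)⁻¹ * g p with hQ
  have hQ0 : ∀ s X, X ≠ 0 → Q (s, X) ≠ 0 := fun s X hX =>
    mul_ne_zero (inv_ne_zero hsω) (hg0 s X hX)
  have hn : ∀ s x, x ≠ 0 → ‖x * quatExp s * x⁻¹‖ = 1 := fun s x hx => by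
    have : ‖x‖ ≠ 0 := norm_ne_zero_iff.2 hx
    rw [norm_mul, norm_mul, norm_quatExp, norm_inv, mul_one, mul_inv_cancel₀ this]
  refine ⟨fun p => ‖Q p‖⁻¹ • Q p, fun p hp => ?_, fun s X hX => ?_, fun X _ => ⟨?_, ?_⟩,
    fun s X m hX hm hJ hK => ?_, fun s x hx => ?_⟩
  · obtain ⟨h1, h2⟩ := contDiffAt_refl (n := 2) hp
    have h3 : ContDiffAt ℝ 2 (fun p : ℝ × ℍ[ℝ] × ℍ[ℝ] => w (reflFst p.1 p.2)) p :=
      ContDiffAt.comp p hw.contDiffAt h1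
    have hgs : ContDiffAt ℝ 2 g p := (h3.fst.quatStar.mul h2.fst).add (h3.snd.quatStar.mul h2.snd)
    have hQs : ContDiffAt ℝ 2 Q p := contDiffAt_const.mul hgs
    have hQp : Q p ≠ 0 := hQ0 p.1 p.2 hp
    exact (((hQs.norm ℝ hQp).inv (norm_ne_zero_iff.2 hQp)).smul hQs).contDiffWithinAt
  · have := norm_ne_zero_iff.2 (hQ0 s X hX)
    rw [norm_smul, norm_inv, norm_norm, inv_mul_cancel₀ this]
  · simp [hQ, hg1 0 X quatExp_zero, inv_mul_cancel₀ hsω]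
  · simp [hQ, hg1 1 X quatExp_one, inv_mul_cancel₀ hsω]
  · have hc : m * quatExp s = quatExp s * m := by
      ext <;> simp [quatExp, hJ, hK] <;> ring
    have : g (s, X.1 * m, X.2 * m) = g (s, X) := by
      simp only [hg, (reflFst_mul s X hm hc).1, (reflFst_mul s X hm hc).2]
    simp only [hQ, this]
  · have : Q (s, 0, x) = x * quatExp s * x⁻¹ := by
      simp only [hQ, hga s x hx]
      rw [← mul_assoc, inv_mul_cancel₀ hsω, one_mul]
    simp only [this, hn s x hx]
    simp

/-- The first complex coordinate of `x = α + j β`. -/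
def quatFst : ℍ[ℝ] →L[ℝ] ℂ := LinearMap.toContinuousLinearMap
  { toFun := fun x => ⟨x.re, x.imI⟩
    map_add' := fun x y => by apply Complex.ext <;> simp
    map_smul' := fun c x => by apply Complex.ext <;> simp }

/-- The second complex coordinate of `x = α + j β`. -/
def quatSnd : ℍ[ℝ] →L[ℝ] ℂ := LinearMap.toContinuousLinearMap
  { toFun := fun x => ⟨x.imJ, -x.imK⟩
    map_add' := fun x y => by apply Complex.ext <;> simp; ring
    map_smul' := fun c x => by apply Complex.ext <;> simp }

/-- The quaternion `α + j β`. -/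
def quatOfPair : ℂ × ℂ →L[ℝ] ℍ[ℝ] := LinearMap.toContinuousLinearMap
  { toFun := fun p => quatMk p.1.re p.1.im p.2.re (-p.2.im)
    map_add' := fun x y => by ext <;> simp; ring
    map_smul' := fun c x => by ext <;> simp }

lemma quatFst_apply (x : ℍ[ℝ]) : quatFst x = ⟨x.re, x.imI⟩ := rfl

lemma quatSnd_apply (x : ℍ[ℝ]) : quatSnd x = ⟨x.imJ, -x.imK⟩ := rfl

lemma quatOfPair_apply (a b : ℂ) : quatOfPair (a, b) = quatMk a.re a.im b.re (-b.im) := rfl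

lemma quatOfPair_eta (x : ℍ[ℝ]) : quatOfPair (quatFst x, quatSnd x) = x := by
  ext <;> simp [quatOfPair_apply, quatFst_apply, quatSnd_apply]

lemma quatOfPair_mul (a b m : ℂ) :
    quatOfPair (a * m, b * m) = quatOfPair (a, b) * quatOfPair (m, 0) := by
  ext <;> simp [quatOfPair_apply] <;> ring

lemma quatOfPair_eq_zero {a b : ℂ} (h : quatOfPair (a, b) = 0) : a = 0 ∧ b = 0 := by
  have e1 := congrArg QuaternionAlgebra.re h
  have e2 := congrArg QuaternionAlgebra.imI h
  have e3 := congrArg QuaternionAlgebra.imJ h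
  have e4 := congrArg QuaternionAlgebra.imK h
  simp [quatOfPair_apply] at e1 e2 e3 e4
  exact ⟨Complex.ext e1 e2, Complex.ext e3 e4⟩

open Polynomial in
/-- The binary form with the given linear factors. -/
def quatPoly (x : Fin 3 → ℍ[ℝ]) : ℂ[X] := ∏ j, (C (quatSnd (x j)) * X + C (quatFst (x j)))

open Polynomial in
lemma quatPoly_ne_zero {x : Fin 3 → ℍ[ℝ]} (hx : ∀ j, x j ≠ 0) : quatPoly x ≠ 0 := by
  refine Finset.prod_ne_zero_iff.2 fun j _ h => hx j ?_
  have h0 := congrArg (fun p => p.coeff 0) h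
  have h1 := congrArg (fun p => p.coeff 1) h
  simp at h0 h1
  rw [← quatOfPair_eta (x j), h0, h1]
  exact quatOfPair.map_zero

open Polynomial in
lemma quatPoly_natDegree_le (x : Fin 3 → ℍ[ℝ]) : (quatPoly x).natDegree ≤ 3 := by
  refine (natDegree_prod_le _ _).trans ?_
  refine (Finset.sum_le_sum fun j _ => natDegree_linear_le).trans ?_
  simp

/-- The coefficients of the binary form with given linear factors, as a point of `ℍ²`. -/
def quatCoeff (x : Fin 3 → ℍ[ℝ]) : ℍ[ℝ] × ℍ[ℝ] :=
  (quatOfPair ((quatPoly x).coeff 2, (quatPoly x).coeff 3),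
    quatOfPair ((quatPoly x).coeff 0, (quatPoly x).coeff 1))

lemma quatCoeff_ne_zero {x : Fin 3 → ℍ[ℝ]} (hx : ∀ j, x j ≠ 0) : quatCoeff x ≠ 0 := by
  intro h
  obtain ⟨h1, h2⟩ := Prod.ext_iff.1 h
  obtain ⟨h3, h4⟩ := quatOfPair_eq_zero h1
  obtain ⟨h5, h6⟩ := quatOfPair_eq_zero h2
  refine quatPoly_ne_zero hx (Polynomial.ext fun k => ?_)
  rcases lt_or_ge 3 k with hk | hk
  · exact Polynomial.coeff_eq_zero_of_natDegree_lt ((quatPoly_natDegree_le x).trans_lt hk)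
  · interval_cases k <;> simpa

lemma quatCoeff_perm (x : Fin 3 → ℍ[ℝ]) (σ : Equiv.Perm (Fin 3)) :
    quatCoeff (fun j => x (σ j)) = quatCoeff x := by
  have : quatPoly (fun j => x (σ j)) = quatPoly x := Equiv.prod_comp σ fun j =>
    (Polynomial.C (quatSnd (x j)) * Polynomial.X + Polynomial.C (quatFst (x j)))
  rw [quatCoeff, this, quatCoeff]

lemma quatFst_mul (x : ℍ[ℝ]) (m : ℂ) : quatFst (x * quatOfPair (m, 0)) = quatFst x * m := by
  apply Complex.ext <;> simp [quatFst_apply, quatOfPair_apply]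

lemma quatSnd_mul (x : ℍ[ℝ]) (m : ℂ) : quatSnd (x * quatOfPair (m, 0)) = quatSnd x * m := by
  apply Complex.ext <;> simp [quatSnd_apply, quatOfPair_apply] <;> ring

open Polynomial in
lemma quatCoeff_mul (x : Fin 3 → ℍ[ℝ]) (m : Fin 3 → ℂ) :
    quatCoeff (fun j => x j * quatOfPair (m j, 0)) =
      ((quatCoeff x).1 * quatOfPair (∏ j, m j, 0), (quatCoeff x).2 * quatOfPair (∏ j, m j, 0)) := by
  have : quatPoly (fun j => x j * quatOfPair (m j, 0)) = quatPoly x * C (∏ j, m j) := by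
    rw [quatPoly, quatPoly, map_prod, ← Finset.prod_mul_distrib]
    refine Finset.prod_congr rfl fun j _ => ?_
    rw [quatFst_mul, quatSnd_mul]
    simp only [map_mul]
    ring
  rw [quatCoeff, this, quatCoeff]
  simp only [coeff_mul_C, quatOfPair_mul]

open Polynomial in
lemma quatPoly_eq (x : Fin 3 → ℍ[ℝ]) (a b : Fin 3 → ℂ) (ha : ∀ j, quatFst (x j) = a j)
    (hb : ∀ j, quatSnd (x j) = b j) : quatPoly x = C (a 0 * a 1 * a 2) +
      C (b 0 * a 1 * a 2 + a 0 * b 1 * a 2 + a 0 * a 1 * b 2) * X ^ 1 +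
      C (b 0 * b 1 * a 2 + b 0 * a 1 * b 2 + a 0 * b 1 * b 2) * X ^ 2 +
      C (b 0 * b 1 * b 2) * X ^ 3 := by
  rw [quatPoly, Fin.prod_univ_three]
  simp only [ha, hb, map_mul, map_add]
  ring

open Polynomial in
lemma quatCoeff_eq (x : Fin 3 → ℍ[ℝ]) (a b : Fin 3 → ℂ) (ha : ∀ j, quatFst (x j) = a j)
    (hb : ∀ j, quatSnd (x j) = b j) : quatCoeff x =
      (quatOfPair (b 0 * b 1 * a 2 + b 0 * a 1 * b 2 + a 0 * b 1 * b 2, b 0 * b 1 * b 2),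
       quatOfPair (a 0 * a 1 * a 2, b 0 * a 1 * a 2 + a 0 * b 1 * a 2 + a 0 * a 1 * b 2)) := by
  rw [quatCoeff, quatPoly_eq x a b ha hb]
  simp only [coeff_add, coeff_C_mul, coeff_X_pow, coeff_C]
  norm_num

lemma contDiff_quatCoeff {n : WithTop ℕ∞} : ContDiff ℝ n quatCoeff := by
  have h : quatCoeff = _ := funext fun x => quatCoeff_eq x _ _ (fun j => rfl) (fun j => rfl)
  rw [h]
  have h1 : ∀ j, ContDiff ℝ n fun x : Fin 3 → ℍ[ℝ] => quatFst (x j) := fun j =>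
    quatFst.contDiff.comp (contDiff_apply ℝ ℍ[ℝ] j)
  have h2 : ∀ j, ContDiff ℝ n fun x : Fin 3 → ℍ[ℝ] => quatSnd (x j) := fun j =>
    quatSnd.contDiff.comp (contDiff_apply ℝ ℍ[ℝ] j)
  have h3 := h1 0
  have h4 := h1 1
  have h5 := h1 2
  have h6 := h2 0
  have h7 := h2 1
  have h8 := h2 2
  exact (quatOfPair.contDiff.comp (((((h6.mul h7).mul h5).add ((h6.mul h4).mul h8)).add
    ((h3.mul h7).mul h8)).prodMk ((h6.mul h7).mul h8))).prodMk
    (quatOfPair.contDiff.comp (((h3.mul h4).mul h5).prodMk ((((h6.mul h4).mul h5).add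
      ((h3.mul h7).mul h5)).add ((h3.mul h4).mul h8))))

lemma quatCoeff_single (x : ℍ[ℝ]) : quatCoeff ![x, 1, 1] = (0, x) := by
  have h1 : quatFst 1 = 1 := by apply Complex.ext <;> simp [quatFst_apply]
  have h2 : quatSnd 1 = 0 := by apply Complex.ext <;> simp [quatSnd_apply]
  rw [quatCoeff_eq ![x, 1, 1] ![quatFst x, 1, 1] ![quatSnd x, 0, 0]]
  · ext1
    · simp only [Matrix.cons_val_zero, Matrix.cons_val_one, Matrix.cons_val]
      simp only [mul_zero, zero_mul, add_zero]
      exact quatOfPair.map_zero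
    · simpa using quatOfPair_eta x
  · intro j; fin_cases j <;> simp [h1]
  · intro j; fin_cases j <;> simp [h2]

/-- The imaginary quaternion formed by the last three of four real coordinates. -/
def quatIm : (Fin 4 → ℝ) →L[ℝ] ℍ[ℝ] := LinearMap.toContinuousLinearMap
  { toFun := fun q => quatMk 0 (q 1) (q 2) (q 3)
    map_add' := fun x y => by ext <;> simp
    map_smul' := fun c x => by ext <;> simp }

lemma quatIm_apply (q : Fin 4 → ℝ) : quatIm q = quatMk 0 (q 1) (q 2) (q 3) := rfl

/-- The quaternion unit `i`. -/
def quatI : ℍ[ℝ] := quatMk 0 1 0 0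

/-- The quaternion unit `j`. -/
def quatJ : ℍ[ℝ] := quatMk 0 0 1 0

/-- `x` conjugates `i` to the direction of `y`. -/
def ConjugatesTo (y x : ℍ[ℝ]) : Prop := x ≠ 0 ∧ y * x = ‖y‖ • (x * quatI)

lemma quatI_ne_zero : quatI ≠ 0 := fun h => by
  simpa [quatI] using congrArg QuaternionAlgebra.imI h

lemma norm_quatI : ‖quatI‖ = 1 := by
  refine (pow_eq_one_iff_of_nonneg (norm_nonneg _) two_ne_zero).1 ?_
  rw [norm_sq_quaternion]; simp [quatI]

lemma quatJ_ne_zero : quatJ ≠ 0 := fun h => by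
  simpa [quatJ] using congrArg QuaternionAlgebra.imJ h

lemma conjugatesTo_quatI : ConjugatesTo quatI 1 := ⟨one_ne_zero, by simp [norm_quatI]⟩

lemma ConjugatesTo.smul {y x : ℍ[ℝ]} (h : ConjugatesTo y x) {c : ℝ} (hc : 0 < c) :
    ConjugatesTo (c • y) x :=
  ⟨h.1, by rw [smul_mul_assoc, h.2, norm_smul, Real.norm_of_nonneg hc.le, smul_smul]⟩

lemma ConjugatesTo.exists_mul {y x x' : ℍ[ℝ]} (hy : y ≠ 0) (h : ConjugatesTo y x)
    (h' : ConjugatesTo y x') : ∃ m : ℂ, m ≠ 0 ∧ x' = x * quatOfPair (m, 0) := by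
  have hy' : ‖y‖ ≠ 0 := norm_ne_zero_iff.2 hy
  obtain ⟨m, hm⟩ : ∃ m, x' = x * m := ⟨x⁻¹ * x', by rw [← mul_assoc, mul_inv_cancel₀ h.1, one_mul]⟩
  have hm0 : m ≠ 0 := fun h0 => h'.1 (by rw [hm, h0, mul_zero])
  have h1 : x * (quatI * m) = x * (m * quatI) := by
    have h2 := h'.2
    rw [hm, ← mul_assoc, h.2, smul_mul_assoc] at h2
    have h3 := smul_right_injective _ hy' h2
    simpa only [mul_assoc] using h3
  have h4 := mul_left_cancel₀ h.1 h1
  have e3 := congrArg QuaternionAlgebra.imJ h4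
  have e4 := congrArg QuaternionAlgebra.imK h4
  simp [quatI] at e3 e4
  have hK : m.imK = 0 := by linarith
  have hJ : m.imJ = 0 := by linarith
  have h5 : m = quatOfPair (quatFst m, 0) := by
    ext <;> simp [quatOfPair_apply, quatFst_apply, hK, hJ]
  refine ⟨quatFst m, fun h0 => hm0 ?_, by rw [← h5, hm]⟩
  rw [h5, h0]
  exact quatOfPair.map_zero

lemma conjugatesTo_add {y : ℍ[ℝ]} (hy : y.re = 0) (h : y + ‖y‖ • quatI ≠ 0) :
    ConjugatesTo y (y + ‖y‖ • quatI) := by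
  refine ⟨h, ?_⟩
  have h1 := norm_sq_quaternion y
  rw [hy] at h1
  ext <;> simp [quatI, hy]
  · linear_combination h1
  all_goals ring

lemma conjugatesTo_sub {y : ℍ[ℝ]} (hy : y.re = 0) (h : y - ‖y‖ • quatI ≠ 0) :
    ConjugatesTo y ((y - ‖y‖ • quatI) * quatJ) := by
  refine ⟨mul_ne_zero h quatJ_ne_zero, ?_⟩
  have h1 := norm_sq_quaternion y
  rw [hy] at h1
  ext <;> simp [quatI, quatJ, hy]
  · ring
  · ring
  · linear_combination h1
  · ring

/-- A local section of the conjugation map, one of two charts. -/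
def conjSec (b : Bool) (y : ℍ[ℝ]) : ℍ[ℝ] :=
  if b then y + ‖y‖ • quatI else (y - ‖y‖ • quatI) * quatJ

lemma conjugatesTo_conjSec {b : Bool} {y : ℍ[ℝ]} (hy : y.re = 0) (h : conjSec b y ≠ 0) :
    ConjugatesTo y (conjSec b y) := by
  cases b
  · refine conjugatesTo_sub hy fun h0 => h ?_
    simp [conjSec, h0]
  · exact conjugatesTo_add hy h

lemma contDiffAt_conjSec (b : Bool) {y : ℍ[ℝ]} (hy : y ≠ 0) {n : ℕ∞} :
    ContDiffAt ℝ n (conjSec b) y := by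
  have h1 : ContDiffAt ℝ n (fun y : ℍ[ℝ] => ‖y‖) y := contDiffAt_norm ℝ hy
  cases b
  · exact (contDiffAt_id.sub (h1.smul contDiffAt_const)).mul contDiffAt_const
  · exact contDiffAt_id.add (h1.smul contDiffAt_const)

lemma exists_conjSec_ne_zero {y : ℍ[ℝ]} (hy : y ≠ 0) : ∃ b, conjSec b y ≠ 0 := by
  by_contra! h
  have h1 : y + ‖y‖ • quatI = 0 := h true
  have h2 : (y - ‖y‖ • quatI) * quatJ = 0 := h false
  replace h2 := (mul_eq_zero.1 h2).resolve_right quatJ_ne_zero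
  apply hy
  have h3 : (2 : ℝ) • y = 0 := by
    rw [two_smul]; nth_rewrite 1 [eq_neg_of_add_eq_zero_left h1]; rw [sub_eq_zero.1 h2]
    rw [norm_smul, norm_norm, norm_quatI]; simp
  exact (smul_eq_zero.1 h3).resolve_left two_ne_zero

theorem exists_symmetric_family
    (h : BasedHomotopic (usph 5) (bpt 7) (bpt 4) commHopf (fun _ => bpt 4)) :
    ∃ R : ℝ × (Fin 3 → Fin 4 → ℝ) → ℍ[ℝ],
      ContDiffOn ℝ 2 R {p | ∀ j, quatIm (p.2 j) ≠ 0} ∧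
      (∀ s q, (∀ j, quatIm (q j) ≠ 0) → ‖R (s, q)‖ = 1) ∧
      (∀ q, (∀ j, quatIm (q j) ≠ 0) → R (0, q) = 1 ∧ R (1, q) = 1) ∧
      (∀ s q, ∀ σ : Equiv.Perm (Fin 3), R (s, fun j => q (σ j)) = R (s, q)) ∧
      (∀ s q q', (∀ j, quatIm (q j) ≠ 0) →
        (∀ j, ∃ c : ℝ, 0 < c ∧ quatIm (q' j) = c • quatIm (q j)) → R (s, q') = R (s, q)) ∧
      ∀ s q, quatIm (q 0) ≠ 0 → quatIm (q 1) = quatI → quatIm (q 2) = quatI →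
        R (s, q) = (Real.cos (2 * Real.pi * s) : ℍ[ℝ]) +
          (Real.sin (2 * Real.pi * s) * ‖quatIm (q 0)‖⁻¹) • quatIm (q 0) := by
  obtain ⟨R, hR, hR1, hR0, hRm, hRa⟩ := exists_circle_action h
  have hinv : ∀ s (y x x' : Fin 3 → ℍ[ℝ]), (∀ j, y j ≠ 0) → (∀ j, ConjugatesTo (y j) (x j)) →
      (∀ j, ConjugatesTo (y j) (x' j)) → R (s, quatCoeff x') = R (s, quatCoeff x) := by
    intro s y x x' hy hx hx'
    choose m hm hm' using fun j => ConjugatesTo.exists_mul (hy j) (hx j) (hx' j)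
    rw [funext hm', quatCoeff_mul]
    refine hRm s _ _ (quatCoeff_ne_zero fun j => (hx j).1) (fun h0 => ?_) rfl ?_
    · exact Finset.prod_ne_zero_iff.2 (fun j _ => hm j) (quatOfPair_eq_zero h0).1
    · simp [quatOfPair_apply]
  have hs : ∀ y : ℍ[ℝ], ∃ x, y.re = 0 → y ≠ 0 → ConjugatesTo y x := by
    intro y
    by_cases hy : y = 0
    · exact ⟨0, fun _ h => absurd hy h⟩
    · obtain ⟨b, hb⟩ := exists_conjSec_ne_zero hy
      exact ⟨_, fun hre _ => conjugatesTo_conjSec hre hb⟩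
  choose sec hsec using hs
  have hsec' : ∀ q : Fin 4 → ℝ, quatIm q ≠ 0 → ConjugatesTo (quatIm q) (sec (quatIm q)) :=
    fun q hq => hsec _ rfl hq
  have hne : ∀ q : Fin 3 → Fin 4 → ℝ, (∀ j, quatIm (q j) ≠ 0) →
      quatCoeff (fun j => sec (quatIm (q j))) ≠ 0 := fun q hq =>
    quatCoeff_ne_zero fun j => (hsec' _ (hq j)).1
  refine ⟨fun p => R (p.1, quatCoeff fun j => sec (quatIm (p.2 j))), fun p hp => ?_,
    fun s q hq => hR1 _ _ (hne q hq), fun q hq => hR0 _ (hne q hq), fun s q σ => ?_,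
    fun s q q' hq hq' => ?_, fun s q h0 h1 h2 => ?_⟩
  · choose b hb using fun j => exists_conjSec_ne_zero (hp j)
    have hq : ∀ j, ContDiffAt ℝ 2 (fun p : ℝ × (Fin 3 → Fin 4 → ℝ) => quatIm (p.2 j)) p := fun j =>
      (quatIm.contDiff.comp ((contDiff_apply ℝ (Fin 4 → ℝ) j).comp contDiff_snd)).contDiffAt
    have hc : ∀ j, ContDiffAt ℝ 2
        (fun p : ℝ × (Fin 3 → Fin 4 → ℝ) => conjSec (b j) (quatIm (p.2 j))) p := fun j =>
      ContDiffAt.comp (g := conjSec (b j)) p (contDiffAt_conjSec (b j) (hp j)) (hq j)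
    have hT : ContDiffAt ℝ 2 (fun p : ℝ × (Fin 3 → Fin 4 → ℝ) =>
        R (p.1, quatCoeff fun j => conjSec (b j) (quatIm (p.2 j)))) p := by
      have hop : IsOpen {p : ℝ × ℍ[ℝ] × ℍ[ℝ] | p.2 ≠ 0} := isOpen_ne.preimage continuous_snd
      refine ContDiffAt.comp p (hR.contDiffAt (hop.mem_nhds ?_))
        (contDiff_fst.contDiffAt.prodMk (contDiff_quatCoeff.contDiffAt.comp p
          (contDiffAt_pi.2 hc)))
      exact quatCoeff_ne_zero hb
    refine (hT.congr_of_eventuallyEq ?_).contDiffWithinAt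
    have h1 : ∀ᶠ p' in 𝓝 p, ∀ j, conjSec (b j) (quatIm (p'.2 j)) ≠ 0 :=
      eventually_all.2 fun j => (hc j).continuousAt.eventually_ne (hb j)
    have h2 : ∀ᶠ p' in 𝓝 p, ∀ j, quatIm (p'.2 j) ≠ 0 :=
      eventually_all.2 fun j => (hq j).continuousAt.eventually_ne (hp j)
    filter_upwards [h1, h2] with p' h1 h2
    exact hinv _ (fun j => quatIm (p'.2 j)) _ _ h2 (fun j => conjugatesTo_conjSec rfl (h1 j))
      fun j => hsec' _ (h2 j)
  · exact congrArg (fun X => R (s, X)) (quatCoeff_perm (fun j => sec (quatIm (q j))) σ)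
  · refine hinv s (fun j => quatIm (q' j)) _ _ (fun j => ?_) (fun j => ?_) fun j => ?_
    · obtain ⟨c, hc, h⟩ := hq' j
      rw [h]
      exact smul_ne_zero hc.ne' (hq j)
    · obtain ⟨c, hc, h⟩ := hq' j
      rw [h]
      exact (hsec' _ (hq j)).smul hc
    · obtain ⟨c, hc, h⟩ := hq' j
      exact hsec' _ (by rw [h]; exact smul_ne_zero hc.ne' (hq j))
  · set x := sec (quatIm (q 0))
    have hx : ConjugatesTo (quatIm (q 0)) x := hsec' _ h0
    have h3 : R (s, quatCoeff fun j => sec (quatIm (q j))) = R (s, quatCoeff ![x, 1, 1]) := by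
      refine hinv s (fun j => quatIm (q j)) _ _ (fun j => ?_) (fun j => ?_) fun j => hsec' _ ?_
      · fin_cases j
        exacts [h0, h1 ▸ quatI_ne_zero, h2 ▸ quatI_ne_zero]
      · fin_cases j
        exacts [hx, h1 ▸ conjugatesTo_quatI, h2 ▸ conjugatesTo_quatI]
      · fin_cases j
        exacts [h0, h1 ▸ quatI_ne_zero, h2 ▸ quatI_ne_zero]
    have h4 : x * quatI = ‖quatIm (q 0)‖⁻¹ • (quatIm (q 0) * x) := by
      rw [hx.2, inv_smul_smul₀ (norm_ne_zero_iff.2 h0)]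
    have h5 : quatExp s = (Real.cos (2 * Real.pi * s) : ℍ[ℝ]) +
        Real.sin (2 * Real.pi * s) • quatI := by
      ext <;> simp [quatExp, quatI]
    change R (s, quatCoeff fun j => sec (quatIm (q j))) = _
    rw [h3, quatCoeff_single, hRa s x hx.1, h5, mul_add, add_mul, mul_smul_comm, h4, smul_smul,
      ← Quaternion.coe_commutes, mul_assoc, mul_inv_cancel₀ hx.1, mul_one, smul_mul_assoc,
      mul_inv_cancel_right₀ hx.1]

section degreeDecomposition

variable {E : Type*} [NormedAddCommGroup E] [NormedSpace ℝ E] [MeasurableSpace E]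
  [BorelSpace E] (μ : Measure E)

lemma degI_congr {U : Set E} (hU : IsOpen U) {Ψ : E → ℝ} {G G' : E → E} (h : EqOn G G' U) :
    degI μ U Ψ G = degI μ U Ψ G' := by
  refine setIntegral_congr_fun hU.measurableSet fun x hx => ?_
  have h1 : G =ᶠ[𝓝 x] G' := h.eventuallyEq_of_mem (hU.mem_nhds hx)
  simp only [h1.fderiv_eq, h hx]

lemma degI_eq_of_subset {U V : Set E} (hU : IsOpen U) (hVU : V ⊆ U) {Ψ : E → ℝ} {G : E → E}
    (h : ∀ x ∈ U, Ψ (G x) ≠ 0 → x ∈ V) : degI μ U Ψ G = degI μ V Ψ G := by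
  refine setIntegral_eq_of_subset_of_forall_sdiff_eq_zero hU.measurableSet hVU fun x hx => ?_
  have : Ψ (G x) = 0 := by
    by_contra h0
    exact hx.2 (h x hx.1 h0)
  rw [this, zero_mul]

variable [FiniteDimensional ℝ E] [μ.IsAddHaarMeasure]

lemma degI_integrableOn {U : Set E} (hU : IsOpen U) {G : E → E} (hG : ContDiffOn ℝ 1 G U)
    {Ψ : E → ℝ} (hΨ : Continuous Ψ) {K : Set E} (hK : IsCompact K) (hKU : K ⊆ U)
    (hsupp : ∀ x ∈ U, Ψ (G x) ≠ 0 → x ∈ K) :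
    IntegrableOn (fun x => Ψ (G x) * (fderiv ℝ G x).det) U μ := by
  have hc : ContinuousOn (fun x => Ψ (G x) * (fderiv ℝ G x).det) U :=
    (hΨ.comp_continuousOn hG.continuousOn).mul
      (ContinuousLinearMap.continuous_det.comp_continuousOn
        (hG.continuousOn_fderiv_of_isOpen hU le_rfl))
  refine ((hc.mono hKU).integrableOn_compact hK).of_forall_sdiff_eq_zero hU.measurableSet
    fun x hx => ?_
  have : Ψ (G x) = 0 := by
    by_contra h0
    exact hx.2 (hsupp x hx.1 h0)
  rw [this, zero_mul]

lemma degI_eq_sum {ι : Type*} [Fintype ι] {U : Set E} (hU : IsOpen U) {G : E → E}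
    (hG : ContDiffOn ℝ 1 G U) {Ψ : E → ℝ} (hΨ : Continuous Ψ) {K : Set E} (hK : IsCompact K)
    (hKU : K ⊆ U) (hsupp : ∀ x ∈ U, Ψ (G x) ≠ 0 → x ∈ K) {V : ι → Set E}
    (hV : ∀ i, IsOpen (V i)) (hVU : ∀ i, V i ⊆ U) (hdis : Pairwise (Function.onFun Disjoint V))
    (hcov : ∀ x ∈ U, Ψ (G x) ≠ 0 → ∃ i, x ∈ V i) :
    degI μ U Ψ G = ∑ i, degI μ (V i) Ψ G := by
  rw [degI_eq_of_subset μ hU (iUnion_subset hVU) fun x hx h => mem_iUnion.2 (hcov x hx h)]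
  exact integral_iUnion_fintype (fun i => (hV i).measurableSet) hdis fun i =>
    (degI_integrableOn μ hU hG hΨ hK hKU hsupp).mono_set (hVU i)

lemma degI_relabel {U V : Set E} (hU : IsOpen U) (hV : IsOpen V) {G : E → E}
    (hG : ContDiffOn ℝ 1 G U) (P P' : E ≃L[ℝ] E) (hP : (P : E →L[ℝ] E).det = 1)
    (hP' : (P' : E →L[ℝ] E).det = 1) (hVU : ∀ x, x ∈ V ↔ P x ∈ U)
    (hGV : ContDiffOn ℝ 1 G V)
    (hcomm : ∀ x ∈ V, G (P x) = P' (G x)) (Ψ : E → ℝ) :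
    degI μ U Ψ G = degI μ V (fun y => Ψ (P' y)) G := by
  have himg : P '' V = U := by
    ext x
    constructor
    · rintro ⟨y, hy, rfl⟩
      exact (hVU y).1 hy
    · intro hx
      exact ⟨P.symm x, (hVU _).2 (by simpa using hx), by simp⟩
  unfold degI
  rw [← himg, integral_image_eq_integral_abs_det_fderiv_smul μ (f := P) hV.measurableSet
    (fun x _ => P.hasFDerivAt.hasFDerivWithinAt) P.injective.injOn]
  refine setIntegral_congr_fun hV.measurableSet fun x hx => ?_
  have hPx := (hVU x).1 hx
  have e1 : HasFDerivAt G (fderiv ℝ G (P x)) (P x) :=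
    ((hG.contDiffAt (hU.mem_nhds hPx)).differentiableAt one_ne_zero).hasFDerivAt
  have e2 : HasFDerivAt G (fderiv ℝ G x) x :=
    ((hGV.contDiffAt (hV.mem_nhds hx)).differentiableAt one_ne_zero).hasFDerivAt
  have e3 := e1.comp x (P : E →L[ℝ] E).hasFDerivAt
  have e4 := (P' : E →L[ℝ] E).hasFDerivAt.comp x e2
  have e5 : (fun z => P' (G z)) =ᶠ[𝓝 x] G ∘ P :=
    (show EqOn _ _ V from fun z hz => (hcomm z hz).symm).eventuallyEq_of_mem (hV.mem_nhds hx)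
  have e6 := congrArg ContinuousLinearMap.det ((e4.congr_of_eventuallyEq e5.symm).unique e3)
  have e7 : ∀ A B : E →L[ℝ] E, (A.comp B).det = A.det * B.det := fun A B =>
    LinearMap.det_comp _ _
  rw [e7, e7] at e6
  rw [hP, hP', one_mul, mul_one] at e6
  rw [hP, abs_one, one_smul, ← e6, hcomm x hx]

end degreeDecomposition

/-- Three blocks of four real coordinates; the `k`-th coordinates of the blocks are permuted by
`τ k`. -/
def blockPerm (τ : Fin 4 → Equiv.Perm (Fin 3)) : (Fin 3 → Fin 4 → ℝ) ≃L[ℝ] (Fin 3 → Fin 4 → ℝ) :=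
  LinearEquiv.toContinuousLinearEquiv
    { toFun := fun q i k => q (τ k i) k
      invFun := fun q i k => q ((τ k).symm i) k
      map_add' := fun _ _ => rfl
      map_smul' := fun _ _ => rfl
      left_inv := fun q => by ext i k; simp
      right_inv := fun q => by ext i k; simp }

lemma blockPerm_apply (τ : Fin 4 → Equiv.Perm (Fin 3)) (q : Fin 3 → Fin 4 → ℝ) (i : Fin 3)
    (k : Fin 4) : blockPerm τ q i k = q (τ k i) k := rfl

lemma blockPerm_eq_conj (τ : Fin 4 → Equiv.Perm (Fin 3)) :
    ((blockPerm τ : (Fin 3 → Fin 4 → ℝ) →L[ℝ] (Fin 3 → Fin 4 → ℝ)) :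
      (Fin 3 → Fin 4 → ℝ) →ₗ[ℝ] (Fin 3 → Fin 4 → ℝ)) =
      (LinearEquiv.curry ℝ ℝ (Fin 3) (Fin 4)).conj
        (Matrix.toLin' (Equiv.Perm.permMatrix ℝ (Equiv.prodCongrLeft τ))) := by
  refine LinearMap.ext fun q => ?_
  ext i k
  rw [LinearEquiv.conj_apply_apply, Matrix.toLin'_apply, Matrix.permMatrix_mulVec]
  rfl

lemma blockPerm_det (τ : Fin 4 → Equiv.Perm (Fin 3)) :
    (blockPerm τ : (Fin 3 → Fin 4 → ℝ) →L[ℝ] (Fin 3 → Fin 4 → ℝ)).det =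
      ((∏ k, (Equiv.Perm.sign (τ k) : ℤ) : ℤ) : ℝ) := by
  rw [ContinuousLinearMap.det, blockPerm_eq_conj, LinearEquiv.conj_apply, LinearMap.comp_assoc, LinearMap.det_conj,
    LinearMap.det_toLin', Matrix.det_permutation, Equiv.Perm.sign_prodCongrLeft]
  push_cast
  rfl

lemma blockPerm_trace (τ : Fin 4 → Equiv.Perm (Fin 3)) :
    LinearMap.trace ℝ (Fin 3 → Fin 4 → ℝ)
      (blockPerm τ : (Fin 3 → Fin 4 → ℝ) →L[ℝ] (Fin 3 → Fin 4 → ℝ)) =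
      (Function.fixedPoints (Equiv.prodCongrLeft τ)).ncard := by
  rw [blockPerm_eq_conj, LinearMap.trace_conj', Matrix.trace_toLin'_eq, Matrix.trace_permutation]

/-- The permutation that leaves the zeroth coordinates fixed. -/
def tailPerm (σ : Equiv.Perm (Fin 3)) (k : Fin 4) : Equiv.Perm (Fin 3) := if k = 0 then 1 else σ

/-- The permutation that only moves the zeroth coordinates. -/
def headPerm (σ : Equiv.Perm (Fin 3)) (k : Fin 4) : Equiv.Perm (Fin 3) := if k = 0 then σ else 1

lemma tailPerm_zero (σ : Equiv.Perm (Fin 3)) : tailPerm σ 0 = 1 := rfl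
lemma headPerm_zero (σ : Equiv.Perm (Fin 3)) : headPerm σ 0 = σ := rfl
lemma tailPerm_succ (σ : Equiv.Perm (Fin 3)) (k : Fin 3) : tailPerm σ k.succ = σ := by
  simp [tailPerm]
lemma headPerm_succ (σ : Equiv.Perm (Fin 3)) (k : Fin 3) : headPerm σ k.succ = 1 := by
  simp [headPerm]

lemma ncard_fixedPoints_tailPerm :
    (Function.fixedPoints (Equiv.prodCongrLeft (tailPerm (finRotate 3)))).ncard = 3 := by
  have : Function.fixedPoints (Equiv.prodCongrLeft (tailPerm (finRotate 3))) =
      ((Finset.univ.filter fun x => Equiv.prodCongrLeft (tailPerm (finRotate 3)) x = x :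
        Finset (Fin 3 × Fin 4)) : Set (Fin 3 × Fin 4)) := by
    ext x; simp [Function.fixedPoints, Function.IsFixedPt]
  rw [this, ncard_coe_finset]
  decide

lemma ncard_fixedPoints_headPerm :
    (Function.fixedPoints (Equiv.prodCongrLeft (headPerm (finRotate 3)))).ncard = 9 := by
  have : Function.fixedPoints (Equiv.prodCongrLeft (headPerm (finRotate 3))) =
      ((Finset.univ.filter fun x => Equiv.prodCongrLeft (headPerm (finRotate 3)) x = x :
        Finset (Fin 3 × Fin 4)) : Set (Fin 3 × Fin 4)) := by
    ext x; simp [Function.fixedPoints, Function.IsFixedPt]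
  rw [this, ncard_coe_finset]
  decide

lemma degI_move {E : Type*} [NormedAddCommGroup E] [NormedSpace ℝ E] [MeasurableSpace E]
    [BorelSpace E] [FiniteDimensional ℝ E] (μ : Measure E) [μ.IsAddHaarMeasure] {U : Set E}
    (hU : IsOpen U) {G : E → E} (hG : ContDiffOn ℝ 2 G U) {K S : Set E} (hK : IsCompact K)
    (hKU : K ⊆ U) (hy : ∀ x ∈ U, G x ∈ S → x ∈ K) {Ψ : E → ℝ} (hΨ : ContDiff ℝ 1 Ψ)
    {z : ℝ → E} (hz : ContDiff ℝ 2 z) (hsupp : ∀ t ∈ Icc (0 : ℝ) 1, ∀ y, Ψ (y - z t) ≠ 0 → y ∈ S) :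
    degI μ U (fun y => Ψ (y - z 0)) G = degI μ U (fun y => Ψ (y - z 1)) G := by
  have h := degI_homotopy μ (W := univ ×ˢ U) (isOpen_univ.prod hU)
    (G := fun p => G p.2 - z p.1) ?_ hΨ (K := Icc 0 1 ×ˢ K)
    (isCompact_Icc.prod hK) (prod_mono (subset_univ _) hKU) ?_
  · have e : ∀ c : E, degI μ U Ψ (fun x => G x - c) = degI μ U (fun y => Ψ (y - c)) G := by
      intro c
      simp only [degI, fderiv_sub_const]
    simpa [e] using h
  · exact ContDiffOn.sub (hG.comp contDiff_snd.contDiffOn fun p hp => hp.2)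
      (hz.comp contDiff_fst).contDiffOn
  · rintro ⟨t, x⟩ hp ht hne
    exact ⟨ht, hy x hp.2 (hsupp t ht _ hne)⟩

/-- A loop of unit quaternions depending symmetrically on three directions in space, which for two
directions equal to `i` is the circle through the third one. -/
structure SymFamily (R : ℝ × (Fin 3 → Fin 4 → ℝ) → ℍ[ℝ]) : Prop where
  contDiffOn : ContDiffOn ℝ 2 R {p | ∀ j, quatIm (p.2 j) ≠ 0}
  norm_eq : ∀ s q, (∀ j, quatIm (q j) ≠ 0) → ‖R (s, q)‖ = 1
  loop : ∀ q, (∀ j, quatIm (q j) ≠ 0) → R (0, q) = 1 ∧ R (1, q) = 1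
  symm : ∀ s q, ∀ σ : Equiv.Perm (Fin 3), R (s, fun j => q (σ j)) = R (s, q)
  homog : ∀ s q q', (∀ j, quatIm (q j) ≠ 0) →
    (∀ j, ∃ c : ℝ, 0 < c ∧ quatIm (q' j) = c • quatIm (q j)) → R (s, q') = R (s, q)
  circle : ∀ s q, quatIm (q 0) ≠ 0 → quatIm (q 1) = quatI → quatIm (q 2) = quatI →
    R (s, q) = (Real.cos (2 * Real.pi * s) : ℍ[ℝ]) +
      (Real.sin (2 * Real.pi * s) * ‖quatIm (q 0)‖⁻¹) • quatIm (q 0)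

/-- The vector whose zeroth coordinate is `r` and whose last coordinates are those of the imaginary
part of `x`. -/
def quatVec (r : ℝ) (x : ℍ[ℝ]) : Fin 4 → ℝ := ![r, x.imI, x.imJ, x.imK]

@[simp] lemma quatVec_zero (r : ℝ) (x : ℍ[ℝ]) : quatVec r x 0 = r := rfl
@[simp] lemma quatVec_one (r : ℝ) (x : ℍ[ℝ]) : quatVec r x 1 = x.imI := rfl
@[simp] lemma quatVec_two (r : ℝ) (x : ℍ[ℝ]) : quatVec r x 2 = x.imJ := rfl
@[simp] lemma quatVec_three (r : ℝ) (x : ℍ[ℝ]) : quatVec r x 3 = x.imK := rfl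

lemma norm_sq_quatIm (q : Fin 4 → ℝ) : ‖quatIm q‖ ^ 2 = q 1 ^ 2 + q 2 ^ 2 + q 3 ^ 2 := by
  rw [norm_sq_quaternion, quatIm_apply]; simp

lemma ContDiffOn.quatVec {X : Type*} [NormedAddCommGroup X] [NormedSpace ℝ X] {n : WithTop ℕ∞}
    {r : X → ℝ} {x : X → ℍ[ℝ]} {S : Set X} (hr : ContDiffOn ℝ n r S) (hx : ContDiffOn ℝ n x S) :
    ContDiffOn ℝ n (fun p => quatVec (r p) (x p)) S := by
  have h := ContDiff.quaternion_coord (n := n) (contDiff_id (𝕜 := ℝ) (E := ℍ[ℝ]))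
  refine contDiffOn_pi.2 fun k => ?_
  fin_cases k
  · exact hr
  · exact (h 1).comp_contDiffOn hx
  · exact (h 2).comp_contDiffOn hx
  · exact (h 3).comp_contDiffOn hx

/-- Configurations whose three spatial vectors are all nonzero. -/
def nzConf : Set (Fin 3 → Fin 4 → ℝ) := {q | ∀ j, quatIm (q j) ≠ 0}

lemma isOpen_nzConf : IsOpen nzConf := by
  simp only [nzConf, ofPred_forall]
  exact isOpen_iInter_of_finite fun j =>
    isOpen_ne.preimage (quatIm.continuous.comp (continuous_apply j))

/-- The map recording, for each slot `i`, the size of the `i`-th vector and the imaginary part of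
the loop at the `i`-th parameter. -/
def slotMap (R : ℝ × (Fin 3 → Fin 4 → ℝ) → ℍ[ℝ])
    (M : ℝ × (Fin 3 → Fin 4 → ℝ) → Fin 3 → Fin 3 → Fin 4 → ℝ) (p : ℝ × (Fin 3 → Fin 4 → ℝ)) :
    Fin 3 → Fin 4 → ℝ :=
  fun i => quatVec (‖quatIm (p.2 i)‖ ^ 2) (R (p.2 i 0, M p i))

/-- The domain of `slotMap` on which the loops have negative real part. -/
def slotDom (R : ℝ × (Fin 3 → Fin 4 → ℝ) → ℍ[ℝ])
    (M : ℝ × (Fin 3 → Fin 4 → ℝ) → Fin 3 → Fin 3 → Fin 4 → ℝ) :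
    Set (ℝ × (Fin 3 → Fin 4 → ℝ)) :=
  {p | p.2 ∈ nzConf ∧ (∀ i, p.2 i 0 ∈ Ioo 0 1) ∧ (∀ i, M p i ∈ nzConf) ∧
    ∀ i, (R (p.2 i 0, M p i)).re < 0}

section slots

variable {R : ℝ × (Fin 3 → Fin 4 → ℝ) → ℍ[ℝ]}
  {M : ℝ × (Fin 3 → Fin 4 → ℝ) → Fin 3 → Fin 3 → Fin 4 → ℝ}

lemma SymFamily.contDiffOn_slot (hR : SymFamily R) (hM : ContDiffOn ℝ 2 M {p | p.2 ∈ nzConf})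
    (i : Fin 3) : ContDiffOn ℝ 2 (fun p => R (p.2 i 0, M p i))
      {p | p.2 ∈ nzConf ∧ ∀ i, M p i ∈ nzConf} := by
  refine hR.contDiffOn.comp (s := {p : ℝ × (Fin 3 → Fin 4 → ℝ) | p.2 ∈ nzConf ∧ ∀ i, M p i ∈ nzConf})
    (f := fun p => (p.2 i 0, M p i)) (ContDiffOn.prodMk ?_ ?_) fun p hp => hp.2 i
  · fun_prop
  · exact (contDiffOn_pi.1 hM i).mono fun p hp => hp.1

lemma isOpen_nz (hM : ContDiffOn ℝ 2 M {p | p.2 ∈ nzConf}) :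
    IsOpen {p | p.2 ∈ nzConf ∧ ∀ i, M p i ∈ nzConf} := by
  have h1 : IsOpen {p : ℝ × (Fin 3 → Fin 4 → ℝ) | p.2 ∈ nzConf} :=
    isOpen_nzConf.preimage continuous_snd
  have h2 : IsOpen {m : Fin 3 → Fin 3 → Fin 4 → ℝ | ∀ i, m i ∈ nzConf} := by
    simp only [ofPred_forall]
    exact isOpen_iInter_of_finite fun j => isOpen_nzConf.preimage (continuous_apply j)
  exact hM.continuousOn.isOpen_inter_preimage h1 h2

lemma SymFamily.isOpen_slotDom (hR : SymFamily R) (hM : ContDiffOn ℝ 2 M {p | p.2 ∈ nzConf}) :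
    IsOpen (slotDom R M) := by
  have h1 := (continuousOn_pi.2 fun i =>
    (hR.contDiffOn_slot hM i).continuousOn).isOpen_inter_preimage (isOpen_nz hM)
    (t := {m : Fin 3 → ℍ[ℝ] | ∀ i, (m i).re < 0}) (by
      simp only [ofPred_forall]
      exact isOpen_iInter_of_finite fun j => isOpen_Iio.preimage
        (Quaternion.continuous_re.comp (continuous_apply j)))
  have h2 : IsOpen {p : ℝ × (Fin 3 → Fin 4 → ℝ) | ∀ i, p.2 i 0 ∈ Ioo (0 : ℝ) 1} := by
    simp only [ofPred_forall]
    exact isOpen_iInter_of_finite fun j => isOpen_Ioo.preimage (by fun_prop)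
  refine (congrArg IsOpen (?_ : slotDom R M = _)).mpr (h1.inter h2)
  ext p
  exact ⟨fun h => ⟨⟨⟨h.1, h.2.2.1⟩, h.2.2.2⟩, h.2.1⟩, fun h => ⟨h.1.1.1, h.2, h.1.1.2, h.1.2⟩⟩

lemma SymFamily.contDiffOn_slotMap (hR : SymFamily R)
    (hM : ContDiffOn ℝ 2 M {p | p.2 ∈ nzConf}) :
    ContDiffOn ℝ 2 (slotMap R M) {p | p.2 ∈ nzConf ∧ ∀ i, M p i ∈ nzConf} := by
  refine contDiffOn_pi.2 fun i => ContDiffOn.quatVec (ContDiff.contDiffOn ?_)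
    (hR.contDiffOn_slot hM i)
  exact (quatIm.contDiff.comp ((contDiff_apply ℝ (Fin 4 → ℝ) i).comp contDiff_snd)).norm_sq ℝ

/-- The part of the domain that is mapped to `S`. -/
def slotPre (R : ℝ × (Fin 3 → Fin 4 → ℝ) → ℍ[ℝ])
    (M : ℝ × (Fin 3 → Fin 4 → ℝ) → Fin 3 → Fin 3 → Fin 4 → ℝ) (S : Set (Fin 3 → Fin 4 → ℝ)) :
    Set (ℝ × (Fin 3 → Fin 4 → ℝ)) :=
  {p | p.1 ∈ Icc 0 1 ∧ p.2 ∈ nzConf ∧ (∀ i, p.2 i 0 ∈ Icc 0 1) ∧ slotMap R M p ∈ S ∧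
    ∀ i, (R (p.2 i 0, M p i)).re ≤ 0}

lemma SymFamily.isCompact_slotPre (hR : SymFamily R)
    (hM : ContDiffOn ℝ 2 M {p | p.2 ∈ nzConf})
    (hM0 : ∀ p, p.1 ∈ Icc (0 : ℝ) 1 → p.2 ∈ nzConf → ∀ i, M p i ∈ nzConf)
    {S : Set (Fin 3 → Fin 4 → ℝ)} (hS : IsCompact S) (hS0 : ∀ z ∈ S, ∀ i, 0 < z i 0) :
    IsCompact (slotPre R M S) := by
  have hc : ∀ i : Fin 3, Continuous fun z : Fin 3 → Fin 4 → ℝ => z i 0 := fun i => by fun_prop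
  choose m hm hmS using fun i => hS.exists_forall_le' (hc i).continuousOn (a := 0)
    fun z hz => hS0 z hz i
  choose B hB using fun i => (hS.image (hc i)).bddAbove
  set Q : Set (ℝ × (Fin 3 → Fin 4 → ℝ)) := {p | p.1 ∈ Icc 0 1 ∧ (∀ i, p.2 i 0 ∈ Icc 0 1) ∧
    ∀ i, ‖quatIm (p.2 i)‖ ^ 2 ∈ Icc (m i) (B i)}
  have hQcl : IsClosed Q := by
    have e : ∀ i : Fin 3, Continuous fun p : ℝ × (Fin 3 → Fin 4 → ℝ) => ‖quatIm (p.2 i)‖ ^ 2 :=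
      fun i => ((quatIm.continuous.comp ((continuous_apply i).comp continuous_snd)).norm).pow 2
    simp only [Q, ofPred_and, ofPred_forall]
    exact (isClosed_Icc.preimage continuous_fst).inter
      ((isClosed_iInter fun i => isClosed_Icc.preimage (by fun_prop)).inter
        (isClosed_iInter fun i => isClosed_Icc.preimage (e i)))
  have hQb : Bornology.IsBounded Q := by
    refine (Metric.isBounded_closedBall (x := 0) (r := 1 + ∑ i, |B i|)).subset fun p hp => ?_
    have hs : ∀ i, |B i| ≤ ∑ i, |B i| := fun i =>
      Finset.single_le_sum (f := fun i => |B i|) (fun i _ => abs_nonneg _) (Finset.mem_univ i)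
    have h0 : 0 ≤ ∑ i, |B i| := (abs_nonneg _).trans (hs 0)
    rw [mem_closedBall_zero_iff, Prod.norm_def, max_le_iff, Real.norm_eq_abs]
    refine ⟨by rw [abs_of_nonneg hp.1.1]; linarith [hp.1.2], ?_⟩
    refine (pi_norm_le_iff_of_nonneg (by linarith)).2 fun i =>
      (pi_norm_le_iff_of_nonneg (by linarith)).2 fun k => ?_
    have h1 := (hp.2.2 i).2
    rw [norm_sq_quatIm] at h1
    have h2 := hs i
    have h3 := le_abs_self (B i)
    rw [Real.norm_eq_abs]
    refine abs_le_of_sq_le_sq ?_ (by linarith)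
    fin_cases k
    · have h4 := (hp.2.1 i)
      simp only [Fin.zero_eta]
      nlinarith [h4.1, h4.2]
    all_goals
      simp only [Fin.mk_one, Fin.reduceFinMk]
      nlinarith [sq_nonneg (p.2 i 1), sq_nonneg (p.2 i 2), sq_nonneg (p.2 i 3)]
  have hQ0 : ∀ p ∈ Q, p.2 ∈ nzConf := fun p hp i h0 => by
    have := (hp.2.2 i).1
    rw [h0, norm_zero] at this
    have := hm i
    norm_num at *
    linarith
  have hsub : Q ⊆ {p | p.2 ∈ nzConf ∧ ∀ i, M p i ∈ nzConf} := fun p hp =>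
    ⟨hQ0 p hp, hM0 p hp.1 (hQ0 p hp)⟩
  have hcont : ContinuousOn (fun p => (slotMap R M p, fun i => R (p.2 i 0, M p i))) Q :=
    ((hR.contDiffOn_slotMap hM).continuousOn.mono hsub).prodMk
      (continuousOn_pi.2 fun i => (hR.contDiffOn_slot hM i).continuousOn.mono hsub)
  have hcl := hcont.preimage_isClosed_of_isClosed hQcl
    (hS.isClosed.prod (s₂ := {m : Fin 3 → ℍ[ℝ] | ∀ i, (m i).re ≤ 0}) (by
      simp only [ofPred_forall]
      exact isClosed_iInter fun j => isClosed_Iic.preimage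
        (Quaternion.continuous_re.comp (continuous_apply j))))
  refine (congrArg IsCompact (?_ : slotPre R M S = _)).mpr
    ((Metric.isCompact_of_isClosed_isBounded hQcl hQb).inter_left hcl)
  ext p
  constructor
  · rintro ⟨h1, h2, h3, h4, h5⟩
    have hp : p ∈ Q := ⟨h1, h3, fun i => ⟨hmS i _ h4, hB i (mem_image_of_mem _ h4)⟩⟩
    exact ⟨⟨hp, h4, h5⟩, hp⟩
  · rintro ⟨⟨hp, h4, h5⟩, -⟩
    exact ⟨hp.1, hQ0 p hp, hp.2.1, h4, h5⟩

lemma SymFamily.slotPre_subset (hR : SymFamily R)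
    (hM0 : ∀ p, p.1 ∈ Icc (0 : ℝ) 1 → p.2 ∈ nzConf → ∀ i, M p i ∈ nzConf)
    {S : Set (Fin 3 → Fin 4 → ℝ)} (hS1 : ∀ z ∈ S, ∀ i, ‖quatIm (z i)‖ < 1) :
    slotPre R M S ⊆ slotDom R M := by
  rintro p ⟨h1, h2, h3, h4, h5⟩
  have hn := hM0 p h1 h2
  refine ⟨h2, fun i => ⟨(h3 i).1.lt_of_ne fun h => ?_, (h3 i).2.lt_of_ne fun h => ?_⟩, hn,
    fun i => (h5 i).lt_of_ne fun h => ?_⟩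
  · have := h5 i
    rw [← h, (hR.loop _ (hn i)).1] at this
    norm_num at this
  · have := h5 i
    rw [h, (hR.loop _ (hn i)).2] at this
    norm_num at this
  · have e1 := hR.norm_eq (p.2 i 0) _ (hn i)
    have e2 := norm_sq_quaternion (R (p.2 i 0, M p i))
    have e3 := norm_sq_quatIm (slotMap R M p i)
    have e4 := hS1 _ h4 i
    simp only [slotMap, quatVec_one, quatVec_two, quatVec_three] at e3 e4
    rw [e1, h] at e2
    nlinarith [norm_nonneg (quatIm (quatVec (‖quatIm (p.2 i)‖ ^ 2) (R (p.2 i 0, M p i))))]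

end slots

section configurations

variable {R : ℝ × (Fin 3 → Fin 4 → ℝ) → ℍ[ℝ]} {N : (Fin 3 → Fin 4 → ℝ) → Fin 3 → Fin 3 → Fin 4 → ℝ}

/-- The version of `slotMap` without a homotopy parameter. -/
def cfgMap (R : ℝ × (Fin 3 → Fin 4 → ℝ) → ℍ[ℝ])
    (N : (Fin 3 → Fin 4 → ℝ) → Fin 3 → Fin 3 → Fin 4 → ℝ) (q : Fin 3 → Fin 4 → ℝ) :
    Fin 3 → Fin 4 → ℝ :=
  fun i => quatVec (‖quatIm (q i)‖ ^ 2) (R (q i 0, N q i))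

/-- The version of `slotDom` without a homotopy parameter. -/
def cfgDom (R : ℝ × (Fin 3 → Fin 4 → ℝ) → ℍ[ℝ])
    (N : (Fin 3 → Fin 4 → ℝ) → Fin 3 → Fin 3 → Fin 4 → ℝ) : Set (Fin 3 → Fin 4 → ℝ) :=
  {q | q ∈ nzConf ∧ (∀ i, q i 0 ∈ Ioo 0 1) ∧ (∀ i, N q i ∈ nzConf) ∧
    ∀ i, (R (q i 0, N q i)).re < 0}

lemma SymFamily.isOpen_cfgDom (hR : SymFamily R) (hN : ContDiffOn ℝ 2 N nzConf) :
    IsOpen (cfgDom R N) :=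
  (hR.isOpen_slotDom (M := fun p => N p.2)
    (hN.comp contDiff_snd.contDiffOn fun _ hp => hp)).preimage (Continuous.prodMk_right (0 : ℝ))

lemma SymFamily.contDiffOn_cfgMap (hR : SymFamily R) (hN : ContDiffOn ℝ 2 N nzConf) :
    ContDiffOn ℝ 2 (cfgMap R N) (cfgDom R N) :=
  (hR.contDiffOn_slotMap (M := fun p => N p.2)
    (hN.comp contDiff_snd.contDiffOn fun _ hp => hp)).comp (s := cfgDom R N)
    (f := fun q => ((0 : ℝ), q)) (by fun_prop) fun _ hq => ⟨hq.1, hq.2.2.1⟩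

lemma SymFamily.exists_isCompact (hR : SymFamily R) (hN : ContDiffOn ℝ 2 N nzConf)
    (hN0 : ∀ q ∈ nzConf, ∀ i, N q i ∈ nzConf) {S : Set (Fin 3 → Fin 4 → ℝ)} (hS : IsCompact S)
    (hS0 : ∀ z ∈ S, ∀ i, 0 < z i 0) (hS1 : ∀ z ∈ S, ∀ i, ‖quatIm (z i)‖ < 1) :
    ∃ K ⊆ cfgDom R N, IsCompact K ∧ ∀ q ∈ cfgDom R N, cfgMap R N q ∈ S → q ∈ K := by
  have hM : ContDiffOn ℝ 2 (fun p : ℝ × (Fin 3 → Fin 4 → ℝ) => N p.2) {p | p.2 ∈ nzConf} :=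
    hN.comp contDiff_snd.contDiffOn fun _ hp => hp
  refine ⟨Prod.snd '' slotPre R (fun p => N p.2) S, ?_,
    (hR.isCompact_slotPre hM (fun p _ hp => hN0 _ hp) hS hS0).image continuous_snd, ?_⟩
  · rintro _ ⟨p, hp, rfl⟩
    exact hR.slotPre_subset (fun p _ hp => hN0 _ hp) hS1 hp
  · intro q hq h
    exact ⟨(0, q), ⟨by simp, hq.1, fun i => Ioo_subset_Icc_self (hq.2.1 i), h,
      fun i => (hq.2.2.2 i).le⟩, rfl⟩

lemma SymFamily.degI_cfg (hR : SymFamily R)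
    {M : ℝ × (Fin 3 → Fin 4 → ℝ) → Fin 3 → Fin 3 → Fin 4 → ℝ}
    (hM : ContDiffOn ℝ 2 M {p | p.2 ∈ nzConf})
    (hM0 : ∀ p, p.1 ∈ Icc (0 : ℝ) 1 → p.2 ∈ nzConf → ∀ i, M p i ∈ nzConf)
    {S : Set (Fin 3 → Fin 4 → ℝ)} (hS : IsCompact S) (hS0 : ∀ z ∈ S, ∀ i, 0 < z i 0)
    (hS1 : ∀ z ∈ S, ∀ i, ‖quatIm (z i)‖ < 1) {Ψ : (Fin 3 → Fin 4 → ℝ) → ℝ}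
    (hΨ : ContDiff ℝ 1 Ψ) (hΨS : ∀ z, Ψ z ≠ 0 → z ∈ S) :
    degI volume (cfgDom R fun q => M (0, q)) Ψ (cfgMap R fun q => M (0, q)) =
      degI volume (cfgDom R fun q => M (1, q)) Ψ (cfgMap R fun q => M (1, q)) :=
  degI_homotopy volume (hR.isOpen_slotDom hM)
    ((hR.contDiffOn_slotMap hM).mono fun _ hp => ⟨hp.1, hp.2.2.1⟩) hΨ
    (hR.isCompact_slotPre hM hM0 hS hS0) (hR.slotPre_subset hM0 hS1) fun _ hp ht h =>
      ⟨ht, hp.1, fun i => Ioo_subset_Icc_self (hp.2.1 i), hΨS _ h, fun i => (hp.2.2.2 i).le⟩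

/-- The slot `i` sees all three vectors transformed by `f i`. -/
def allSlot (f : Fin 3 → (Fin 4 → ℝ) → Fin 4 → ℝ) (q : Fin 3 → Fin 4 → ℝ) :
    Fin 3 → Fin 3 → Fin 4 → ℝ :=
  fun i j => f i (q j)

/-- The slot `i` only sees the vector `σ i`, transformed by `f i`. -/
def oneSlot (σ : Equiv.Perm (Fin 3)) (f : Fin 3 → (Fin 4 → ℝ) → Fin 4 → ℝ)
    (q : Fin 3 → Fin 4 → ℝ) : Fin 3 → Fin 3 → Fin 4 → ℝ :=
  fun i j => if j = 0 then f i (q (σ i)) else Pi.single 1 1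

lemma quatIm_single : quatIm (Pi.single 1 1) = quatI := by
  ext <;> simp [quatIm_apply, quatI]

variable {Φ : Fin 3 → ℝ × (Fin 4 → ℝ) → Fin 4 → ℝ}

lemma contDiffOn_slot_arg (hΦ : ∀ i, ContDiffOn ℝ 2 (Φ i) {p | quatIm p.2 ≠ 0}) (i j : Fin 3) :
    ContDiffOn ℝ 2 (fun p : ℝ × (Fin 3 → Fin 4 → ℝ) => Φ i (p.1, p.2 j)) {p | p.2 ∈ nzConf} :=
  (hΦ i).comp (f := fun p : ℝ × (Fin 3 → Fin 4 → ℝ) => (p.1, p.2 j)) (by fun_prop)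
    fun p hp => hp j

lemma SymFamily.degI_allSlot (hR : SymFamily R)
    (hΦ : ∀ i, ContDiffOn ℝ 2 (Φ i) {p | quatIm p.2 ≠ 0})
    (hΦ0 : ∀ i, ∀ t ∈ Icc (0 : ℝ) 1, ∀ y, quatIm y ≠ 0 → quatIm (Φ i (t, y)) ≠ 0)
    {S : Set (Fin 3 → Fin 4 → ℝ)} (hS : IsCompact S) (hS0 : ∀ z ∈ S, ∀ i, 0 < z i 0)
    (hS1 : ∀ z ∈ S, ∀ i, ‖quatIm (z i)‖ < 1) {Ψ : (Fin 3 → Fin 4 → ℝ) → ℝ}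
    (hΨ : ContDiff ℝ 1 Ψ) (hΨS : ∀ z, Ψ z ≠ 0 → z ∈ S) :
    degI volume (cfgDom R (allSlot fun i y => Φ i (0, y))) Ψ
      (cfgMap R (allSlot fun i y => Φ i (0, y))) =
      degI volume (cfgDom R (allSlot fun i y => Φ i (1, y))) Ψ
        (cfgMap R (allSlot fun i y => Φ i (1, y))) :=
  hR.degI_cfg (M := fun p => allSlot (fun i y => Φ i (p.1, y)) p.2)
    (contDiffOn_pi.2 fun i => contDiffOn_pi.2 fun j => contDiffOn_slot_arg hΦ i j)
    (fun p ht hp i j => hΦ0 i _ ht _ (hp j)) hS hS0 hS1 hΨ hΨS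

lemma SymFamily.degI_oneSlot (hR : SymFamily R) (σ : Equiv.Perm (Fin 3))
    (hΦ : ∀ i, ContDiffOn ℝ 2 (Φ i) {p | quatIm p.2 ≠ 0})
    (hΦ0 : ∀ i, ∀ t ∈ Icc (0 : ℝ) 1, ∀ y, quatIm y ≠ 0 → quatIm (Φ i (t, y)) ≠ 0)
    {S : Set (Fin 3 → Fin 4 → ℝ)} (hS : IsCompact S) (hS0 : ∀ z ∈ S, ∀ i, 0 < z i 0)
    (hS1 : ∀ z ∈ S, ∀ i, ‖quatIm (z i)‖ < 1) {Ψ : (Fin 3 → Fin 4 → ℝ) → ℝ}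
    (hΨ : ContDiff ℝ 1 Ψ) (hΨS : ∀ z, Ψ z ≠ 0 → z ∈ S) :
    degI volume (cfgDom R (oneSlot σ fun i y => Φ i (0, y))) Ψ
      (cfgMap R (oneSlot σ fun i y => Φ i (0, y))) =
      degI volume (cfgDom R (oneSlot σ fun i y => Φ i (1, y))) Ψ
        (cfgMap R (oneSlot σ fun i y => Φ i (1, y))) := by
  refine hR.degI_cfg (M := fun p => oneSlot σ (fun i y => Φ i (p.1, y)) p.2)
    (contDiffOn_pi.2 fun i => contDiffOn_pi.2 fun j => ?_) (fun p ht hp i j => ?_)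
    hS hS0 hS1 hΨ hΨS
  · by_cases hj : j = 0
    · simpa only [oneSlot, hj, if_true] using contDiffOn_slot_arg hΦ i (σ i)
    · simpa only [oneSlot, hj, if_false] using contDiffOn_const
  · by_cases hj : j = 0
    · simpa only [oneSlot, hj, if_true] using hΦ0 i _ ht _ (hp (σ i))
    · simpa only [oneSlot, hj, if_false, quatIm_single] using quatI_ne_zero

end configurations

/-- Cyclic rotation of the last three coordinates. -/
def rotCoord (i : Fin 3) (y : Fin 4 → ℝ) : Fin 4 → ℝ :=
  ![y 0, y i.succ, y (i + 1).succ, y (i + 2).succ]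

lemma contDiff_rotCoord (i : Fin 3) {n : WithTop ℕ∞} : ContDiff ℝ n (rotCoord i) := by
  refine contDiff_pi.2 fun k => ?_
  fin_cases k <;> exact contDiff_apply ℝ ℝ _

lemma norm_quatIm_rotCoord (i : Fin 3) (y : Fin 4 → ℝ) : ‖quatIm (rotCoord i y)‖ = ‖quatIm y‖ := by
  refine (pow_left_inj₀ (norm_nonneg _) (norm_nonneg _) two_ne_zero).1 ?_
  rw [norm_sq_quatIm, norm_sq_quatIm]
  fin_cases i <;> simp [rotCoord] <;> ring

/-- The straight path from the identity to a cyclic rotation. -/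
def rotPath (i : Fin 3) (p : ℝ × (Fin 4 → ℝ)) : Fin 4 → ℝ := (1 - p.1) • p.2 + p.1 • rotCoord i p.2

lemma contDiff_rotPath (i : Fin 3) : ContDiff ℝ 2 (rotPath i) := by
  have := (contDiff_rotCoord i (n := 2)).comp (contDiff_snd (E := ℝ))
  unfold rotPath
  fun_prop

lemma quatIm_rotPath_ne_zero (i : Fin 3) (t : ℝ) {y : Fin 4 → ℝ} (hy : quatIm y ≠ 0) :
    quatIm (rotPath i (t, y)) ≠ 0 := by
  intro h
  have h0 := norm_sq_quatIm (rotPath i (t, y))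
  rw [h, norm_zero] at h0
  have key : ∀ a b c : ℝ, 0 = ((1 - t) * a + t * b) ^ 2 + ((1 - t) * b + t * c) ^ 2 +
      ((1 - t) * c + t * a) ^ 2 → a ^ 2 + b ^ 2 + c ^ 2 = 0 := by
    intro a b c h
    have e : 0 = (1 - 3 * t + 3 * t ^ 2) * (a ^ 2 + b ^ 2 + c ^ 2) + t * (1 - t) * (a + b + c) ^ 2
      := by rw [h]; ring
    have h1 : (1 - t) * a + t * b = 0 := by nlinarith
    have h2 : (1 - t) * b + t * c = 0 := by nlinarith
    have h3 : (1 - t) * c + t * a = 0 := by nlinarith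
    have h4 : a + b + c = 0 := by linarith
    rw [h4] at e
    have h5 : 0 < 1 - 3 * t + 3 * t ^ 2 := by nlinarith [sq_nonneg (t - 1 / 2)]
    exact (mul_eq_zero.1 (by linarith : (1 - 3 * t + 3 * t ^ 2) * (a ^ 2 + b ^ 2 + c ^ 2) = 0)
      ).resolve_left h5.ne'
  have h1 : y 1 ^ 2 + y 2 ^ 2 + y 3 ^ 2 = 0 := by
    fin_cases i
    · have := norm_sq_quatIm y
      have e : rotPath 0 (t, y) 1 = y 1 ∧ rotPath 0 (t, y) 2 = y 2 ∧ rotPath 0 (t, y) 3 = y 3 := by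
        refine ⟨?_, ?_, ?_⟩ <;> simp [rotPath, rotCoord] <;> ring
      simp only [Fin.zero_eta, e.1, e.2.1, e.2.2] at h0
      linarith
    · have := key (y 1) (y 2) (y 3) (by simpa [rotPath, rotCoord] using h0)
      linarith
    · have := key (y 1) (y 3) (y 2) (by
        simp [rotPath, rotCoord] at h0
        linarith)
      linarith
  rw [← norm_sq_quatIm] at h1
  exact hy (norm_eq_zero.1 (pow_eq_zero_iff two_ne_zero |>.1 h1))

/-- A cutoff equal to one at the direction `-i` and vanishing outside a cap around it. -/
def capCutoff (y : Fin 4 → ℝ) : ℝ := Real.smoothTransition (4 * (-(y 1) / ‖quatIm y‖ - 3 / 4))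

/-- A map that expands a cap around `-i` over all directions, everything else being sent to `i`. -/
def capMap (y : Fin 4 → ℝ) : Fin 4 → ℝ :=
  capCutoff y • y + ((1 - capCutoff y) * ‖quatIm y‖) • Pi.single 1 1

lemma contDiffOn_capMap : ContDiffOn ℝ 2 capMap {y | quatIm y ≠ 0} := by
  have h1 : ContDiffOn ℝ 2 (fun y : Fin 4 → ℝ => ‖quatIm y‖) {y | quatIm y ≠ 0} :=
    quatIm.contDiff.contDiffOn.norm ℝ fun _ h => h
  have h2 : ContDiffOn ℝ 2 capCutoff {y | quatIm y ≠ 0} := by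
    refine Real.smoothTransition.contDiff.comp_contDiffOn (contDiffOn_const.mul
      (ContDiffOn.sub (ContDiffOn.div (ContDiff.contDiffOn ?_) h1 fun y hy =>
        norm_ne_zero_iff.2 hy) contDiffOn_const))
    exact (contDiff_apply ℝ ℝ (1 : Fin 4)).neg
  exact (h2.smul contDiffOn_id).add (((contDiffOn_const.sub h2).mul h1).smul contDiffOn_const)

lemma capCutoff_mem (y : Fin 4 → ℝ) : capCutoff y ∈ Icc (0 : ℝ) 1 :=
  ⟨Real.smoothTransition.nonneg _, Real.smoothTransition.le_one _⟩

lemma quatIm_capMap_of_cutoff {y : Fin 4 → ℝ} (h : capCutoff y = 0) :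
    quatIm (capMap y) = ‖quatIm y‖ • quatI := by
  rw [capMap, h]
  simp [quatIm_single]

lemma capCutoff_ne_zero {y : Fin 4 → ℝ} (hy : quatIm y ≠ 0) (h : capCutoff y ≠ 0) :
    3 / 4 * ‖quatIm y‖ < -(y 1) := by
  by_contra! h1
  refine h (Real.smoothTransition.zero_of_nonpos ?_)
  have : -(y 1) / ‖quatIm y‖ ≤ 3 / 4 := (div_le_iff₀ (norm_pos_iff.2 hy)).2 h1
  linarith

lemma quatIm_capPath_ne_zero {t : ℝ} (ht : t ∈ Icc (0 : ℝ) 1) {y : Fin 4 → ℝ} (hy : quatIm y ≠ 0) :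
    quatIm ((1 - t) • y + t • capMap y) ≠ 0 := by
  intro h
  have hn := norm_pos_iff.2 hy
  have hχ := capCutoff_mem y
  set α := 1 - t + t * capCutoff y with hα
  have h0 := norm_sq_quatIm ((1 - t) • y + t • capMap y)
  have e1 : ((1 - t) • y + t • capMap y) 1 = α * y 1 + t * (1 - capCutoff y) * ‖quatIm y‖ := by
    simp [capMap, hα]; ring
  have e2 : ((1 - t) • y + t • capMap y) 2 = α * y 2 := by simp [capMap, hα]; ring
  have e3 : ((1 - t) • y + t • capMap y) 3 = α * y 3 := by simp [capMap, hα]; ring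
  rw [h, norm_zero, e1, e2, e3] at h0
  have f1 : α * y 1 + t * (1 - capCutoff y) * ‖quatIm y‖ = 0 := by nlinarith
  have f2 : α * y 2 = 0 := by nlinarith
  have f3 : α * y 3 = 0 := by nlinarith
  have hα0 : 0 ≤ α := by nlinarith [ht.1, ht.2, hχ.1, hχ.2]
  have hβ : 0 ≤ t * (1 - capCutoff y) := mul_nonneg ht.1 (by linarith [hχ.2])
  rcases hα0.eq_or_lt with hα1 | hα1
  · rw [← hα1, zero_mul, zero_add] at f1
    have : t * (1 - capCutoff y) = 1 := by rw [hα] at hα1; linarith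
    rw [this] at f1
    linarith
  · have g2 := (mul_eq_zero.1 f2).resolve_left hα1.ne'
    have g3 := (mul_eq_zero.1 f3).resolve_left hα1.ne'
    have g := norm_sq_quatIm y
    rw [g2, g3] at g
    have hy1 : y 1 ≤ 0 := by
      by_contra! h1
      have := mul_pos hα1 h1
      have := mul_nonneg hβ hn.le
      linarith
    have hny : ‖quatIm y‖ = -(y 1) := by nlinarith
    have hc : capCutoff y = 1 := by
      refine Real.smoothTransition.one_of_one_le ?_
      rw [← hny, div_self hn.ne']
      norm_num
    rw [hc, sub_self, mul_zero, zero_mul, add_zero] at f1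
    have := (mul_eq_zero.1 f1).resolve_left hα1.ne'
    rw [this] at hny
    linarith

/-- The straight path from a cyclic rotation to the rotated cap map. -/
def capPath (i : Fin 3) (p : ℝ × (Fin 4 → ℝ)) : Fin 4 → ℝ :=
  (1 - p.1) • rotCoord i p.2 + p.1 • capMap (rotCoord i p.2)

lemma quatIm_rotCoord_ne_zero (i : Fin 3) {y : Fin 4 → ℝ} (hy : quatIm y ≠ 0) :
    quatIm (rotCoord i y) ≠ 0 := by
  rwa [← norm_ne_zero_iff, norm_quatIm_rotCoord, norm_ne_zero_iff]

lemma contDiffOn_capMap_rotCoord (i : Fin 3) :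
    ContDiffOn ℝ 2 (fun y => capMap (rotCoord i y)) {y | quatIm y ≠ 0} :=
  contDiffOn_capMap.comp (contDiff_rotCoord i).contDiffOn fun _ hy => quatIm_rotCoord_ne_zero i hy

lemma contDiffOn_capPath (i : Fin 3) : ContDiffOn ℝ 2 (capPath i) {p | quatIm p.2 ≠ 0} := by
  have h1 : ContDiffOn ℝ 2 (fun p : ℝ × (Fin 4 → ℝ) => capMap (rotCoord i p.2))
      {p | quatIm p.2 ≠ 0} :=
    (contDiffOn_capMap_rotCoord i).comp contDiff_snd.contDiffOn fun _ hp => hp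
  have h2 := ((contDiff_rotCoord i (n := 2)).comp (contDiff_snd (E := ℝ))).contDiffOn
    (s := {p : ℝ × (Fin 4 → ℝ) | quatIm p.2 ≠ 0})
  exact ((contDiffOn_const.sub contDiff_fst.contDiffOn).smul h2).add
    (contDiff_fst.contDiffOn.smul h1)

/-- The cap of directions on which the `i`-th cap map is not constant. -/
def capSet (i : Fin 3) : Set (Fin 4 → ℝ) := {y | 3 / 4 * ‖quatIm y‖ < -(y i.succ)}

lemma isOpen_capSet (i : Fin 3) : IsOpen (capSet i) :=
  isOpen_lt (continuous_const.mul quatIm.continuous.norm) (continuous_apply i.succ).neg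

lemma quatIm_capMap_rotCoord {i : Fin 3} {y : Fin 4 → ℝ} (hy : quatIm y ≠ 0) (h : y ∉ capSet i) :
    quatIm (capMap (rotCoord i y)) = ‖quatIm y‖ • quatI := by
  rw [quatIm_capMap_of_cutoff, norm_quatIm_rotCoord]
  by_contra h0
  have := capCutoff_ne_zero (quatIm_rotCoord_ne_zero i hy) h0
  rw [norm_quatIm_rotCoord] at this
  exact h this

lemma capSet_disjoint {i j : Fin 3} {y : Fin 4 → ℝ} (hi : y ∈ capSet i) (hj : y ∈ capSet j) :
    i = j := by
  have h := norm_sq_quatIm y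
  have h0 := norm_nonneg (quatIm y)
  have key : ∀ a b : ℝ, 3 / 4 * ‖quatIm y‖ < -a → 3 / 4 * ‖quatIm y‖ < -b →
      ‖quatIm y‖ ^ 2 < a ^ 2 + b ^ 2 := fun a b ha hb => by nlinarith
  have hij := key _ _ hi hj
  by_contra hne
  have h1 := sq_nonneg (y 1)
  have h2 := sq_nonneg (y 2)
  have h3 := sq_nonneg (y 3)
  fin_cases i <;> fin_cases j <;> simp at hne hij <;> linarith

section split

variable {R : ℝ × (Fin 3 → Fin 4 → ℝ) → ℍ[ℝ]}

lemma SymFamily.circle_axis (hR : SymFamily R) {s : ℝ} {q : Fin 3 → Fin 4 → ℝ}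
    (hq : ∀ j, ∃ c : ℝ, 0 < c ∧ quatIm (q j) = c • quatI) :
    (R (s, q)).imJ = 0 ∧ (R (s, q)).imK = 0 := by
  have h1 : R (s, q) = R (s, fun _ => Pi.single 1 1) :=
    hR.homog s _ q (fun _ => by rw [quatIm_single]; exact quatI_ne_zero) fun j => by
      rw [quatIm_single]; exact hq j
  rw [h1, hR.circle s _ (by rw [quatIm_single]; exact quatI_ne_zero) quatIm_single quatIm_single,
    quatIm_single]
  constructor <;> simp [quatI]

lemma SymFamily.allSlot_eq_oneSlot (hR : SymFamily R) {σ : Equiv.Perm (Fin 3)}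
    {q : Fin 3 → Fin 4 → ℝ} (hq : q ∈ nzConf) (hcap : ∀ i, q (σ i) ∈ capSet i)
    (hC : ∀ (i : Fin 3) y, quatIm y ≠ 0 → quatIm (capMap (rotCoord i y)) ≠ 0) (s : ℝ) (i : Fin 3) :
    R (s, allSlot (fun i y => capMap (rotCoord i y)) q i) =
      R (s, oneSlot σ (fun i y => capMap (rotCoord i y)) q i) := by
  rw [← hR.symm s _ (Equiv.swap 0 (σ i))]
  refine hR.homog s _ _ (fun j => ?_) fun j => ?_
  · by_cases hj : j = 0
    · simpa only [oneSlot, hj, if_true] using hC i _ (hq (σ i))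
    · simpa only [oneSlot, hj, if_false, quatIm_single] using quatI_ne_zero
  · by_cases hj : j = 0
    · exact ⟨1, one_pos, by simp [allSlot, oneSlot, hj]⟩
    · refine ⟨_, norm_pos_iff.2 (hq (Equiv.swap 0 (σ i) j)), ?_⟩
      simp only [oneSlot, hj, if_false, quatIm_single, allSlot]
      refine quatIm_capMap_rotCoord (hq _) fun hmem => hj ?_
      have h1 := hcap (σ.symm (Equiv.swap 0 (σ i) j))
      rw [Equiv.apply_symm_apply] at h1
      have h2 := congrArg σ (capSet_disjoint h1 hmem)
      rw [Equiv.apply_symm_apply] at h2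
      exact (Equiv.swap 0 (σ i)).injective (h2.trans (Equiv.swap_apply_left 0 (σ i)).symm)

theorem SymFamily.degI_eq_sum_oneSlot (hR : SymFamily R)
    {S : Set (Fin 3 → Fin 4 → ℝ)} (hS : IsCompact S) (hS0 : ∀ z ∈ S, ∀ i, 0 < z i 0)
    (hS1 : ∀ z ∈ S, ∀ i, ‖quatIm (z i)‖ < 1) (hS2 : ∀ z ∈ S, ∀ i, z i 2 ≠ 0 ∨ z i 3 ≠ 0)
    {Ψ : (Fin 3 → Fin 4 → ℝ) → ℝ} (hΨ : ContDiff ℝ 1 Ψ) (hΨS : ∀ z, Ψ z ≠ 0 → z ∈ S) :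
    degI volume (cfgDom R (allSlot fun _ y => y)) Ψ (cfgMap R (allSlot fun _ y => y)) =
      ∑ σ, degI volume (cfgDom R (oneSlot σ fun _ y => y)) Ψ
        (cfgMap R (oneSlot σ fun _ y => y)) := by
  have r0 : (fun (i : Fin 3) y => rotPath i (0, y)) = fun _ y => y := by
    funext i y; simp [rotPath]
  have r1 : (fun (i : Fin 3) y => rotPath i (1, y)) = fun i y => rotCoord i y := by
    funext i y; simp [rotPath]
  have c0 : (fun (i : Fin 3) y => capPath i (0, y)) = fun i y => rotCoord i y := by
    funext i y; simp [capPath]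
  have c1 : (fun (i : Fin 3) y => capPath i (1, y)) = fun i y => capMap (rotCoord i y) := by
    funext i y; simp [capPath]
  have hrot : ∀ i, ContDiffOn ℝ 2 (rotPath i) {p | quatIm p.2 ≠ 0} := fun i =>
    (contDiff_rotPath i).contDiffOn
  have hrot0 : ∀ i, ∀ t ∈ Icc (0 : ℝ) 1, ∀ y, quatIm y ≠ 0 → quatIm (rotPath i (t, y)) ≠ 0 :=
    fun i t _ y hy => quatIm_rotPath_ne_zero i t hy
  have hcap0 : ∀ i, ∀ t ∈ Icc (0 : ℝ) 1, ∀ y, quatIm y ≠ 0 → quatIm (capPath i (t, y)) ≠ 0 :=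
    fun i t ht y hy => quatIm_capPath_ne_zero ht (quatIm_rotCoord_ne_zero i hy)
  have hC : ∀ (i : Fin 3) y, quatIm y ≠ 0 → quatIm (capMap (rotCoord i y)) ≠ 0 := fun i y hy => by
    have := hcap0 i 1 (by simp) y hy
    rwa [show capPath i (1, y) = capMap (rotCoord i y) from congrFun (congrFun c1 i) y] at this
  have a1 := hR.degI_allSlot hrot hrot0 hS hS0 hS1 hΨ hΨS
  have a2 := hR.degI_allSlot contDiffOn_capPath hcap0 hS hS0 hS1 hΨ hΨS
  rw [r0, r1] at a1
  rw [c0, c1] at a2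
  have b : ∀ σ, _ := fun σ => (hR.degI_oneSlot σ hrot hrot0 hS hS0 hS1 hΨ hΨS).trans
    ((by rw [r1, c0] : _ = _).trans
      (hR.degI_oneSlot σ contDiffOn_capPath hcap0 hS hS0 hS1 hΨ hΨS))
  simp only [r0, c1] at b
  set C : Fin 3 → (Fin 4 → ℝ) → Fin 4 → ℝ := fun i y => capMap (rotCoord i y) with hCdef
  have hall : ContDiffOn ℝ 2 (allSlot C) nzConf := contDiffOn_pi.2 fun i => contDiffOn_pi.2
    fun j => (contDiffOn_capMap_rotCoord i).comp (contDiff_apply ℝ _ j).contDiffOn fun q (hq : q ∈ nzConf) => hq j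
  have hone : ∀ σ, ContDiffOn ℝ 2 (oneSlot σ C) nzConf := fun σ => contDiffOn_pi.2 fun i =>
    contDiffOn_pi.2 fun j => by
      by_cases hj : j = 0
      · have h := (contDiffOn_capMap_rotCoord i).comp (contDiff_apply ℝ _ (σ i)).contDiffOn fun q (hq : q ∈ nzConf) => hq (σ i)
        simpa only [oneSlot, hj, if_true] using! h
      · simpa only [oneSlot, hj, if_false] using contDiffOn_const
  have hallnz : ∀ q ∈ nzConf, ∀ i, allSlot C q i ∈ nzConf := fun q hq i j => hC i _ (hq j)
  have honenz : ∀ σ, ∀ q ∈ nzConf, ∀ i, oneSlot σ C q i ∈ nzConf := fun σ q hq i j => by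
    by_cases hj : j = 0
    · simpa only [oneSlot, hj, if_true] using hC i _ (hq (σ i))
    · simpa only [oneSlot, hj, if_false, quatIm_single] using quatI_ne_zero
  obtain ⟨K, hKU, hK, hKS⟩ := hR.exists_isCompact hall hallnz hS hS0 hS1
  set V : Equiv.Perm (Fin 3) → Set (Fin 3 → Fin 4 → ℝ) := fun σ =>
    cfgDom R (allSlot C) ∩ {q | ∀ i, q (σ i) ∈ capSet i} with hV
  have hVo : ∀ σ, IsOpen (V σ) := fun σ => (hR.isOpen_cfgDom hall).inter (by
    simp only [ofPred_forall]
    exact isOpen_iInter_of_finite fun i => (isOpen_capSet i).preimage (continuous_apply (σ i)))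
  have hoff : ∀ z ∈ S, ∀ i : Fin 3, ∀ r x, z i = quatVec r x → x.imJ = 0 ∧ x.imK = 0 → False := by
    intro z hz i r x hx h
    have h2 := hS2 z hz i
    rw [hx] at h2
    exact h2.elim (fun h2 => h2 h.1) fun h2 => h2 h.2
  rw [a1, a2, degI_eq_sum volume (hR.isOpen_cfgDom hall)
    ((hR.contDiffOn_cfgMap hall).of_le one_le_two) hΨ.continuous hK hKU
    (fun q hq h => hKS q hq (hΨS _ h)) hVo (fun σ => inter_subset_left) ?_ ?_]
  · refine Finset.sum_congr rfl fun σ _ => ?_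
    rw [b σ]
    have hval : ∀ q ∈ nzConf, (∀ i, q (σ i) ∈ capSet i) → ∀ s i, R (s, allSlot C q i) =
        R (s, oneSlot σ C q i) := fun q hq h s i => hR.allSlot_eq_oneSlot hq h hC s i
    have e1 : EqOn (cfgMap R (allSlot C)) (cfgMap R (oneSlot σ C)) (V σ) := fun q hq => by
      funext i
      simp only [cfgMap, hval q hq.1.1 hq.2]
    rw [degI_congr volume (hVo σ) e1]
    refine (degI_eq_of_subset volume (hR.isOpen_cfgDom (hone σ)) (fun q hq => ?_)
      fun q hq h => ?_).symm
    · exact ⟨hq.1.1, hq.1.2.1, honenz σ q hq.1.1, fun i => by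
        rw [← hval q hq.1.1 hq.2]; exact hq.1.2.2.2 i⟩
    · have h1 : ∀ i, q (σ i) ∈ capSet i := fun i => by
        by_contra h0
        refine hoff _ (hΨS _ h) i _ _ rfl (hR.circle_axis fun j => ?_)
        by_cases hj : j = 0
        · simp only [oneSlot, hj, if_true]
          exact ⟨_, norm_pos_iff.2 (hq.1 (σ i)), quatIm_capMap_rotCoord (hq.1 (σ i)) h0⟩
        · simp only [oneSlot, hj, if_false]
          exact ⟨1, one_pos, by rw [quatIm_single, one_smul]⟩
      exact ⟨⟨hq.1, hq.2.1, hallnz q hq.1, fun i => by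
        rw [hval q hq.1 h1]; exact hq.2.2.2 i⟩, h1⟩
  · intro σ σ' hne
    refine disjoint_left.2 fun q hq hq' => hne (Equiv.ext fun i => ?_)
    have h1 := hq'.2 (σ'.symm (σ i))
    rw [Equiv.apply_symm_apply] at h1
    exact (Equiv.symm_apply_eq σ').1 (capSet_disjoint h1 (hq.2 i))
  · intro q hq h
    have h1 : ∀ i, ∃ j, q j ∈ capSet i := fun i => by
      by_contra! h0
      exact hoff _ (hΨS _ h) i _ _ rfl (hR.circle_axis fun j =>
        ⟨_, norm_pos_iff.2 (hq.1 j), quatIm_capMap_rotCoord (hq.1 j) (h0 j)⟩)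
    choose f hf using h1
    have hinj : Function.Injective f := fun i j hij => capSet_disjoint (hf i) (hij ▸ hf j)
    exact ⟨Equiv.ofBijective f (Finite.injective_iff_bijective.1 hinj), hq, hf⟩

end split

lemma quatIm_imI (q : Fin 4 → ℝ) : (quatIm q).imI = q 1 := rfl
lemma quatIm_imJ (q : Fin 4 → ℝ) : (quatIm q).imJ = q 2 := rfl
lemma quatIm_imK (q : Fin 4 → ℝ) : (quatIm q).imK = q 3 := rfl

/-- The polar map that wraps the direction of a vector around a circle. -/
def polarMap (x : Fin 4 → ℝ) : Fin 4 → ℝ :=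
  quatVec (‖quatIm x‖ ^ 2) ((Real.sin (2 * Real.pi * x 0) * ‖quatIm x‖⁻¹) • quatIm x)

/-- The derivative of `polarMap` over the unit sphere, where `C` and `S` stand for the
derivative and the value of the sine factor. -/
def polarMatrix (C S : ℝ) (x : Fin 4 → ℝ) : Matrix (Fin 4) (Fin 4) ℝ :=
  !![0, 2 * x 1, 2 * x 2, 2 * x 3;
     C * x 1, S * (1 - x 1 * x 1), -(S * (x 1 * x 2)), -(S * (x 1 * x 3));
     C * x 2, -(S * (x 2 * x 1)), S * (1 - x 2 * x 2), -(S * (x 2 * x 3));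
     C * x 3, -(S * (x 3 * x 1)), -(S * (x 3 * x 2)), S * (1 - x 3 * x 3)]

lemma det_polarMatrix (C S : ℝ) {x : Fin 4 → ℝ} (hx : x 1 ^ 2 + x 2 ^ 2 + x 3 ^ 2 = 1) :
    (polarMatrix C S x).det = -(2 * C * S ^ 2) := by
  have h : (polarMatrix C S x).det =
      -(2 * C * S ^ 2) * (x 1 ^ 2 + x 2 ^ 2 + x 3 ^ 2) := by
    rw [polarMatrix, Matrix.det_succ_row_zero]
    simp [Fin.sum_univ_four, Matrix.det_fin_three, Matrix.submatrix_apply, Fin.succAbove]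
    ring
  rw [h, hx, mul_one]

lemma hasFDerivAt_polarMap {x : Fin 4 → ℝ} (hx : ‖quatIm x‖ = 1) :
    HasFDerivAt polarMap (Matrix.toLin' (polarMatrix (2 * Real.pi * Real.cos (2 * Real.pi * x 0))
      (Real.sin (2 * Real.pi * x 0)) x)).toContinuousLinearMap x := by
  have hn : x 1 ^ 2 + x 2 ^ 2 + x 3 ^ 2 = 1 := by rw [← norm_sq_quatIm, hx, one_pow]
  have hp : ∀ k, HasFDerivAt (fun y : Fin 4 → ℝ => y k) (ContinuousLinearMap.proj k : (Fin 4 → ℝ) →L[ℝ] ℝ) x :=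
    fun k => (ContinuousLinearMap.proj k : (Fin 4 → ℝ) →L[ℝ] ℝ).hasFDerivAt
  have h1 : HasFDerivAt (fun y : Fin 4 → ℝ => ‖quatIm y‖ ^ 2)
      (∑ k : Fin 3, (2 * x k.succ) • (ContinuousLinearMap.proj k.succ : (Fin 4 → ℝ) →L[ℝ] ℝ)) x := by
    simp only [norm_sq_quatIm]
    refine (((hp 1).pow 2).add ((hp 2).pow 2)).add ((hp 3).pow 2) |>.congr_fderiv ?_
    ext v
    simp [Fin.sum_univ_three]
  have h2 : HasFDerivAt (fun y : Fin 4 → ℝ => ‖quatIm y‖⁻¹)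
      (-(∑ k : Fin 3, x k.succ • (ContinuousLinearMap.proj k.succ : (Fin 4 → ℝ) →L[ℝ] ℝ))) x := by
    have e : (fun y : Fin 4 → ℝ => ‖quatIm y‖⁻¹) = fun y => (√(‖quatIm y‖ ^ 2))⁻¹ := by
      funext y; rw [Real.sqrt_sq (norm_nonneg _)]
    rw [e]
    have h3 := (h1.sqrt (by rw [hx]; norm_num))
    have h4 := (hasDerivAt_inv (x := √(‖quatIm x‖ ^ 2)) (by rw [hx]; norm_num)).comp_hasFDerivAt x h3
    refine h4.congr_fderiv ?_
    ext v
    simp [Fin.sum_univ_three, hx]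
    ring
  have h3 := ((hasFDerivAt_const (2 * Real.pi) x).mul (hp 0)).sin.mul h2
  have h4 : ∀ k : Fin 3, HasFDerivAt (fun y : Fin 4 → ℝ => polarMap y k.succ)
      ((ContinuousLinearMap.proj k.succ).comp (Matrix.toLin' (polarMatrix
        (2 * Real.pi * Real.cos (2 * Real.pi * x 0))
        (Real.sin (2 * Real.pi * x 0)) x)).toContinuousLinearMap) x := by
    intro k
    have e : (fun y : Fin 4 → ℝ => polarMap y k.succ) =
        fun y => Real.sin (2 * Real.pi * y 0) * ‖quatIm y‖⁻¹ * y k.succ := by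
      funext y; fin_cases k <;> simp [polarMap, quatIm_imI, quatIm_imJ, quatIm_imK]
    rw [e]
    refine (h3.mul (hp k.succ)).congr_fderiv ?_
    ext v
    fin_cases k <;>
      simp [polarMatrix, Matrix.vecHead, Matrix.vecTail, Matrix.mulVec, dotProduct, Fin.sum_univ_three, Fin.sum_univ_four, hx] <;> ring
  refine hasFDerivAt_pi'.2 fun i => ?_
  refine Fin.cases ?_ (fun k => h4 k) i
  refine h1.congr_fderiv ?_
  ext v
  simp [polarMatrix, Matrix.mulVec, dotProduct, Fin.sum_univ_three, Fin.sum_univ_four]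

lemma polarMap_eq_iff {x p : Fin 4 → ℝ} (hx : quatIm x ≠ 0) (hx0 : x 0 ∈ Ioo (0 : ℝ) 1)
    (hc : Real.cos (2 * Real.pi * x 0) < 0) (hp0 : p 0 = 1) (hp : ‖quatIm p‖ = 1 / 2) :
    polarMap x = p ↔ x = ![5 / 12, 2 * p 1, 2 * p 2, 2 * p 3] ∨
      x = ![7 / 12, -(2 * p 1), -(2 * p 2), -(2 * p 3)] := by
  have hpn := norm_sq_quatIm p
  rw [hp] at hpn
  have hxn := norm_sq_quatIm x
  have hpi := Real.pi_pos
  have hsin5 : Real.sin (2 * Real.pi * (5 / 12)) = 1 / 2 := by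
    rw [show 2 * Real.pi * (5 / 12) = Real.pi - Real.pi / 6 by ring, Real.sin_pi_sub,
      Real.sin_pi_div_six]
  have hsin7 : Real.sin (2 * Real.pi * (7 / 12)) = -(1 / 2) := by
    rw [show 2 * Real.pi * (7 / 12) = Real.pi / 6 + Real.pi by ring, Real.sin_add_pi,
      Real.sin_pi_div_six]
  constructor
  · intro h
    have h0 : ‖quatIm x‖ = 1 := by
      have h1 := congrFun h 0
      rw [hp0] at h1
      exact (pow_eq_one_iff_of_nonneg (norm_nonneg _) two_ne_zero).1 h1
    have hk : ∀ k : Fin 3, Real.sin (2 * Real.pi * x 0) * x k.succ = p k.succ := fun k => by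
      have h1 := congrFun h k.succ
      fin_cases k <;> simpa [polarMap, quatIm_imI, quatIm_imJ, quatIm_imK, h0] using h1
    have k1 := hk 0
    have k2 := hk 1
    have k3 := hk 2
    simp only [Fin.succ_zero_eq_one, Fin.succ_one_eq_two, show Fin.succ (2 : Fin 3) = 3 from rfl] at k1 k2 k3
    set u := 2 * Real.pi * x 0 - Real.pi with hu
    have hs : Real.sin (2 * Real.pi * x 0) = -Real.sin u := by rw [hu, Real.sin_sub_pi, neg_neg]
    have hcu : 0 < Real.cos u := by rw [hu, Real.cos_sub_pi]; linarith
    have hu1 : u < Real.pi := by nlinarith [hx0.2]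
    have hu2 : -Real.pi < u := by nlinarith [hx0.1]
    have hub : u ∈ Icc (-(Real.pi / 2)) (Real.pi / 2) := by
      constructor
      · by_contra! h1
        rw [← Real.cos_neg] at hcu
        exact absurd hcu (Real.cos_nonpos_of_pi_div_two_le_of_le (by linarith) (by linarith)).not_gt
      · by_contra! h1
        exact absurd hcu (Real.cos_nonpos_of_pi_div_two_le_of_le (by linarith) (by linarith)).not_gt
    have hsq : Real.sin u ^ 2 = (1 / 2) ^ 2 := by
      rw [hs] at k1 k2 k3
      rw [h0] at hxn
      rw [← k1, ← k2, ← k3] at hpn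
      linear_combination Real.sin u ^ 2 * hxn - hpn
    have hm : ∀ v ∈ Icc (-(Real.pi / 2)) (Real.pi / 2), Real.sin u = Real.sin v → u = v :=
      fun v hv h1 => Real.strictMonoOn_sin.injOn hub hv h1
    rcases sq_eq_sq_iff_eq_or_eq_neg.1 hsq with h1 | h1
    · right
      have h2 := hm (Real.pi / 6) ⟨by linarith, by linarith⟩ (by rw [h1, Real.sin_pi_div_six])
      have h3 : x 0 = 7 / 12 := by
        have : Real.pi * (2 * x 0 - 7 / 6) = 0 := by linear_combination h2
        rcases mul_eq_zero.1 this with h | h <;> linarith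
      rw [hs, h1] at k1 k2 k3
      ext k
      fin_cases k <;> simp [h3] <;> linarith
    · left
      have h2 := hm (-(Real.pi / 6)) ⟨by linarith, by linarith⟩
        (by rw [h1, Real.sin_neg, Real.sin_pi_div_six])
      have h3 : x 0 = 5 / 12 := by
        have : Real.pi * (2 * x 0 - 5 / 6) = 0 := by linear_combination h2
        rcases mul_eq_zero.1 this with h | h <;> linarith
      rw [hs, h1] at k1 k2 k3
      ext k
      fin_cases k <;> simp [h3] <;> linarith
  · have hnn : ∀ h : x 1 ^ 2 + x 2 ^ 2 + x 3 ^ 2 = 4 * (p 1 ^ 2 + p 2 ^ 2 + p 3 ^ 2),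
        ‖quatIm x‖ = 1 := fun h => by
      refine (pow_eq_one_iff_of_nonneg (norm_nonneg _) two_ne_zero).1 ?_
      rw [hxn, h]; linarith
    rintro (h | h)
    · have h1 := hnn (by rw [h]; simp; ring)
      have e0 : x 0 = 5 / 12 := by rw [h]; rfl
      ext k
      fin_cases k <;> simp [polarMap, h1, hp0, e0, hsin5] <;> simp [h, quatIm_imI, quatIm_imJ, quatIm_imK]
    · have h1 := hnn (by rw [h]; simp; ring)
      have e0 : x 0 = 7 / 12 := by rw [h]; rfl
      ext k
      fin_cases k <;> simp [polarMap, h1, hp0, e0, hsin7] <;> simp [h, quatIm_imI, quatIm_imJ, quatIm_imK]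

/-- Configurations of values near which all the counts take place. -/
def goodVal : Set (Fin 3 → Fin 4 → ℝ) :=
  {z | (∀ i, 0 < z i 0) ∧ (∀ i, ‖quatIm (z i)‖ < 1) ∧ (∀ i, z i 2 ≠ 0 ∨ z i 3 ≠ 0) ∧
    ∀ i j, i ≠ j → quatIm (z i) ≠ quatIm (z j)}

lemma isOpen_goodVal : IsOpen goodVal := by
  have hc : ∀ i k, Continuous fun z : Fin 3 → Fin 4 → ℝ => z i k := fun i k =>
    (continuous_apply k).comp (continuous_apply i)
  have hq : ∀ i, Continuous fun z : Fin 3 → Fin 4 → ℝ => quatIm (z i) := fun i =>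
    quatIm.continuous.comp (continuous_apply i)
  simp only [goodVal, ofPred_and, ofPred_forall]
  refine (isOpen_iInter_of_finite fun i => isOpen_lt continuous_const (hc i 0)).inter
    ((isOpen_iInter_of_finite fun i => isOpen_lt (hq i).norm continuous_const).inter
    ((isOpen_iInter_of_finite fun i => ?_).inter (isOpen_iInter_of_finite fun i =>
      isOpen_iInter_of_finite fun j => isOpen_iInter_of_finite fun _ =>
        isOpen_ne_fun (hq i) (hq j))))
  exact (isOpen_ne_fun (hc i 2) continuous_const).union (isOpen_ne_fun (hc i 3) continuous_const)

lemma contDiffOn_oneSlot_id (σ : Equiv.Perm (Fin 3)) :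
    ContDiffOn ℝ 2 (oneSlot σ fun _ y => y) nzConf := by
  refine ContDiff.contDiffOn (contDiff_pi.2 fun i => contDiff_pi.2 fun j => ?_)
  by_cases hj : j = 0
  · simpa only [oneSlot, hj, if_true] using! contDiff_apply ℝ (Fin 4 → ℝ) (σ i)
  · simpa only [oneSlot, hj, if_false] using contDiff_const

lemma oneSlot_id_mem (σ : Equiv.Perm (Fin 3)) {q : Fin 3 → Fin 4 → ℝ} (hq : q ∈ nzConf) (i : Fin 3) :
    oneSlot σ (fun _ y => y) q i ∈ nzConf := fun j => by
  by_cases hj : j = 0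
  · simpa only [oneSlot, hj, if_true] using hq (σ i)
  · simpa only [oneSlot, hj, if_false, quatIm_single] using quatI_ne_zero

lemma quatIm_blockPerm_tailPerm (σ : Equiv.Perm (Fin 3)) (q : Fin 3 → Fin 4 → ℝ) (i : Fin 3) :
    quatIm (blockPerm (tailPerm σ) q i) = quatIm (q (σ i)) := rfl

lemma blockPerm_tailPerm_mem (σ : Equiv.Perm (Fin 3)) {q : Fin 3 → Fin 4 → ℝ} :
    blockPerm (tailPerm σ) q ∈ nzConf ↔ q ∈ nzConf := by
  refine ⟨fun h j => ?_, fun h j => h (σ j)⟩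
  have := h (σ.symm j)
  rwa [quatIm_blockPerm_tailPerm, Equiv.apply_symm_apply] at this

/-- The product of three polar maps. -/
def polarMap₃ (q : Fin 3 → Fin 4 → ℝ) : Fin 3 → Fin 4 → ℝ := fun i => polarMap (q i)

lemma det_fderiv_polarMap₃ {q : Fin 3 → Fin 4 → ℝ} (hq : ∀ i, ‖quatIm (q i)‖ = 1) :
    DifferentiableAt ℝ polarMap₃ q ∧ (fderiv ℝ polarMap₃ q).det =
      ∏ i, -(2 * (2 * Real.pi * Real.cos (2 * Real.pi * q i 0)) *
        Real.sin (2 * Real.pi * q i 0) ^ 2) := by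
  have h : HasFDerivAt polarMap₃ (ContinuousLinearMap.pi fun i =>
      (Matrix.toLin' (polarMatrix (2 * Real.pi * Real.cos (2 * Real.pi * q i 0))
      (Real.sin (2 * Real.pi * q i 0)) (q i))).toContinuousLinearMap.comp
      (ContinuousLinearMap.proj i : (Fin 3 → Fin 4 → ℝ) →L[ℝ] (Fin 4 → ℝ))) q :=
    hasFDerivAt_pi.2 fun i => (hasFDerivAt_polarMap (hq i)).comp q
      (ContinuousLinearMap.proj i : (Fin 3 → Fin 4 → ℝ) →L[ℝ] (Fin 4 → ℝ)).hasFDerivAt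
  refine ⟨h.differentiableAt, ?_⟩
  rw [h.fderiv, ContinuousLinearMap.det]
  refine (LinearMap.det_pi fun i => Matrix.toLin' (polarMatrix
    (2 * Real.pi * Real.cos (2 * Real.pi * q i 0)) (Real.sin (2 * Real.pi * q i 0)) (q i))).trans ?_
  refine Finset.prod_congr rfl fun i _ => ?_
  rw [LinearMap.det_toLin', det_polarMatrix]
  rw [← norm_sq_quatIm, hq, one_pow]

section count

variable {R : ℝ × (Fin 3 → Fin 4 → ℝ) → ℍ[ℝ]}

lemma SymFamily.oneSlot_value (hR : SymFamily R) (σ : Equiv.Perm (Fin 3)) {q : Fin 3 → Fin 4 → ℝ}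
    (hq : q ∈ nzConf) (i : Fin 3) :
    R (q i 0, oneSlot σ (fun _ y => y) q i) = (Real.cos (2 * Real.pi * q i 0) : ℍ[ℝ]) +
      (Real.sin (2 * Real.pi * q i 0) * ‖quatIm (q (σ i))‖⁻¹) • quatIm (q (σ i)) :=
  hR.circle _ _ (hq (σ i)) quatIm_single quatIm_single

lemma SymFamily.cfgMap_oneSlot (hR : SymFamily R) (σ : Equiv.Perm (Fin 3)) {q : Fin 3 → Fin 4 → ℝ}
    (hq : q ∈ nzConf) : cfgMap R (oneSlot σ fun _ y => y) q =
      blockPerm (headPerm σ⁻¹) (polarMap₃ (blockPerm (tailPerm σ) q)) := by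
  funext i
  simp only [cfgMap, hR.oneSlot_value σ hq]
  ext k
  rw [blockPerm_apply]
  refine Fin.cases ?_ (fun k => ?_) k
  · rw [headPerm_zero, polarMap₃, polarMap, quatVec_zero, quatVec_zero, quatIm_blockPerm_tailPerm]
    simp
  · rw [headPerm_succ, polarMap₃, polarMap, quatIm_blockPerm_tailPerm, blockPerm_apply, tailPerm_zero]
    fin_cases k <;> simp

theorem SymFamily.exists_degI_oneSlot (hR : SymFamily R) (σ : Equiv.Perm (Fin 3))
    {z : Fin 3 → Fin 4 → ℝ} (hz : z ∈ goodVal) (hz0 : ∀ i, z i 0 = 1)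
    (hz1 : ∀ i, ‖quatIm (z i)‖ = 1 / 2) :
    ∃ ε > 0, ∀ Ψ : (Fin 3 → Fin 4 → ℝ) → ℝ, Continuous Ψ →
      (∀ y, Ψ y ≠ 0 → y ∈ Metric.ball z ε) →
      degI volume (cfgDom R (oneSlot σ fun _ y => y)) Ψ (cfgMap R (oneSlot σ fun _ y => y)) =
        8 * ∫ y, Ψ y := by
  obtain ⟨δ, hδ, hδS⟩ := Metric.nhds_basis_closedBall.mem_iff.1 (isOpen_goodVal.mem_nhds hz)
  have hN := contDiffOn_oneSlot_id σ
  set N := oneSlot σ fun (_ : Fin 3) (y : Fin 4 → ℝ) => y with hNdef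
  obtain ⟨K, hKU, hK, hKS⟩ := hR.exists_isCompact hN (fun q hq i => oneSlot_id_mem σ hq i)
    (isCompact_closedBall z δ) (fun w hw => (hδS hw).1) (fun w hw => (hδS hw).2.1)
  have hpt : ∀ x ∈ cfgDom R N, cfgMap R N x = z → ∀ i,
      polarMap (blockPerm (tailPerm σ) x i) = z i := by
    intro x hx h i
    rw [hR.cfgMap_oneSlot σ hx.1] at h
    ext k
    refine Fin.cases ?_ (fun k => ?_) k
    · have h1 := congrFun (congrFun h (σ i)) 0
      rw [blockPerm_apply, headPerm_zero, hz0, show σ⁻¹ (σ i) = i from σ.symm_apply_apply i] at h1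
      rw [hz0]; exact h1
    · have h1 := congrFun (congrFun h i) k.succ
      rwa [blockPerm_apply, headPerm_succ] at h1
  have hcos : ∀ x ∈ cfgDom R N, ∀ i, Real.cos (2 * Real.pi * blockPerm (tailPerm σ) x i 0) < 0 := by
    intro x hx i
    have := hx.2.2.2 i
    rw [hR.oneSlot_value σ hx.1 i] at this
    rw [blockPerm_apply, tailPerm_zero]
    simpa [quatIm_apply] using this
  have hpos : ∀ x ∈ cfgDom R N, cfgMap R N x = z → 0 < (fderiv ℝ (cfgMap R N) x).det := by
    intro x hx h
    have hp := hpt x hx h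
    have hn : ∀ i, ‖quatIm (blockPerm (tailPerm σ) x i)‖ = 1 := fun i => by
      have h1 := congrFun (hp i) 0
      rw [hz0] at h1
      exact (pow_eq_one_iff_of_nonneg (norm_nonneg _) two_ne_zero).1 h1
    obtain ⟨hd, hdet⟩ := det_fderiv_polarMap₃ hn
    have he : cfgMap R N =ᶠ[𝓝 x] fun q =>
        blockPerm (headPerm σ⁻¹) (polarMap₃ (blockPerm (tailPerm σ) q)) :=
      Filter.eventuallyEq_of_mem (isOpen_nzConf.mem_nhds hx.1) fun q hq => hR.cfgMap_oneSlot σ hq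
    have hD : HasFDerivAt (fun q => blockPerm (headPerm σ⁻¹) (polarMap₃ (blockPerm (tailPerm σ) q)))
        ((blockPerm (headPerm σ⁻¹) : _ →L[ℝ] (Fin 3 → Fin 4 → ℝ)).comp
          ((fderiv ℝ polarMap₃ (blockPerm (tailPerm σ) x)).comp
            (blockPerm (tailPerm σ) : _ →L[ℝ] (Fin 3 → Fin 4 → ℝ)))) x :=
      (blockPerm (headPerm σ⁻¹)).hasFDerivAt.comp x
        (hd.hasFDerivAt.comp x (blockPerm (tailPerm σ)).hasFDerivAt)
    have hs : ((Equiv.Perm.sign σ : ℤ) : ℝ) * (Equiv.Perm.sign σ : ℤ) = 1 := by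
      exact_mod_cast Int.isUnit_mul_self (Units.isUnit (Equiv.Perm.sign σ))
    rw [he.fderiv_eq, hD.fderiv]
    have e : ∀ f g : (Fin 3 → Fin 4 → ℝ) →L[ℝ] (Fin 3 → Fin 4 → ℝ), (f.comp g).det = f.det * g.det :=
      fun f g => LinearMap.det_comp _ _
    rw [e, e, blockPerm_det, blockPerm_det, hdet]
    have hprod : 0 < ∏ i, -(2 * (2 * Real.pi * Real.cos (2 * Real.pi * blockPerm (tailPerm σ) x i 0)) *
        Real.sin (2 * Real.pi * blockPerm (tailPerm σ) x i 0) ^ 2) := by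
      refine Finset.prod_pos fun i _ => ?_
      have h1 := hcos x hx i
      have h2 : Real.sin (2 * Real.pi * blockPerm (tailPerm σ) x i 0) ≠ 0 := fun h0 => by
        have h3 := congrArg (fun v => ‖quatIm v‖) (hp i)
        have h4 : quatIm (polarMap (blockPerm (tailPerm σ) x i)) = 0 := by
          rw [polarMap, h0]; ext <;> simp [quatIm_apply]
        simp only [h4, norm_zero, hz1] at h3
        norm_num at h3
      have h3 := Real.pi_pos
      have h4 : 0 < Real.sin (2 * Real.pi * blockPerm (tailPerm σ) x i 0) ^ 2 := by positivity
      have h5 := mul_pos (mul_pos h3 (neg_pos.2 h1)) h4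
      nlinarith
    have h1 : (∏ k, (Equiv.Perm.sign (headPerm σ⁻¹ k) : ℤ)) = Equiv.Perm.sign σ := by
      simp [Fin.prod_univ_succ, headPerm_zero, headPerm]
    have h2 : (∏ k, (Equiv.Perm.sign (tailPerm σ k) : ℤ)) = (Equiv.Perm.sign σ : ℤ) ^ 3 := by
      simp [Fin.prod_univ_succ, tailPerm]
    rw [h1, h2]
    push_cast
    set c : ℝ := ((Equiv.Perm.sign σ : ℤ) : ℝ)
    have hc : ∀ a : ℝ, c * (a * c ^ 3) = a := fun a => by
      rw [show c * (a * c ^ 3) = (c * c) * (c * c) * a by ring, hs, one_mul, one_mul]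
    rw [hc]
    exact hprod
  have hfin := finite_preimage (hR.isOpen_cfgDom hN) ((hR.contDiffOn_cfgMap hN).of_le one_le_two) hK hKU
    (y₀ := z) (fun x hx h => hKS x hx (h ▸ Metric.mem_closedBall_self hδ.le))
    (fun x hx h => (hpos x hx h).ne')
  obtain ⟨ε, hε, h⟩ := degI_eq_sum_sign volume (hR.isOpen_cfgDom hN)
    ((hR.contDiffOn_cfgMap hN).of_le one_le_two) hK hKU hδ
    (fun x hx h => hKS x hx (Metric.ball_subset_closedBall h))
    (fun x hx h => (hpos x hx h).ne') hfin
  refine ⟨ε, hε, fun Ψ hΨ hΨs => ?_⟩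
  rw [h Ψ hΨ hΨs]
  congr 1
  rw [Finset.sum_congr rfl (g := fun _ => (1 : ℤ)) fun x hx => by
    rw [hfin.mem_toFinset] at hx
    rw [sign_pos (hpos x hx.1 hx.2)]; rfl]
  set pre : (Fin 3 → Bool) → Fin 3 → Fin 4 → ℝ := fun b => (blockPerm (tailPerm σ)).symm fun i =>
    if b i then ![5 / 12, 2 * z i 1, 2 * z i 2, 2 * z i 3] else
      ![7 / 12, -(2 * z i 1), -(2 * z i 2), -(2 * z i 3)] with hpre
  have hinj : Function.Injective pre := fun b b' hbb => by
    have h1 := (blockPerm (tailPerm σ)).symm.injective hbb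
    funext i
    have h2 := congrFun (congrFun h1 i) 0
    by_cases hb : b i = true <;> by_cases hb' : b' i = true <;> simp [hb, hb'] at h2 ⊢ <;> norm_num at h2
  have himg : hfin.toFinset = Finset.univ.image pre := by
    ext x
    rw [hfin.mem_toFinset, Finset.mem_image]
    constructor
    · rintro ⟨hx, hxz⟩
      have h1 : ∀ i, _ := fun i => (polarMap_eq_iff (x := blockPerm (tailPerm σ) x i)
        ((blockPerm_tailPerm_mem σ).2 hx.1 i) (hx.2.1 i) (hcos x hx i) (hz0 i) (hz1 i)).1
          (hpt x hx hxz i)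
      classical
      refine ⟨fun i => decide (blockPerm (tailPerm σ) x i =
        ![5 / 12, 2 * z i 1, 2 * z i 2, 2 * z i 3]), Finset.mem_univ _, ?_⟩
      rw [hpre]
      simp only [decide_eq_true_eq]
      refine (blockPerm (tailPerm σ)).symm_apply_eq.2 (funext fun i => ?_)
      split_ifs with h2
      · exact h2.symm
      · exact ((h1 i).resolve_left h2).symm
    · rintro ⟨b, -, rfl⟩
      have hb : ∀ i, blockPerm (tailPerm σ) (pre b) i =
          if b i then ![5 / 12, 2 * z i 1, 2 * z i 2, 2 * z i 3] else
            ![7 / 12, -(2 * z i 1), -(2 * z i 2), -(2 * z i 3)] := fun i =>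
        congrFun ((blockPerm (tailPerm σ)).apply_symm_apply _) i
      have hb0 : ∀ i, pre b i 0 = if b i then 5 / 12 else 7 / 12 := fun i => by
        have := congrFun (hb i) 0
        rw [blockPerm_apply, tailPerm_zero] at this
        by_cases h : b i = true <;> simpa [h] using this
      have hbn : ∀ i, quatIm (blockPerm (tailPerm σ) (pre b) i) ≠ 0 := fun i => by
        have hzi : quatIm (z i) ≠ 0 := by rw [← norm_ne_zero_iff, hz1]; norm_num
        have : quatIm (blockPerm (tailPerm σ) (pre b) i) = (if b i then (2 : ℝ) else -2) • quatIm (z i) := by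
          rw [hb]
          by_cases h : b i = true <;> ext <;> simp [h, quatIm_apply]
        rw [this]
        refine smul_ne_zero ?_ hzi
        split_ifs <;> norm_num
      have hnz : pre b ∈ nzConf := (blockPerm_tailPerm_mem σ).1 hbn
      have hcb : ∀ i, Real.cos (2 * Real.pi * pre b i 0) < 0 := fun i => by
        have := Real.pi_pos
        rw [hb0]
        split_ifs <;> exact Real.cos_neg_of_pi_div_two_lt_of_lt (by linarith) (by linarith)
      have hIoo : ∀ i, pre b i 0 ∈ Ioo (0 : ℝ) 1 := fun i => by
        rw [hb0]
        split_ifs <;> norm_num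
      refine ⟨⟨hnz, hIoo, fun i => oneSlot_id_mem σ hnz i, fun i => ?_⟩, ?_⟩
      · rw [hR.oneSlot_value σ hnz i]
        simpa [quatIm_apply] using hcb i
      · have h1 : polarMap₃ (blockPerm (tailPerm σ) (pre b)) = z := funext fun i =>
          (polarMap_eq_iff (hbn i) (hIoo i) (hcb i) (hz0 i) (hz1 i)).2 (by
            rw [hb]; split_ifs
            · exact Or.inl rfl
            · exact Or.inr rfl)
        rw [hR.cfgMap_oneSlot σ hnz, h1]
        ext i k
        rw [blockPerm_apply]
        refine Fin.cases ?_ (fun k => ?_) k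
        · rw [hz0, hz0]
        · rw [headPerm_succ]; rfl
  rw [himg, Finset.sum_const, Finset.card_image_of_injective _ hinj]
  simp

end count

/-- Three equally spaced values on a rotating circle. -/
def zPt (t : ℝ) (i : Fin 3) : Fin 4 → ℝ :=
  ![1, 0, Real.cos (2 * Real.pi * (t + i) / 3) / 2, Real.sin (2 * Real.pi * (t + i) / 3) / 2]

lemma contDiff_zPt : ContDiff ℝ 2 zPt := by
  refine contDiff_pi.2 fun i => contDiff_pi.2 fun k => ?_
  have h : ContDiff ℝ 2 fun t : ℝ => 2 * Real.pi * (t + i) / 3 :=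
    (contDiff_const.mul (contDiff_id.add contDiff_const)).div_const _
  fin_cases k
  · exact contDiff_const
  · exact contDiff_const
  · exact (Real.contDiff_cos.comp h).div_const 2
  · exact (Real.contDiff_sin.comp h).div_const 2

lemma norm_quatIm_zPt (t : ℝ) (i : Fin 3) : ‖quatIm (zPt t i)‖ = 1 / 2 := by
  have h := norm_sq_quatIm (zPt t i)
  have h1 : ‖quatIm (zPt t i)‖ ^ 2 = (1 / 2) ^ 2 := by
    rw [h]
    simp only [zPt, Matrix.cons_val]
    linear_combination (1 / 4) * Real.sin_sq_add_cos_sq (2 * Real.pi * (t + i) / 3)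
  exact (sq_eq_sq₀ (norm_nonneg _) (by norm_num)).1 h1

lemma zPt_mem (t : ℝ) : zPt t ∈ goodVal := by
  refine ⟨fun i => one_pos, fun i => by rw [norm_quatIm_zPt]; norm_num, fun i => ?_, fun i j hij h => ?_⟩
  · by_contra! h
    have h1 := norm_sq_quatIm (zPt t i)
    rw [norm_quatIm_zPt, h.1, h.2] at h1
    norm_num [zPt] at h1
  · have h2 := congrArg QuaternionAlgebra.imJ h
    have h3 := congrArg QuaternionAlgebra.imK h
    simp only [quatIm_imJ, quatIm_imK, zPt, Matrix.cons_val] at h2 h3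
    set a := 2 * Real.pi * (t + i) / 3 with ha
    set b := 2 * Real.pi * (t + j) / 3 with hb
    have h4 : Real.cos (a - b) = 1 := by
      rw [Real.cos_sub]
      have e1 : Real.cos a = Real.cos b := by linarith
      have e2 : Real.sin a = Real.sin b := by linarith
      rw [e1, e2]
      linear_combination Real.sin_sq_add_cos_sq b
    obtain ⟨n, hn⟩ := (Real.cos_eq_one_iff _).1 h4
    have h5 : Real.pi * (3 * n - ((i : ℕ) - (j : ℕ) : ℝ)) = 0 := by
      rw [ha, hb] at hn
      linear_combination (3 / 2) * hn
    have h6 : (3 * n - ((i : ℕ) - (j : ℕ) : ℝ)) = 0 := (mul_eq_zero.1 h5).resolve_left Real.pi_ne_zero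
    have h7 : 3 * n = ((i : ℕ) : ℤ) - (j : ℕ) := by
      have : (3 * n : ℝ) = ((i : ℕ) : ℝ) - (j : ℕ) := by linarith
      exact_mod_cast this
    exact hij (by omega)

lemma zPt_one : zPt 1 = blockPerm (tailPerm (finRotate 3)) (zPt 0) := by
  ext i k
  rw [blockPerm_apply]
  have e : 2 * Real.pi * (1 + 2) / 3 = 0 + 2 * Real.pi := by ring
  refine Fin.cases rfl (fun k => ?_) k
  rw [tailPerm_succ]
  fin_cases i <;> fin_cases k <;> simp [zPt, finRotate_apply, e] <;> norm_num

lemma exists_compact_goodVal : ∃ S ⊆ goodVal, IsCompact S ∧ ∃ δ > 0, ∀ t ∈ Icc (0 : ℝ) 1,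
    ∀ y, dist y (zPt t) < δ → y ∈ S := by
  have hK : IsCompact (zPt '' Icc 0 1) := isCompact_Icc.image contDiff_zPt.continuous
  obtain ⟨δ, hδ, h⟩ := hK.exists_cthickening_subset_open isOpen_goodVal
    (image_subset_iff.2 fun t _ => zPt_mem t)
  refine ⟨_, h, hK.cthickening, δ, hδ, fun t ht y hy => ?_⟩
  exact Metric.mem_cthickening_of_dist_le y _ δ _ (mem_image_of_mem _ ht) hy.le

lemma exists_bump {ε : ℝ} (hε : 0 < ε) : ∃ Ψ : (Fin 3 → Fin 4 → ℝ) → ℝ, ContDiff ℝ 1 Ψ ∧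
    (∀ y, Ψ y ≠ 0 → y ∈ Metric.ball 0 ε) ∧ (∀ τ y, Ψ (blockPerm τ y) = Ψ y) ∧ 0 < ∫ y, Ψ y := by
  have hc : ∀ i k, ContDiff ℝ 1 fun y : Fin 3 → Fin 4 → ℝ => y i k := fun i k =>
    (contDiff_apply ℝ ℝ k).comp (contDiff_apply ℝ (Fin 4 → ℝ) i)
  set Ψ : (Fin 3 → Fin 4 → ℝ) → ℝ := fun y =>
    Real.smoothTransition (1 - (ε ^ 2)⁻¹ * ∑ k, ∑ i, y i k ^ 2) with hΨ
  have hC : ContDiff ℝ 1 Ψ := Real.smoothTransition.contDiff.comp (contDiff_const.sub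
    (contDiff_const.mul (ContDiff.sum fun k _ => ContDiff.sum fun i _ => (hc i k).pow 2)))
  have hs : ∀ y, Ψ y ≠ 0 → y ∈ Metric.ball 0 ε := fun y hy => by
    have h1 : ∑ k, ∑ i, y i k ^ 2 < ε ^ 2 := by
      by_contra! h1
      refine hy (Real.smoothTransition.zero_of_nonpos ?_)
      rw [← div_eq_inv_mul, sub_nonpos]
      exact (one_le_div (by positivity)).2 h1
    rw [mem_ball_zero_iff, pi_norm_lt_iff hε]
    intro i
    rw [pi_norm_lt_iff hε]
    intro k
    rw [Real.norm_eq_abs]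
    refine abs_lt_of_sq_lt_sq (lt_of_le_of_lt ?_ h1) hε.le
    exact (Finset.single_le_sum (f := fun i => y i k ^ 2) (fun i _ => sq_nonneg _) (Finset.mem_univ i)).trans
      (Finset.single_le_sum (f := fun k => ∑ i, y i k ^ 2)
        (fun k _ => Finset.sum_nonneg fun i _ => sq_nonneg _) (Finset.mem_univ k))
  have hcs : HasCompactSupport Ψ := HasCompactSupport.intro (isCompact_closedBall 0 ε) fun y hy => by
    by_contra h0
    exact hy (Metric.ball_subset_closedBall (hs y h0))
  refine ⟨Ψ, hC, hs, fun τ y => ?_, ?_⟩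
  · rw [hΨ]
    simp only [blockPerm_apply]
    congr 3
    exact Finset.sum_congr rfl fun k _ => Equiv.sum_comp (τ k) fun i => y i k ^ 2
  · refine hC.continuous.integral_pos_of_hasCompactSupport_nonneg_nonzero hcs
      (fun y => Real.smoothTransition.nonneg _) (x := 0) ?_
    simp [hΨ]

/-- The configuration map of the family itself. -/
def diagMap (R : ℝ × (Fin 3 → Fin 4 → ℝ) → ℍ[ℝ]) : (Fin 3 → Fin 4 → ℝ) → Fin 3 → Fin 4 → ℝ :=
  cfgMap R (allSlot fun _ y => y)

/-- The domain of the configuration map of the family itself. -/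
def diagDom (R : ℝ × (Fin 3 → Fin 4 → ℝ) → ℍ[ℝ]) : Set (Fin 3 → Fin 4 → ℝ) :=
  cfgDom R (allSlot fun _ y => y)

/-- The part of the domain on which the loop parameters are in a given order. -/
def ordPiece (R : ℝ × (Fin 3 → Fin 4 → ℝ) → ℍ[ℝ]) (τ : Equiv.Perm (Fin 3)) :
    Set (Fin 3 → Fin 4 → ℝ) :=
  diagDom R ∩ {q | StrictMono fun i => q (τ i) 0}

/-- Coordinatewise scaling. -/
def scaleEquiv (c : Fin 3 → Fin 4 → ℝ) (hc : ∀ i k, c i k ≠ 0) :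
    (Fin 3 → Fin 4 → ℝ) ≃L[ℝ] (Fin 3 → Fin 4 → ℝ) :=
  LinearEquiv.toContinuousLinearEquiv
    { toFun := fun q i k => c i k * q i k
      invFun := fun q i k => (c i k)⁻¹ * q i k
      map_add' := fun _ _ => funext fun _ => funext fun _ => mul_add _ _ _
      map_smul' := fun _ _ => funext fun _ => funext fun _ => mul_left_comm _ _ _
      left_inv := fun _ => funext fun i => funext fun k => inv_mul_cancel_left₀ (hc i k) _
      right_inv := fun _ => funext fun i => funext fun k => mul_inv_cancel_left₀ (hc i k) _ }

lemma scaleEquiv_apply (c : Fin 3 → Fin 4 → ℝ) (hc : ∀ i k, c i k ≠ 0) (q : Fin 3 → Fin 4 → ℝ)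
    (i : Fin 3) (k : Fin 4) : scaleEquiv c hc q i k = c i k * q i k := rfl

lemma contDiffOn_allSlot_id : ContDiffOn ℝ 2 (allSlot fun _ y => y) nzConf :=
  ContDiff.contDiffOn (contDiff_pi.2 fun _ => contDiff_pi.2 fun j => contDiff_apply ℝ (Fin 4 → ℝ) j)

section diag

variable {R : ℝ × (Fin 3 → Fin 4 → ℝ) → ℍ[ℝ]}

lemma SymFamily.isOpen_diagDom (hR : SymFamily R) : IsOpen (diagDom R) :=
  hR.isOpen_cfgDom contDiffOn_allSlot_id

lemma SymFamily.contDiffOn_diagMap (hR : SymFamily R) : ContDiffOn ℝ 2 (diagMap R) (diagDom R) :=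
  hR.contDiffOn_cfgMap contDiffOn_allSlot_id

lemma SymFamily.isOpen_ordPiece (hR : SymFamily R) (τ : Equiv.Perm (Fin 3)) :
    IsOpen (ordPiece R τ) := by
  refine hR.isOpen_diagDom.inter ?_
  simp only [StrictMono, ofPred_forall]
  exact isOpen_iInter_of_finite fun i => isOpen_iInter_of_finite fun j =>
    isOpen_iInter_of_finite fun _ => isOpen_lt
      ((continuous_apply 0).comp (continuous_apply (τ i)))
      ((continuous_apply 0).comp (continuous_apply (τ j)))

lemma diagMap_ne {q : Fin 3 → Fin 4 → ℝ} (h : diagMap R q ∈ goodVal) {i j : Fin 3} (hij : i ≠ j) :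
    q i 0 ≠ q j 0 := fun h0 => by
  refine h.2.2.2 i j hij ?_
  have e : ∀ i, quatIm (diagMap R q i) = quatMk 0 (R (q i 0, q)).imI (R (q i 0, q)).imJ
      (R (q i 0, q)).imK := fun i => rfl
  rw [e, e, h0]

lemma SymFamily.exists_isCompact_diagDom (hR : SymFamily R) {S : Set (Fin 3 → Fin 4 → ℝ)}
    (hS : IsCompact S) (hSg : S ⊆ goodVal) :
    ∃ K ⊆ diagDom R, IsCompact K ∧ ∀ q ∈ diagDom R, diagMap R q ∈ S → q ∈ K :=
  hR.exists_isCompact contDiffOn_allSlot_id (fun _ hq _ => hq) hS (fun _ hw => (hSg hw).1)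
    fun _ hw => (hSg hw).2.1

lemma SymFamily.exists_isCompact_ordPiece (hR : SymFamily R) (τ : Equiv.Perm (Fin 3))
    {S : Set (Fin 3 → Fin 4 → ℝ)} (hS : IsCompact S) (hSg : S ⊆ goodVal) :
    ∃ K ⊆ ordPiece R τ, IsCompact K ∧ ∀ q ∈ ordPiece R τ, diagMap R q ∈ S → q ∈ K := by
  obtain ⟨K, hKU, hK, hKS⟩ := hR.exists_isCompact_diagDom hS hSg
  have hc : IsClosed {q : Fin 3 → Fin 4 → ℝ | Monotone fun i => q (τ i) 0} := by
    simp only [Monotone, ofPred_forall]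
    exact isClosed_iInter fun i => isClosed_iInter fun j => isClosed_iInter fun _ => isClosed_le
      ((continuous_apply 0).comp (continuous_apply (τ i)))
      ((continuous_apply 0).comp (continuous_apply (τ j)))
  refine ⟨K ∩ diagMap R ⁻¹' S ∩ {q | Monotone fun i => q (τ i) 0}, ?_, ?_, ?_⟩
  · rintro q ⟨⟨hq, hqS⟩, hm⟩
    refine ⟨hKU hq, fun i j hij => lt_of_le_of_ne (hm hij.le) ?_⟩
    exact diagMap_ne (hSg hqS) (τ.injective.ne hij.ne)
  · exact (hK.of_isClosed_subset ((hR.contDiffOn_diagMap.continuousOn.mono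
      hKU).preimage_isClosed_of_isClosed hK.isClosed hS.isClosed) inter_subset_left).inter_right hc
  · exact fun q hq hqS => ⟨⟨hKS q hq.1 hqS, hqS⟩, hq.2.monotone⟩

lemma exists_mem_ordPiece {q : Fin 3 → Fin 4 → ℝ} (hq : q ∈ diagDom R)
    (h : diagMap R q ∈ goodVal) : ∃ τ, q ∈ ordPiece R τ := by
  refine ⟨Tuple.sort fun i => q i 0, hq, fun i j hij => ?_⟩
  exact lt_of_le_of_ne (Tuple.monotone_sort (fun i => q i 0) hij.le)
    (diagMap_ne h ((Tuple.sort _).injective.ne hij.ne))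

lemma disjoint_ordPiece : Pairwise (Function.onFun Disjoint (ordPiece R)) := by
  intro τ τ' hne
  refine disjoint_left.2 fun q hq hq' => hne (Equiv.ext fun i => ?_)
  have h := Tuple.unique_monotone (f := fun i => q i 0) (σ := τ) (τ := τ') hq.2.monotone hq'.2.monotone
  have h1 := congrFun h i
  have hinj : Function.Injective fun i => q i 0 := fun a b hab => by
    have := hq.2.injective (a₁ := τ.symm a) (a₂ := τ.symm b) (by simpa using hab)
    exact τ.symm.injective this
  exact hinj h1

lemma SymFamily.eq_of_quatIm_eq (hR : SymFamily R) {q q' : Fin 3 → Fin 4 → ℝ} (hq : q ∈ nzConf)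
    (h : ∀ j, quatIm (q' j) = quatIm (q j)) (s : ℝ) : R (s, q') = R (s, q) :=
  hR.homog s q q' hq fun j => ⟨1, one_pos, by rw [one_smul, h]⟩

lemma SymFamily.family_tailPerm (hR : SymFamily R) (c : Equiv.Perm (Fin 3))
    {q : Fin 3 → Fin 4 → ℝ} (hq : q ∈ nzConf) (s : ℝ) :
    R (s, blockPerm (tailPerm c) q) = R (s, q) := by
  rw [← hR.symm s q c]
  exact hR.eq_of_quatIm_eq (q' := blockPerm (tailPerm c) q) (fun j => hq (c j)) (fun j => rfl) s

lemma SymFamily.family_headPerm (hR : SymFamily R) (c : Equiv.Perm (Fin 3))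
    {q : Fin 3 → Fin 4 → ℝ} (hq : q ∈ nzConf) (s : ℝ) :
    R (s, blockPerm (headPerm c) q) = R (s, q) :=
  hR.eq_of_quatIm_eq (q' := blockPerm (headPerm c) q) hq (fun j => rfl) s

lemma SymFamily.diagMap_blockPerm_tailPerm (hR : SymFamily R) (c : Equiv.Perm (Fin 3))
    {q : Fin 3 → Fin 4 → ℝ} (hq : q ∈ nzConf) :
    diagMap R (blockPerm (tailPerm c) q) = blockPerm (headPerm c) (diagMap R q) := by
  have e : diagMap R (blockPerm (tailPerm c) q) = fun i => quatVec (‖quatIm (q (c i))‖ ^ 2)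
      (R (q i 0, q)) := funext fun i =>
    congrArg (quatVec _) (hR.family_tailPerm c hq (q i 0))
  rw [e]
  ext i k
  fin_cases k <;> rfl

lemma SymFamily.diagMap_blockPerm_headPerm (hR : SymFamily R) (c : Equiv.Perm (Fin 3))
    {q : Fin 3 → Fin 4 → ℝ} (hq : q ∈ nzConf) :
    diagMap R (blockPerm (headPerm c) q) = blockPerm (tailPerm c) (diagMap R q) := by
  have e : diagMap R (blockPerm (headPerm c) q) = fun i => quatVec (‖quatIm (q i)‖ ^ 2)
      (R (q (c i) 0, q)) := funext fun i =>
    congrArg (quatVec _) (hR.family_headPerm c hq (q (c i) 0))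
  rw [e]
  ext i k
  fin_cases k <;> rfl

lemma SymFamily.blockPerm_tailPerm_mem_ordPiece (hR : SymFamily R) (c τ : Equiv.Perm (Fin 3))
    {q : Fin 3 → Fin 4 → ℝ} (hq : q ∈ ordPiece R τ) : blockPerm (tailPerm c) q ∈ ordPiece R τ := by
  have hn : blockPerm (tailPerm c) q ∈ nzConf := (blockPerm_tailPerm_mem c).2 hq.1.1
  refine ⟨⟨hn, hq.1.2.1, fun _ => hn, fun i => ?_⟩, hq.2⟩
  exact (congrArg QuaternionAlgebra.re (hR.family_tailPerm c hq.1.1 (q i 0))).trans_lt (hq.1.2.2.2 i)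

lemma SymFamily.mem_ordPiece_mul (hR : SymFamily R) (c τ : Equiv.Perm (Fin 3))
    {q : Fin 3 → Fin 4 → ℝ} : q ∈ ordPiece R (c * τ) ↔ blockPerm (headPerm c) q ∈ ordPiece R τ := by
  have key : ∀ (c : Equiv.Perm (Fin 3)) (q : Fin 3 → Fin 4 → ℝ), q ∈ diagDom R →
      blockPerm (headPerm c) q ∈ diagDom R := fun c q hq =>
    ⟨hq.1, fun i => hq.2.1 (c i), fun _ => hq.1, fun i =>
      (congrArg QuaternionAlgebra.re (hR.family_headPerm c hq.1 (q (c i) 0))).trans_lt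
        (hq.2.2.2 (c i))⟩
  refine ⟨fun h => ⟨key c q h.1, h.2⟩, fun h => ⟨?_, h.2⟩⟩
  have h1 := key c⁻¹ _ h.1
  have h2 : blockPerm (headPerm c⁻¹) (blockPerm (headPerm c) q) = q := by
    ext i k
    refine Fin.cases ?_ (fun k => ?_) k
    · exact congrArg (fun i => q i 0) (c.apply_symm_apply i)
    · rfl
  rwa [h2] at h1

/-- Near every configuration there is a regular value with unit norms. -/
lemma SymFamily.exists_regular (hR : SymFamily R) {z : Fin 3 → Fin 4 → ℝ} (hz : z ∈ goodVal)
    (hz0 : ∀ i, z i 0 = 1) {δ : ℝ} (hδ : 0 < δ) :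
    ∃ z', dist z' z < δ ∧ (∀ i, z' i 0 = 1) ∧
      ∀ x ∈ diagDom R, diagMap R x = z' → (fderiv ℝ (diagMap R) x).det ≠ 0 := by
  set G := diagMap R with hG
  have hU := hR.isOpen_diagDom
  have hd : ∀ x ∈ diagDom R, DifferentiableAt ℝ G x := fun x hx =>
    (hR.contDiffOn_diagMap.differentiableOn two_ne_zero).differentiableAt (hU.mem_nhds hx)
  have h0 : volume (G '' {x | x ∈ diagDom R ∧ (fderiv ℝ G x).det = 0}) = 0 :=
    addHaar_image_eq_zero_of_det_fderivWithin_eq_zero volume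
      (fun x hx => (hd x hx.1).hasFDerivAt.hasFDerivWithinAt) fun x hx => hx.2
  have hO : IsOpen (Metric.ball z δ ∩ goodVal) := Metric.isOpen_ball.inter isOpen_goodVal
  obtain ⟨w, ⟨hwz, hw⟩, hwn⟩ : ∃ w ∈ Metric.ball z δ ∩ goodVal,
      w ∉ G '' {x | x ∈ diagDom R ∧ (fderiv ℝ G x).det = 0} := by
    by_contra! h
    exact (hO.measure_pos volume ⟨z, Metric.mem_ball_self hδ, hz⟩).ne'
      (measure_mono_null h h0)
  have hw0 := hw.1
  refine ⟨fun i k => if k = 0 then 1 else w i k, ?_, fun i => rfl, fun x hx hxz hdet => hwn ?_⟩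
  · refine lt_of_le_of_lt ((dist_pi_le_iff dist_nonneg).2 fun i => (dist_pi_le_iff dist_nonneg).2
      fun k => ?_) (Metric.mem_ball.1 hwz)
    by_cases hk : k = 0
    · simp [hk, hz0]
    · simp only [hk, if_false]
      exact (dist_le_pi_dist (w i) (z i) k).trans (dist_le_pi_dist w z i)
  · set M := scaleEquiv (fun i k => if k = 0 then 1 else √(w i 0)) (fun i k => by
      split_ifs
      · exact one_ne_zero
      · exact (Real.sqrt_pos.2 (hw0 i)).ne')
    set M' := scaleEquiv (fun i k => if k = 0 then w i 0 else 1) (fun i k => by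
      split_ifs
      · exact (hw0 i).ne'
      · exact one_ne_zero)
    have hq : ∀ q i, quatIm (M q i) = √(w i 0) • quatIm (q i) := fun q i => by
      ext <;> simp [M, scaleEquiv_apply, quatIm_apply]
    have h00 : ∀ q i, M q i 0 = q i 0 := fun q i => one_mul _
    have hMn : ∀ q ∈ nzConf, M q ∈ nzConf := fun q hqn j => by
      rw [hq]; exact smul_ne_zero (Real.sqrt_pos.2 (hw0 j)).ne' (hqn j)
    have hRM : ∀ q ∈ nzConf, ∀ s, R (s, M q) = R (s, q) := fun q hqn s =>
      hR.homog s q _ hqn fun j => ⟨_, Real.sqrt_pos.2 (hw0 j), hq q j⟩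
    have hGM : ∀ q ∈ nzConf, G (M q) = M' (G q) := fun q hqn => by
      have e : G (M q) = fun i => quatVec (w i 0 * ‖quatIm (q i)‖ ^ 2) (R (q i 0, q)) := by
        funext i
        have : G (M q) i = quatVec (‖quatIm (M q i)‖ ^ 2) (R (M q i 0, M q)) := rfl
        rw [this, hq, h00, hRM q hqn, norm_smul, Real.norm_of_nonneg (Real.sqrt_nonneg _), mul_pow,
          Real.sq_sqrt (hw0 i).le]
      rw [e]
      ext i k
      rw [scaleEquiv_apply]
      fin_cases k
      · rfl
      · exact (one_mul _).symm
      · exact (one_mul _).symm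
      · exact (one_mul _).symm
    have hMx : M x ∈ diagDom R := ⟨hMn x hx.1, fun i => by rw [h00]; exact hx.2.1 i,
      fun _ => hMn x hx.1, fun i => by
        have := hx.2.2.2 i
        rw [h00]
        exact (congrArg QuaternionAlgebra.re (hRM x hx.1 (x i 0))).trans_lt this⟩
    refine ⟨M x, ⟨hMx, ?_⟩, ?_⟩
    · have h1 : HasFDerivAt (fun q => G (M q)) ((fderiv ℝ G (M x)).comp (M : _ →L[ℝ] _)) x :=
        (hd _ hMx).hasFDerivAt.comp x M.hasFDerivAt
      have h2 : HasFDerivAt (fun q => M' (G q)) ((M' : _ →L[ℝ] _).comp (fderiv ℝ G x)) x :=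
        M'.hasFDerivAt.comp x (hd x hx).hasFDerivAt
      have h3 : (fun q => G (M q)) =ᶠ[𝓝 x] fun q => M' (G q) :=
        Filter.eventuallyEq_of_mem (isOpen_nzConf.mem_nhds hx.1) fun q hqn => hGM q hqn
      have h4 := (h1.congr_of_eventuallyEq h3.symm).unique h2
      have e : ∀ f g : (Fin 3 → Fin 4 → ℝ) →L[ℝ] (Fin 3 → Fin 4 → ℝ),
        (f.comp g).det = f.det * g.det := fun f g => LinearMap.det_comp _ _
      have h5 := congrArg ContinuousLinearMap.det h4
      rw [e, e, hdet, mul_zero] at h5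
      exact (mul_eq_zero.1 h5).resolve_right (LinearEquiv.isUnit_det' M.toLinearEquiv).ne_zero
    · rw [hGM x hx.1, hxz]
      ext i k
      rw [scaleEquiv_apply]
      by_cases hk : k = 0
      · simp [hk]
      · simp [hk]

end diag

lemma det_tailPerm_finRotate :
    (blockPerm (tailPerm (finRotate 3)) : (Fin 3 → Fin 4 → ℝ) →L[ℝ] (Fin 3 → Fin 4 → ℝ)).det = 1 := by
  rw [blockPerm_det]
  simp [Fin.prod_univ_succ, tailPerm]

lemma det_headPerm_finRotate :
    (blockPerm (headPerm (finRotate 3)) : (Fin 3 → Fin 4 → ℝ) →L[ℝ] (Fin 3 → Fin 4 → ℝ)).det = 1 := by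
  rw [blockPerm_det]
  simp [Fin.prod_univ_succ, headPerm]

lemma blockPerm_cube {τ : Fin 4 → Equiv.Perm (Fin 3)} (h : ∀ k, τ k * (τ k * τ k) = 1)
    (q : Fin 3 → Fin 4 → ℝ) : blockPerm τ (blockPerm τ (blockPerm τ q)) = q := by
  ext i k
  exact congrArg (fun i => q i k) (Equiv.congr_fun (h k) i)

lemma finRotate_three_cube : finRotate 3 * (finRotate 3 * finRotate 3) = 1 := by decide

lemma three_dvd_sum_of_finRotate {n : Equiv.Perm (Fin 3) → ℤ}
    (h : ∀ τ, n (finRotate 3 * τ) = n τ) : 3 ∣ ∑ τ, n τ := by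
  have hu : (Finset.univ : Finset (Equiv.Perm (Fin 3))) =
      {1, finRotate 3 * 1, finRotate 3 * (finRotate 3 * 1), Equiv.swap 0 1,
        finRotate 3 * Equiv.swap 0 1, finRotate 3 * (finRotate 3 * Equiv.swap 0 1)} := by decide
  rw [hu, Finset.sum_insert (by decide), Finset.sum_insert (by decide), Finset.sum_insert (by decide),
    Finset.sum_insert (by decide), Finset.sum_insert (by decide), Finset.sum_singleton]
  simp only [h]
  exact ⟨n 1 + n (Equiv.swap 0 1), by ring⟩

section final

variable {R : ℝ × (Fin 3 → Fin 4 → ℝ) → ℍ[ℝ]}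

lemma SymFamily.exists_ordPiece_count (hR : SymFamily R) (τ : Equiv.Perm (Fin 3)) :
    ∃ n : ℤ, ∃ ε > 0, ∀ Ψ : (Fin 3 → Fin 4 → ℝ) → ℝ, ContDiff ℝ 1 Ψ →
      (∀ y, Ψ y ≠ 0 → y ∈ Metric.ball 0 ε) →
      degI volume (ordPiece R τ) (fun y => Ψ (y - zPt 0)) (diagMap R) = 3 * n * ∫ y, Ψ y := by
  obtain ⟨S, hSg, hS, δ, hδ, hδS⟩ := exists_compact_goodVal
  obtain ⟨z, hz, hz0, hreg⟩ := hR.exists_regular (zPt_mem 0) (fun _ => rfl) (half_pos hδ)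
  obtain ⟨K, hKU, hK, hKS⟩ := hR.exists_isCompact_ordPiece τ hS hSg
  have hU := hR.isOpen_ordPiece τ
  have hG : ContDiffOn ℝ 2 (diagMap R) (ordPiece R τ) := hR.contDiffOn_diagMap.mono inter_subset_left
  have hG1 := hG.of_le one_le_two
  have h0 : (0 : ℝ) ∈ Icc (0 : ℝ) 1 := by simp
  have hzS : ∀ y, dist y z < δ / 2 → y ∈ S := fun y hy => hδS 0 h0 y
    (lt_of_le_of_lt (dist_triangle y z _) (by linarith))
  have hr : ∀ x ∈ ordPiece R τ, diagMap R x = z → (fderiv ℝ (diagMap R) x).det ≠ 0 :=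
    fun x hx => hreg x hx.1
  have hfin := finite_preimage hU hG1 hK hKU (y₀ := z)
    (fun x hx h => hKS x hx (hzS _ (by rw [h, dist_self]; positivity))) hr
  have hc3 : ∀ k, tailPerm (finRotate 3) k * (tailPerm (finRotate 3) k * tailPerm (finRotate 3) k) = 1 ∧
      headPerm (finRotate 3) k * (headPerm (finRotate 3) k * headPerm (finRotate 3) k) = 1 := fun k => by
    refine Fin.cases ?_ (fun k => ?_) k
    · rw [tailPerm_zero, headPerm_zero]
      exact ⟨by simp, finRotate_three_cube⟩
    · rw [tailPerm_succ, headPerm_succ]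
      exact ⟨finRotate_three_cube, by simp⟩
  have hdvd := three_dvd_sum_sign hU hG1 (blockPerm (tailPerm (finRotate 3)))
    (blockPerm (headPerm (finRotate 3))) (blockPerm_cube fun k => (hc3 k).1)
    (blockPerm_cube fun k => (hc3 k).2) (fun x hx => hR.blockPerm_tailPerm_mem_ordPiece _ τ hx)
    (fun x hx => hR.diagMap_blockPerm_tailPerm _ hx.1.1)
    (by rw [blockPerm_trace, blockPerm_trace, ncard_fixedPoints_tailPerm,
      ncard_fixedPoints_headPerm]; norm_num) (y₀ := z) (by
      ext i k
      rw [blockPerm_apply]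
      refine Fin.cases ?_ (fun k => ?_) k
      · rw [hz0, hz0]
      · rw [headPerm_succ]; rfl) hr hfin
  obtain ⟨ε, hε, hsum⟩ := degI_eq_sum_sign volume hU hG1 hK hKU (half_pos hδ)
    (fun x hx h => hKS x hx (hzS _ h)) hr hfin
  obtain ⟨n, hn⟩ := hdvd
  refine ⟨n, min ε (δ / 2), lt_min hε (half_pos hδ), fun Ψ hΨ hΨs => ?_⟩
  have hs : ∀ y, Ψ y ≠ 0 → ‖y‖ < ε ∧ ‖y‖ < δ / 2 := fun y hy => by
    have := hΨs y hy
    rwa [mem_ball_zero_iff, lt_min_iff] at this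
  have h1 := degI_move volume hU hG hK hKU hKS hΨ (z := fun t => zPt 0 + t • (z - zPt 0))
    (contDiff_const.add (contDiff_id.smul contDiff_const)) fun t ht y hy => by
      refine hδS 0 h0 y ?_
      have h2 := (hs _ hy).2
      have h3 : ‖t • (z - zPt 0)‖ ≤ δ / 2 := by
        rw [norm_smul, Real.norm_of_nonneg ht.1, ← dist_eq_norm]
        nlinarith [ht.2, dist_nonneg (x := z) (y := zPt 0), ht.1]
      have h4 : y - zPt 0 = (y - (zPt 0 + t • (z - zPt 0))) + t • (z - zPt 0) := by abel
      rw [dist_eq_norm, h4]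
      exact lt_of_le_of_lt (norm_add_le _ _) (by linarith)
  simp only [zero_smul, add_zero, one_smul, add_sub_cancel] at h1
  rw [h1, hsum (fun y => Ψ (y - z)) (hΨ.continuous.comp (continuous_sub_right z))
    (fun y hy => by rw [mem_ball_iff_norm]; exact (hs _ hy).1), hn, integral_sub_right_eq_self Ψ z]
  push_cast
  ring

lemma SymFamily.exists_ordPiece_rotate (hR : SymFamily R) (τ : Equiv.Perm (Fin 3)) :
    ∃ ε > 0, ∀ Ψ : (Fin 3 → Fin 4 → ℝ) → ℝ, ContDiff ℝ 1 Ψ →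
      (∀ y, Ψ y ≠ 0 → y ∈ Metric.ball 0 ε) → (∀ τ y, Ψ (blockPerm τ y) = Ψ y) →
      degI volume (ordPiece R τ) (fun y => Ψ (y - zPt 0)) (diagMap R) =
        degI volume (ordPiece R (finRotate 3 * τ)) (fun y => Ψ (y - zPt 0)) (diagMap R) := by
  obtain ⟨S, hSg, hS, δ, hδ, hδS⟩ := exists_compact_goodVal
  obtain ⟨K, hKU, hK, hKS⟩ := hR.exists_isCompact_ordPiece τ hS hSg
  have hG : ∀ τ, ContDiffOn ℝ 2 (diagMap R) (ordPiece R τ) := fun τ =>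
    hR.contDiffOn_diagMap.mono inter_subset_left
  refine ⟨δ, hδ, fun Ψ hΨ hΨs hinv => ?_⟩
  rw [degI_move volume (hR.isOpen_ordPiece τ) (hG τ) hK hKU hKS hΨ contDiff_zPt
    fun t ht y hy => hδS t ht y (by rw [dist_eq_norm]; exact mem_ball_zero_iff.1 (hΨs _ hy)),
    degI_relabel volume (hR.isOpen_ordPiece τ) (hR.isOpen_ordPiece (finRotate 3 * τ))
      ((hG τ).of_le one_le_two) _ _ det_headPerm_finRotate det_tailPerm_finRotate
      (fun x => hR.mem_ordPiece_mul _ τ) ((hG _).of_le one_le_two)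
      (fun x hx => hR.diagMap_blockPerm_headPerm _ hx.1.1)]
  congr 1
  funext y
  rw [zPt_one, ← map_sub, hinv]

theorem not_symFamily : ¬ SymFamily R := by
  intro hR
  obtain ⟨S, hSg, hS, δ, hδ, hδS⟩ := exists_compact_goodVal
  choose n ε₁ hε₁ h₁ using hR.exists_ordPiece_count
  choose ε₂ hε₂ h₂ using hR.exists_ordPiece_rotate
  choose ε₃ hε₃ h₃ using fun σ => hR.exists_degI_oneSlot σ (zPt_mem 0) (fun _ => rfl)
    (norm_quatIm_zPt 0)
  set ε : ℝ := min δ (Finset.univ.inf' Finset.univ_nonempty fun σ => min (ε₁ σ) (min (ε₂ σ) (ε₃ σ)))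
    with hε
  have hεpos : 0 < ε := lt_min hδ ((Finset.lt_inf'_iff _).2 fun σ _ =>
    lt_min (hε₁ σ) (lt_min (hε₂ σ) (hε₃ σ)))
  have hεσ : ∀ σ, ε ≤ min (ε₁ σ) (min (ε₂ σ) (ε₃ σ)) := fun σ =>
    (min_le_right _ _).trans (Finset.inf'_le _ (Finset.mem_univ σ))
  obtain ⟨Ψ, hΨ, hΨs, hinv, hint⟩ := exists_bump hεpos
  have hs : ∀ r, ε ≤ r → ∀ y, Ψ y ≠ 0 → y ∈ Metric.ball 0 r := fun r hr y hy =>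
    Metric.ball_subset_ball hr (hΨs y hy)
  have e₁ := fun τ => h₁ τ Ψ hΨ (hs _ ((hεσ τ).trans (min_le_left _ _)))
  have e₂ := fun τ => h₂ τ Ψ hΨ (hs _ ((hεσ τ).trans ((min_le_right _ _).trans (min_le_left _ _)))) hinv
  have hΨ' : ContDiff ℝ 1 fun y => Ψ (y - zPt 0) := hΨ.comp (contDiff_id.sub contDiff_const)
  have e₃ := fun σ => h₃ σ (fun y => Ψ (y - zPt 0)) hΨ'.continuous fun y hy => by
    have := hs _ ((hεσ σ).trans ((min_le_right _ _).trans (min_le_right _ _))) _ hy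
    rwa [mem_ball_iff_norm, ← mem_ball_zero_iff]
  have hsupp : ∀ y, Ψ (y - zPt 0) ≠ 0 → y ∈ S := fun y hy => hδS 0 (by simp) y (by
    rw [dist_eq_norm]; exact mem_ball_zero_iff.1 (hs δ (min_le_left _ _) _ hy))
  have htot := hR.degI_eq_sum_oneSlot hS (fun z hz => (hSg hz).1) (fun z hz => (hSg hz).2.1)
    (fun z hz => (hSg hz).2.2.1) hΨ' hsupp
  obtain ⟨K, hKU, hK, hKS⟩ := hR.exists_isCompact_diagDom hS hSg
  have hpieces : degI volume (diagDom R) (fun y => Ψ (y - zPt 0)) (diagMap R) =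
      ∑ τ, degI volume (ordPiece R τ) (fun y => Ψ (y - zPt 0)) (diagMap R) :=
    degI_eq_sum volume hR.isOpen_diagDom (hR.contDiffOn_diagMap.of_le one_le_two) hΨ'.continuous hK hKU
      (fun x hx h => hKS x hx (hsupp _ h)) (hR.isOpen_ordPiece) (fun _ => inter_subset_left)
      disjoint_ordPiece fun x hx h => exists_mem_ordPiece hx (hSg (hsupp _ h))
  have hn : ∀ τ, n (finRotate 3 * τ) = n τ := fun τ => by
    have h := e₂ τ
    rw [e₁, e₁] at h
    have h' := mul_right_cancel₀ hint.ne' h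
    have : (n τ : ℝ) = n (finRotate 3 * τ) := by linarith
    exact_mod_cast this.symm
  obtain ⟨m, hm⟩ := three_dvd_sum_of_finRotate hn
  have hI : ∫ y, Ψ (y - zPt 0) = ∫ y, Ψ y := integral_sub_right_eq_self Ψ _
  have hcard : Fintype.card (Equiv.Perm (Fin 3)) = 6 := by decide
  rw [Finset.sum_congr rfl fun σ _ => e₃ σ, Finset.sum_const, Finset.card_univ, hcard, hI] at htot
  rw [Finset.sum_congr rfl fun τ _ => e₁ τ, ← Finset.sum_mul, ← Finset.mul_sum] at hpieces
  have hfin : (3 * ∑ τ, (n τ : ℝ)) * ∫ y, Ψ y = 48 * ∫ y, Ψ y := by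
    rw [← hpieces]
    refine Eq.trans htot ?_
    rw [nsmul_eq_mul]; push_cast; ring
  have h48 := mul_right_cancel₀ hint.ne' hfin
  have : 3 * ∑ τ, n τ = 48 := by exact_mod_cast h48
  omega

theorem not_basedHomotopic_commHopf :
    ¬ BasedHomotopic (usph 5) (bpt 7) (bpt 4) commHopf (fun _ => bpt 4) := fun h => by
  obtain ⟨R, h1, h2, h3, h4, h5, h6⟩ := exists_symmetric_family h
  exact not_symFamily ⟨h1, h2, h3, h4, h5, h6⟩

end final

section Fold

lemma hasDerivAt_mul_max (x : ℝ) : HasDerivAt (fun x : ℝ => x * max x 0) (2 * max x 0) x := by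
  rcases lt_trichotomy x 0 with h | rfl | h
  · have h1 : (fun x : ℝ => x * max x 0) =ᶠ[𝓝 x] fun _ => 0 := by
      filter_upwards [eventually_lt_nhds h] with y hy
      rw [max_eq_right hy.le, mul_zero]
    rw [max_eq_right h.le, mul_zero]
    exact (hasDerivAt_const x (0 : ℝ)).congr_of_eventuallyEq h1
  · rw [hasDerivAt_iff_isLittleO_nhds_zero]
    refine Asymptotics.IsBigO.trans_isLittleO (g := fun h : ℝ => h ^ 2) ?_ ?_
    · refine Asymptotics.IsBigO.of_bound 1 (Eventually.of_forall fun h => ?_)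
      simp only [zero_add, max_self, mul_zero, smul_eq_mul, sub_zero, norm_mul, norm_pow, one_mul,
        Real.norm_eq_abs, sq]
      refine mul_le_mul_of_nonneg_left ?_ (abs_nonneg h)
      simpa using abs_max_le_max_abs_abs (a := h) (b := 0)
    · exact Asymptotics.isLittleO_pow_id one_lt_two
  · have h1 : (fun x : ℝ => x * max x 0) =ᶠ[𝓝 x] fun y => y ^ 2 := by
      filter_upwards [eventually_gt_nhds h] with y hy
      rw [max_eq_left (le_of_lt hy), sq]
    rw [max_eq_left h.le]
    simpa using (hasDerivAt_pow 2 x).congr_of_eventuallyEq h1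

/-- A `C¹` ramp, vanishing below `1/10` and equal to one above `9/10`. -/
def ramp (s : ℝ) : ℝ :=
  40 / 3 * ((s - 1 / 10) * max (s - 1 / 10) 0 - (s - 3 / 20) * max (s - 3 / 20) 0
    - (s - 17 / 20) * max (s - 17 / 20) 0 + (s - 9 / 10) * max (s - 9 / 10) 0)

/-- The derivative of the ramp. -/
def rampDeriv (s : ℝ) : ℝ :=
  80 / 3 * (max (s - 1 / 10) 0 - max (s - 3 / 20) 0 - max (s - 17 / 20) 0 + max (s - 9 / 10) 0)

lemma hasDerivAt_ramp (s : ℝ) : HasDerivAt ramp (rampDeriv s) s := by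
  have h : ∀ c : ℝ, HasDerivAt (fun s => (s - c) * max (s - c) 0) (2 * max (s - c) 0) s :=
    fun c => by simpa using (hasDerivAt_mul_max (s - c)).comp_sub_const s c
  refine (((((h (1 / 10)).sub (h (3 / 20))).sub (h (17 / 20))).add (h (9 / 10))).const_mul
    (40 / 3)).congr_deriv ?_
  rw [rampDeriv]
  ring

lemma contDiff_ramp : ContDiff ℝ 1 ramp := by
  refine contDiff_one_iff_deriv.2 ⟨fun s => (hasDerivAt_ramp s).differentiableAt, ?_⟩
  rw [show deriv ramp = rampDeriv from funext fun s => (hasDerivAt_ramp s).deriv]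
  unfold rampDeriv
  fun_prop

lemma abs_rampDeriv_le (s : ℝ) : |rampDeriv s| ≤ 4 / 3 := by
  rw [rampDeriv, abs_le]
  rcases max_cases (s - 1 / 10) 0 with h1 | h1 <;> rcases max_cases (s - 3 / 20) 0 with h2 | h2 <;>
  rcases max_cases (s - 17 / 20) 0 with h3 | h3 <;> rcases max_cases (s - 9 / 10) 0 with h4 | h4 <;>
  constructor <;> linarith

lemma ramp_eq_zero {s : ℝ} (h : s ≤ 1 / 10) : ramp s = 0 := by
  rw [ramp, max_eq_right (by linarith), max_eq_right (by linarith), max_eq_right (by linarith),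
    max_eq_right (by linarith)]
  ring

lemma ramp_eq_one {s : ℝ} (h : 9 / 10 ≤ s) : ramp s = 1 := by
  rw [ramp, max_eq_left (by linarith), max_eq_left (by linarith), max_eq_left (by linarith),
    max_eq_left (by linarith)]
  ring

/-- A smooth step, vanishing for `x ≤ a` and equal to one for `x ≥ a + 1 / k`. -/
def stepFun (k a x : ℝ) : ℝ := Real.smoothTransition (k * (x - a))

lemma contDiff_stepFun (k a : ℝ) : ContDiff ℝ 1 (stepFun k a) :=
  Real.smoothTransition.contDiff.comp (by fun_prop)

lemma stepFun_eq_zero {k a x : ℝ} (hk : 0 ≤ k) (h : x ≤ a) : stepFun k a x = 0 :=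
  Real.smoothTransition.zero_of_nonpos (mul_nonpos_of_nonneg_of_nonpos hk (by linarith))

lemma stepFun_eq_one {k a x : ℝ} (h : 1 ≤ k * (x - a)) : stepFun k a x = 1 :=
  Real.smoothTransition.one_of_one_le h

lemma stepFun_nonneg (k a x : ℝ) : 0 ≤ stepFun k a x := Real.smoothTransition.nonneg _

lemma stepFun_le_one (k a x : ℝ) : stepFun k a x ≤ 1 := Real.smoothTransition.le_one _

/-- Three strands traversed back and forth. -/
def strand (u : ℝ) : ℝ :=
  4 * u + 3 + stepFun 4 (-1 / 2) u * (-8 * u - 3) + stepFun 4 (1 / 4) u * (8 * u - 3)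

/-- First component of the folding map. -/
def foldU (u s : ℝ) : ℝ :=
  strand u + stepFun 50 (94 / 100) s * (4 * u - 3 - strand u)
    + (1 - stepFun 50 (4 / 100) s) * (4 * u + 3 - strand u)

/-- The height along the three strands. -/
def strandHeight (u s : ℝ) : ℝ :=
  ramp s / 3 + stepFun 4 (-1 / 2) u * (2 - 2 * ramp s) / 3 + stepFun 4 (1 / 4) u * (2 * ramp s) / 3

/-- Second component of the folding map. -/
def foldS (u s : ℝ) : ℝ :=
  stepFun 100 (2 / 100) s * strandHeight u s + stepFun 100 (97 / 100) s * (1 - strandHeight u s)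

lemma contDiff_foldU : ContDiff ℝ 1 fun p : ℝ × ℝ => foldU p.1 p.2 := by
  have h1 := fun k a => (contDiff_stepFun k a).comp (contDiff_fst (E := ℝ) (F := ℝ))
  have h2 := fun k a => (contDiff_stepFun k a).comp (contDiff_snd (E := ℝ) (F := ℝ))
  simp only [Function.comp_def] at h1 h2
  unfold foldU strand
  fun_prop

lemma contDiff_foldS : ContDiff ℝ 1 fun p : ℝ × ℝ => foldS p.1 p.2 := by
  have h1 := fun k a => (contDiff_stepFun k a).comp (contDiff_fst (E := ℝ) (F := ℝ))
  have h2 := fun k a => (contDiff_stepFun k a).comp (contDiff_snd (E := ℝ) (F := ℝ))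
  have h3 := contDiff_ramp.comp (contDiff_snd (E := ℝ) (F := ℝ))
  simp only [Function.comp_def] at h1 h2 h3
  unfold foldS strandHeight
  fun_prop

lemma foldU_of_le {u s : ℝ} (h : s ≤ 94 / 100) :
    foldU u s = strand u + (1 - stepFun 50 (4 / 100) s) * (4 * u + 3 - strand u) := by
  rw [foldU, stepFun_eq_zero (by norm_num) h]; ring

lemma foldU_of_ge {u s : ℝ} (h : 6 / 100 ≤ s) :
    foldU u s = strand u + stepFun 50 (94 / 100) s * (4 * u - 3 - strand u) := by
  rw [foldU, stepFun_eq_one (a := 4 / 100) (by linarith)]; ring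

lemma one_le_strand {u : ℝ} (h1 : -1 / 2 ≤ u) (h2 : u ≤ -1 / 4) : 1 ≤ strand u := by
  rw [strand, stepFun_eq_zero (a := 1 / 4) (by norm_num) (by linarith)]
  nlinarith [stepFun_nonneg 4 (-1 / 2) u, stepFun_le_one 4 (-1 / 2) u]

lemma strand_le_neg_one {u : ℝ} (h1 : 1 / 4 ≤ u) (h2 : u ≤ 1 / 2) : strand u ≤ -1 := by
  rw [strand, stepFun_eq_one (a := -1 / 2) (by linarith)]
  nlinarith [stepFun_nonneg 4 (1 / 4) u, stepFun_le_one 4 (1 / 4) u]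

lemma strand_of_le {u : ℝ} (h : u ≤ -1 / 2) : strand u = 4 * u + 3 := by
  rw [strand, stepFun_eq_zero (a := 1 / 4) (by norm_num) (by linarith),
    stepFun_eq_zero (a := -1 / 2) (by norm_num) h]
  ring

lemma strand_of_mem {u : ℝ} (h1 : -1 / 4 ≤ u) (h2 : u ≤ 1 / 4) : strand u = -4 * u := by
  rw [strand, stepFun_eq_zero (a := 1 / 4) (by norm_num) h2,
    stepFun_eq_one (a := -1 / 2) (by linarith)]
  ring

lemma strand_of_ge {u : ℝ} (h : 1 / 2 ≤ u) : strand u = 4 * u - 3 := by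
  rw [strand, stepFun_eq_one (a := 1 / 4) (by linarith),
    stepFun_eq_one (a := -1 / 2) (by linarith)]
  ring

lemma strandHeight_of_le {u : ℝ} (s : ℝ) (h : u ≤ -1 / 2) : strandHeight u s = ramp s / 3 := by
  rw [strandHeight, stepFun_eq_zero (a := 1 / 4) (by norm_num) (by linarith),
    stepFun_eq_zero (a := -1 / 2) (by norm_num) h]
  ring

lemma strandHeight_of_mem {u : ℝ} (s : ℝ) (h1 : -1 / 4 ≤ u) (h2 : u ≤ 1 / 4) :
    strandHeight u s = 2 / 3 - ramp s / 3 := by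
  rw [strandHeight, stepFun_eq_zero (a := 1 / 4) (by norm_num) h2,
    stepFun_eq_one (a := -1 / 2) (by linarith)]
  ring

lemma strandHeight_of_ge {u : ℝ} (s : ℝ) (h : 1 / 2 ≤ u) :
    strandHeight u s = 2 / 3 + ramp s / 3 := by
  rw [strandHeight, stepFun_eq_one (a := 1 / 4) (by linarith),
    stepFun_eq_one (a := -1 / 2) (by linarith)]
  ring

lemma foldS_of_mem (u : ℝ) {s : ℝ} (h1 : 3 / 100 ≤ s) (h2 : s ≤ 97 / 100) :
    foldS u s = strandHeight u s := by
  rw [foldS, stepFun_eq_one (a := 2 / 100) (by linarith),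
    stepFun_eq_zero (a := 97 / 100) (by norm_num) h2]
  ring

lemma foldS_of_le (u : ℝ) {s : ℝ} (h : s ≤ 2 / 100) : foldS u s = 0 := by
  rw [foldS, stepFun_eq_zero (a := 2 / 100) (by norm_num) h,
    stepFun_eq_zero (a := 97 / 100) (by norm_num) (by linarith)]
  ring

lemma foldS_of_ge (u : ℝ) {s : ℝ} (h : 98 / 100 ≤ s) : foldS u s = 1 := by
  rw [foldS, stepFun_eq_one (a := 2 / 100) (by linarith),
    stepFun_eq_one (a := 97 / 100) (by linarith)]
  ring

lemma foldU_le_neg_one {u : ℝ} (s : ℝ) (h : u ≤ -1) : foldU u s ≤ -1 := by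
  have h1 := stepFun_nonneg 50 (94 / 100) s
  rw [foldU, strand_of_le (by linarith)]
  nlinarith

lemma one_le_foldU {u : ℝ} (s : ℝ) (h : 1 ≤ u) : 1 ≤ foldU u s := by
  have h1 := stepFun_le_one 50 (4 / 100) s
  rw [foldU, strand_of_ge (by linarith)]
  nlinarith

/-- Locally, the folding map either leaves the strip, or has constant height, or is an affine
function times a small multiple of the ramp. -/
lemma fold_cases (u s : ℝ) : 1 ≤ |foldU u s| ∨
    (∃ c, ∀ᶠ p : ℝ × ℝ in 𝓝 (u, s), foldS p.1 p.2 = c) ∨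
    ∃ c d e f : ℝ, |c| ≤ 4 ∧ |f| ≤ 1 / 3 ∧
      ∀ᶠ p : ℝ × ℝ in 𝓝 (u, s), foldU p.1 p.2 = c * p.1 + d ∧ foldS p.1 p.2 = e + f * ramp p.2 := by
  have hu1 : ∀ {c}, u < c → ∀ᶠ p : ℝ × ℝ in 𝓝 (u, s), p.1 < c :=
    fun h => (continuous_fst.tendsto (u, s)).eventually_lt_const h
  have hu2 : ∀ {c}, c < u → ∀ᶠ p : ℝ × ℝ in 𝓝 (u, s), c < p.1 :=
    fun h => (continuous_fst.tendsto (u, s)).eventually_const_lt h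
  have hs1 : ∀ {c}, s < c → ∀ᶠ p : ℝ × ℝ in 𝓝 (u, s), p.2 < c :=
    fun h => (continuous_snd.tendsto (u, s)).eventually_lt_const h
  have hs2 : ∀ {c}, c < s → ∀ᶠ p : ℝ × ℝ in 𝓝 (u, s), c < p.2 :=
    fun h => (continuous_snd.tendsto (u, s)).eventually_const_lt h
  have hb := stepFun_nonneg 50 (4 / 100) s
  have hb' := stepFun_le_one 50 (4 / 100) s
  have ht := stepFun_nonneg 50 (94 / 100) s
  have ht' := stepFun_le_one 50 (94 / 100) s
  rcases lt_or_ge s (4 / 100) with h | h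
  · rcases lt_or_ge u (-1 / 2) with hu | hu
    · refine Or.inr (Or.inl ⟨0, ?_⟩)
      filter_upwards [hs1 h, hu1 hu] with p hp1 hp2
      rw [foldS, strandHeight_of_le _ hp2.le, ramp_eq_zero (by linarith),
        stepFun_eq_zero (a := 97 / 100) (by norm_num) (by linarith)]
      ring
    · refine Or.inl (le_trans ?_ (le_abs_self _))
      rw [foldU_of_le (by linarith), stepFun_eq_zero (by norm_num) h.le]
      linarith
  rcases lt_or_ge s (1 / 10) with h' | h'
  · rcases lt_or_ge u (-1 / 2) with hu | hu
    · refine Or.inr (Or.inl ⟨0, ?_⟩)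
      filter_upwards [hs1 h', hs2 (show 3 / 100 < s by linarith), hu1 hu] with p hp1 hp2 hp3
      rw [foldS_of_mem _ hp2.le (by linarith), strandHeight_of_le _ hp3.le,
        ramp_eq_zero (by linarith)]
      ring
    rcases le_or_gt u (-1 / 4) with hu' | hu'
    · refine Or.inl (le_trans ?_ (le_abs_self _))
      rw [foldU_of_le (by linarith)]
      have := one_le_strand hu hu'
      nlinarith
    · refine Or.inr (Or.inl ⟨2 / 3, ?_⟩)
      filter_upwards [hs1 h', hs2 (show 3 / 100 < s by linarith), hu2 hu'] with p hp1 hp2 hp3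
      rw [foldS_of_mem _ hp2.le (by linarith), strandHeight, ramp_eq_zero (by linarith),
        stepFun_eq_one (a := -1 / 2) (by linarith)]
      ring
  rcases lt_or_ge s (94 / 100) with h'' | h''
  · have hs : ∀ᶠ p : ℝ × ℝ in 𝓝 (u, s), foldU p.1 p.2 = strand p.1 ∧
        foldS p.1 p.2 = strandHeight p.1 p.2 := by
      filter_upwards [hs1 h'', hs2 (show 6 / 100 < s by linarith)] with p hp1 hp2
      rw [foldS_of_mem _ (by linarith) (by linarith), foldU_of_ge hp2.le,
        stepFun_eq_zero (by norm_num) hp1.le]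
      exact ⟨by ring, rfl⟩
    rcases lt_or_ge u (-1 / 2) with hu | hu
    · refine Or.inr (Or.inr ⟨4, 3, 0, 1 / 3, by norm_num, by norm_num [abs_le], ?_⟩)
      filter_upwards [hs, hu1 hu] with p hp1 hp2
      rw [hp1.1, hp1.2, strand_of_le hp2.le, strandHeight_of_le _ hp2.le]
      exact ⟨rfl, by ring⟩
    rcases le_or_gt u (-1 / 4) with hu' | hu'
    · refine Or.inl (le_trans ?_ (le_abs_self _))
      rw [hs.self_of_nhds.1]
      exact one_le_strand hu hu'
    rcases lt_or_ge u (1 / 4) with hu | hu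
    · refine Or.inr (Or.inr ⟨-4, 0, 2 / 3, -(1 / 3), by norm_num, by norm_num [abs_le], ?_⟩)
      filter_upwards [hs, hu1 hu, hu2 hu'] with p hp1 hp2 hp3
      rw [hp1.1, hp1.2, strand_of_mem hp3.le hp2.le, strandHeight_of_mem _ hp3.le hp2.le]
      exact ⟨by ring, by ring⟩
    rcases le_or_gt u (1 / 2) with hu' | hu'
    · refine Or.inl (le_trans ?_ (neg_le_abs _))
      rw [hs.self_of_nhds.1]
      linarith [strand_le_neg_one hu hu']
    · refine Or.inr (Or.inr ⟨4, -3, 2 / 3, 1 / 3, by norm_num, by norm_num [abs_le], ?_⟩)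
      filter_upwards [hs, hu2 hu'] with p hp1 hp2
      rw [hp1.1, hp1.2, strand_of_ge hp2.le, strandHeight_of_ge _ hp2.le]
      exact ⟨by ring, by ring⟩
  rcases lt_or_ge s (97 / 100) with h3 | h3
  · rcases lt_or_ge u (1 / 4) with hu | hu
    · refine Or.inr (Or.inl ⟨1 / 3, ?_⟩)
      filter_upwards [hs1 h3, hs2 (show 9 / 10 < s by linarith), hu1 hu] with p hp1 hp2 hp3
      rw [foldS_of_mem _ (by linarith) hp1.le, strandHeight, ramp_eq_one hp2.le,
        stepFun_eq_zero (a := 1 / 4) (by norm_num) hp3.le]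
      ring
    rcases le_or_gt u (1 / 2) with hu' | hu'
    · refine Or.inl (le_trans ?_ (neg_le_abs _))
      rw [foldU_of_ge (by linarith)]
      have := strand_le_neg_one hu hu'
      nlinarith
    · refine Or.inr (Or.inl ⟨1, ?_⟩)
      filter_upwards [hs1 h3, hs2 (show 9 / 10 < s by linarith), hu2 hu'] with p hp1 hp2 hp3
      rw [foldS_of_mem _ (by linarith) hp1.le, strandHeight_of_ge _ hp3.le, ramp_eq_one hp2.le]
      ring
  · rcases le_or_gt u (1 / 2) with hu | hu
    · refine Or.inl (le_trans ?_ (neg_le_abs _))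
      rw [foldU_of_ge (by linarith), stepFun_eq_one (by linarith)]
      linarith
    · refine Or.inr (Or.inl ⟨1, ?_⟩)
      filter_upwards [hs2 (show 9 / 10 < s by linarith), hu2 hu] with p hp1 hp2
      rw [foldS, strandHeight_of_ge _ hp2.le, ramp_eq_one hp1.le,
        stepFun_eq_one (a := 2 / 100) (by linarith)]
      ring

end Fold

section Snake

/-- The linear homotopy, with parameter `r`, from the identity to the folding map acting on the
`i`-th coordinate and on the height. -/
def foldStep (r : ℝ) (i : Fin 6) (Y : (Fin 6 → ℝ) × ℝ) : (Fin 6 → ℝ) × ℝ :=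
  (fun j => if j = i then Y.1 i + r * (foldU (Y.1 i) Y.2 - Y.1 i) else Y.1 j,
    Y.2 + r * (foldS (Y.1 i) Y.2 - Y.2))

/-- Composition of the folding steps along a list of coordinates. -/
def snake (r : ℝ) : List (Fin 6) → (Fin 6 → ℝ) × ℝ → (Fin 6 → ℝ) × ℝ
  | [], Y => Y
  | i :: l, Y => foldStep r i (snake r l Y)

lemma contDiff_foldStep (i : Fin 6) :
    ContDiff ℝ 1 fun q : ℝ × (Fin 6 → ℝ) × ℝ => foldStep q.1 i q.2 := by
  have hU : ContDiff ℝ 1 fun q : ℝ × (Fin 6 → ℝ) × ℝ => foldU (q.2.1 i) q.2.2 :=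
    contDiff_foldU.comp (f := fun q : ℝ × (Fin 6 → ℝ) × ℝ => (q.2.1 i, q.2.2)) (by fun_prop)
  have hS : ContDiff ℝ 1 fun q : ℝ × (Fin 6 → ℝ) × ℝ => foldS (q.2.1 i) q.2.2 :=
    contDiff_foldS.comp (f := fun q : ℝ × (Fin 6 → ℝ) × ℝ => (q.2.1 i, q.2.2)) (by fun_prop)
  refine ContDiff.prodMk (contDiff_pi.2 fun j => ?_) (by fun_prop)
  by_cases h : j = i
  · simp only [h, if_true]
    fun_prop
  · simp only [h, if_false]
    fun_prop

lemma contDiff_snake (l : List (Fin 6)) :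
    ContDiff ℝ 1 fun q : ℝ × (Fin 6 → ℝ) × ℝ => snake q.1 l q.2 := by
  induction l with
  | nil => exact contDiff_snd
  | cons i l ih =>
    exact (contDiff_foldStep i).comp
      (f := fun q : ℝ × (Fin 6 → ℝ) × ℝ => (q.1, snake q.1 l q.2)) (contDiff_fst.prodMk ih)

lemma snake_zero (l : List (Fin 6)) (Y : (Fin 6 → ℝ) × ℝ) : snake 0 l Y = Y := by
  induction l with
  | nil => rfl
  | cons i l ih =>
    rw [snake, ih, foldStep]
    ext j
    · by_cases h : j = i <;> simp [h]
    · simp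

lemma one_le_abs_snake {r : ℝ} (hr : r ∈ Icc (0 : ℝ) 1) (l : List (Fin 6))
    {Y : (Fin 6 → ℝ) × ℝ} {j : Fin 6} (h : 1 ≤ |Y.1 j|) : 1 ≤ |(snake r l Y).1 j| := by
  induction l with
  | nil => exact h
  | cons i l ih =>
    set Z := snake r l Y
    change 1 ≤ |(if j = i then Z.1 i + r * (foldU (Z.1 i) Z.2 - Z.1 i) else Z.1 j)|
    split_ifs with hj
    · subst hj
      rcases le_abs.1 ih with h1 | h1
      · refine le_abs.2 (Or.inl ?_)
        nlinarith [one_le_foldU Z.2 h1, hr.1, hr.2]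
      · refine le_abs.2 (Or.inr ?_)
        nlinarith [foldU_le_neg_one Z.2 (le_neg.1 h1), hr.1, hr.2]
    · exact ih

lemma snake_snd_le {r : ℝ} (hr : r ∈ Icc (0 : ℝ) 1) (l : List (Fin 6))
    {Y : (Fin 6 → ℝ) × ℝ} (h : Y.2 ≤ 2 / 100) : (snake r l Y).2 ≤ 2 / 100 := by
  induction l with
  | nil => exact h
  | cons i l ih =>
    rw [snake, foldStep, foldS_of_le _ ih]
    nlinarith [hr.1, hr.2]

lemma le_snake_snd {r : ℝ} (hr : r ∈ Icc (0 : ℝ) 1) (l : List (Fin 6))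
    {Y : (Fin 6 → ℝ) × ℝ} (h : 98 / 100 ≤ Y.2) : 98 / 100 ≤ (snake r l Y).2 := by
  induction l with
  | nil => exact h
  | cons i l ih =>
    rw [snake, foldStep, foldS_of_ge _ ih]
    nlinarith [hr.1, hr.2]

variable {X : Type*} [NormedAddCommGroup X] [NormedSpace ℝ X]

/-- After the snake, a point either leaves the cube, or its height is stationary, or the
derivative has been stretched in the coordinates and contracted in the height. -/
lemma snake_cases {Y : X → (Fin 6 → ℝ) × ℝ} {x : X} (hY : DifferentiableAt ℝ Y x) {C K : ℝ}
    (hC : ∀ i, ‖fderiv ℝ (fun x => (Y x).1 i) x‖ ≤ C) (hK : ‖fderiv ℝ (fun x => (Y x).2) x‖ ≤ K)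
    (l : List (Fin 6)) :
    (∃ i, 1 ≤ |(snake 1 l (Y x)).1 i|) ∨ fderiv ℝ (fun x => (snake 1 l (Y x)).2) x = 0 ∨
      (∀ i, ‖fderiv ℝ (fun x => (snake 1 l (Y x)).1 i) x‖ ≤ 4 ^ l.count i * C) ∧
        ‖fderiv ℝ (fun x => (snake 1 l (Y x)).2) x‖ ≤ (4 / 9) ^ l.length * K := by
  induction l with
  | nil => exact Or.inr (Or.inr (by simpa [snake] using ⟨hC, hK⟩))
  | cons i l ih =>
    have hd : DifferentiableAt ℝ (fun x => snake 1 l (Y x)) x :=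
      (((contDiff_snake l).differentiable (by norm_num)) (1, Y x)).comp
        (f := fun x => ((1 : ℝ), Y x)) x ((differentiableAt_const _).prodMk hY)
    set Z := fun x => snake 1 l (Y x) with hZ
    have hZ1 : ∀ x j, (snake 1 (i :: l) (Y x)).1 j =
        if j = i then foldU ((Z x).1 i) (Z x).2 else (Z x).1 j := by
      intro x j
      simp [snake, foldStep, hZ]
    have hZ2 : ∀ x, (snake 1 (i :: l) (Y x)).2 = foldS ((Z x).1 i) (Z x).2 := by
      intro x
      simp [snake, foldStep, hZ]
    have hd1 : ∀ j, DifferentiableAt ℝ (fun x => (Z x).1 j) x := fun j => by fun_prop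
    have hd2 : DifferentiableAt ℝ (fun x => (Z x).2) x := by fun_prop
    have hc : Tendsto (fun x => ((Z x).1 i, (Z x).2)) (𝓝 x) (𝓝 ((Z x).1 i, (Z x).2)) :=
      ((hd1 i).continuousAt.prodMk hd2.continuousAt).tendsto
    by_cases ho : ∃ j, 1 ≤ |(Z x).1 j|
    · obtain ⟨j, hj⟩ := ho
      exact Or.inl ⟨j, one_le_abs_snake (l := [i]) (Y := Z x) (by simp) hj⟩
    rcases fold_cases ((Z x).1 i) (Z x).2 with h | ⟨c, h⟩ | ⟨c, d, e, f, hc4, hf, h⟩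
    · exact Or.inl ⟨i, by simpa [hZ1] using h⟩
    · refine Or.inr (Or.inl ?_)
      have h' : (fun x => (snake 1 (i :: l) (Y x)).2) =ᶠ[𝓝 x] fun _ => c := by
        filter_upwards [hc.eventually h] with y hy
        rw [hZ2, hy]
      rw [h'.fderiv_eq, fderiv_const_apply]
    · have h1 : (fun x => (snake 1 (i :: l) (Y x)).1 i) =ᶠ[𝓝 x] fun x => c * (Z x).1 i + d := by
        filter_upwards [hc.eventually h] with y hy
        rw [hZ1, if_pos rfl, hy.1]
      have h2 : (fun x => (snake 1 (i :: l) (Y x)).2) =ᶠ[𝓝 x] fun x => e + f * ramp (Z x).2 := by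
        filter_upwards [hc.eventually h] with y hy
        rw [hZ2, hy.2]
      have h1' : fderiv ℝ (fun x => (snake 1 (i :: l) (Y x)).1 i) x =
          c • fderiv ℝ (fun x => (Z x).1 i) x := by
        rw [h1.fderiv_eq]
        exact (((hd1 i).hasFDerivAt.const_mul c).add_const d).fderiv
      have h2' : fderiv ℝ (fun x => (snake 1 (i :: l) (Y x)).2) x =
          (f * rampDeriv (Z x).2) • fderiv ℝ (fun x => (Z x).2) x := by
        rw [h2.fderiv_eq, mul_smul]
        exact ((((hasDerivAt_ramp (Z x).2).comp_hasFDerivAt x hd2.hasFDerivAt).const_mul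
          f).const_add e).fderiv
      rcases ih with ih | ih | ih
      · exact absurd ih ho
      · exact Or.inr (Or.inl (by rw [h2', ih, smul_zero]))
      · refine Or.inr (Or.inr ⟨fun j => ?_, ?_⟩)
        · by_cases hj : j = i
          · subst hj
            rw [h1', norm_smul, List.count_cons_self, pow_succ', mul_assoc]
            exact mul_le_mul hc4 (ih.1 j) (norm_nonneg _) (by norm_num)
          · rw [List.count_cons_of_ne (Ne.symm hj)]
            simpa [hZ1, hj] using ih.1 j
        · rw [h2', norm_smul, List.length_cons, pow_succ', mul_assoc]
          refine mul_le_mul ?_ ih.2 (norm_nonneg _) (by norm_num)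
          rw [norm_mul]
          calc ‖f‖ * ‖rampDeriv (Z x).2‖ ≤ 1 / 3 * (4 / 3) :=
                mul_le_mul hf (abs_rampDeriv_le _) (abs_nonneg _) (by norm_num)
            _ = 4 / 9 := by norm_num

end Snake

section Commutator

/-- A smooth function of three variables, equal to one at the origin and vanishing outside a
neighbourhood of it. -/
def cubeBump (u : Fin 3 → ℝ) : ℝ := ∏ i, Real.smoothTransition (1 - 2 * u i ^ 2)

lemma contDiff_cubeBump : ContDiff ℝ 1 cubeBump :=
  contDiff_prod fun i _ => Real.smoothTransition.contDiff.comp (by fun_prop)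

lemma cubeBump_nonneg (u : Fin 3 → ℝ) : 0 ≤ cubeBump u :=
  Finset.prod_nonneg fun _ _ => Real.smoothTransition.nonneg _

lemma cubeBump_zero : cubeBump 0 = 1 := by simp [cubeBump]

lemma cubeBump_eventually_zero {u : Fin 3 → ℝ} {i : Fin 3} (h : 1 ≤ |u i|) :
    ∀ᶠ y in 𝓝 u, cubeBump y = 0 := by
  have hc : Continuous fun y : Fin 3 → ℝ => y i ^ 2 := by fun_prop
  have h1 : 1 / 2 < u i ^ 2 := by
    rw [← sq_abs]
    nlinarith
  filter_upwards [(hc.tendsto u).eventually_const_lt h1] with y hy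
  exact Finset.prod_eq_zero (Finset.mem_univ i)
    (Real.smoothTransition.zero_of_nonpos (by linarith))

/-- A map from `ℝ³` to the nonzero quaternions, equal to one outside a cube, which is homotopic to
the inverse of a stereographic projection. -/
def puffQuat (u : Fin 3 → ℝ) : ℍ[ℝ] :=
  quatMk (1 - 2 * cubeBump u) (cubeBump u * u 0) (cubeBump u * u 1) (cubeBump u * u 2)

lemma contDiff_puffQuat : ContDiff ℝ 1 puffQuat := by
  have := contDiff_cubeBump
  exact .quatMk (by fun_prop) (by fun_prop) (by fun_prop) (by fun_prop)

lemma puffQuat_of_cubeBump {u : Fin 3 → ℝ} (h : cubeBump u = 0) : puffQuat u = 1 := by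
  ext <;> simp [puffQuat, h]

/-- Linear interpolation between `puffQuat` and the identity. -/
def arm (v : ℝ) (a : ℍ[ℝ]) (u : Fin 3 → ℝ) : ℍ[ℝ] :=
  (1 - v) • (if a.re < 0 then puffQuat u else 1) + v • a

lemma puffQuat_ne_zero (u : Fin 3 → ℝ) : puffQuat u ≠ 0 := by
  intro h
  have h0 : cubeBump u ≠ 0 := fun h' => by simp [puffQuat_of_cubeBump h'] at h
  have hu : u = 0 := by
    funext i
    fin_cases i
    · simpa [puffQuat, h0] using congrArg (fun q : ℍ[ℝ] => q.imI) h
    · simpa [puffQuat, h0] using congrArg (fun q : ℍ[ℝ] => q.imJ) h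
    · simpa [puffQuat, h0] using congrArg (fun q : ℍ[ℝ] => q.imK) h
  have := congrArg (fun q : ℍ[ℝ] => q.re) h
  rw [hu] at this
  simp [puffQuat, cubeBump_zero] at this
  norm_num at this

/-- Rescaled imaginary part of a quaternion. -/
def imCoord (a : ℍ[ℝ]) : Fin 3 → ℝ :=
  ![2 * ‖a‖⁻¹ * a.imI, 2 * ‖a‖⁻¹ * a.imJ, 2 * ‖a‖⁻¹ * a.imK]

@[simp] lemma imCoord_zero (a : ℍ[ℝ]) : imCoord a 0 = 2 * ‖a‖⁻¹ * a.imI := rfl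
@[simp] lemma imCoord_one (a : ℍ[ℝ]) : imCoord a 1 = 2 * ‖a‖⁻¹ * a.imJ := rfl
@[simp] lemma imCoord_two (a : ℍ[ℝ]) : imCoord a 2 = 2 * ‖a‖⁻¹ * a.imK := rfl

lemma arm_zero_ne_zero (a : ℍ[ℝ]) (u : Fin 3 → ℝ) : arm 0 a u ≠ 0 := by
  have := puffQuat_ne_zero u
  rw [arm]
  split_ifs <;> simpa

lemma arm_one (a : ℍ[ℝ]) (u : Fin 3 → ℝ) : arm 1 a u = a := by simp [arm]

lemma arm_imCoord_ne_zero {v : ℝ} (hv : v ∈ Icc (0 : ℝ) 1) {a : ℍ[ℝ]} (ha : a ≠ 0) :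
    arm v a (imCoord a) ≠ 0 := by
  have hn : 0 < ‖a‖⁻¹ := inv_pos.2 (norm_pos_iff.2 ha)
  have hv' : 0 ≤ 1 - v := by linarith [hv.2]
  rw [arm]
  intro h
  have hre := congrArg (fun q : ℍ[ℝ] => q.re) h
  split_ifs at h hre with hr
  · set K := cubeBump (imCoord a) with hK
    have hK0 : 0 ≤ K := cubeBump_nonneg _
    have h1 : ((1 - v) * (K * (2 * ‖a‖⁻¹)) + v) * a.imI = 0 := by
      have := congrArg (fun q : ℍ[ℝ] => q.imI) h
      simp [puffQuat, ← hK] at this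
      linear_combination this
    have h2 : ((1 - v) * (K * (2 * ‖a‖⁻¹)) + v) * a.imJ = 0 := by
      have := congrArg (fun q : ℍ[ℝ] => q.imJ) h
      simp [puffQuat, ← hK] at this
      linear_combination this
    have h3 : ((1 - v) * (K * (2 * ‖a‖⁻¹)) + v) * a.imK = 0 := by
      have := congrArg (fun q : ℍ[ℝ] => q.imK) h
      simp [puffQuat, ← hK] at this
      linear_combination this
    have h4 : 0 ≤ (1 - v) * (K * (2 * ‖a‖⁻¹)) := by positivity
    rcases eq_or_ne ((1 - v) * (K * (2 * ‖a‖⁻¹)) + v) 0 with h0 | h0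
    · have hv0 : v = 0 := le_antisymm (by linarith) hv.1
      subst hv0
      simp at h
      exact puffQuat_ne_zero _ h
    · have hi : imCoord a = 0 := by
        funext i
        fin_cases i
        · simp [imCoord, (mul_eq_zero.1 h1).resolve_left h0]
        · simp [imCoord, (mul_eq_zero.1 h2).resolve_left h0]
        · simp [imCoord, (mul_eq_zero.1 h3).resolve_left h0]
      simp [puffQuat, hi, cubeBump_zero] at hre
      rcases hv.1.eq_or_lt with h5 | h5
      · rw [← h5] at hre
        norm_num at hre
      · nlinarith [mul_pos_of_neg_of_neg hr (neg_lt_zero.2 h5)]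
  · simp at hre
    have hv1 : 1 - v = 0 := by nlinarith [hv.1, mul_nonneg hv.1 (not_lt.1 hr)]
    rw [hv1, show v = 1 by linarith] at h
    exact ha (by simpa using h)

lemma exists_one_le_imCoord {a : ℍ[ℝ]} (ha : a ≠ 0) (h : a.re = 0) : ∃ i, 1 ≤ |imCoord a i| := by
  have hn := norm_pos_iff.2 ha
  have hsq := norm_sq_quaternion a
  by_contra! hlt
  have h1 : ∀ i, imCoord a i ^ 2 < 1 := fun i => by
    rw [← sq_abs]
    exact pow_lt_one₀ (abs_nonneg _) (hlt i) two_ne_zero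
  have h2 : imCoord a 0 ^ 2 + imCoord a 1 ^ 2 + imCoord a 2 ^ 2 = 4 := by
    simp only [imCoord, Matrix.cons_val]
    field_simp
    rw [hsq, h]
    ring
  linarith [h1 0, h1 1, h1 2]

/-- Near a given configuration, the arm with `v = 0` is given by a single formula. -/
lemma arm_eventually {ι : Type*} {F : Filter ι} {a : ι → ℍ[ℝ]} {u : ι → Fin 3 → ℝ} {a₀ : ℍ[ℝ]}
    {u₀ : Fin 3 → ℝ} (ha : Tendsto a F (𝓝 a₀)) (hu : Tendsto u F (𝓝 u₀))
    (h : a₀.re = 0 → ∃ i, 1 ≤ |u₀ i|) :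
    (∀ᶠ x in F, (if (a x).re < 0 then puffQuat (u x) else 1) = puffQuat (u x)) ∨
      (∀ᶠ x in F, (if (a x).re < 0 then puffQuat (u x) else 1) = 1) := by
  have hre : Tendsto (fun x => (a x).re) F (𝓝 a₀.re) :=
    (Quaternion.continuous_re.tendsto a₀).comp ha
  rcases lt_trichotomy a₀.re 0 with h0 | h0 | h0
  · left
    filter_upwards [hre.eventually_lt_const h0] with x hx
    rw [if_pos hx]
  · right
    obtain ⟨i, hi⟩ := h h0
    filter_upwards [hu.eventually (cubeBump_eventually_zero hi)] with x hx
    rw [puffQuat_of_cubeBump hx, ite_self]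
  · right
    filter_upwards [hre.eventually_const_lt h0] with x hx
    rw [if_neg hx.not_gt]

lemma tendsto_puff {ι : Type*} {F : Filter ι} {a : ι → ℍ[ℝ]} {u : ι → Fin 3 → ℝ} {x₀ : ι}
    (hF : pure x₀ ≤ F) (ha : Tendsto a F (𝓝 (a x₀))) (hu : Tendsto u F (𝓝 (u x₀)))
    (h : (a x₀).re = 0 → ∃ i, 1 ≤ |u x₀ i|) :
    Tendsto (fun x => if (a x).re < 0 then puffQuat (u x) else 1) F
      (𝓝 (if (a x₀).re < 0 then puffQuat (u x₀) else 1)) := by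
  rcases arm_eventually ha hu h with h1 | h1
  · have h2 : _ = _ := h1.filter_mono hF
    rw [h2]
    exact ((contDiff_puffQuat.continuous.tendsto _).comp hu).congr'
      (h1.mono fun x hx => hx.symm)
  · have h2 : _ = _ := h1.filter_mono hF
    rw [h2]
    exact tendsto_const_nhds.congr' (h1.mono fun x hx => hx.symm)

/-- The commutator of two nonzero quaternions. -/
def unitComm (p q : ℍ[ℝ]) : ℍ[ℝ] := (‖p‖ ^ 2 * ‖q‖ ^ 2)⁻¹ • (p * q * star p * star q)

lemma norm_unitComm {p q : ℍ[ℝ]} (hp : p ≠ 0) (hq : q ≠ 0) : ‖unitComm p q‖ = 1 := by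
  have hp' := norm_pos_iff.2 hp
  have hq' := norm_pos_iff.2 hq
  rw [unitComm, norm_smul, norm_mul, norm_mul, norm_mul, norm_star, norm_star, Real.norm_eq_abs,
    abs_of_pos (by positivity)]
  field_simp

lemma unitComm_one_left {q : ℍ[ℝ]} (hq : q ≠ 0) : unitComm 1 q = 1 := by
  have hq' := norm_pos_iff.2 hq
  rw [unitComm]
  simp only [norm_one, star_one, mul_one, one_mul, one_pow]
  rw [mul_star_self_eq_norm, Quaternion.smul_coe, inv_mul_cancel₀ (by positivity)]
  simp

lemma unitComm_one_right {p : ℍ[ℝ]} (hp : p ≠ 0) : unitComm p 1 = 1 := by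
  have hp' := norm_pos_iff.2 hp
  rw [unitComm]
  simp only [norm_one, star_one, mul_one, one_pow]
  rw [mul_star_self_eq_norm, Quaternion.smul_coe, inv_mul_cancel₀ (by positivity)]
  simp

lemma contDiff_quaternion_star : ContDiff ℝ 1 (star : ℍ[ℝ] → ℍ[ℝ]) := by
  have h := ContDiff.quaternion_coord (n := 1) (contDiff_id (E := ℍ[ℝ]))
  have h' : (star : ℍ[ℝ] → ℍ[ℝ]) = fun q => quatMk q.re (-q.imI) (-q.imJ) (-q.imK) := by
    funext q
    ext <;> simp
  rw [h']
  exact .quatMk (h 0) (h 1).neg (h 2).neg (h 3).neg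

lemma ContDiffAt.unitComm {X : Type*} [NormedAddCommGroup X] [NormedSpace ℝ X] {p q : X → ℍ[ℝ]}
    {x : X} (hp : ContDiffAt ℝ 1 p x) (hq : ContDiffAt ℝ 1 q x) (hp0 : p x ≠ 0) (hq0 : q x ≠ 0) :
    ContDiffAt ℝ 1 (fun x => unitComm (p x) (q x)) x := by
  have hp' := norm_pos_iff.2 hp0
  have hq' := norm_pos_iff.2 hq0
  have h1 := (contDiff_quaternion_star.contDiffAt (x := p x)).comp x hp
  have h2 := (contDiff_quaternion_star.contDiffAt (x := q x)).comp x hq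
  refine ContDiffAt.smul (ContDiffAt.inv ((hp.norm_sq ℝ).mul (hq.norm_sq ℝ)) (by positivity)) ?_
  exact ((hp.mul hq).mul h1).mul h2

lemma continuousAt_unitComm {p q : ℍ[ℝ]} (hp : p ≠ 0) (hq : q ≠ 0) :
    ContinuousAt (fun z : ℍ[ℝ] × ℍ[ℝ] => unitComm z.1 z.2) (p, q) :=
  (ContDiffAt.unitComm (x := (p, q)) contDiffAt_fst contDiffAt_snd hp hq).continuousAt

lemma smul_unitComm (a b : ℍ[ℝ]) : (2 * ‖a‖ * ‖b‖) • unitComm a b =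
    (2 * ‖a‖⁻¹ * ‖b‖⁻¹) • (a * b * star a * star b) := by
  rcases eq_or_ne a 0 with rfl | ha
  · simp
  rcases eq_or_ne b 0 with rfl | hb
  · simp
  have ha' := norm_pos_iff.2 ha
  have hb' := norm_pos_iff.2 hb
  rw [unitComm, smul_smul]
  congr 1
  field_simp

end Commutator

section Volume

lemma abs_det_le_of_rows {n : ℕ} {R : Matrix (Fin n) (Fin n) ℝ} {c : Fin n → ℝ}
    (h : ∀ i j, |R i j| ≤ c i) : |R.det| ≤ n.factorial * ∏ i, c i := by
  rw [Matrix.det_apply]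
  refine (Finset.abs_sum_le_sum_abs _ _).trans ?_
  have h1 : ∀ σ ∈ (Finset.univ : Finset (Equiv.Perm (Fin n))),
      |Equiv.Perm.sign σ • ∏ i, R (σ i) i| ≤ ∏ i, c i := by
    intro σ _
    rw [Units.smul_def, zsmul_eq_mul, abs_mul, Finset.abs_prod, ← Equiv.prod_comp σ c]
    have : |(((Equiv.Perm.sign σ : ℤˣ) : ℤ) : ℝ)| = 1 := by
      rcases Int.units_eq_one_or (Equiv.Perm.sign σ) with h | h <;> simp [h]
    rw [this, one_mul]
    exact Finset.prod_le_prod (fun i _ => abs_nonneg _) fun i _ => h _ _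
  refine (Finset.sum_le_card_nsmul _ _ _ h1).trans (le_of_eq ?_)
  rw [Finset.card_univ, Fintype.card_perm, Fintype.card_fin, nsmul_eq_mul]

/-- `quatReal` as a continuous linear map. -/
def quatRealL : ℍ[ℝ] × ℝ →L[ℝ] EucA 5 where
  toFun p := quatReal p.1 p.2
  map_add' p q := by ext i; fin_cases i <;> simp [quatReal]
  map_smul' c p := by ext i; fin_cases i <;> simp [quatReal]
  cont := continuous_quatReal

lemma quatRealL_apply (p : ℍ[ℝ] × ℝ) : quatRealL p = quatReal p.1 p.2 := rfl

lemma abs_im_le_norm (y : ℍ[ℝ]) : |y.imI| ≤ ‖y‖ ∧ |y.imJ| ≤ ‖y‖ ∧ |y.imK| ≤ ‖y‖ := by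
  have h := norm_sq_quaternion y
  refine ⟨?_, ?_, ?_⟩ <;> refine abs_le_of_sq_le_sq ?_ (norm_nonneg _) <;>
  nlinarith [sq_nonneg y.re, sq_nonneg y.imI, sq_nonneg y.imJ, sq_nonneg y.imK]

lemma norm_quatReal_eq_one {m : ℍ[ℝ]} {h : ℝ} (hm : ‖m‖ ^ 2 + h ^ 2 = 1) : ‖quatReal m h‖ = 1 :=
  (pow_eq_one_iff_of_nonneg (norm_nonneg _) two_ne_zero).1 (by rw [norm_sq_quatReal, hm])

variable {X : Type*} [NormedAddCommGroup X] [InnerProductSpace ℝ X]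

/-- The suspension of a map to the unit quaternions stretches `4`-volumes by at most a constant
times the cube of the derivative of the map times the derivative of the height. -/
lemma sqrt_gramDet_suspension_le {β : X → ℍ[ℝ]} {s : X → ℝ} {x : X}
    (hβ : DifferentiableAt ℝ β x) (hs : DifferentiableAt ℝ s x) (h1 : ∀ᶠ y in 𝓝 x, ‖β y‖ = 1)
    {v : Fin 4 → X} (hv : Orthonormal ℝ v) :
    Real.sqrt (gramDet fun i => fderiv ℝ (fun x => quatReal
      (Real.sin (Real.pi * ramp (s x)) • β x) (Real.cos (Real.pi * ramp (s x)))) x (v i)) ≤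
      600 * (‖fderiv ℝ β x‖ ^ 3 * ‖fderiv ℝ s x‖) := by
  set D := fderiv ℝ β x
  set d := fderiv ℝ s x
  set τ := Real.pi * ramp (s x) with hτ
  set b := β x
  set ρ := Real.pi * rampDeriv (s x) with hρ
  have hb : ‖b‖ = 1 := h1.self_of_nhds
  have hbb : star b * b = 1 := by rw [star_mul_self_eq_norm, hb]; simp
  have hbb' : b * star b = 1 := by rw [mul_star_self_eq_norm, hb]; simp
  have hτd : HasFDerivAt (fun x => Real.pi * ramp (s x)) (ρ • d) x := by
    have := ((hasDerivAt_ramp (s x)).comp_hasFDerivAt x hs.hasFDerivAt).const_mul Real.pi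
    simpa only [smul_smul] using! this
  have hf : HasFDerivAt (fun x => quatReal
      (Real.sin (Real.pi * ramp (s x)) • β x) (Real.cos (Real.pi * ramp (s x)))) _ x :=
    quatRealL.hasFDerivAt.comp x ((hτd.sin.smul hβ.hasFDerivAt).prodMk hτd.cos)
  have hre : ∀ w, (star b * D w).re = 0 := by
    intro w
    have h2 := (hβ.hasFDerivAt.norm_sq (F := ℍ[ℝ]))
    have h3 : (fun y => ‖β y‖ ^ 2) =ᶠ[𝓝 x] fun _ => (1 : ℝ) := by
      filter_upwards [h1] with y hy
      rw [hy, one_pow]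
    have h4 := h2.unique ((hasFDerivAt_const (1 : ℝ) x).congr_of_eventuallyEq h3)
    have h5 := congrArg (fun L => L w) h4
    simp [Quaternion.inner_def] at h5
    simp
    linear_combination (1 / 2 : ℝ) * h5
  let q : Fin 4 → EucA 5 := ![quatReal (b * quatMk 0 1 0 0) 0, quatReal (b * quatMk 0 0 1 0) 0,
    quatReal (b * quatMk 0 0 0 1) 0, quatReal (Real.cos τ • b) (-Real.sin τ)]
  let R : Matrix (Fin 4) (Fin 4) ℝ := ![fun j => Real.sin τ * (star b * D (v j)).imI,
    fun j => Real.sin τ * (star b * D (v j)).imJ, fun j => Real.sin τ * (star b * D (v j)).imK,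
    fun j => ρ * d (v j)]
  have hq : ∀ i, ‖q i‖ ≤ 1 := by
    have hn : ∀ a b c : ℝ, a ^ 2 + b ^ 2 + c ^ 2 = 1 → ‖quatReal (β x * quatMk 0 a b c) 0‖ ≤ 1 := by
      intro a b c h
      refine (norm_quatReal_eq_one ?_).le
      rw [norm_mul, mul_pow, norm_sq_quaternion (quatMk 0 a b c), h1.self_of_nhds]
      simpa using h
    intro i
    fin_cases i
    · exact hn 1 0 0 (by norm_num)
    · exact hn 0 1 0 (by norm_num)
    · exact hn 0 0 1 (by norm_num)
    · refine (norm_quatReal_eq_one ?_).le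
      rw [norm_smul, hb, mul_one, neg_sq, Real.norm_eq_abs, sq_abs, Real.cos_sq_add_sin_sq]
  have hR : (fun j => fderiv ℝ (fun x => quatReal (Real.sin (Real.pi * ramp (s x)) • β x)
      (Real.cos (Real.pi * ramp (s x)))) x (v j)) = fun j => ∑ i, R i j • q i := by
    funext j
    rw [hf.fderiv]
    have hD : D (v j) = b * quatMk 0 (star b * D (v j)).imI (star b * D (v j)).imJ
        (star b * D (v j)).imK := by
      have : quatMk 0 (star b * D (v j)).imI (star b * D (v j)).imJ (star b * D (v j)).imK =
          star b * D (v j) := by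
        ext
        · exact (hre (v j)).symm
        all_goals rfl
      rw [this, ← mul_assoc, hbb', one_mul]
    have hL : ∀ m h, quatReal m h = quatRealL (m, h) := fun _ _ => rfl
    simp only [Fin.sum_univ_four, R, q, Matrix.cons_val, hL, ← map_smul, ← map_add]
    simp only [ContinuousLinearMap.comp_apply]
    refine congrArg quatRealL (Prod.ext ?_ ?_)
    · have h7 : ∀ a b c : ℝ, quatMk 0 a b c =
          a • quatMk 0 1 0 0 + b • quatMk 0 0 1 0 + c • quatMk 0 0 0 1 := by
        intro a b c
        ext <;> simp
      rw [h7] at hD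
      simp only [ContinuousLinearMap.prod_apply, add_apply,
        smul_apply, ContinuousLinearMap.smulRight_apply, Prod.fst_add,
        Prod.smul_fst]
      change Real.sin τ • D (v j) + _ = _
      conv_lhs => rw [hD]
      simp only [mul_add, mul_smul_comm, smul_add, smul_smul, smul_eq_mul]
      congr 2
      ring
    · simp
      ring
  have hbd : ∀ i j, |R i j| ≤ ![‖D‖, ‖D‖, ‖D‖, 5 * ‖d‖] i := by
    intro i j
    have h2 : ‖star b * D (v j)‖ ≤ ‖D‖ := by
      rw [norm_mul, norm_star, hb, one_mul]
      simpa [hv.1 j] using D.le_opNorm (v j)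
    obtain ⟨h3, h4, h5⟩ := abs_im_le_norm (star b * D (v j))
    have h6 : ∀ y : ℝ, |y| ≤ ‖star b * D (v j)‖ → |Real.sin τ * y| ≤ ‖D‖ := by
      intro y hy
      rw [abs_mul]
      exact (mul_le_mul (Real.abs_sin_le_one τ) (hy.trans h2) (abs_nonneg _) zero_le_one).trans
        (one_mul _).le
    fin_cases i
    · exact h6 _ h3
    · exact h6 _ h4
    · exact h6 _ h5
    · change |ρ * d (v j)| ≤ 5 * ‖d‖
      have h7 : |d (v j)| ≤ ‖d‖ := by simpa [hv.1 j] using d.le_opNorm (v j)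
      rw [abs_mul]
      refine mul_le_mul ?_ h7 (abs_nonneg _) (by norm_num)
      rw [hρ, abs_mul, abs_of_pos Real.pi_pos]
      nlinarith [abs_rampDeriv_le (s x), Real.pi_lt_d2, Real.pi_pos, abs_nonneg (rampDeriv (s x))]
  have hg : Real.sqrt (gramDet q) ≤ 5 := by
    have := gramDet_le hq
    rw [Real.sqrt_le_left (by norm_num)]
    refine (le_abs_self _).trans (this.trans ?_)
    norm_num [Nat.factorial]
  have hdet := abs_det_le_of_rows hbd
  rw [hR, gramDet_combination, Real.sqrt_mul (sq_nonneg _), Real.sqrt_sq_eq_abs]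
  refine (mul_le_mul hdet hg (Real.sqrt_nonneg _) ((abs_nonneg _).trans hdet)).trans
    (le_of_eq ?_)
  simp [Fin.prod_univ_four, Nat.factorial]
  ring

end Volume

section SnakeMap

/-- The first three coordinates. -/
def fstHalf (u : Fin 6 → ℝ) : Fin 3 → ℝ := ![u 0, u 1, u 2]

/-- The last three coordinates. -/
def sndHalf (u : Fin 6 → ℝ) : Fin 3 → ℝ := ![u 3, u 4, u 5]

/-- Coordinates of `ℝ⁸` minus two subspaces: two rescaled imaginary parts and a height. -/
def joinCoord (x : EucA 8) : (Fin 6 → ℝ) × ℝ :=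
  (![imCoord (quatA x) 0, imCoord (quatA x) 1, imCoord (quatA x) 2,
    imCoord (quatB x) 0, imCoord (quatB x) 1, imCoord (quatB x) 2], ‖quatA x‖ ^ 2)

lemma contDiff_fstHalf : ContDiff ℝ 1 fstHalf := by
  refine contDiff_pi.2 fun i => ?_
  fin_cases i
  exacts [contDiff_apply ℝ ℝ 0, contDiff_apply ℝ ℝ 1, contDiff_apply ℝ ℝ 2]

lemma contDiff_sndHalf : ContDiff ℝ 1 sndHalf := by
  refine contDiff_pi.2 fun i => ?_
  fin_cases i
  exacts [contDiff_apply ℝ ℝ 3, contDiff_apply ℝ ℝ 4, contDiff_apply ℝ ℝ 5]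

lemma fstHalf_joinCoord (x : EucA 8) : fstHalf (joinCoord x).1 = imCoord (quatA x) := by
  funext i
  fin_cases i <;> rfl

lemma sndHalf_joinCoord (x : EucA 8) : sndHalf (joinCoord x).1 = imCoord (quatB x) := by
  funext i
  fin_cases i <;> rfl

lemma contDiffAt_imCoord {X : Type*} [NormedAddCommGroup X] [NormedSpace ℝ X] {m : X → ℍ[ℝ]}
    {x : X} (hm : ContDiff ℝ 1 m) (h : m x ≠ 0) (i : Fin 3) :
    ContDiffAt ℝ 1 (fun x => imCoord (m x) i) x := by
  have h1 : ContDiffAt ℝ 1 (fun x => ‖m x‖⁻¹) x :=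
    (hm.contDiffAt.norm ℝ h).inv (norm_ne_zero_iff.2 h)
  have h2 := fun j => (ContDiff.quaternion_coord hm j).contDiffAt (x := x)
  fin_cases i
  · exact (contDiffAt_const.mul h1).mul (h2 1)
  · exact (contDiffAt_const.mul h1).mul (h2 2)
  · exact (contDiffAt_const.mul h1).mul (h2 3)

lemma contDiffAt_joinCoord {x : EucA 8} (hA : quatA x ≠ 0) (hB : quatB x ≠ 0) :
    ContDiffAt ℝ 1 joinCoord x := by
  have h1 := contDiffAt_imCoord (contDiff_quatA (n := 1)) hA
  have h2 := contDiffAt_imCoord (contDiff_quatB (n := 1)) hB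
  refine ContDiffAt.prodMk (contDiffAt_pi.2 fun i => ?_) (contDiff_quatA.contDiffAt.norm_sq ℝ)
  fin_cases i
  exacts [h1 0, h1 1, h1 2, h2 0, h2 1, h2 2]

lemma exists_one_le_fstHalf {r : ℝ} (hr : r ∈ Icc (0 : ℝ) 1) (l : List (Fin 6)) {x : EucA 8}
    (hA : quatA x ≠ 0) (h : (quatA x).re = 0) :
    ∃ i, 1 ≤ |fstHalf (snake r l (joinCoord x)).1 i| := by
  obtain ⟨i, hi⟩ := exists_one_le_imCoord hA h
  refine ⟨i, ?_⟩
  fin_cases i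
  · exact one_le_abs_snake hr l (j := 0) hi
  · exact one_le_abs_snake hr l (j := 1) hi
  · exact one_le_abs_snake hr l (j := 2) hi

lemma exists_one_le_sndHalf {r : ℝ} (hr : r ∈ Icc (0 : ℝ) 1) (l : List (Fin 6)) {x : EucA 8}
    (hB : quatB x ≠ 0) (h : (quatB x).re = 0) :
    ∃ i, 1 ≤ |sndHalf (snake r l (joinCoord x)).1 i| := by
  obtain ⟨i, hi⟩ := exists_one_le_imCoord hB h
  refine ⟨i, ?_⟩
  fin_cases i
  · exact one_le_abs_snake hr l (j := 3) hi
  · exact one_le_abs_snake hr l (j := 4) hi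
  · exact one_le_abs_snake hr l (j := 5) hi

/-- The polar angle of `snakeMap`. -/
def snakeAngle (r v : ℝ) (l : List (Fin 6)) (x : EucA 8) : ℝ :=
  (1 - v) * (Real.pi * ramp (snake r l (joinCoord x)).2) + v * (2 * Real.arcsin ‖quatA x‖)

/-- The spherical component of `snakeMap`. -/
def snakeComm (r v : ℝ) (l : List (Fin 6)) (x : EucA 8) : ℍ[ℝ] :=
  unitComm (arm v (quatA x) (fstHalf (snake r l (joinCoord x)).1))
    (arm v (quatB x) (sndHalf (snake r l (joinCoord x)).1))

/-- A two-parameter family containing `commHopf` and, for `r = 1`, `v = 0`, maps of small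
`4`-dilation. -/
def snakeMap (r v : ℝ) (l : List (Fin 6)) (x : EucA 8) : EucA 5 :=
  quatReal (Real.sin (snakeAngle r v l x) • snakeComm r v l x) (Real.cos (snakeAngle r v l x))

/-- The parameter domain on which `snakeMap` is continuous. -/
def snakeDom : Set (ℝ × ℝ × EucA 8) :=
  {p | p.1 ∈ Icc (0 : ℝ) 1 ∧ p.2.1 ∈ Icc (0 : ℝ) 1 ∧ (p.1 = 0 ∨ p.2.1 = 0) ∧ p.2.2 ∈ usph 8}

lemma norm_quatA_quatB_of_mem {x : EucA 8} (hx : x ∈ usph 8) :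
    ‖quatA x‖ ^ 2 + ‖quatB x‖ ^ 2 = 1 := by
  have h : ‖x‖ = 1 := by simpa [usph] using hx
  rw [← norm_sq_eq_quatA_quatB, h, one_pow]

lemma ramp_snake_of_le {r : ℝ} (hr : r ∈ Icc (0 : ℝ) 1) (l : List (Fin 6)) {x : EucA 8}
    (h : ‖quatA x‖ ^ 2 ≤ 2 / 100) : ramp (snake r l (joinCoord x)).2 = 0 :=
  ramp_eq_zero ((snake_snd_le hr l (Y := joinCoord x) h).trans (by norm_num))

lemma ramp_snake_of_ge {r : ℝ} (hr : r ∈ Icc (0 : ℝ) 1) (l : List (Fin 6)) {x : EucA 8}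
    (h : 98 / 100 ≤ ‖quatA x‖ ^ 2) : ramp (snake r l (joinCoord x)).2 = 1 :=
  ramp_eq_one ((le_snake_snd hr l (Y := joinCoord x) h).trans' (by norm_num))

lemma continuousAt_snake (l : List (Fin 6)) {p : ℝ × ℝ × EucA 8} (hA : quatA p.2.2 ≠ 0)
    (hB : quatB p.2.2 ≠ 0) :
    ContinuousAt (fun p : ℝ × ℝ × EucA 8 => snake p.1 l (joinCoord p.2.2)) p := by
  have h1 : ContinuousAt (fun p : ℝ × ℝ × EucA 8 => joinCoord p.2.2) p :=
    (contDiffAt_joinCoord hA hB).continuousAt.comp (f := fun p : ℝ × ℝ × EucA 8 => p.2.2)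
      (by fun_prop)
  exact (contDiff_snake l).continuous.continuousAt.comp
    (f := fun p : ℝ × ℝ × EucA 8 => (p.1, joinCoord p.2.2)) (continuousAt_fst.prodMk h1)

lemma continuousOn_snakeAngle (l : List (Fin 6)) :
    ContinuousOn (fun p : ℝ × ℝ × EucA 8 => snakeAngle p.1 p.2.1 l p.2.2) snakeDom := by
  have hA := continuous_quatA
  have hc : Continuous fun p : ℝ × ℝ × EucA 8 => ‖quatA p.2.2‖ ^ 2 := by fun_prop
  have hr : ContinuousOn (fun p : ℝ × ℝ × EucA 8 => ramp (snake p.1 l (joinCoord p.2.2)).2)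
      snakeDom := by
    intro p hp
    rcases lt_or_ge (‖quatA p.2.2‖ ^ 2) (2 / 100) with h | h
    · refine ContinuousWithinAt.congr_of_eventuallyEq (f := fun _ => (0 : ℝ))
        continuousWithinAt_const ?_
        (ramp_snake_of_le hp.1 l h.le)
      filter_upwards [self_mem_nhdsWithin,
        ((hc.tendsto p).eventually_lt_const h).filter_mono nhdsWithin_le_nhds] with q hq hq'
      exact ramp_snake_of_le hq.1 l hq'.le
    rcases lt_or_ge (98 / 100) (‖quatA p.2.2‖ ^ 2) with h' | h'
    · refine ContinuousWithinAt.congr_of_eventuallyEq (f := fun _ => (1 : ℝ))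
        continuousWithinAt_const ?_
        (ramp_snake_of_ge hp.1 l h'.le)
      filter_upwards [self_mem_nhdsWithin,
        ((hc.tendsto p).eventually_const_lt h').filter_mono nhdsWithin_le_nhds] with q hq hq'
      exact ramp_snake_of_ge hq.1 l hq'.le
    · have h1 := norm_quatA_quatB_of_mem hp.2.2.2
      have hA0 : quatA p.2.2 ≠ 0 := fun h0 => by
        rw [h0] at h
        norm_num at h
      have hB0 : quatB p.2.2 ≠ 0 := fun h0 => by
        rw [h0, norm_zero] at h1
        linarith
      have h2 : ContinuousAt (fun p : ℝ × ℝ × EucA 8 => (snake p.1 l (joinCoord p.2.2)).2) p :=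
        (continuousAt_snake l hA0 hB0).snd
      exact (contDiff_ramp.continuous.continuousAt.comp h2).continuousWithinAt
  have hv : Continuous fun p : ℝ × ℝ × EucA 8 => Real.arcsin ‖quatA p.2.2‖ := by fun_prop
  have hv2 : Continuous fun p : ℝ × ℝ × EucA 8 => p.2.1 := by fun_prop
  exact ((continuous_const.sub hv2).continuousOn.mul (continuousOn_const.mul hr)).add
    (hv2.mul (continuous_const.mul hv)).continuousOn

lemma snakeAngle_of_quatA {p : ℝ × ℝ × EucA 8} (hp : p ∈ snakeDom) (l : List (Fin 6))
    (h : quatA p.2.2 = 0) : snakeAngle p.1 p.2.1 l p.2.2 = 0 := by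
  rw [snakeAngle, ramp_snake_of_le hp.1 l (by rw [h]; norm_num), h]
  simp

lemma snakeAngle_of_quatB {p : ℝ × ℝ × EucA 8} (hp : p ∈ snakeDom) (l : List (Fin 6))
    (h : quatB p.2.2 = 0) : snakeAngle p.1 p.2.1 l p.2.2 = Real.pi := by
  have h1 := norm_quatA_quatB_of_mem hp.2.2.2
  rw [h] at h1
  have h2 : ‖quatA p.2.2‖ = 1 :=
    (pow_eq_one_iff_of_nonneg (norm_nonneg _) two_ne_zero).1 (by simpa using h1)
  rw [snakeAngle, ramp_snake_of_ge hp.1 l (by rw [h2]; norm_num), h2, Real.arcsin_one]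
  ring

lemma fst_arm_ne_zero {p : ℝ × ℝ × EucA 8} (hp : p ∈ snakeDom) (l : List (Fin 6))
    (hA : quatA p.2.2 ≠ 0) :
    arm p.2.1 (quatA p.2.2) (fstHalf (snake p.1 l (joinCoord p.2.2)).1) ≠ 0 := by
  rcases hp.2.2.1 with h | h
  · rw [h, snake_zero, fstHalf_joinCoord]
    exact arm_imCoord_ne_zero hp.2.1 hA
  · rw [h]
    exact arm_zero_ne_zero _ _

lemma snd_arm_ne_zero {p : ℝ × ℝ × EucA 8} (hp : p ∈ snakeDom) (l : List (Fin 6))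
    (hB : quatB p.2.2 ≠ 0) :
    arm p.2.1 (quatB p.2.2) (sndHalf (snake p.1 l (joinCoord p.2.2)).1) ≠ 0 := by
  rcases hp.2.2.1 with h | h
  · rw [h, snake_zero, sndHalf_joinCoord]
    exact arm_imCoord_ne_zero hp.2.1 hB
  · rw [h]
    exact arm_zero_ne_zero _ _

lemma ne_zero_of_sin_snakeAngle {p : ℝ × ℝ × EucA 8} (hp : p ∈ snakeDom) (l : List (Fin 6))
    (h : Real.sin (snakeAngle p.1 p.2.1 l p.2.2) ≠ 0) : quatA p.2.2 ≠ 0 ∧ quatB p.2.2 ≠ 0 :=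
  ⟨fun h0 => h (by rw [snakeAngle_of_quatA hp l h0, Real.sin_zero]),
    fun h0 => h (by rw [snakeAngle_of_quatB hp l h0, Real.sin_pi])⟩

lemma norm_sin_smul_snakeComm {p : ℝ × ℝ × EucA 8} (hp : p ∈ snakeDom) (l : List (Fin 6)) :
    ‖Real.sin (snakeAngle p.1 p.2.1 l p.2.2) • snakeComm p.1 p.2.1 l p.2.2‖ =
      |Real.sin (snakeAngle p.1 p.2.1 l p.2.2)| := by
  by_cases h : Real.sin (snakeAngle p.1 p.2.1 l p.2.2) = 0
  · rw [h, zero_smul, norm_zero, abs_zero]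
  · obtain ⟨h1, h2⟩ := ne_zero_of_sin_snakeAngle hp l h
    rw [norm_smul, snakeComm, norm_unitComm (fst_arm_ne_zero hp l h1) (snd_arm_ne_zero hp l h2),
      mul_one, Real.norm_eq_abs]

lemma norm_snakeMap {p : ℝ × ℝ × EucA 8} (hp : p ∈ snakeDom) (l : List (Fin 6)) :
    ‖snakeMap p.1 p.2.1 l p.2.2‖ = 1 :=
  norm_quatReal_eq_one (by rw [norm_sin_smul_snakeComm hp, sq_abs, Real.sin_sq_add_cos_sq])

lemma continuousWithinAt_fst_arm {p : ℝ × ℝ × EucA 8} (hp : p ∈ snakeDom) (l : List (Fin 6))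
    (hA : quatA p.2.2 ≠ 0) (hB : quatB p.2.2 ≠ 0) :
    ContinuousWithinAt (fun p : ℝ × ℝ × EucA 8 => arm p.2.1 (quatA p.2.2)
      (fstHalf (snake p.1 l (joinCoord p.2.2)).1)) snakeDom p := by
  have hv : ContinuousWithinAt (fun p : ℝ × ℝ × EucA 8 => p.2.1) snakeDom p := by fun_prop
  have cA : ContinuousWithinAt (fun p : ℝ × ℝ × EucA 8 => quatA p.2.2) snakeDom p := by
    have := continuous_quatA
    fun_prop
  have h1 := tendsto_puff (pure_le_nhdsWithin hp) cA
    (contDiff_fstHalf.continuous.continuousAt.comp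
      (continuousAt_snake l hA hB).fst).continuousWithinAt (exists_one_le_fstHalf hp.1 l hA)
  exact ((continuousWithinAt_const.sub hv).smul h1).add (hv.smul cA)

lemma continuousWithinAt_snd_arm {p : ℝ × ℝ × EucA 8} (hp : p ∈ snakeDom) (l : List (Fin 6))
    (hA : quatA p.2.2 ≠ 0) (hB : quatB p.2.2 ≠ 0) :
    ContinuousWithinAt (fun p : ℝ × ℝ × EucA 8 => arm p.2.1 (quatB p.2.2)
      (sndHalf (snake p.1 l (joinCoord p.2.2)).1)) snakeDom p := by
  have hv : ContinuousWithinAt (fun p : ℝ × ℝ × EucA 8 => p.2.1) snakeDom p := by fun_prop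
  have cB : ContinuousWithinAt (fun p : ℝ × ℝ × EucA 8 => quatB p.2.2) snakeDom p := by
    have := continuous_quatB
    fun_prop
  have h1 := tendsto_puff (pure_le_nhdsWithin hp) cB
    (contDiff_sndHalf.continuous.continuousAt.comp
      (continuousAt_snake l hA hB).fst).continuousWithinAt (exists_one_le_sndHalf hp.1 l hB)
  exact ((continuousWithinAt_const.sub hv).smul h1).add (hv.smul cB)

lemma tendsto_unitComm {ι : Type*} {F : Filter ι} {p q : ι → ℍ[ℝ]} {a b : ℍ[ℝ]}
    (hp : Tendsto p F (𝓝 a)) (hq : Tendsto q F (𝓝 b)) (ha : a ≠ 0) (hb : b ≠ 0) :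
    Tendsto (fun x => unitComm (p x) (q x)) F (𝓝 (unitComm a b)) := by
  have h1 : Tendsto (fun z : ℍ[ℝ] × ℍ[ℝ] => unitComm z.1 z.2) (𝓝 (a, b)) (𝓝 (unitComm a b)) :=
    continuousAt_unitComm ha hb
  have h2 := Tendsto.comp h1 (hp.prodMk_nhds hq)
  exact h2

lemma continuousWithinAt_snakeComm {p : ℝ × ℝ × EucA 8} (hp : p ∈ snakeDom) (l : List (Fin 6))
    (hA : quatA p.2.2 ≠ 0) (hB : quatB p.2.2 ≠ 0) :
    ContinuousWithinAt (fun p : ℝ × ℝ × EucA 8 => snakeComm p.1 p.2.1 l p.2.2) snakeDom p := by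
  have h1 := continuousWithinAt_fst_arm hp l hA hB
  have h2 := continuousWithinAt_snd_arm hp l hA hB
  exact tendsto_unitComm h1 h2 (fst_arm_ne_zero hp l hA) (snd_arm_ne_zero hp l hB)

lemma continuousOn_snakeMap (l : List (Fin 6)) :
    ContinuousOn (fun p : ℝ × ℝ × EucA 8 => snakeMap p.1 p.2.1 l p.2.2) snakeDom := by
  have hτ := continuousOn_snakeAngle l
  refine continuous_quatReal.comp_continuousOn
    (f := fun p : ℝ × ℝ × EucA 8 => (Real.sin (snakeAngle p.1 p.2.1 l p.2.2) •
      snakeComm p.1 p.2.1 l p.2.2, Real.cos (snakeAngle p.1 p.2.1 l p.2.2)))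
    (ContinuousOn.prodMk ?_ (Real.continuous_cos.comp_continuousOn hτ))
  refine continuousOn_of_norm_le (Real.continuous_sin.comp_continuousOn hτ).abs
    (fun p hp => (norm_sin_smul_snakeComm hp l).le) fun p hp h => ?_
  obtain ⟨h1, h2⟩ := ne_zero_of_sin_snakeAngle hp l fun h0 => h (by simp [h0])
  exact ((Real.continuous_sin.comp_continuousOn hτ) p hp).smul
    (continuousWithinAt_snakeComm hp l h1 h2)

lemma snakeMap_bpt {r v : ℝ} (hr : r ∈ Icc (0 : ℝ) 1) (l : List (Fin 6)) :
    snakeMap r v l (bpt 7) = bpt 4 := by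
  rw [snakeMap, snakeAngle, ramp_snake_of_le hr l (by rw [quatA_bpt]; norm_num), quatA_bpt,
    ← quatReal_zero_one]
  simp

lemma snakeMap_one_right (r : ℝ) (l : List (Fin 6)) {x : EucA 8} (hx : x ∈ usph 8) :
    snakeMap r 1 l x = commHopf x := by
  have h := norm_quatA_quatB_of_mem hx
  have h1 : ‖quatA x‖ ≤ 1 := by nlinarith [norm_nonneg (quatA x), sq_nonneg (‖quatB x‖)]
  have hs : Real.sin (Real.arcsin ‖quatA x‖) = ‖quatA x‖ :=
    Real.sin_arcsin (by linarith [norm_nonneg (quatA x)]) h1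
  have hc : Real.cos (Real.arcsin ‖quatA x‖) = ‖quatB x‖ := by
    rw [Real.cos_arcsin, ← h, add_sub_cancel_left, Real.sqrt_sq (norm_nonneg _)]
  have hτ : snakeAngle r 1 l x = 2 * Real.arcsin ‖quatA x‖ := by rw [snakeAngle]; ring
  rw [snakeMap, hτ, snakeComm, arm_one, arm_one, Real.sin_two_mul, Real.cos_two_mul', hs, hc,
    smul_unitComm, commHopf]

lemma basedHomotopic_snakeMap (l : List (Fin 6)) :
    BasedHomotopic (usph 5) (bpt 7) (bpt 4) (snakeMap 1 0 l) commHopf := by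
  have hmem : ∀ t ∈ Icc (0 : ℝ) 1, ∀ x ∈ usph 8,
      (max 0 (1 - 2 * t), max 0 (2 * t - 1), x) ∈ snakeDom := by
    intro t ht x hx
    refine ⟨⟨le_max_left _ _, max_le zero_le_one (by linarith [ht.1])⟩,
      ⟨le_max_left _ _, max_le zero_le_one (by linarith [ht.2])⟩, ?_, hx⟩
    rcases le_total t (1 / 2) with h | h
    · exact Or.inr (max_eq_left (by linarith))
    · exact Or.inl (max_eq_left (by linarith))
  refine ⟨fun t x => snakeMap (max 0 (1 - 2 * t)) (max 0 (2 * t - 1)) l x, ?_, ?_, ?_, ?_, ?_⟩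
  · exact (continuousOn_snakeMap l).comp (f := fun q : ℝ × EucA 8 =>
      (max 0 (1 - 2 * q.1), max 0 (2 * q.1 - 1), q.2)) (by fun_prop)
      fun q hq => hmem q.1 hq.1 q.2 hq.2
  · intro t ht x hx
    simpa [usph] using norm_snakeMap (hmem t ht x hx) l
  · intro t ht
    exact snakeMap_bpt ⟨le_max_left _ _, max_le zero_le_one (by linarith [ht.1])⟩ l
  · intro x _
    norm_num
  · intro x hx
    norm_num
    exact snakeMap_one_right 0 l hx

end SnakeMap

section SnakeDilation

/-- The commutator of two copies of `puffQuat`. -/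
def puffComm (u : Fin 6 → ℝ) : ℍ[ℝ] := unitComm (puffQuat (fstHalf u)) (puffQuat (sndHalf u))

lemma contDiff_puffComm : ContDiff ℝ 1 puffComm :=
  contDiff_iff_contDiffAt.2 fun _ =>
    ContDiffAt.unitComm (contDiff_puffQuat.comp contDiff_fstHalf).contDiffAt
      (contDiff_puffQuat.comp contDiff_sndHalf).contDiffAt (puffQuat_ne_zero _) (puffQuat_ne_zero _)

lemma fderiv_puffComm_eq_zero {u : Fin 6 → ℝ} (h : ∃ i, 1 ≤ |u i|) : fderiv ℝ puffComm u = 0 := by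
  have h1 : (∃ i, 1 ≤ |fstHalf u i|) ∨ ∃ i, 1 ≤ |sndHalf u i| := by
    obtain ⟨i, hi⟩ := h
    fin_cases i
    exacts [.inl ⟨0, hi⟩, .inl ⟨1, hi⟩, .inl ⟨2, hi⟩, .inr ⟨0, hi⟩, .inr ⟨1, hi⟩, .inr ⟨2, hi⟩]
  have h2 : puffComm =ᶠ[𝓝 u] fun _ => 1 := by
    rcases h1 with ⟨i, hi⟩ | ⟨i, hi⟩
    · filter_upwards [(contDiff_fstHalf.continuous.tendsto u).eventually
        (cubeBump_eventually_zero hi)] with y hy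
      rw [puffComm, puffQuat_of_cubeBump hy, unitComm_one_left (puffQuat_ne_zero _)]
    · filter_upwards [(contDiff_sndHalf.continuous.tendsto u).eventually
        (cubeBump_eventually_zero hi)] with y hy
      rw [puffComm, puffQuat_of_cubeBump hy, unitComm_one_right (puffQuat_ne_zero _)]
  rw [h2.fderiv_eq, fderiv_fun_const, Pi.zero_apply]

lemma exists_norm_fderiv_puffComm_le : ∃ C, 0 ≤ C ∧ ∀ u, ‖fderiv ℝ puffComm u‖ ≤ C := by
  obtain ⟨C, hC⟩ := (isCompact_closedBall (0 : Fin 6 → ℝ) 1).exists_bound_of_continuousOn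
    (contDiff_puffComm.continuous_fderiv one_ne_zero).continuousOn
  refine ⟨C, (ContinuousLinearMap.opNorm_nonneg _).trans (hC 0 (by simp)), fun u => ?_⟩
  by_cases h : ∃ i, 1 ≤ |u i|
  · rw [fderiv_puffComm_eq_zero h, ContinuousLinearMap.opNorm_zero]
    exact (ContinuousLinearMap.opNorm_nonneg _).trans (hC 0 (by simp))
  · push Not at h
    refine hC u ?_
    rw [mem_closedBall_zero_iff, pi_norm_le_iff_of_nonneg zero_le_one]
    exact fun i => (h i).le

lemma norm_fderiv_pi_le {X : Type*} [NormedAddCommGroup X] [NormedSpace ℝ X] {n : ℕ}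
    {U : X → Fin n → ℝ} {x : X} (hU : DifferentiableAt ℝ U x) {C : ℝ} (hC : 0 ≤ C)
    (h : ∀ i, ‖fderiv ℝ (fun x => U x i) x‖ ≤ C) : ‖fderiv ℝ U x‖ ≤ C := by
  refine ContinuousLinearMap.opNorm_le_bound _ hC fun w => ?_
  rw [pi_norm_le_iff_of_nonneg (by positivity)]
  intro i
  have h1 := ((ContinuousLinearMap.proj (R := ℝ) (φ := fun _ : Fin n => ℝ) i).hasFDerivAt.comp x
    hU.hasFDerivAt).fderiv
  have h2 : fderiv ℝ U x w i = fderiv ℝ (fun x => U x i) x w :=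
    (congrArg (fun L => L w) h1).symm
  rw [h2]
  exact ContinuousLinearMap.le_of_opNorm_le _ (h i) w

lemma exists_norm_fderiv_joinCoord_le : ∃ C, 0 ≤ C ∧ ∀ x ∈ usph 8, 2 / 100 ≤ ‖quatA x‖ ^ 2 →
    ‖quatA x‖ ^ 2 ≤ 98 / 100 → (∀ i, ‖fderiv ℝ (fun x => (joinCoord x).1 i) x‖ ≤ C) ∧
      ‖fderiv ℝ (fun x => (joinCoord x).2) x‖ ≤ C := by
  have hcA := continuous_quatA
  have hcB := continuous_quatB
  have hc : Continuous fun x : EucA 8 => ‖quatA x‖ ^ 2 := by fun_prop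
  have hW : IsOpen {x | quatA x ≠ 0 ∧ quatB x ≠ 0} :=
    (isOpen_ne_fun hcA continuous_const).inter (isOpen_ne_fun hcB continuous_const)
  have hj : ContDiffOn ℝ 1 joinCoord {x | quatA x ≠ 0 ∧ quatB x ≠ 0} :=
    fun x hx => (contDiffAt_joinCoord hx.1 hx.2).contDiffWithinAt
  have hK : IsCompact (usph 8 ∩ {x | 2 / 100 ≤ ‖quatA x‖ ^ 2 ∧ ‖quatA x‖ ^ 2 ≤ 98 / 100}) :=
    (isCompact_sphere 0 1).inter_right
      ((isClosed_le continuous_const hc).inter (isClosed_le hc continuous_const))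
  have hsub : ∀ x ∈ usph 8, 2 / 100 ≤ ‖quatA x‖ ^ 2 → ‖quatA x‖ ^ 2 ≤ 98 / 100 →
      quatA x ≠ 0 ∧ quatB x ≠ 0 := by
    intro x hx h h'
    have h1 := norm_quatA_quatB_of_mem hx
    refine ⟨fun h0 => ?_, fun h0 => ?_⟩
    · rw [h0] at h
      norm_num at h
    · rw [h0, norm_zero] at h1
      linarith
  obtain ⟨C, hC⟩ := hK.exists_bound_of_continuousOn
    ((hj.continuousOn_fderiv_of_isOpen hW le_rfl).mono fun x hx => hsub x hx.1 hx.2.1 hx.2.2)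
  refine ⟨max C 0, le_max_right _ _, fun x hx h h' => ?_⟩
  obtain ⟨hA, hB⟩ := hsub x hx h h'
  have hd := ((contDiffAt_joinCoord hA hB).differentiableAt one_ne_zero).hasFDerivAt
  have hle : ∀ w, ‖fderiv ℝ joinCoord x w‖ ≤ max C 0 * ‖w‖ := fun w =>
    ContinuousLinearMap.le_of_opNorm_le _ ((hC x ⟨hx, h, h'⟩).trans (le_max_left _ _)) w
  refine ⟨fun i => ?_, ?_⟩
  · have h1 : HasFDerivAt (fun x => (joinCoord x).1 i) _ x :=
      (ContinuousLinearMap.proj (R := ℝ) (φ := fun _ : Fin 6 => ℝ) i).hasFDerivAt.comp x hd.fst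
    rw [h1.fderiv]
    refine ContinuousLinearMap.opNorm_le_bound _ (le_max_right _ _) fun w => ?_
    exact ((norm_le_pi_norm _ i).trans (norm_fst_le _)).trans (hle w)
  · rw [hd.snd.fderiv]
    refine ContinuousLinearMap.opNorm_le_bound _ (le_max_right _ _) fun w => ?_
    exact (norm_snd_le _).trans (hle w)

lemma arm_zero (a : ℍ[ℝ]) (u : Fin 3 → ℝ) : arm 0 a u = if a.re < 0 then puffQuat u else 1 := by
  simp [arm]

lemma contDiffAt_snake (l : List (Fin 6)) {x : EucA 8} (hA : quatA x ≠ 0) (hB : quatB x ≠ 0) :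
    ContDiffAt ℝ 1 (fun x => snake 1 l (joinCoord x)) x :=
  (contDiff_snake l).contDiffAt.comp (f := fun x => ((1 : ℝ), joinCoord x)) x
    (contDiffAt_const.prodMk (contDiffAt_joinCoord hA hB))

/-- Away from the two subspaces, `snakeComm` for `v = 0` is locally constant or given by
`puffComm`. -/
lemma snakeComm_eventually (l : List (Fin 6)) {x : EucA 8} (hA : quatA x ≠ 0) (hB : quatB x ≠ 0) :
    (snakeComm 1 0 l =ᶠ[𝓝 x] fun y => puffComm (snake 1 l (joinCoord y)).1) ∨
      snakeComm 1 0 l =ᶠ[𝓝 x] fun _ => 1 := by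
  have hs := (contDiffAt_snake l hA hB).continuousAt.fst
  have h1 := arm_eventually (continuous_quatA.tendsto x)
    (contDiff_fstHalf.continuous.continuousAt.comp hs).tendsto
    (exists_one_le_fstHalf (right_mem_Icc.2 zero_le_one) l hA)
  have h2 := arm_eventually (continuous_quatB.tendsto x)
    (contDiff_sndHalf.continuous.continuousAt.comp hs).tendsto
    (exists_one_le_sndHalf (right_mem_Icc.2 zero_le_one) l hB)
  rcases h1 with h1 | h1
  · rcases h2 with h2 | h2
    · left
      filter_upwards [h1, h2] with y hy hy'
      rw [snakeComm, arm_zero, arm_zero]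
      exact congrArg₂ unitComm hy hy'
    · right
      filter_upwards [h2] with y hy
      rw [snakeComm, arm_zero (quatB y)]
      exact (congrArg (unitComm _) hy).trans (unitComm_one_right (arm_zero_ne_zero _ _))
  · right
    filter_upwards [h1] with y hy
    rw [snakeComm, arm_zero (quatA y)]
    exact (congrArg (fun a => unitComm a _) hy).trans (unitComm_one_left (arm_zero_ne_zero _ _))

lemma contDiffAt_snakeComm (l : List (Fin 6)) {x : EucA 8} (hA : quatA x ≠ 0)
    (hB : quatB x ≠ 0) : ContDiffAt ℝ 1 (snakeComm 1 0 l) x := by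
  rcases snakeComm_eventually l hA hB with h | h
  · exact ContDiffAt.congr_of_eventuallyEq (contDiff_puffComm.contDiffAt.comp
      (f := fun y => (snake 1 l (joinCoord y)).1) x (contDiffAt_snake l hA hB).fst) h
  · exact contDiffAt_const.congr_of_eventuallyEq h

lemma norm_fderiv_snakeComm_le {K C : ℝ} (hK : ∀ u, ‖fderiv ℝ puffComm u‖ ≤ K) (hC : 0 ≤ C)
    (l : List (Fin 6)) {n : ℕ} (hl : ∀ i, l.count i = n) {x : EucA 8} (hA : quatA x ≠ 0)
    (hB : quatB x ≠ 0) (h1 : ∀ i, ‖fderiv ℝ (fun x => (joinCoord x).1 i) x‖ ≤ C)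
    (h2 : ‖fderiv ℝ (fun x => (joinCoord x).2) x‖ ≤ C) :
    ‖fderiv ℝ (snakeComm 1 0 l) x‖ ^ 3 * ‖fderiv ℝ (fun x => (snake 1 l (joinCoord x)).2) x‖ ≤
      (K * (4 ^ n * C)) ^ 3 * ((4 / 9) ^ l.length * C) := by
  have hK0 : 0 ≤ K := (ContinuousLinearMap.opNorm_nonneg _).trans (hK 0)
  have hnn : 0 ≤ (K * (4 ^ n * C)) ^ 3 * ((4 / 9) ^ l.length * C) := by positivity
  have hd := (contDiffAt_snake l hA hB).differentiableAt one_ne_zero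
  have hzero : fderiv ℝ (snakeComm 1 0 l) x = 0 →
      ‖fderiv ℝ (snakeComm 1 0 l) x‖ ^ 3 * ‖fderiv ℝ (fun x => (snake 1 l (joinCoord x)).2) x‖ ≤
        (K * (4 ^ n * C)) ^ 3 * ((4 / 9) ^ l.length * C) := by
    intro h0
    rw [h0, ContinuousLinearMap.opNorm_zero, zero_pow three_ne_zero, zero_mul]
    exact hnn
  rcases snakeComm_eventually l hA hB with h | h
  · have hU : DifferentiableAt ℝ (fun y => (snake 1 l (joinCoord y)).1) x := hd.fst
    have hD : fderiv ℝ (snakeComm 1 0 l) x = (fderiv ℝ puffComm (snake 1 l (joinCoord x)).1).comp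
        (fderiv ℝ (fun y => (snake 1 l (joinCoord y)).1) x) := by
      rw [h.fderiv_eq]
      exact fderiv_fun_comp x (contDiff_puffComm.differentiable one_ne_zero _) hU
    rcases snake_cases ((contDiffAt_joinCoord hA hB).differentiableAt one_ne_zero) h1 h2 l with
      h3 | h3 | ⟨h3, h4⟩
    · refine hzero ?_
      rw [hD, fderiv_puffComm_eq_zero h3, ContinuousLinearMap.zero_comp]
    · rw [h3, norm_zero, mul_zero]
      exact hnn
    · have h5 := norm_fderiv_pi_le hU (C := 4 ^ n * C) (by positivity) fun i => by
        simpa only [hl] using h3 i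
      have h6 : ‖fderiv ℝ (snakeComm 1 0 l) x‖ ≤ K * (4 ^ n * C) := by
        rw [hD]
        exact (ContinuousLinearMap.opNorm_comp_le _ _).trans
          (mul_le_mul (hK _) h5 (ContinuousLinearMap.opNorm_nonneg _) hK0)
      exact mul_le_mul (pow_le_pow_left₀ (ContinuousLinearMap.opNorm_nonneg _) h6 3) h4
        (norm_nonneg _) (by positivity)
  · refine hzero ?_
    rw [h.fderiv_eq, fderiv_fun_const, Pi.zero_apply]

lemma snakeAngle_zero_right (r : ℝ) (l : List (Fin 6)) (x : EucA 8) :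
    snakeAngle r 0 l x = Real.pi * ramp (snake r l (joinCoord x)).2 := by
  rw [snakeAngle]
  ring

lemma snakeMap_of_le (l : List (Fin 6)) {x : EucA 8} (h : ‖quatA x‖ ^ 2 ≤ 2 / 100) :
    snakeMap 1 0 l x = quatReal 0 1 := by
  rw [snakeMap, snakeAngle_zero_right, ramp_snake_of_le (right_mem_Icc.2 zero_le_one) l h]
  simp

lemma snakeMap_of_ge (l : List (Fin 6)) {x : EucA 8} (h : 98 / 100 ≤ ‖quatA x‖ ^ 2) :
    snakeMap 1 0 l x = quatReal 0 (-1) := by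
  rw [snakeMap, snakeAngle_zero_right, ramp_snake_of_ge (right_mem_Icc.2 zero_le_one) l h]
  simp

lemma contDiffAt_snakeMap (l : List (Fin 6)) {x : EucA 8} (h : 99 / 100 ≤ ‖x‖ ^ 2) :
    ContDiffAt ℝ 1 (snakeMap 1 0 l) x := by
  have hcA := continuous_quatA
  have hc : Continuous fun x : EucA 8 => ‖quatA x‖ ^ 2 := by fun_prop
  by_cases hA : quatA x = 0
  · refine contDiffAt_const (c := quatReal 0 1) |>.congr_of_eventuallyEq ?_
    filter_upwards [(hc.tendsto x).eventually_lt_const (u := 2 / 100)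
      (by rw [hA]; norm_num)] with y hy
    exact snakeMap_of_le l hy.le
  by_cases hB : quatB x = 0
  · refine contDiffAt_const (c := quatReal 0 (-1)) |>.congr_of_eventuallyEq ?_
    have h1 := norm_sq_eq_quatA_quatB x
    rw [hB, norm_zero] at h1
    filter_upwards [(hc.tendsto x).eventually_const_lt (u := 98 / 100) (by linarith)] with y hy
    exact snakeMap_of_ge l hy.le
  have hτ : ContDiffAt ℝ 1 (snakeAngle 1 0 l) x := by
    have h2 : ContDiffAt ℝ 1 (fun x => (snake 1 l (joinCoord x)).2) x :=
      (contDiffAt_snake l hA hB).snd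
    have h3 := contDiffAt_const (c := Real.pi) |>.mul (contDiff_ramp.contDiffAt.comp x h2)
    exact h3.congr_of_eventuallyEq (Eventually.of_forall fun y => snakeAngle_zero_right 1 l y)
  have hm : ContDiffAt ℝ 1 (fun x => (Real.sin (snakeAngle 1 0 l x) • snakeComm 1 0 l x,
      Real.cos (snakeAngle 1 0 l x))) x :=
    (hτ.sin.smul (contDiffAt_snakeComm l hA hB)).prodMk hτ.cos
  exact (contDiff_quatReal (n := 1)).contDiffAt.comp x hm

/-- A `C¹` extension of `snakeMap` to the whole space. -/
def smoothSnake (l : List (Fin 6)) (x : EucA 8) : EucA 5 :=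
  stepFun 200 (99 / 100) (‖x‖ ^ 2) • snakeMap 1 0 l x

lemma smoothSnake_eventuallyEq (l : List (Fin 6)) {x : EucA 8} (hx : x ∈ usph 8) :
    smoothSnake l =ᶠ[𝓝 x] snakeMap 1 0 l := by
  have h : ‖x‖ = 1 := by simpa [usph] using hx
  have hc : Continuous fun x : EucA 8 => ‖x‖ ^ 2 := by fun_prop
  filter_upwards [(hc.tendsto x).eventually_const_lt (u := 995 / 1000)
    (by rw [h]; norm_num)] with y hy
  rw [smoothSnake, stepFun_eq_one (by linarith), one_smul]

lemma contDiff_smoothSnake (l : List (Fin 6)) : ContDiff ℝ 1 (smoothSnake l) := by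
  have hc : Continuous fun x : EucA 8 => ‖x‖ ^ 2 := by fun_prop
  refine contDiff_iff_contDiffAt.2 fun x => ?_
  rcases lt_or_ge (‖x‖ ^ 2) (99 / 100) with h | h
  · refine contDiffAt_const (c := (0 : EucA 5)) |>.congr_of_eventuallyEq ?_
    filter_upwards [(hc.tendsto x).eventually_lt_const h] with y hy
    rw [smoothSnake, stepFun_eq_zero (by norm_num) hy.le, zero_smul]
  · exact ((contDiff_stepFun 200 (99 / 100)).contDiffAt.comp x
      (contDiff_norm_sq ℝ).contDiffAt).smul (contDiffAt_snakeMap l h)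

lemma sqrt_gramDet_zero : Real.sqrt (gramDet fun _ : Fin 4 => (0 : EucA 5)) = 0 := by
  have h : gramDet (fun _ : Fin 4 => (0 : EucA 5)) = 0 := by
    rw [gramDet]
    exact Matrix.det_eq_zero_of_row_eq_zero 0 fun j => by simp
  rw [h, Real.sqrt_zero]

lemma sqrt_gramDet_snakeMap_le {K C : ℝ} (hK : ∀ u, ‖fderiv ℝ puffComm u‖ ≤ K) (hC : 0 ≤ C)
    (h : ∀ x ∈ usph 8, 2 / 100 ≤ ‖quatA x‖ ^ 2 → ‖quatA x‖ ^ 2 ≤ 98 / 100 →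
      (∀ i, ‖fderiv ℝ (fun x => (joinCoord x).1 i) x‖ ≤ C) ∧
      ‖fderiv ℝ (fun x => (joinCoord x).2) x‖ ≤ C)
    (l : List (Fin 6)) {n : ℕ} (hl : ∀ i, l.count i = n) {x : EucA 8} (hx : x ∈ usph 8)
    {v : Fin 4 → EucA 8} (hv : Orthonormal ℝ v) :
    Real.sqrt (gramDet fun i => fderiv ℝ (snakeMap 1 0 l) x (v i)) ≤
      600 * ((K * (4 ^ n * C)) ^ 3 * ((4 / 9) ^ l.length * C)) := by
  have hK0 : 0 ≤ K := (ContinuousLinearMap.opNorm_nonneg _).trans (hK 0)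
  have hcA := continuous_quatA
  have hc : Continuous fun x : EucA 8 => ‖quatA x‖ ^ 2 := by fun_prop
  have hconst : ∀ c : EucA 5, snakeMap 1 0 l =ᶠ[𝓝 x] (fun _ => c) →
      Real.sqrt (gramDet fun i => fderiv ℝ (snakeMap 1 0 l) x (v i)) ≤
        600 * ((K * (4 ^ n * C)) ^ 3 * ((4 / 9) ^ l.length * C)) := by
    intro c hc
    have h0 : (fun i => fderiv ℝ (snakeMap 1 0 l) x (v i)) = fun _ => 0 := by
      rw [hc.fderiv_eq]
      simp
    rw [h0, sqrt_gramDet_zero]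
    positivity
  rcases lt_or_ge (‖quatA x‖ ^ 2) (2 / 100) with h1 | h1
  · refine hconst (quatReal 0 1) ?_
    filter_upwards [(hc.tendsto x).eventually_lt_const h1] with y hy
    exact snakeMap_of_le l hy.le
  rcases lt_or_ge (98 / 100) (‖quatA x‖ ^ 2) with h2 | h2
  · refine hconst (quatReal 0 (-1)) ?_
    filter_upwards [(hc.tendsto x).eventually_const_lt h2] with y hy
    exact snakeMap_of_ge l hy.le
  have h3 := norm_quatA_quatB_of_mem hx
  have hA : quatA x ≠ 0 := fun h0 => by
    rw [h0] at h1
    norm_num at h1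
  have hB : quatB x ≠ 0 := fun h0 => by
    rw [h0, norm_zero] at h3
    linarith
  obtain ⟨h4, h5⟩ := h x hx h1 h2
  have h6 : snakeMap 1 0 l = fun x => quatReal
      (Real.sin (Real.pi * ramp (snake 1 l (joinCoord x)).2) • snakeComm 1 0 l x)
      (Real.cos (Real.pi * ramp (snake 1 l (joinCoord x)).2)) := by
    funext y
    rw [snakeMap, snakeAngle_zero_right]
  rw [h6]
  refine (sqrt_gramDet_suspension_le (s := fun x => (snake 1 l (joinCoord x)).2)
    ((contDiffAt_snakeComm l hA hB).differentiableAt one_ne_zero)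
    ((contDiffAt_snake l hA hB).differentiableAt one_ne_zero).snd
    (Eventually.of_forall fun y => norm_unitComm (arm_zero_ne_zero _ _) (arm_zero_ne_zero _ _))
    hv).trans ?_
  exact mul_le_mul_of_nonneg_left (norm_fderiv_snakeComm_le hK hC l hl hA hB h4 h5) (by norm_num)

/-- The list running `n` times through all six coordinates. -/
def coordCycle : ℕ → List (Fin 6)
  | 0 => []
  | n + 1 => List.finRange 6 ++ coordCycle n

lemma length_coordCycle (n : ℕ) : (coordCycle n).length = 6 * n := by
  induction n with
  | zero => rfl
  | succ n ih =>
    rw [coordCycle, List.length_append, ih, List.length_finRange]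
    ring

lemma count_coordCycle (n : ℕ) (i : Fin 6) : (coordCycle n).count i = n := by
  induction n with
  | zero => rfl
  | succ n ih =>
    rw [coordCycle, List.count_append, ih, (List.nodup_finRange 6).count,
      if_pos (List.mem_finRange i)]
    ring

/-- The class of `commHopf` contains `C¹` maps of arbitrarily small `4`-dilation. -/
theorem exists_kDilation_lt_commHopf {ε : ℝ} (hε : 0 < ε) : ∃ F : EucA 8 → EucA 5,
    ContDiff ℝ 1 F ∧ MapsTo F (usph 8) (usph 5) ∧ F (bpt 7) = bpt 4 ∧
      BasedHomotopic (usph 5) (bpt 7) (bpt 4) F commHopf ∧ kDilation 4 F < ε := by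
  obtain ⟨K, hK0, hK⟩ := exists_norm_fderiv_puffComm_le
  obtain ⟨C, hC0, hC⟩ := exists_norm_fderiv_joinCoord_le
  obtain ⟨n, hn⟩ : ∃ n : ℕ, 600 * (K ^ 3 * C ^ 4) * (64 * (4 / 9) ^ 6) ^ n < ε := by
    have h := (tendsto_pow_atTop_nhds_zero_of_lt_one (r := (64 * (4 / 9) ^ 6 : ℝ)) (by norm_num)
      (by norm_num)).const_mul (600 * (K ^ 3 * C ^ 4))
    rw [mul_zero] at h
    exact (h.eventually_lt_const hε).exists
  set l := coordCycle n
  have hEq : EqOn (smoothSnake l) (snakeMap 1 0 l) (usph 8) := fun x hx =>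
    (smoothSnake_eventuallyEq l hx).self_of_nhds
  have hb : bpt 7 ∈ usph 8 := by simpa [usph] using norm_bpt 7
  refine ⟨smoothSnake l, contDiff_smoothSnake l, fun x hx => ?_, ?_, ?_, ?_⟩
  · rw [hEq hx]
    simpa [usph] using norm_snakeMap (p := (1, 0, x))
      ⟨right_mem_Icc.2 zero_le_one, left_mem_Icc.2 zero_le_one, Or.inr rfl, hx⟩ l
  · rw [hEq hb]
    exact snakeMap_bpt (right_mem_Icc.2 zero_le_one) l
  · obtain ⟨H, h1, h2, h3, h4, h5⟩ := basedHomotopic_snakeMap l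
    exact ⟨H, h1, h2, h3, fun x hx => (h4 hx).trans (hEq hx).symm, h5⟩
  · refine (kDilation_le (C := 600 * ((K * (4 ^ n * C)) ^ 3 * ((4 / 9) ^ l.length * C)))
      (by positivity) fun x hx v hv _ => ?_).trans_lt ?_
    · rw [(smoothSnake_eventuallyEq l hx).fderiv_eq]
      exact sqrt_gramDet_snakeMap_le hK hC0 hC l (count_coordCycle n) hx hv
    · refine lt_of_eq_of_lt ?_ hn
      rw [length_coordCycle, pow_mul, mul_pow (64 : ℝ), show (64 : ℝ) ^ n = (4 ^ n) ^ 3 by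
        rw [← pow_mul, mul_comm, pow_mul]
        norm_num]
      ring

end SnakeDilation

/-- **Theorem 2** (second part).  The set of homotopy classes in `π₇(S⁴)` representable by `C¹`
maps of arbitrarily small `4`-dilation is a proper, non-zero subgroup: (i) there is a
homotopically non-trivial based map `g : S⁷ → S⁴` such that for every `ε > 0` some `C¹` map in
the class of `g` has `4`-dilation less than `ε`; and (ii) there is a based map `g' : S⁷ → S⁴`
and a constant `c > 0` such that every `C¹` map in the class of `g'` has `4`-dilation at least
`c`.  Here `S⁷ = usph 8 ⊆ ℝ⁸`, `S⁴ = usph 5 ⊆ ℝ⁵`, with basepoints `bpt 7`, `bpt 4`; maps of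
spheres are represented by ambient maps sending the unit sphere to the unit sphere. -/
theorem small_4dilation_classes_proper_nonzero :
    (∃ g : EucA 8 → EucA 5,
      Continuous g ∧ MapsTo g (usph 8) (usph 5) ∧ g (bpt 7) = bpt 4 ∧
      ¬ BasedHomotopic (usph 5) (bpt 7) (bpt 4) g (fun _ => bpt 4) ∧
      ∀ ε : ℝ, 0 < ε →
        ∃ F : EucA 8 → EucA 5,
          ContDiff ℝ 1 F ∧ MapsTo F (usph 8) (usph 5) ∧ F (bpt 7) = bpt 4 ∧
          BasedHomotopic (usph 5) (bpt 7) (bpt 4) F g ∧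
          kDilation 4 F < ε) ∧
    (∃ g' : EucA 8 → EucA 5,
      Continuous g' ∧ MapsTo g' (usph 8) (usph 5) ∧ g' (bpt 7) = bpt 4 ∧
      ∃ c : ℝ, 0 < c ∧
        ∀ F : EucA 8 → EucA 5,
          ContDiff ℝ 1 F → MapsTo F (usph 8) (usph 5) → F (bpt 7) = bpt 4 →
          BasedHomotopic (usph 5) (bpt 7) (bpt 4) F g' →
          c ≤ kDilation 4 F) := by
  refine ⟨⟨commHopf, commHopf_continuous, commHopf_mapsTo, commHopf_bpt,
    not_basedHomotopic_commHopf, fun ε hε => exists_kDilation_lt_commHopf hε⟩,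
    ⟨hopfMap, (hopfMap_contDiff (n := 0)).continuous, hopfMap_mapsTo, hopfMap_bpt, ?_⟩⟩
  obtain ⟨c, hc, h⟩ := exists_le_kDilation_hopfMap
  exact ⟨c, hc, fun F h1 _ _ h2 => h F h1 h2⟩
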